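/- Let D > 1 be a squarefree fundamental discriminant and let ψ be the associated primitive quadratic character modulo D. Let q be a prime with q ∤ D. Then for any δ > 0, the number of primitive even Dirichlet characters χ modulo q with |1 + ε(χ)·ε(χψ)| < 2δ is O(δ·φ(q) + q^{3/4}), with an absolute implied constant. -/

import Mathlib

open Complex DirichletCharacter Finset

/-- `e(x) = exp(2πix)`. -/
noncomputable def eFun (x : ℝ) : ℂ := Complex.exp (2 * Real.pi * Complex.I * x)

/-- The root number `ε(χ) = τ(χ)/N^{1/2}` of a Dirichlet character mod `N`
(the terms with `(a, N) > 1` vanish since `χ a = 0` there). -/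
noncomputable def epsChar {N : ℕ} [NeZero N] (χ : DirichletCharacter ℂ N) : ℂ :=
  (Real.sqrt N : ℂ)⁻¹ * ∑ a : ZMod N, χ a * eFun ((a.val : ℝ) / N)

/-- The product of a character mod `q` and a character mod `D`, as a character mod `q * D`. -/
noncomputable def prodChar {q D : ℕ} (χ : DirichletCharacter ℂ q)
    (ψ : DirichletCharacter ℂ D) : DirichletCharacter ℂ (q * D) :=
  changeLevel (dvd_mul_right q D) χ * changeLevel (dvd_mul_left D q) ψ

open IsUltrametricDist
set_option linter.unusedSectionVars false

namespace HyperKloosterman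

section LogDeriv
open PowerSeries

/-- `F` is the normalised power series whose logarithmic derivative `X F' / F` is `S`. -/
structure IsZeta {K : Type*} [Field K] (F S : K⟦X⟧) : Prop where
  const : constantCoeff F = 1
  deriv : X * d⁄dX K F = S * F

variable {K : Type*} [Field K] {F G S S' : K⟦X⟧}

lemma coeff_X_mul_derivative (F : K⟦X⟧) (n : ℕ) :
    coeff n (X * d⁄dX K F) = n * coeff n F := by
  cases n with
  | zero => simp
  | succ n => rw [coeff_succ_X_mul, coeff_derivative]; push_cast; ring

lemma IsZeta.coeff_rec (h : IsZeta F S) (n : ℕ) :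
    (n : K) * coeff n F = ∑ x ∈ antidiagonal n, coeff x.1 S * coeff x.2 F := by
  rw [← coeff_X_mul_derivative, h.deriv, coeff_mul]

lemma IsZeta.ne_zero (h : IsZeta F S) : F ≠ 0 := by
  rintro rfl
  simpa using h.const

lemma IsZeta.coeff_zero (h : IsZeta F S) : coeff 0 F = 1 := by simpa using h.const

lemma IsZeta.coeff_zero_right (h : IsZeta F S) : coeff 0 S = 0 := by
  have := h.coeff_rec 0
  simpa [h.const] using this.symm

lemma IsZeta.one : IsZeta (1 : K⟦X⟧) 0 := ⟨by simp, by simp⟩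

lemma IsZeta.mul (h : IsZeta F S) (h' : IsZeta G S') : IsZeta (F * G) (S + S') := by
  refine ⟨by simp [h.const, h'.const], ?_⟩
  have e : d⁄dX K (F * G) = F * d⁄dX K G + G * d⁄dX K F := by
    simp [Derivation.leibniz]
  rw [e]
  linear_combination F * h'.deriv + G * h.deriv

lemma IsZeta.inv (h : IsZeta F S) : IsZeta F⁻¹ (-S) := by
  have hF : F * F⁻¹ = 1 := PowerSeries.mul_inv_cancel _ (by simp [h.const])
  refine ⟨by simp [h.const], ?_⟩
  rw [derivative_inv']
  linear_combination (-F⁻¹ ^ 2) * h.deriv + (-S * F⁻¹) * hF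

lemma IsZeta.pow (h : IsZeta F S) (n : ℕ) : IsZeta (F ^ n) (n • S) := by
  induction n with
  | zero => simpa using IsZeta.one
  | succ n ih => rw [pow_succ, succ_nsmul]; exact ih.mul h

lemma IsZeta.prod {ι : Type*} (s : Finset ι) {F S : ι → K⟦X⟧}
    (h : ∀ i ∈ s, IsZeta (F i) (S i)) : IsZeta (∏ i ∈ s, F i) (∑ i ∈ s, S i) := by
  classical
  induction s using Finset.induction_on with
  | empty => simpa using IsZeta.one
  | insert a s ha ih =>
    rw [Finset.prod_insert ha, Finset.sum_insert ha]
    exact (h a (by simp)).mul (ih fun i hi => h i (by simp [hi]))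

/-- Agreement of logarithmic derivatives up to degree `n` forces agreement up to degree `n`. -/
lemma IsZeta.coeff_congr [CharZero K] (h : IsZeta F S) (h' : IsZeta G S') (n : ℕ)
    (hS : ∀ m ≤ n, coeff m S = coeff m S') : coeff n F = coeff n G := by
  induction n using Nat.strong_induction_on with
  | _ n ih =>
    rcases Nat.eq_zero_or_pos n with rfl | hn
    · rw [h.coeff_zero, h'.coeff_zero]
    · have hn' : (n : K) ≠ 0 := by exact_mod_cast hn.ne'
      apply mul_left_cancel₀ hn'
      rw [h.coeff_rec, h'.coeff_rec]
      refine Finset.sum_congr rfl fun x hx => ?_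
      have hx' := mem_antidiagonal.1 hx
      rw [hS x.1 (by omega)]
      rcases Nat.eq_zero_or_pos x.1 with h0 | h0
      · rw [h0, h'.coeff_zero_right]; simp
      grind

lemma IsZeta.unique [CharZero K] (h : IsZeta F S) (h' : IsZeta G S) : F = G :=
  PowerSeries.ext fun n => h.coeff_congr h' n fun _ _ => rfl

/-- The coefficients of the solution of `X F' = S F`. -/
noncomputable def zetaCoeff (S : K⟦X⟧) : ℕ → K
  | 0 => 1
  | n + 1 => ((n + 1 : ℕ) : K)⁻¹ * ∑ i : Fin (n + 1), coeff (n + 1 - i) S * zetaCoeff S i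

lemma isZeta_mk_zetaCoeff [CharZero K] (hS : coeff 0 S = 0) : IsZeta (mk (zetaCoeff S)) S := by
  refine ⟨by simp [zetaCoeff], ?_⟩
  ext n
  rw [coeff_X_mul_derivative, coeff_mk, coeff_mul]
  cases n with
  | zero => simp [hS]
  | succ n =>
    have hn : ((n + 1 : ℕ) : K) ≠ 0 := Nat.cast_ne_zero.2 n.succ_ne_zero
    rw [zetaCoeff, mul_inv_cancel_left₀ hn,
      ← Finset.Nat.sum_antidiagonal_swap (f := fun x : ℕ × ℕ => coeff x.1 S * coeff x.2 (mk (zetaCoeff S)))]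
    rw [Finset.Nat.sum_antidiagonal_eq_sum_range_succ_mk, Finset.sum_range_succ]
    simp [hS, Finset.sum_range]

lemma exists_isZeta [CharZero K] (hS : coeff 0 S = 0) : ∃ F, IsZeta F S :=
  ⟨_, isZeta_mk_zetaCoeff hS⟩

/-- The power series `∑_{m ≥ 1} τ m X ^ m`. -/
noncomputable def tailSeries (τ : ℕ → K) : K⟦X⟧ := mk fun m => if m = 0 then 0 else τ m

lemma coeff_tailSeries_zero (τ : ℕ → K) : coeff 0 (tailSeries τ) = 0 := by
  simp [tailSeries]

@[simp] theorem constantCoeff_tailSeries (τ : ℕ → K) : constantCoeff (tailSeries τ) = 0 := by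
  simp [tailSeries]

lemma coeff_tailSeries (τ : ℕ → K) {m : ℕ} (hm : m ≠ 0) : coeff m (tailSeries τ) = τ m := by
  simp [tailSeries, hm]

lemma tailSeries_add (τ τ' : ℕ → K) :
    tailSeries (fun m => τ m + τ' m) = tailSeries τ + tailSeries τ' := by
  ext m; by_cases hm : m = 0 <;> simp [tailSeries, hm]

lemma tailSeries_neg (τ : ℕ → K) : tailSeries (fun m => -τ m) = -tailSeries τ := by
  ext m; by_cases hm : m = 0 <;> simp [tailSeries, hm]

lemma tailSeries_sub (τ τ' : ℕ → K) :
    tailSeries (fun m => τ m - τ' m) = tailSeries τ - tailSeries τ' := by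
  simp only [sub_eq_add_neg, tailSeries_add, tailSeries_neg]

/-- Rescaling the variable. -/
lemma IsZeta.rescale (h : IsZeta F S) (a : K) : IsZeta (rescale a F) (rescale a S) := by
  refine ⟨by rw [← coeff_zero_eq_constantCoeff_apply, coeff_rescale, h.coeff_zero]; simp, ?_⟩
  ext n
  rw [coeff_X_mul_derivative, coeff_rescale, ← map_mul, coeff_rescale, ← h.deriv,
    coeff_X_mul_derivative]
  ring

lemma isZeta_one_sub (a : K) : IsZeta (1 - C a * X) (-tailSeries fun m => a ^ m) := by
  refine ⟨by simp, ?_⟩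
  ext n
  rw [coeff_X_mul_derivative]
  rcases n with _ | n
  · simp
  · have h1 (S : K⟦X⟧) : coeff (n + 1) (S * (1 - C a * X)) = coeff (n + 1) S - a * coeff n S := by
      have : S * (1 - C a * X) = S - C a * (S * X) := by ring
      simp_all
    rw [h1]
    rcases n with _ | n
    · simp [coeff_tailSeries, coeff_one]
    · simp [coeff_tailSeries, coeff_one]
      ring

end LogDeriv

section Det
open PowerSeries Matrix

lemma derivation_prod {R A : Type*} [CommRing R] [CommRing A] [Algebra R A]
    (D : Derivation R A A) {ι : Type*} [DecidableEq ι] (s : Finset ι) (f : ι → A) :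
    D (∏ i ∈ s, f i) = ∑ i ∈ s, (∏ j ∈ s.erase i, f j) • D (f i) := by
  induction s using Finset.induction_on with
  | empty => simp
  | insert a s ha ih =>
    rw [Finset.prod_insert ha, Derivation.leibniz, ih, Finset.sum_insert ha, add_comm,
      Finset.erase_insert ha, Finset.smul_sum]
    congr 1
    refine Finset.sum_congr rfl fun i hi => ?_
    have hne : a ≠ i := fun h => ha (h ▸ hi)
    rw [Finset.erase_insert_of_ne hne, Finset.prod_insert (by simp [ha]), smul_smul]

lemma derivation_det {R A : Type*} [CommRing R] [CommRing A] [Algebra R A]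
    (D : Derivation R A A) {ι : Type*} [Fintype ι] [DecidableEq ι] (M : Matrix ι ι A) :
    D M.det = (M.adjugate * M.map D).trace := by
  have h1 : D M.det = ∑ i, (M.updateCol i fun j => D (M j i)).det := by
    simp only [det_apply, map_sum]
    rw [Finset.sum_comm]
    refine Finset.sum_congr rfl fun σ _ => ?_
    rw [Units.smul_def, map_zsmul, ← Units.smul_def, derivation_prod, ← Finset.smul_sum]
    congr 1
    refine Finset.sum_congr rfl fun i _ => ?_
    rw [← Finset.mul_prod_erase univ _ (mem_univ i), updateCol_self, smul_eq_mul, mul_comm]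
    congr 1
    refine Finset.prod_congr rfl fun j hj => ?_
    simp_all
  rw [h1, trace]
  refine Finset.sum_congr rfl fun i _ => ?_
  rw [← cramer_apply, cramer_eq_adjugate_mulVec]
  simp [mulVec, dotProduct, mul_apply]

variable {K : Type*} [Field K] {ι : Type*} [Fintype ι] [DecidableEq ι]

lemma isZeta_charpolyRev (M : Matrix ι ι K) :
    IsZeta (M.charpolyRev : K⟦X⟧) (-tailSeries fun m => (M ^ m).trace) := by
  set A : Matrix ι ι K⟦X⟧ := 1 - (X : K⟦X⟧) • M.map (C (R := K)) with hA
  have hdet : (M.charpolyRev : K⟦X⟧) = A.det := by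
    rw [charpolyRev, ← Polynomial.coeToPowerSeries.ringHom_apply, RingHom.map_det]
    congr 1
    ext i j : 1
    by_cases h : i = j <;> simp [hA, h, mul_comm (C _) X]
  let G : Matrix ι ι K⟦X⟧ := of fun i j => mk fun m => (M ^ m) i j
  have hG : (X : K⟦X⟧) • (M.map (C (R := K)) * G) = G - 1 := by
    ext i j n
    rcases n with _ | n
    · simp [G, Matrix.one_apply]
    · have : coeff (n + 1) ((1 : Matrix ι ι K⟦X⟧) i j) = 0 := by
        rw [Matrix.one_apply]; split_ifs <;> simp [coeff_one]
      simp only [Matrix.smul_apply, smul_eq_mul, Matrix.sub_apply, map_sub, this]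
      rw [coeff_succ_X_mul, mul_apply, map_sum]
      simp [G, pow_succ', mul_apply]
  have hAG : A * G = 1 := by
    rw [hA, sub_mul, smul_mul_assoc, hG]; simp
  have hadj : A.adjugate = A.det • G := by
    calc A.adjugate = A.adjugate * (A * G) := by rw [hAG, mul_one]
      _ = _ := by rw [← mul_assoc, adjugate_mul, smul_mul_assoc, one_mul]
  have hDA : A.map (d⁄dX K) = -M.map (C (R := K)) := by
    ext1 i j
    have : d⁄dX K ((1 : Matrix ι ι K⟦X⟧) i j) = 0 := by
      rw [Matrix.one_apply]; split_ifs <;> simp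
    simp_all
  refine ⟨?_, ?_⟩
  · rw [← coeff_zero_eq_constantCoeff, Polynomial.coeff_coe, Polynomial.coeff_zero_eq_eval_zero,
      eval_charpolyRev]
  rw [hdet, derivation_det, hadj, hDA]
  have h3 : ((X : K⟦X⟧) • (M.map (C (R := K)) * G)).trace = tailSeries fun m => (M ^ m).trace := by
    rw [hG]
    ext n
    rcases n with _ | n
    · simp [G, trace]
    · rw [trace_sub, map_sub, trace_one, ← map_natCast (C (R := K)), coeff_C]
      simp [coeff_tailSeries, G, trace]
  rw [← h3, trace_smul, smul_mul_assoc, trace_smul, mul_neg, trace_neg, trace_mul_comm, smul_eq_mul,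
    smul_eq_mul]
  ring

end Det

section PadicNorm
variable {p : ℕ} [hp : Fact p.Prime] {K : Type*} [NormedField K] [IsUltrametricDist K]

lemma norm_eq_one_of_pow {x : K} {n : ℕ} (h : x ^ n = 1) (hn : n ≠ 0) : ‖x‖ = 1 :=
  (pow_eq_one_iff_of_nonneg (norm_nonneg _) hn).1 (by rw [← norm_pow, h, norm_one])

lemma inv_prime_lt_one (p : ℕ) [hp : Fact p.Prime] : (p : ℝ)⁻¹ < 1 :=
  inv_lt_one_of_one_lt₀ (by exact_mod_cast hp.1.one_lt)

lemma ultra_add_le {x y : K} {b : ℝ} (hx : ‖x‖ ≤ b) (hy : ‖y‖ ≤ b) : ‖x + y‖ ≤ b :=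
  (norm_add_le_max _ _).trans (max_le hx hy)

lemma ultra_sub_le {x y : K} {b : ℝ} (hx : ‖x‖ ≤ b) (hy : ‖y‖ ≤ b) : ‖x - y‖ ≤ b := by
  rw [sub_eq_add_neg]
  exact ultra_add_le hx (by rwa [norm_neg])

lemma norm_natCast_of_not_dvd (hK : ‖(p : K)‖ = (p : ℝ)⁻¹) {n : ℕ} (hn : ¬ p ∣ n) :
    ‖(n : K)‖ = 1 := by
  refine le_antisymm (norm_natCast_le_one K n) ?_
  obtain ⟨a, b, hab⟩ := Nat.isCoprime_iff_coprime.2 ((Nat.Prime.coprime_iff_not_dvd hp.1).2 hn)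
  have hab' : (a : K) * p + b * n = 1 := by exact_mod_cast congrArg (Int.cast : ℤ → K) hab
  by_contra! h
  have hl (a : ℤ) {x : K} (hx : ‖x‖ < 1) : ‖a * x‖ < 1 := by
    rw [norm_mul]
    exact mul_lt_one_of_nonneg_of_lt_one_right (norm_intCast_le_one K a) (norm_nonneg _) hx
  have := (norm_add_le_max _ _).trans_lt (max_lt (hl a (hK.trans_lt (inv_prime_lt_one p))) (hl b h))
  simp_all

lemma norm_natCast_eq (hK : ‖(p : K)‖ = (p : ℝ)⁻¹) {n : ℕ} (hn : n ≠ 0) :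
    ‖(n : K)‖ = (p : ℝ)⁻¹ ^ padicValNat p n := by
  conv_lhs => rw [← Nat.ordProj_mul_ordCompl_eq_self n p]
  rw [← Nat.factorization_def n hp.1, Nat.cast_mul, Nat.cast_pow, norm_mul, norm_pow, hK,
    norm_natCast_of_not_dvd hK (Nat.not_dvd_ordCompl hp.1 hn), mul_one]

lemma norm_ratCast_eq [CharZero K] (hK : ‖(p : K)‖ = (p : ℝ)⁻¹) (r : ℚ) :
    ‖(r : K)‖ = ‖(r : ℚ_[p])‖ := by
  have hnat (n : ℕ) : ‖(n : K)‖ = ‖(n : ℚ_[p])‖ := by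
    rcases eq_or_ne n 0 with rfl | hn
    · simp
    · rw [norm_natCast_eq hK hn, norm_natCast_eq (Padic.norm_p) hn]
  have hint (n : ℤ) : ‖(n : K)‖ = ‖(n : ℚ_[p])‖ := by
    obtain ⟨m, rfl | rfl⟩ := n.eq_nat_or_neg <;> simpa using hnat m
  rw [Rat.cast_def, Rat.cast_def, norm_div, norm_div, hnat, hint]

variable {ϖ : K}

lemma norm_pow_sub_one (hK : ‖(p : K)‖ = (p : ℝ)⁻¹) (hϖ : ϖ ^ (p - 1) = -p) :
    ‖ϖ‖ ^ (p - 1) = (p : ℝ)⁻¹ := by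
  rw [← norm_pow, hϖ, norm_neg, hK]

lemma norm_varpi_pos (hK : ‖(p : K)‖ = (p : ℝ)⁻¹) (hϖ : ϖ ^ (p - 1) = -p) : 0 < ‖ϖ‖ := by
  refine norm_pos_iff.2 fun h => inv_ne_zero (Nat.cast_ne_zero (R := ℝ).2 hp.1.ne_zero) ?_
  rw [← norm_pow_sub_one hK hϖ, h, norm_zero, zero_pow (Nat.sub_pos_of_lt hp.1.one_lt).ne']

lemma norm_varpi_eq (hK : ‖(p : K)‖ = (p : ℝ)⁻¹) (hϖ : ϖ ^ (p - 1) = -p) :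
    ‖ϖ‖ = (p : ℝ) ^ (-(1 / ((p : ℝ) - 1))) := by
  have h2 : (p : ℝ) - 1 ≠ 0 := sub_ne_zero.2 (by exact_mod_cast hp.1.ne_one)
  have hp0 : (0 : ℝ) ≤ p := by positivity
  rw [Real.rpow_neg hp0, ← Real.inv_rpow hp0, ← norm_pow_sub_one hK hϖ, ← Real.rpow_natCast,
    ← Real.rpow_mul (norm_nonneg _), Nat.cast_sub hp.1.one_le, Nat.cast_one,
    mul_one_div_cancel h2, Real.rpow_one]

lemma norm_varpi_lt_one (hK : ‖(p : K)‖ = (p : ℝ)⁻¹) (hϖ : ϖ ^ (p - 1) = -p) : ‖ϖ‖ < 1 := by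
  by_contra! h
  exact ((one_le_pow₀ h).trans_eq (norm_pow_sub_one hK hϖ)).not_gt (inv_prime_lt_one p)

/-- `|n!| ≥ |ϖ| ^ n`. -/
lemma norm_varpi_pow_le_factorial (hK : ‖(p : K)‖ = (p : ℝ)⁻¹) (hϖ : ϖ ^ (p - 1) = -p) (n : ℕ) :
    ‖ϖ‖ ^ n ≤ ‖(n.factorial : K)‖ := by
  rw [norm_natCast_eq hK n.factorial_ne_zero, ← norm_pow_sub_one hK hϖ, ← pow_mul,
    sub_one_mul_padicValNat_factorial]
  exact pow_le_pow_of_le_one (norm_nonneg _) (norm_varpi_lt_one hK hϖ).le (Nat.sub_le _ _)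

end PadicNorm

section ArtinHasse
open PowerSeries
variable {p : ℕ} [hp : Fact p.Prime]

open Classical in
/-- `∑_j X ^ (p ^ j)`. -/
noncomputable def ahLog (p : ℕ) (K : Type*) [Field K] : K⟦X⟧ :=
  mk fun n => if n ∈ Set.range (fun j : ℕ => p ^ j) then 1 else 0

lemma zero_notMem_range_pow : (0 : ℕ) ∉ Set.range (fun j : ℕ => p ^ j) := by
  simp [hp.1.ne_zero]

lemma coeff_zero_ahLog (K : Type*) [Field K] : coeff 0 (ahLog p K) = 0 := by
  rw [ahLog, coeff_mk, if_neg zero_notMem_range_pow]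

lemma dvd_coeff_pow_sub_expand (f : Polynomial ℤ_[p]) (m : ℕ) :
    (p : ℤ_[p]) ∣ (f ^ p - Polynomial.expand _ p f).coeff m := by
  have h0 : (f ^ p - Polynomial.expand _ p f).map PadicInt.toZMod = 0 := by
    rw [Polynomial.map_sub, Polynomial.map_pow, Polynomial.map_expand, ZMod.expand_card, sub_self]
  rw [← Ideal.mem_span_singleton, ← PadicInt.maximalIdeal_eq_span_p, ← PadicInt.ker_toZMod,
    RingHom.mem_ker, ← Polynomial.coeff_map, h0, Polynomial.coeff_zero]

lemma expand_derivative {K : Type*} [Field K] {F S : K⟦X⟧} (h : IsZeta F S) {n : ℕ}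
    (hn : n ≠ 0) : IsZeta (expand n hn F) (n • expand n hn S) := by
  refine ⟨by rw [constantCoeff_expand, h.const], ?_⟩
  rw [smul_mul_assoc, ← map_mul, ← h.deriv]
  ext m
  rw [coeff_X_mul_derivative, map_nsmul, coeff_expand, coeff_expand]
  split_ifs with hd
  · obtain ⟨k, rfl⟩ := hd
    rw [Nat.mul_div_cancel_left _ (Nat.pos_of_ne_zero hn), coeff_X_mul_derivative]
    grind
  · simp

lemma isZeta_exp_monomial {K : Type*} [Field K] [CharZero K] {m : ℕ} (hm : m ≠ 0) (c : K) :
    IsZeta (mk fun n => if m ∣ n then c ^ (n / m) / (n / m).factorial else 0)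
      (monomial m (m * c)) := by
  refine ⟨by simp, ?_⟩
  ext n
  rw [coeff_X_mul_derivative, coeff_mk, monomial_eq_C_mul_X_pow, mul_assoc, coeff_C_mul,
    coeff_X_pow_mul']
  have hm' := Nat.pos_of_ne_zero hm
  split_ifs with h1 h2 h2
  · obtain ⟨k, rfl⟩ := h1
    obtain ⟨k, rfl⟩ := Nat.exists_eq_succ_of_ne_zero (n := k) (by rintro rfl; omega)
    have h3 : m * (k + 1) - m = m * k := by rw [mul_add]; omega
    rw [coeff_mk, h3, if_pos (dvd_mul_right _ _), Nat.mul_div_cancel_left _ hm',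
      Nat.mul_div_cancel_left _ hm']
    have : ((k + 1 : ℕ) : K) ≠ 0 := Nat.cast_ne_zero.2 k.succ_ne_zero
    have h4 : ((k.factorial : ℕ) : K) ≠ 0 := Nat.cast_ne_zero.2 k.factorial_ne_zero
    rw [Nat.factorial_succ]
    grind
  · obtain ⟨k, rfl⟩ := h1
    simp_all
  · rw [coeff_mk, if_neg (by rwa [Nat.dvd_sub_iff_left h2 dvd_rfl]), mul_zero, mul_zero]
  · simp

lemma ahLog_functional (K : Type*) [Field K] [CharZero K] :
    p • ahLog p K = p • expand p hp.1.ne_zero (ahLog p K) + monomial 1 (((1 : ℕ) : K) * (p : K)) := by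
  ext n
  rw [map_add, map_nsmul, map_nsmul, coeff_expand, coeff_monomial, ahLog, coeff_mk]
  have hp1 := hp.1.one_lt
  by_cases h1 : n = 1
  · subst h1
    have : ¬ p ∣ 1 := by simpa using hp.1.ne_one
    simp_all
  · rw [if_neg h1, add_zero]
    congr 1
    split_ifs with h2 h3 h3
    · obtain ⟨_ | j, rfl⟩ := h2
      · simp at h1
      have : p ^ (j + 1) / p = p ^ j := by rw [pow_succ, Nat.mul_div_cancel _ hp.1.pos]
      simp_all
    · obtain ⟨j, rfl⟩ := h2
      simp_all
    · obtain ⟨k, rfl⟩ := h3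
      rw [Nat.mul_div_cancel_left _ hp.1.pos, coeff_mk, if_neg]
      rintro ⟨j, rfl⟩
      exact h2 ⟨j + 1, by simp [pow_succ']⟩
    · rfl

lemma norm_coeff_artinHasse_padic {A : ℚ_[p]⟦X⟧} (hA : IsZeta A (ahLog p ℚ_[p])) (n : ℕ) :
    ‖coeff n A‖ ≤ 1 := by
  induction n using Nat.strong_induction_on with
  | _ n ih =>
  rcases Nat.eq_zero_or_pos n with rfl | hn
  · rw [hA.coeff_zero, norm_one]
  set E : ℚ_[p]⟦X⟧ := mk fun n => if 1 ∣ n then (p : ℚ_[p]) ^ (n / 1) / (n / 1).factorial else 0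
    with hE
  have hEz : IsZeta E (monomial 1 (((1 : ℕ) : ℚ_[p]) * (p : ℚ_[p]))) :=
    isZeta_exp_monomial one_ne_zero _
  have hpR : (0 : ℝ) < p := by exact_mod_cast hp.1.pos
  have hEi {i : ℕ} (hi : i ≠ 0) : ‖coeff i E‖ ≤ (p : ℝ)⁻¹ := by
    rw [hE, coeff_mk, if_pos (one_dvd i), Nat.div_one, norm_div, norm_pow, Padic.norm_p, norm_natCast_eq Padic.norm_p i.factorial_ne_zero,
      div_le_iff₀ (by positivity), ← pow_succ']
    exact pow_le_pow_of_le_one (by positivity) (inv_prime_lt_one p).le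
      (padicValNat_factorial_lt_of_ne_zero p hi)
  have hfun : A ^ p = expand p hp.1.ne_zero A * E := by
    apply (hA.pow p).unique
    rw [ahLog_functional]
    exact (expand_derivative hA hp.1.ne_zero).mul hEz
  have hlift i : ∃ a : ℤ_[p], i < n → (a : ℚ_[p]) = coeff i A := by
    by_cases hi : i < n
    · exact ⟨⟨coeff i A, ih i hi⟩, fun _ => rfl⟩
    simp_all
  choose a ha using hlift
  set f : Polynomial ℤ_[p] := ∑ i ∈ range n, Polynomial.monomial i (a i) with hf
  have hfc i : f.coeff i = if i < n then a i else 0 := by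
    simp [hf, Polynomial.coeff_monomial]
  let φ : ℤ_[p] →+* ℚ_[p] := PadicInt.Coe.ringHom
  have hφ : ∀ x, φ x = (x : ℚ_[p]) := fun _ => rfl
  set g : ℚ_[p]⟦X⟧ := ((f.map φ : Polynomial ℚ_[p]) : ℚ_[p]⟦X⟧) with hg
  have hgc i : coeff i g = if i < n then coeff i A else 0 := by
    rw [hg, Polynomial.coeff_coe, Polynomial.coeff_map, hfc, hφ]
    grind
  obtain ⟨B, hB⟩ : X ^ n ∣ A - g := by
    rw [X_pow_dvd_iff]
    grind
  have hB0 : coeff 0 B = coeff n A := by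
    simpa [hgc, coeff_X_pow_mul'] using (congrArg (coeff n) hB).symm
  have hg0 : coeff 0 g = 1 := by rw [hgc, if_pos hn, hA.coeff_zero]
  have hleft : coeff n (A ^ p) = coeff n (g ^ p) + p * coeff n A := by
    have hAg : A = g + X ^ n * B := by rw [← hB]; ring
    obtain ⟨k, hk⟩ := Polynomial.powAddExpansion g (X ^ n * B) p
    conv_lhs => rw [hAg, hk]
    have e1 : (p : ℚ_[p]⟦X⟧) * g ^ (p - 1) * (X ^ n * B) = C (p : ℚ_[p]) * (X ^ n * (g ^ (p - 1) * B)) := by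
      rw [map_natCast]; ring
    have e2 : k * (X ^ n * B) ^ 2 = X ^ (2 * n) * (k * B ^ 2) := by ring
    rw [e1, e2, map_add, map_add, coeff_C_mul, coeff_X_pow_mul', if_pos le_rfl, Nat.sub_self,
      coeff_X_pow_mul', if_neg (by omega), add_zero]
    congr 2
    simp only [coeff_zero_eq_constantCoeff, map_mul, map_pow] at hg0 hB0 ⊢
    rw [hg0, hB0, one_pow, one_mul]
  have hexp : ∀ i ≤ n, coeff i (expand p hp.1.ne_zero A) =
      (((Polynomial.expand _ p f).coeff i : ℤ_[p]) : ℚ_[p]) := by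
    intro i hi
    rw [coeff_expand, Polynomial.coeff_expand hp.1.pos]
    split_ifs with hd
    · have hlt : i / p < n := by
        rcases Nat.eq_zero_or_pos i with rfl | h0
        · simpa using hn
        · exact (Nat.div_lt_self h0 hp.1.one_lt).trans_le hi
      grind
    · simp
  have hright : ‖coeff n (expand p hp.1.ne_zero A * E) -
      coeff n (expand p hp.1.ne_zero A)‖ ≤ (p : ℝ)⁻¹ := by
    have : coeff n (expand p hp.1.ne_zero A * E) - coeff n (expand p hp.1.ne_zero A) =
        coeff n (expand p hp.1.ne_zero A * (E - 1)) := by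
      rw [mul_sub, map_sub, mul_one]
    rw [this, coeff_mul]
    refine norm_sum_le_of_forall_le_of_nonneg (by positivity) fun x hx => ?_
    have hx' := mem_antidiagonal.1 hx
    rw [norm_mul, hexp x.1 (by omega)]
    refine (mul_le_mul (PadicInt.norm_le_one _) (?_ : _ ≤ (p : ℝ)⁻¹) (norm_nonneg _) zero_le_one).trans (by rw [one_mul])
    by_cases h0 : x.2 = 0
    · rw [h0, map_sub, hEz.coeff_zero]; simp
    · simpa [coeff_one, h0] using hEi h0
  have hmid : ‖coeff n (g ^ p) - coeff n (expand p hp.1.ne_zero A)‖ ≤ (p : ℝ)⁻¹ := by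
    have e1 : coeff n (g ^ p) = (((f ^ p).coeff n : ℤ_[p]) : ℚ_[p]) := by
      rw [hg, ← Polynomial.coe_pow, Polynomial.coeff_coe, ← Polynomial.map_pow,
        Polynomial.coeff_map, hφ]
    rw [e1, hexp n le_rfl, ← PadicInt.coe_sub, ← Polynomial.coeff_sub]
    obtain ⟨c, hc⟩ := dvd_coeff_pow_sub_expand f n
    rw [hc, PadicInt.coe_mul, norm_mul, PadicInt.coe_natCast, Padic.norm_p]
    exact mul_le_of_le_one_right (by positivity) (PadicInt.norm_le_one c)
  have hfin : (p : ℚ_[p]) * coeff n A =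
      (coeff n (expand p hp.1.ne_zero A * E) - coeff n (expand p hp.1.ne_zero A)) -
        (coeff n (g ^ p) - coeff n (expand p hp.1.ne_zero A)) := by
    rw [← hfun, hleft]; ring
  have hle : ‖(p : ℚ_[p]) * coeff n A‖ ≤ (p : ℝ)⁻¹ := by
    rw [hfin]
    exact ultra_sub_le hright hmid
  rw [norm_mul, Padic.norm_p] at hle
  simp_all

lemma IsZeta.map {K L : Type*} [Field K] [Field L] {F S : K⟦X⟧} (h : IsZeta F S) (φ : K →+* L) :
    IsZeta (PowerSeries.map φ F) (PowerSeries.map φ S) := by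
  refine ⟨by rw [← coeff_zero_eq_constantCoeff_apply, coeff_map, h.coeff_zero, map_one], ?_⟩
  ext n
  rw [coeff_X_mul_derivative, coeff_map, ← map_mul, ← h.deriv, coeff_map, coeff_X_mul_derivative]
  simp

lemma map_ahLog (L : Type*) [Field L] [CharZero L] :
    PowerSeries.map (Rat.castHom L) (ahLog p ℚ) = ahLog p L := by
  ext m
  rw [coeff_map, ahLog, ahLog, coeff_mk, coeff_mk]
  split_ifs <;> simp

lemma norm_coeff_artinHasse {K : Type*} [NormedField K] [IsUltrametricDist K] [CharZero K]
    (hK : ‖(p : K)‖ = (p : ℝ)⁻¹) {A : K⟦X⟧} (hA : IsZeta A (ahLog p K)) (n : ℕ) :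
    ‖coeff n A‖ ≤ 1 := by
  obtain ⟨A₀, hA₀⟩ := exists_isZeta (coeff_zero_ahLog (p := p) ℚ)
  have h1 : IsZeta (PowerSeries.map (Rat.castHom K) A₀) (ahLog p K) := by
    rw [← map_ahLog K]; exact hA₀.map _
  have h2 : IsZeta (PowerSeries.map (Rat.castHom ℚ_[p]) A₀) (ahLog p ℚ_[p]) := by
    rw [← map_ahLog ℚ_[p]]; exact hA₀.map _
  rw [hA.unique h1, coeff_map]
  simpa [norm_ratCast_eq hK] using norm_coeff_artinHasse_padic h2 n

end ArtinHasse

section Theta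
open PowerSeries
variable {p : ℕ} [hp : Fact p.Prime] {K : Type*} [NormedField K] [IsUltrametricDist K]

lemma norm_coeff_mul_le {F G : K⟦X⟧} {r : ℝ} (hr : 0 ≤ r) (hF : ∀ n, ‖coeff n F‖ ≤ r ^ n)
    (hG : ∀ n, ‖coeff n G‖ ≤ r ^ n) (n : ℕ) : ‖coeff n (F * G)‖ ≤ r ^ n := by
  rw [coeff_mul]
  refine norm_sum_le_of_forall_le_of_nonneg (by positivity) fun x hx => ?_
  rw [norm_mul, ← mem_antidiagonal.1 hx, pow_add]
  exact mul_le_mul (hF _) (hG _) (norm_nonneg _) (by positivity)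

lemma norm_coeff_one_le {r : ℝ} (hr : 0 ≤ r) (n : ℕ) : ‖coeff n (1 : K⟦X⟧)‖ ≤ r ^ n := by
  rw [coeff_one]; split_ifs with h
  · simp [h]
  simp_all

lemma norm_coeff_prod_le {ι : Type*} {r : ℝ} (hr : 0 ≤ r) (s : Finset ι) (F : ι → K⟦X⟧)
    (hF : ∀ i ∈ s, ∀ n, ‖coeff n (F i)‖ ≤ r ^ n) (n : ℕ) :
    ‖coeff n (∏ i ∈ s, F i)‖ ≤ r ^ n := by
  classical
  induction s using Finset.induction_on generalizing n with
  | empty => simpa using norm_coeff_one_le hr n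
  | insert a s ha ih =>
    rw [Finset.prod_insert ha]
    exact norm_coeff_mul_le hr (hF a (by simp)) (fun n => ih (fun i hi => hF i (by simp [hi])) n) n

variable [CharZero K] {ϖ : K}

/-- Coefficient bound for the exponential of a series with small coefficients. -/
lemma IsZeta.norm_coeff_le (hK : ‖(p : K)‖ = (p : ℝ)⁻¹) (hϖ : ϖ ^ (p - 1) = -p)
    {F S : K⟦X⟧} (h : IsZeta F S) {r : ℝ} (hr : 0 ≤ r)
    (hS : ∀ m, ‖coeff m S‖ ≤ ‖(m : K)‖ * (‖ϖ‖ * r ^ m)) (n : ℕ) : ‖coeff n F‖ ≤ r ^ n := by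
  let c : ℕ → K := fun m => coeff m S / m
  let E : ℕ → K⟦X⟧ := fun m =>
    PowerSeries.mk fun n => if m ∣ n then c m ^ (n / m) / (n / m).factorial else 0
  have hE : IsZeta (∏ m ∈ Icc 1 n, E m) (∑ m ∈ Icc 1 n, monomial m (m * c m)) :=
    IsZeta.prod _ fun m hm => isZeta_exp_monomial (by have := mem_Icc.1 hm; omega) _
  rw [h.coeff_congr hE n]
  · refine norm_coeff_prod_le hr _ _ (fun m hm i => ?_) n
    have hm0 : m ≠ 0 := by have := mem_Icc.1 hm; omega
    simp only [E, coeff_mk]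
    split_ifs with hd
    · obtain ⟨k, rfl⟩ := hd
      rw [Nat.mul_div_cancel_left _ (Nat.pos_of_ne_zero hm0), norm_div, norm_pow]
      have hm' : 0 < ‖(m : K)‖ := norm_pos_iff.2 (Nat.cast_ne_zero.2 hm0)
      have hc : ‖c m‖ ≤ ‖ϖ‖ * r ^ m := by
        rw [norm_div, div_le_iff₀ hm', mul_comm]; exact hS m
      have hf : 0 < ‖(k.factorial : K)‖ := norm_pos_iff.2 (Nat.cast_ne_zero.2 k.factorial_ne_zero)
      rw [div_le_iff₀ hf, pow_mul]
      calc ‖c m‖ ^ k ≤ (‖ϖ‖ * r ^ m) ^ k := by gcongr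
        _ = (r ^ m) ^ k * ‖ϖ‖ ^ k := by rw [mul_pow, mul_comm]
        _ ≤ _ := by gcongr; exact norm_varpi_pow_le_factorial hK hϖ k
    simp_all
  · intro m hm
    rw [map_sum]
    rcases Nat.eq_zero_or_pos m with rfl | hm0
    · rw [h.coeff_zero_right, Finset.sum_eq_zero]
      intro i hi
      rw [coeff_monomial, if_neg (by have := mem_Icc.1 hi; omega)]
    · rw [Finset.sum_eq_single m]
      · have : (m : K) ≠ 0 := Nat.cast_ne_zero.2 hm0.ne'
        simp only [coeff_monomial, if_true, c]; field_simp
      · intro i _ hi; rw [coeff_monomial, if_neg hi.symm]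
      grind

/-- Logarithmic derivative of Dwork's series. -/
noncomputable def thetaLog (p : ℕ) (ϖ : K) : K⟦X⟧ := monomial 1 ϖ + monomial p (ϖ ^ p)

/-- Dwork's splitting series `exp (ϖ (X - X ^ p))`, for `ϖ ^ (p - 1) = -p`. -/
noncomputable def theta (p : ℕ) (ϖ : K) : K⟦X⟧ := mk (zetaCoeff (thetaLog p ϖ))

lemma isZeta_theta : IsZeta (theta p ϖ) (thetaLog p ϖ) :=
  isZeta_mk_zetaCoeff (by
    rw [thetaLog, map_add, coeff_monomial, coeff_monomial, if_neg (by omega),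
      if_neg hp.1.ne_zero.symm, add_zero])

lemma coeff_theta_of_lt {n : ℕ} (hn : n < p) :
    coeff n (theta p ϖ) = ϖ ^ n / n.factorial := by
  have h := isZeta_exp_monomial one_ne_zero ϖ
  rw [(isZeta_theta (p := p)).coeff_congr h n]
  · simp
  · intro m hm
    rw [thetaLog, map_add, coeff_monomial m p, if_neg (by omega), add_zero]
    simp

/-- The radius governing the growth of the coefficients of `theta`. -/
noncomputable def thetaRadius (p : ℕ) : ℝ := (p : ℝ) ^ (-(((p : ℝ) - 1) / p ^ 2))

lemma thetaRadius_pos : 0 < thetaRadius p :=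
  Real.rpow_pos_of_pos (by exact_mod_cast hp.1.pos) _

lemma norm_varpi_le_thetaRadius (hK : ‖(p : K)‖ = (p : ℝ)⁻¹) (hϖ : ϖ ^ (p - 1) = -p) :
    ‖ϖ‖ ≤ thetaRadius p := by
  have h1 : (1 : ℝ) < p := by exact_mod_cast hp.1.one_lt
  rw [norm_varpi_eq hK hϖ, thetaRadius]
  refine Real.rpow_le_rpow_of_exponent_le h1.le (neg_le_neg ?_)
  rw [div_le_div_iff₀ (by positivity) (by linarith)]
  nlinarith

lemma two_mul_pow_ge (hp2 : 2 ≤ p) (j : ℕ) : j + 2 ≤ 2 * p ^ j := by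
  induction j with
  | zero => simp
  | succ j ih =>
    have : 2 * p ^ j ≤ p * p ^ j := Nat.mul_le_mul_right _ hp2
    grind

lemma norm_coeff_theta_le (hK : ‖(p : K)‖ = (p : ℝ)⁻¹) (hϖ : ϖ ^ (p - 1) = -p) (n : ℕ) :
    ‖coeff n (theta p ϖ)‖ ≤ thetaRadius p ^ n := by
  obtain ⟨A, hA⟩ := exists_isZeta (coeff_zero_ahLog (p := p) K)
  have hA1 := hA.rescale ϖ
  have h0 : coeff 0 (thetaLog p ϖ - rescale ϖ (ahLog p K)) = 0 := by
    rw [map_sub, (isZeta_theta (p := p) (ϖ := ϖ)).coeff_zero_right, hA1.coeff_zero_right, sub_zero]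
  obtain ⟨H, hH⟩ := exists_isZeta h0
  have hθ : theta p ϖ = rescale ϖ A * H := by
    apply isZeta_theta.unique
    have := hA1.mul hH
    rwa [add_sub_cancel] at this
  have hr := (thetaRadius_pos (p := p)).le
  have hp1 : (1 : ℝ) < p := by exact_mod_cast hp.1.one_lt
  rw [hθ]
  refine norm_coeff_mul_le hr (fun m => ?_) (hH.norm_coeff_le hK hϖ hr fun m => ?_) n
  · rw [coeff_rescale, norm_mul, norm_pow]
    calc ‖ϖ‖ ^ m * ‖coeff m A‖ ≤ ‖ϖ‖ ^ m * 1 := by gcongr; exact norm_coeff_artinHasse hK hA m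
      _ ≤ _ := by rw [mul_one]; gcongr; exact norm_varpi_le_thetaRadius hK hϖ
  · rw [map_sub, coeff_rescale, thetaLog, map_add, coeff_monomial, coeff_monomial, ahLog, coeff_mk]
    by_cases hm : m ∈ Set.range (fun j : ℕ => p ^ j)
    · rw [if_pos hm]
      obtain ⟨j, rfl⟩ := hm
      rcases j with _ | _ | j
      · have : (1 : ℕ) ≠ p := hp.1.ne_one.symm
        simp [this]; positivity
      · have : p ≠ 1 := hp.1.ne_one
        simp [this]; positivity
      · have e1 : p ^ (j + 1 + 1) ≠ 1 := (Nat.one_lt_pow (by omega) hp.1.one_lt).ne'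
        have e2 : p ^ (j + 1 + 1) ≠ p := by
          intro h
          have : p ^ (j + 1 + 1) = p ^ 1 := by rw [h, pow_one]
          have := Nat.pow_right_injective hp.1.two_le this
          omega
        simp only [if_neg e1, if_neg e2, add_zero, zero_sub, mul_one, norm_neg, norm_pow]
        rw [Nat.cast_pow, norm_pow, hK, norm_varpi_eq hK hϖ, thetaRadius, ← Real.rpow_natCast,
          ← Real.rpow_natCast, ← Real.rpow_natCast, ← Real.rpow_neg_one,
          ← Real.rpow_mul (by positivity), ← Real.rpow_mul (by positivity),
          ← Real.rpow_mul (by positivity), ← Real.rpow_add (by positivity),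
          ← Real.rpow_add (by positivity)]
        refine Real.rpow_le_rpow_of_exponent_le hp1.le ?_
        have h2 : ((j : ℝ) + 2) ≤ 2 * (p : ℝ) ^ j := by
          exact_mod_cast two_mul_pow_ge hp.1.two_le j
        have h3 : (1 : ℝ) ≤ (p : ℝ) ^ j := one_le_pow₀ hp1.le
        push_cast
        have hq : (0 : ℝ) < (p : ℝ) - 1 := by linarith
        have hpp : (0 : ℝ) < (p : ℝ) := by positivity
        have e3 : (p : ℝ) ^ (j + 1 + 1) = (p : ℝ) ^ j * p ^ 2 := by ring
        rw [e3]
        have e4 : -(((p : ℝ) - 1) / p ^ 2) * ((p : ℝ) ^ j * p ^ 2) = -((p : ℝ) - 1) * p ^ j := by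
          field_simp
        rw [e4]
        have e5 : -(1 / ((p : ℝ) - 1)) * ((p : ℝ) ^ j * p ^ 2) =
            -(p ^ j * (p + 1)) - p ^ j * (1 / ((p : ℝ) - 1)) := by
          field_simp; ring
        rw [e5]
        have h4 : 0 < 1 / ((p : ℝ) - 1) := by positivity
        nlinarith
    · rw [if_neg hm]
      have e1 : m ≠ 1 := fun h => hm ⟨0, by simp [h]⟩
      have e2 : m ≠ p := fun h => hm ⟨1, by simp [h]⟩
      simp [e1, e2]; positivity

end Theta

section Gauss
open Polynomial
variable {K : Type*} [NormedField K] [IsUltrametricDist K] {ρ A B : ℝ} {f g : K[X]}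

/-- `f` has Gauss norm at most `A` on the disc of radius `ρ`. -/
def GBound (ρ A : ℝ) (f : K[X]) : Prop := ∀ i, ‖f.coeff i‖ * ρ ^ i ≤ A

lemma GBound.nonneg (h : GBound ρ A f) : 0 ≤ A :=
  le_trans (by simp) (h 0)

lemma GBound.mono (h : GBound ρ A f) (hAB : A ≤ B) : GBound ρ B f := fun i => (h i).trans hAB

lemma GBound.zero (hA : 0 ≤ A) : GBound ρ A (0 : K[X]) := fun i => by simpa using hA

lemma GBound.add (hρ : 0 ≤ ρ) (hf : GBound ρ A f) (hg : GBound ρ A g) : GBound ρ A (f + g) := by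
  intro i
  rw [coeff_add]
  rcases max_choice ‖f.coeff i‖ ‖g.coeff i‖ with h | h
  · exact (mul_le_mul_of_nonneg_right ((norm_add_le_max _ _).trans h.le)
      (pow_nonneg hρ i)).trans (hf i)
  · exact (mul_le_mul_of_nonneg_right ((norm_add_le_max _ _).trans h.le)
      (pow_nonneg hρ i)).trans (hg i)

lemma GBound.neg (hf : GBound ρ A f) : GBound ρ A (-f) := fun i => by
  rw [coeff_neg, norm_neg]; exact hf i

lemma GBound.sub (hρ : 0 ≤ ρ) (hf : GBound ρ A f) (hg : GBound ρ A g) : GBound ρ A (f - g) := by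
  rw [sub_eq_add_neg]; exact hf.add hρ hg.neg

lemma GBound.sum {ι : Type*} (hρ : 0 ≤ ρ) (hA : 0 ≤ A) (s : Finset ι) (F : ι → K[X])
    (h : ∀ i ∈ s, GBound ρ A (F i)) : GBound ρ A (∑ i ∈ s, F i) := by
  classical
  induction s using Finset.induction_on with
  | empty => simpa using GBound.zero hA
  | insert a s ha ih =>
    rw [sum_insert ha]
    exact (h a (by simp)).add hρ (ih fun i hi => h i (by simp [hi]))

lemma GBound.mul (hρ : 0 < ρ) (hf : GBound ρ A f) (hg : GBound ρ B g) :
    GBound ρ (A * B) (f * g) := by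
  intro i
  have hA := hf.nonneg
  have hB := hg.nonneg
  rw [coeff_mul, ← le_div_iff₀ (by positivity)]
  refine norm_sum_le_of_forall_le_of_nonneg (by positivity) fun x hx => ?_
  rw [le_div_iff₀ (by positivity), norm_mul, ← mem_antidiagonal.1 hx, pow_add,
    mul_mul_mul_comm]
  exact mul_le_mul (hf _) (hg _) (by positivity) hA

lemma GBound.C (c : K) : GBound ρ ‖c‖ (C c) := by
  intro i
  rw [coeff_C]; split_ifs with h
  · simp [h]
  · simp

lemma GBound.one : GBound ρ 1 (1 : K[X]) := by
  simpa using GBound.C (ρ := ρ) (1 : K)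

lemma GBound.C_mul (hρ : 0 < ρ) (c : K) (hf : GBound ρ A f) : GBound ρ (‖c‖ * A) (.C c * f) :=
  (GBound.C c).mul hρ hf

lemma GBound.X : GBound ρ ρ (X : K[X]) ∨ ρ < 0 := by
  by_cases h : 0 ≤ ρ
  · left; intro i
    rw [coeff_X]; split_ifs with h'
    · simp [← h']
    · simpa using h
  · right; exact not_le.1 h

lemma GBound.linear (hρ : 0 < ρ) {a c : K} (ha : ‖a‖ * ρ ≤ A) (hc : ‖c‖ ≤ A) :
    GBound ρ A (.C a * (Polynomial.X : K[X]) - .C c) := by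
  refine GBound.sub hρ.le ?_ ((GBound.C c).mono hc)
  exact ((GBound.X.resolve_right (not_lt.2 hρ.le)).C_mul hρ a).mono ha

lemma GBound.prod {ι : Type*} (hρ : 0 < ρ) (s : Finset ι) (F : ι → K[X]) (A : ι → ℝ)
    (h : ∀ i ∈ s, GBound ρ (A i) (F i)) : GBound ρ (∏ i ∈ s, A i) (∏ i ∈ s, F i) := by
  classical
  induction s using Finset.induction_on with
  | empty => simpa using GBound.one
  | insert a s ha ih =>
    rw [prod_insert ha, prod_insert ha]
    exact (h a (by simp)).mul hρ (ih fun i hi => h i (by simp [hi]))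

lemma GBound.pow (hρ : 0 < ρ) (h : GBound ρ A f) (n : ℕ) : GBound ρ (A ^ n) (f ^ n) := by
  simpa using GBound.prod hρ (range n) (fun _ => f) (fun _ => A) fun _ _ => h

lemma GBound.comp (hρ : 0 < ρ) (hf : GBound ρ A f) (hg : GBound ρ ρ g) :
    GBound ρ A (f.comp g) := by
  rw [comp_eq_sum_left, Polynomial.sum]
  exact GBound.sum hρ.le hf.nonneg _ _ fun i _ => ((hg.pow hρ i).C_mul hρ _).mono (hf i)

lemma GBound.norm_eval_le (hρ : 0 < ρ) (hf : GBound ρ A f) {x : K} (hx : ‖x‖ ≤ ρ) :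
    ‖f.eval x‖ ≤ A := by
  rw [eval_eq_sum, Polynomial.sum]
  refine norm_sum_le_of_forall_le_of_nonneg hf.nonneg fun i _ => ?_
  rw [norm_mul, norm_pow]
  exact le_trans (by gcongr) (hf i)

lemma GBound.pow_sub_pow (hρ : 0 < ρ) {ε : ℝ} (hf : GBound ρ 1 f) (hg : GBound ρ 1 g)
    (h : GBound ρ ε (f - g)) (n : ℕ) : GBound ρ ε (f ^ n - g ^ n) := by
  rw [← Commute.mul_geom_sum₂ (Commute.all f g) n, ← mul_one ε]
  refine h.mul hρ (GBound.sum hρ.le zero_le_one _ _ fun i _ => ?_)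
  simpa using (hf.pow hρ i).mul hρ (hg.pow hρ (n - 1 - i))

end Gauss

section FallBasis
open Polynomial
variable {K : Type*} [Field K]

/-- The product of the first `a` factors of `s ^ k (s - 1) ^ k (s - 2) ^ k ⋯`. -/
noncomputable def fall (K : Type*) [Field K] (k a : ℕ) : K[X] :=
  ∏ i ∈ range a, (X - C (((i / k : ℕ) : K)))

lemma fall_zero (k : ℕ) : fall K k 0 = 1 := by simp [fall]

lemma fall_succ (k a : ℕ) : fall K k (a + 1) = fall K k a * (X - C (((a / k : ℕ) : K))) := by
  rw [fall, prod_range_succ, fall]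

lemma monic_fall (k a : ℕ) : (fall K k a).Monic := monic_prod_of_monic _ _ fun i _ => monic_X_sub_C _

lemma natDegree_fall (k a : ℕ) : (fall K k a).natDegree = a := by
  rw [fall, natDegree_prod_of_monic _ _ fun i _ => monic_X_sub_C _]; simp [natDegree_X_sub_C, -map_natCast]

/-- The polynomials `fall K k a` as a polynomial sequence. -/
noncomputable def fallSeq (K : Type*) [Field K] (k : ℕ) : Sequence K where
  elems' := fall K k
  degree_eq' a := by
    rw [degree_eq_natDegree (monic_fall k a).ne_zero, natDegree_fall]

/-- The basis `fall K k` of the space of polynomials. -/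
noncomputable def fallBasis (K : Type*) [Field K] (k : ℕ) : Module.Basis ℕ K K[X] :=
  (fallSeq K k).basis fun i => by simp

lemma fallBasis_apply (k a : ℕ) : fallBasis K k a = fall K k a :=
  Sequence.basis_eq_self _ _ a

/-- The coordinate functionals of `fallBasis`. -/
noncomputable def fallCoord (k a : ℕ) : K[X] →ₗ[K] K := (fallBasis K k).coord a

lemma fallCoord_fall (k a b : ℕ) : fallCoord k a (fall K k b) = if a = b then 1 else 0 := by
  rw [fallCoord, ← fallBasis_apply, Module.Basis.coord_apply, Module.Basis.repr_self,
    Finsupp.single_apply]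
  simp only [eq_comm]

lemma X_mul_fall (k a : ℕ) :
    X * fall K k a = C (((a / k : ℕ) : K)) * fall K k a + fall K k (a + 1) := by
  rw [fall_succ]; ring

lemma fallCoord_X_mul (k a : ℕ) (g : K[X]) :
    fallCoord k a (X * g) = ((a / k : ℕ) : K) * fallCoord k a g +
      if a = 0 then 0 else fallCoord k (a - 1) g := by
  have : (fallCoord k a) ∘ₗ (LinearMap.mulLeft K (X : K[X])) =
      (((a / k : ℕ) : K)) • fallCoord k a + if a = 0 then 0 else fallCoord k (a - 1) := by
    refine (fallBasis K k).ext fun b => ?_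
    rw [LinearMap.comp_apply, fallBasis_apply, LinearMap.mulLeft_apply, X_mul_fall, map_add,
      ← smul_eq_C_mul, map_smul, fallCoord_fall, fallCoord_fall]
    split_ifs with h1 h2 h3 h4 h5 <;>
      simp [fallCoord_fall, *] <;> omega
  have h := LinearMap.congr_fun this g
  rw [LinearMap.comp_apply, LinearMap.mulLeft_apply] at h
  rw [h]
  split_ifs <;> simp

/-- Expansion in the basis `fall`. -/
lemma sum_fallCoord_mul (k : ℕ) (g : K[X]) {s : Finset ℕ} (hs : ∀ a, fallCoord k a g ≠ 0 → a ∈ s) :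
    ∑ a ∈ s, C (fallCoord k a g) * fall K k a = g := by
  conv_rhs => rw [← (fallBasis K k).linearCombination_repr g]
  rw [Finsupp.linearCombination_apply, Finsupp.sum_of_support_subset _ (s := s)]
  · refine sum_congr rfl fun a _ => ?_
    rw [fallBasis_apply, smul_eq_C_mul, fallCoord, Module.Basis.coord_apply]
  · intro a ha
    exact hs a (by simpa [fallCoord, Module.Basis.coord_apply] using ha)
  · simp

lemma finite_fallCoord (k : ℕ) (g : K[X]) : (Function.support fun a => fallCoord k a g).Finite := by
  have := ((fallBasis K k).repr g).hasFiniteSupport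
  exact this

lemma fall_add (k : ℕ) (hk : 0 < k) (a : ℕ) :
    fall K k (a + k) = X ^ k * (fall K k a).comp (X - C 1) := by
  rw [fall, add_comm, prod_range_add, prod_congr rfl (g := fun _ => X), prod_const, card_range]
  · rw [fall, Polynomial.prod_comp]
    congr 1
    refine prod_congr rfl fun i _ => ?_
    rw [Nat.add_div_left _ hk]
    simp
    ring
  · intro i hi
    rw [Nat.div_eq_of_lt (mem_range.1 hi)]; simp

lemma fallCoord_shift (k : ℕ) (hk : 0 < k) (a : ℕ) (g : K[X]) :
    fallCoord k a (X ^ k * g.comp (X - C 1)) = if a < k then 0 else fallCoord k (a - k) g := by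
  have : (fallCoord k a) ∘ₗ (LinearMap.mulLeft K ((X : K[X]) ^ k)) ∘ₗ
      (aeval (X - C 1 : K[X])).toLinearMap = if a < k then 0 else fallCoord k (a - k) := by
    refine (fallBasis K k).ext fun b => ?_
    have h := fall_add (K := K) k hk b
    rw [LinearMap.comp_apply, LinearMap.comp_apply, fallBasis_apply, LinearMap.mulLeft_apply,
      AlgHom.toLinearMap_apply, show aeval (X - C 1 : K[X]) (fall K k b) =
        (fall K k b).comp (X - C 1) from rfl, ← h, fallCoord_fall]
    split_ifs with h1 h2 h2 <;> simp [fallCoord_fall] <;> omega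
  have h := LinearMap.congr_fun this g
  rw [LinearMap.comp_apply, LinearMap.comp_apply, LinearMap.mulLeft_apply] at h
  refine h.trans ?_
  split_ifs <;> simp

lemma fallCoord_X_pow_mul (k : ℕ) (hk : 0 < k) {a : ℕ} (ha : a < k) (g : K[X]) :
    fallCoord k a (X ^ k * g) = 0 := by
  have := fallCoord_shift k hk a (g.comp (X + C 1))
  rwa [comp_assoc, add_comp, X_comp, C_comp, sub_add_cancel, comp_X, if_pos ha] at this

lemma degree_sub_fall_lt (k : ℕ) {n : ℕ} {g : K[X]} (h : g.degree < (n + 1 : ℕ)) :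
    (g - C (g.coeff n) * fall K k n).degree < n := by
  rw [degree_lt_iff_coeff_zero] at h ⊢
  intro i hi
  rw [coeff_sub, coeff_C_mul]
  rcases hi.eq_or_lt with rfl | hi
  · have := monic_fall (K := K) k n
    rw [Monic, leadingCoeff, natDegree_fall] at this
    rw [this, mul_one, sub_self]
  · rw [h i hi, coeff_eq_zero_of_natDegree_lt (p := fall K k n) (by rwa [natDegree_fall]), mul_zero, sub_zero]

lemma fallCoord_of_degree_lt (k : ℕ) {n a : ℕ} {g : K[X]} (h : g.degree < n) (ha : n ≤ a) :
    fallCoord k a g = 0 := by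
  induction n generalizing g with
  | zero =>
    simp_all
  | succ n ih =>
    have := ih (degree_sub_fall_lt k h) (by omega)
    rwa [map_sub, ← smul_eq_C_mul, map_smul, fallCoord_fall, if_neg (by omega), smul_zero,
      sub_zero] at this

end FallBasis

section CoordBound
open Polynomial
variable {K : Type*} [NormedField K] [IsUltrametricDist K] {ρ A : ℝ}

lemma gBound_linear_nat (hρ : 1 ≤ ρ) (i : ℕ) : GBound ρ ρ (X - C (i : K)) := by
  have := GBound.linear (A := ρ) (by linarith) (a := (1 : K)) (c := (i : K)) (by simp)
        ((norm_natCast_le_one K _).trans hρ)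
  rwa [C_1, one_mul] at this

lemma gBound_fall (hρ : 1 ≤ ρ) (k a : ℕ) : GBound ρ (ρ ^ a) (fall K k a) := by
  rw [show ρ ^ a = ∏ i ∈ range a, ρ by simp]
  exact GBound.prod (by linarith) _ _ _ fun i _ => gBound_linear_nat hρ _

/-- The coordinates in the basis `fall` are controlled by the Gauss norm. -/
lemma GBound.norm_fallCoord_le (hρ : 1 ≤ ρ) (k : ℕ) {g : K[X]} (hg : GBound ρ A g) (a : ℕ) :
    ‖fallCoord k a g‖ * ρ ^ a ≤ A := by
  have h0 : 0 < ρ := by linarith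
  obtain ⟨n, hn⟩ : ∃ n : ℕ, g.degree < n :=
    ⟨g.natDegree + 1, degree_le_natDegree.trans_lt (by exact_mod_cast Nat.lt_succ_self _)⟩
  induction n generalizing g with
  | zero =>
    rw [Nat.cast_zero, Nat.WithBot.lt_zero_iff, degree_eq_bot] at hn
    rw [hn, map_zero]; simpa using hg.nonneg
  | succ n ih =>
    have hlt := degree_sub_fall_lt k hn
    have hB : GBound ρ A (.C (g.coeff n) * fall K k n) := ((gBound_fall hρ k _).C_mul h0 _).mono (hg n)
    have h1 := ih (hg.sub h0.le hB) hlt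
    by_cases ha : a = n
    · subst ha
      have := fallCoord_of_degree_lt k hlt le_rfl
      rw [map_sub, ← smul_eq_C_mul, map_smul, fallCoord_fall, if_pos rfl, sub_eq_zero] at this
      rw [this, smul_eq_mul, mul_one]
      exact hg a
    · rwa [map_sub, ← smul_eq_C_mul, map_smul, fallCoord_fall, if_neg ha, smul_zero, sub_zero] at h1

end CoordBound

section DwMat
open Polynomial Filter Topology
variable {K : Type*} [NormedField K] [IsUltrametricDist K] {ρ κ A B : ℝ} {k : ℕ}

/-- The matrix of the weighted composition operator `g ↦ h * g ∘ L` in the basis `fall`. -/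
noncomputable def dwMat (k : ℕ) (h L : K[X]) (a b : ℕ) : K :=
  fallCoord k a (h * (fall K k b).comp L)

/-- A linear substitution mapping the disc of radius `ρ` into the unit disc. -/
def Contracts (ρ : ℝ) (L : K[X]) : Prop := ∀ n : ℕ, GBound ρ 1 (L - C (n : K))

lemma Contracts.gBound_fall_comp (hρ : 1 ≤ ρ) {L : K[X]} (hL : Contracts ρ L) (b : ℕ) :
    GBound ρ 1 ((fall K k b).comp L) := by
  rw [fall, Polynomial.prod_comp, show (1 : ℝ) = ∏ i ∈ range b, 1 by simp]
  refine GBound.prod (by linarith) _ _ _ fun i _ => ?_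
  simpa using hL (i / k)

lemma norm_dwMat_le (hρ : 1 ≤ ρ) {h L : K[X]} (hh : GBound ρ A h) (hL : Contracts ρ L) (a b : ℕ) :
    ‖dwMat k h L a b‖ ≤ A * (ρ⁻¹) ^ a := by
  have := (hh.mul (by linarith) (hL.gBound_fall_comp (k := k) hρ b)).norm_fallCoord_le hρ k a
  rw [mul_one] at this
  have h0 : 0 < ρ := by linarith
  rw [inv_pow, ← div_eq_mul_inv, le_div_iff₀ (by positivity)]
  exact this

lemma dwMat_sub (h h' L : K[X]) (a b : ℕ) :
    dwMat k (h - h') L a b = dwMat k h L a b - dwMat k h' L a b := by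
  rw [dwMat, sub_mul, map_sub]; rfl

/-- `h` is a sequence of polynomials converging geometrically in Gauss norm. -/
structure GCauchy (ρ κ A : ℝ) (h : ℕ → K[X]) : Prop where
  bdd : ∀ N, GBound ρ A (h N)
  cauchy : ∀ N M, N ≤ M → GBound ρ (A * κ ^ N) (h M - h N)

lemma GCauchy.const (hκ : 0 ≤ κ) {f : K[X]} (hf : GBound ρ A f) :
    GCauchy ρ κ A (fun _ => f) :=
  ⟨fun _ => hf, fun N M _ => by
    rw [sub_self]; exact GBound.zero (mul_nonneg hf.nonneg (pow_nonneg hκ N))⟩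

lemma GCauchy.mul (hρ : 0 < ρ) {f g : ℕ → K[X]} (hf : GCauchy ρ κ A f)
    (hg : GCauchy ρ κ B g) : GCauchy ρ κ (A * B) (fun N => f N * g N) := by
  refine ⟨fun N => (hf.bdd N).mul hρ (hg.bdd N), fun N M h => ?_⟩
  rw [show f M * g M - f N * g N = f M * (g M - g N) + (f M - f N) * g N by ring]
  refine GBound.add hρ.le ?_ ?_
  · rw [mul_assoc]
    exact (hf.bdd M).mul hρ (hg.cauchy N M h)
  · rw [mul_right_comm]
    exact (hf.cauchy N M h).mul hρ (hg.bdd N)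

lemma GCauchy.prod {ι : Type*} (hρ : 0 < ρ) (hκ : 0 ≤ κ) (s : Finset ι) {f : ι → ℕ → K[X]}
    (hf : ∀ i ∈ s, GCauchy ρ κ 1 (f i)) : GCauchy ρ κ 1 (fun N => ∏ i ∈ s, f i N) := by
  classical
  induction s using Finset.induction_on with
  | empty => simpa using GCauchy.const hκ GBound.one
  | insert a s ha ih =>
    simp only [prod_insert ha]
    simpa using (hf a (by simp)).mul hρ (ih fun i hi => hf i (by simp [hi]))

lemma GCauchy.pow (hρ : 0 < ρ) (hκ : 0 ≤ κ) {f : ℕ → K[X]} (hf : GCauchy ρ κ 1 f) (n : ℕ) :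
    GCauchy ρ κ 1 (fun N => f N ^ n) := by
  simpa using GCauchy.prod hρ hκ (range n) fun _ _ => hf

lemma GCauchy.comp (hρ : 0 < ρ) {f : ℕ → K[X]} (hf : GCauchy ρ κ A f) {L : K[X]}
    (hL : GBound ρ ρ L) : GCauchy ρ κ A (fun N => (f N).comp L) :=
  ⟨fun N => (hf.bdd N).comp hρ hL, fun N M h => by
    rw [← sub_comp]; exact (hf.cauchy N M h).comp hρ hL⟩

variable [CompleteSpace K]

lemma exists_tendsto_of_geom {x : ℕ → K} (hκ0 : 0 ≤ κ) (hκ : κ < 1)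
    (hx : ∀ N M, N ≤ M → ‖x M - x N‖ ≤ A * κ ^ N) : ∃ y, Tendsto x atTop (𝓝 y) := by
  apply cauchySeq_tendsto_of_complete
  refine cauchySeq_of_le_geometric κ A hκ fun n => ?_
  rw [dist_comm, dist_eq_norm]
  grind

/-- The entries of the limiting matrix. -/
noncomputable def dwLim (k : ℕ) (h : ℕ → K[X]) (L : K[X]) (a b : ℕ) : K :=
  limUnder atTop fun N => dwMat k (h N) L a b

lemma tendsto_dwMat (hρ : 1 ≤ ρ) (hκ0 : 0 ≤ κ) (hκ : κ < 1) {h : ℕ → K[X]}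
    (hh : GCauchy ρ κ A h) {L : K[X]} (hL : Contracts ρ L) (a b : ℕ) :
    Tendsto (fun N => dwMat k (h N) L a b) atTop (𝓝 (dwLim k h L a b)) := by
  apply tendsto_nhds_limUnder
  refine exists_tendsto_of_geom (A := A) hκ0 hκ fun N M hNM => ?_
  rw [← dwMat_sub]
  have hA : 0 ≤ A := (hh.bdd 0).nonneg
  refine (norm_dwMat_le hρ (hh.cauchy N M hNM) hL a b).trans ?_
  exact mul_le_of_le_one_right (by positivity) (pow_le_one₀ (by positivity) (inv_le_one_of_one_le₀ hρ))

lemma norm_dwLim_le (hρ : 1 ≤ ρ) (hκ0 : 0 ≤ κ) (hκ : κ < 1) {h : ℕ → K[X]}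
    (hh : GCauchy ρ κ A h) {L : K[X]} (hL : Contracts ρ L) (a b : ℕ) :
    ‖dwLim k h L a b‖ ≤ A * (ρ⁻¹) ^ a :=
  le_of_tendsto (tendsto_dwMat hρ hκ0 hκ hh hL a b).norm
    (Eventually.of_forall fun N => norm_dwMat_le hρ (hh.bdd N) hL a b)

lemma hasSum_dwMat_mul (h₁ h₂ L₁ L₂ : K[X]) (a b : ℕ) :
    HasSum (fun c => dwMat k h₂ L₂ a c * dwMat k h₁ L₁ c b)
      (dwMat k (h₂ * h₁.comp L₂) (L₁.comp L₂) a b) := by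
  set g := h₁ * (fall K k b).comp L₁
  set s := (finite_fallCoord k g).toFinset
  have hs := sum_fallCoord_mul k g (s := s) fun a ha => by simpa [s] using ha
  have : dwMat k (h₂ * h₁.comp L₂) (L₁.comp L₂) a b =
      ∑ c ∈ s, dwMat k h₂ L₂ a c * dwMat k h₁ L₁ c b := by
    have e : h₂ * h₁.comp L₂ * (fall K k b).comp (L₁.comp L₂) = h₂ * g.comp L₂ := by
      rw [mul_comp, comp_assoc, mul_assoc]
    rw [dwMat, e, ← hs, Polynomial.sum_comp, mul_sum, map_sum]
    refine sum_congr rfl fun c _ => ?_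
    rw [mul_comp, C_comp, mul_left_comm, ← smul_eq_C_mul, map_smul, smul_eq_mul, mul_comm]
    rfl
  rw [this]
  refine hasSum_sum_of_ne_finset_zero fun c hc => ?_
  have : fallCoord k c g = 0 := by simpa [s] using hc
  rw [show dwMat k h₁ L₁ c b = 0 from this, mul_zero]

lemma hasSum_dwLim_mul (hρ : 1 < ρ) (hκ0 : 0 ≤ κ) (hκ : κ < 1) {h₁ h₂ : ℕ → K[X]}
    (hh₁ : GCauchy ρ κ A h₁) (hh₂ : GCauchy ρ κ B h₂) {L₁ L₂ : K[X]} (hL₁ : Contracts ρ L₁)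
    (hL₂ : Contracts ρ L₂) (hL₂' : GBound ρ ρ L₂) (hL : Contracts ρ (L₁.comp L₂)) (a b : ℕ) :
    HasSum (fun c => dwLim k h₂ L₂ a c * dwLim k h₁ L₁ c b)
      (dwLim k (fun N => h₂ N * (h₁ N).comp L₂) (L₁.comp L₂) a b) := by
  have h0 : 0 < ρ := by linarith
  have hA : 0 ≤ A := (hh₁.bdd 0).nonneg
  have hB : 0 ≤ B := (hh₂.bdd 0).nonneg
  have hi : ρ⁻¹ < 1 := inv_lt_one_of_one_lt₀ hρ
  have hg := hh₂.mul h0 (hh₁.comp h0 hL₂')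
  have key := tendsto_tsum_of_dominated_convergence (𝓕 := atTop)
    (f := fun N c => dwMat k (h₂ N) L₂ a c * dwMat k (h₁ N) L₁ c b)
    (g := fun c => dwLim k h₂ L₂ a c * dwLim k h₁ L₁ c b)
    (bound := fun c => B * ρ⁻¹ ^ a * (A * ρ⁻¹ ^ c))
    (((summable_geometric_of_lt_one (by positivity) hi).mul_left A).mul_left _)
    (fun c => (tendsto_dwMat hρ.le hκ0 hκ hh₂ hL₂ a c).mul (tendsto_dwMat hρ.le hκ0 hκ hh₁ hL₁ c b))
    (Eventually.of_forall fun N c => by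
      rw [norm_mul]
      exact mul_le_mul (norm_dwMat_le hρ.le (hh₂.bdd N) hL₂ a c)
        (norm_dwMat_le hρ.le (hh₁.bdd N) hL₁ c b) (norm_nonneg _) (by positivity))
  have e N : ∑' c, dwMat k (h₂ N) L₂ a c * dwMat k (h₁ N) L₁ c b =
      dwMat k (h₂ N * (h₁ N).comp L₂) (L₁.comp L₂) a b :=
    (hasSum_dwMat_mul _ _ _ _ a b).tsum_eq
  simp only [e] at key
  rw [← tendsto_nhds_unique key (tendsto_dwMat hρ.le hκ0 hκ hg hL a b)]
  apply Summable.hasSum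
  refine Summable.of_norm_bounded (g := fun c => B * ρ⁻¹ ^ a * (A * ρ⁻¹ ^ c))
    (((summable_geometric_of_lt_one (by positivity) hi).mul_left A).mul_left _) fun c => ?_
  rw [norm_mul]
  exact mul_le_mul (norm_dwLim_le hρ.le hκ0 hκ hh₂ hL₂ a c)
        (norm_dwLim_le hρ.le hκ0 hκ hh₁ hL₁ c b) (norm_nonneg _) (by positivity)

lemma exists_gBound (hρ : 0 ≤ ρ) (f : K[X]) : ∃ A, GBound ρ A f := by
  refine ⟨∑ i ∈ f.support, ‖f.coeff i‖ * ρ ^ i, fun i => ?_⟩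
  by_cases hi : i ∈ f.support
  · exact single_le_sum (f := fun i => ‖f.coeff i‖ * ρ ^ i) (fun i _ => by positivity) hi
  · rw [notMem_support_iff.1 hi, norm_zero, zero_mul]
    positivity

lemma dwMat_X_sub_C_mul (x : K) (h L : K[X]) (a b : ℕ) :
    dwMat k ((X - C x) * h) L a b = (((a / k : ℕ) : K) - x) * dwMat k h L a b +
      if a = 0 then 0 else dwMat k h L (a - 1) b := by
  rw [dwMat, sub_mul, sub_mul, map_sub, mul_assoc, fallCoord_X_mul, mul_assoc, ← smul_eq_C_mul,
    map_smul, smul_eq_mul, sub_mul]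
  simp only [dwMat]
  ring

/-- Trace formula for a weighted composition operator, polynomial case. -/
lemma hasSum_dwMat_diag (hρ : 1 < ρ) {q l : K} (hq : ‖q‖ < 1) (h : K[X])
    (hL : Contracts ρ (C q * (X - C l))) :
    HasSum (fun a => dwMat k h (C q * (X - C l)) a a) (h.eval (q * l / (q - 1)) / (1 - q)) := by
  have h0 : 0 < ρ := by linarith
  have hi : ρ⁻¹ < 1 := inv_lt_one_of_one_lt₀ hρ
  set L := C q * (X - C l)
  set x := q * l / (q - 1)
  have hq1 : q - 1 ≠ 0 := by
    intro e; rw [sub_eq_zero.1 e] at hq; simp at hq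
  obtain ⟨h', hh'⟩ : X - C x ∣ h - C (h.eval x) := by
    rw [dvd_iff_isRoot]; simp
  have hx : q * l + x = q * x := by grind
  have one : HasSum (fun a => dwMat k 1 L a a) (1 / (1 - q)) := by
    rw [one_div]
    convert hasSum_geometric_of_norm_lt_one hq using 2 with a
    rw [dwMat, one_mul]
    have hd : ((fall K k a).comp L).degree < (a + 1 : ℕ) := by
      refine degree_le_natDegree.trans_lt ?_
      rw [Nat.cast_lt, Nat.lt_succ_iff]
      refine natDegree_comp_le.trans ?_
      rw [natDegree_fall]
      refine (Nat.mul_le_mul_left a (m := 1) ?_).trans (mul_one a).le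
      exact (natDegree_C_mul_le _ _).trans (natDegree_X_sub_C_le _)
    have := fallCoord_of_degree_lt k (degree_sub_fall_lt k hd) le_rfl
    rw [map_sub, ← smul_eq_C_mul, map_smul, fallCoord_fall, if_pos rfl, sub_eq_zero] at this
    rw [this, smul_eq_mul, mul_one, fall, Polynomial.prod_comp]
    have := coeff_prod_of_natDegree_le (range a)
      (fun i => (X - C (((i / k : ℕ) : K))).comp L) 1 (fun i _ => ?_)
    · rw [card_range, mul_one] at this
      rw [this, prod_congr rfl (g := fun _ => q), prod_const, card_range]
      intro i _
      simp [L, mul_sub, coeff_C, -map_natCast, ← C_mul, -map_mul]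
    · refine natDegree_comp_le.trans ?_
      rw [natDegree_X_sub_C, one_mul]
      exact (natDegree_C_mul_le _ _).trans (natDegree_X_sub_C_le _)
  have zero : HasSum (fun a => dwMat k ((X - C x) * h') L a a) 0 := by
    obtain ⟨A, hA⟩ := exists_gBound h0.le h'
    set t := dwMat k h' L
    have ht a b : ‖t a b‖ ≤ A * ρ⁻¹ ^ a := norm_dwMat_le hρ.le hA hL a b
    have hg := (summable_geometric_of_lt_one (by positivity) hi).mul_left A
    have sD : Summable fun a => (((a / k : ℕ) : K) - x) * t a a := by
      refine Summable.of_norm_bounded (g := fun a => max 1 ‖x‖ * (A * ρ⁻¹ ^ a)) (hg.mul_left _)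
        fun a => ?_
      rw [norm_mul]
      refine mul_le_mul ?_ (ht a a) (norm_nonneg _) (by positivity)
      rw [sub_eq_add_neg]
      refine (norm_add_le_max _ _).trans ?_
      rw [norm_neg]
      exact max_le_max (norm_natCast_le_one K _) le_rfl
    have sE : Summable fun a => t a (a + 1) := Summable.of_norm_bounded hg fun a => ht a _
    have sE' : HasSum (fun a => if a = 0 then 0 else t (a - 1) a) (∑' a, t a (a + 1)) := by
      rw [← hasSum_nat_add_iff' 1]
      simpa using sE.hasSum
    have hS := sD.hasSum.add sE'
    have hS' := sD.hasSum.add sE.hasSum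
    have e1 a : dwMat k ((X - C x) * h') L a a =
        (((a / k : ℕ) : K) - x) * t a a + if a = 0 then 0 else t (a - 1) a :=
      dwMat_X_sub_C_mul x h' L a a
    have e2 a : q * dwMat k ((X - C x) * h') L a a =
        (((a / k : ℕ) : K) - x) * t a a + t a (a + 1) := by
      have hc : C q * (((X - C x) * h') * (fall K k a).comp L) =
          C ((((a / k : ℕ) : K) - x)) * (h' * (fall K k a).comp L) + h' * (fall K k (a + 1)).comp L := by
        rw [fall_succ, mul_comp, sub_comp, X_comp, C_comp]
        have : L - C x = C q * (X - C x) := by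
          simp only [L]
          rw [mul_sub, mul_sub, ← C_mul, ← C_mul, sub_sub, ← C_add, hx]
        grind
      have := congrArg (fallCoord k a) hc
      rw [map_add, ← smul_eq_C_mul, ← smul_eq_C_mul, map_smul, map_smul, smul_eq_mul,
        smul_eq_mul] at this
      exact this
    simp only [← e1] at hS
    simp only [← e2] at hS'
    have := (hS.mul_left q).unique hS'
    grind
  have := (one.mul_left (h.eval x)).add zero
  rw [add_zero, mul_one_div] at this
  have e a : dwMat k h L a a =
      h.eval x * dwMat k 1 L a a + dwMat k ((X - C x) * h') L a a := by
    have hd : h = C (h.eval x) * 1 + (X - C x) * h' := by rw [← hh']; ring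
    have := congrArg (fun f => fallCoord k a (f * (fall K k a).comp L)) hd
    simp only [add_mul, map_add] at this
    rw [mul_assoc (C _), ← smul_eq_C_mul, map_smul, smul_eq_mul] at this
    exact this
  simp only [e]
  exact this

/-- Trace formula for a weighted composition operator. -/
lemma hasSum_dwLim_diag (hρ : 1 < ρ) (hκ0 : 0 ≤ κ) (hκ : κ < 1) {q l : K} (hq : ‖q‖ < 1)
    {h : ℕ → K[X]} (hh : GCauchy ρ κ A h) (hL : Contracts ρ (C q * (X - C l))) {y : K}
    (hy : Tendsto (fun N => (h N).eval (q * l / (q - 1))) atTop (𝓝 y)) :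
    HasSum (fun a => dwLim k h (C q * (X - C l)) a a) (y / (1 - q)) := by
  have h0 : 0 < ρ := by linarith
  have hi : ρ⁻¹ < 1 := inv_lt_one_of_one_lt₀ hρ
  have hg := (summable_geometric_of_lt_one (by positivity) hi).mul_left A
  have key := tendsto_tsum_of_dominated_convergence (𝓕 := atTop)
    (f := fun N a => dwMat k (h N) (C q * (X - C l)) a a) hg
    (fun a => tendsto_dwMat hρ.le hκ0 hκ hh hL a a)
    (Eventually.of_forall fun N a => norm_dwMat_le hρ.le (hh.bdd N) hL a a)
  simp only [fun N => (hasSum_dwMat_diag (k := k) hρ hq (h N) hL).tsum_eq] at key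
  rw [← tendsto_nhds_unique key (hy.div_const _)]
  exact (Summable.of_norm_bounded hg fun a => norm_dwLim_le hρ.le hκ0 hκ hh hL a a).hasSum

end DwMat

section GammaSeries
open Polynomial Filter Topology
variable {p : ℕ} [hp : Fact p.Prime] {K : Type*} [NormedField K] [IsUltrametricDist K]
  [CharZero K] {ϖ : K} {ρ κ : ℝ} {k : ℕ}

/-- Coefficients of `theta`, indexed by the integers. -/
noncomputable def thCoeff (p : ℕ) (ϖ : K) (e : ℤ) : K :=
  if 0 ≤ e then PowerSeries.coeff e.toNat (theta p ϖ) else 0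

lemma thCoeff_of_neg {e : ℤ} (he : e < 0) : thCoeff p ϖ e = 0 := if_neg (not_le.2 he)

lemma thCoeff_natCast (n : ℕ) : thCoeff p ϖ n = PowerSeries.coeff n (theta p ϖ) := by
  simp [thCoeff]

lemma thCoeff_rec (hϖ : ϖ ^ (p - 1) = -p) (e : ℤ) :
    e * thCoeff p ϖ e = ϖ * thCoeff p ϖ (e - 1) - p * ϖ * thCoeff p ϖ (e - p) := by
  have hp0 := hp.1.pos
  have hϖp : ϖ ^ p = -(p * ϖ) := by
    rw [← Nat.sub_add_cancel hp.1.one_le, pow_succ, hϖ, Nat.sub_add_cancel hp.1.one_le]; ring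
  rcases lt_or_ge e 0 with he | he
  · rw [thCoeff_of_neg he, thCoeff_of_neg (by omega), thCoeff_of_neg (by omega)]; simp
  obtain ⟨n, rfl⟩ := Int.eq_ofNat_of_zero_le he
  have h := (isZeta_theta (p := p) (ϖ := ϖ)).coeff_rec n
  rw [thCoeff_natCast, Int.cast_natCast, h]
  have key (m : ℕ) (c : K) : ∑ x ∈ antidiagonal n, PowerSeries.coeff x.1 (PowerSeries.monomial m c) *
      PowerSeries.coeff x.2 (theta p ϖ) = c * thCoeff p ϖ ((n : ℤ) - m) := by
    by_cases hm : m ≤ n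
    · rw [sum_eq_single (m, n - m), PowerSeries.coeff_monomial_same, ← Nat.cast_sub hm,
        thCoeff_natCast]
      · intro x hx hne
        rw [PowerSeries.coeff_monomial, if_neg, zero_mul]
        rintro h1
        have := mem_antidiagonal.1 hx
        grind
      simp_all
    · rw [thCoeff_of_neg (by omega), mul_zero]
      refine sum_eq_zero fun x hx => ?_
      have := mem_antidiagonal.1 hx
      rw [PowerSeries.coeff_monomial, if_neg (by omega), zero_mul]
  simp only [thetaLog, map_add, add_mul, sum_add_distrib]
  rw [key, key, hϖp]; push_cast; ring

lemma thetaRadius_lt_one : thetaRadius p < 1 := by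
  have h1 : (1 : ℝ) < p := by exact_mod_cast hp.1.one_lt
  refine Real.rpow_lt_one_of_one_lt_of_neg h1 (neg_neg_of_pos ?_)
  positivity

lemma norm_thCoeff_le (hK : ‖(p : K)‖ = (p : ℝ)⁻¹) (hϖ : ϖ ^ (p - 1) = -p) (n m : ℕ) :
    ‖thCoeff p ϖ (n - m)‖ ≤ (thetaRadius p)⁻¹ ^ m * thetaRadius p ^ n := by
  have h0 := thetaRadius_pos (p := p)
  rcases lt_or_ge n m with h | h
  · rw [thCoeff_of_neg (by omega), norm_zero]; positivity
  · rw [← Nat.cast_sub h, thCoeff_natCast]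
    refine (norm_coeff_theta_le hK hϖ _).trans (le_of_eq ?_)
    obtain ⟨d, rfl⟩ := Nat.exists_eq_add_of_le h
    rw [Nat.add_sub_cancel_left, pow_add, ← mul_assoc, inv_pow, inv_mul_cancel₀ (by positivity),
      one_mul]

/-- Truncations of the series `∑ θ_{pn - m} ϖ⁻ⁿ (s)_n`. -/
noncomputable def gamTrunc (p : ℕ) (ϖ : K) (m N : ℕ) : K[X] :=
  ∑ n ∈ range N, C (thCoeff p ϖ ((p * n : ℕ) - m) * ϖ⁻¹ ^ n) * fall K 1 n

/-- The hypotheses on the radius used for the `s`-model. -/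
structure GoodRadius (p : ℕ) (ϖ : K) (ρ κ : ℝ) : Prop where
  norm_p : ‖(p : K)‖ = (p : ℝ)⁻¹
  varpi : ϖ ^ (p - 1) = -p
  one_lt : 1 < ρ
  le_p : ρ ≤ p
  kappa_le : thetaRadius p ^ p * ‖ϖ‖⁻¹ * ρ ≤ κ
  kappa_lt : κ < 1

namespace GoodRadius
variable (H : GoodRadius p ϖ ρ κ)
include H

lemma pos : 0 < ρ := by linarith [H.one_lt]

lemma varpi_pos : 0 < ‖ϖ‖ := norm_varpi_pos H.norm_p H.varpi

lemma varpi_ne : ϖ ≠ 0 := norm_pos_iff.1 H.varpi_pos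

lemma kappa_nonneg : 0 ≤ κ := by
  have := H.varpi_pos
  have := H.pos
  have := thetaRadius_pos (p := p)
  exact le_trans (by positivity) H.kappa_le

lemma norm_mul_le_one : ‖(p : K)‖ * ρ ≤ 1 := by
  have : (0 : ℝ) < p := by exact_mod_cast hp.1.pos
  rw [H.norm_p, inv_mul_le_iff₀ this, mul_one]
  exact H.le_p

lemma gBound_term (n m j : ℕ) :
    GBound ρ ((thetaRadius p)⁻¹ ^ (p * j + m) * κ ^ n)
      (C (thCoeff p ϖ ((p * n : ℕ) - (p * j + m : ℕ)) * ϖ⁻¹ ^ n) * fall K 1 n) := by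
  have h0 := thetaRadius_pos (p := p)
  have h1 := H.varpi_pos
  have h2 := H.pos
  refine ((gBound_fall H.one_lt.le 1 n).C_mul H.pos _).mono ?_
  rw [norm_mul, norm_pow, norm_inv]
  calc _ ≤ ((thetaRadius p)⁻¹ ^ (p * j + m) * thetaRadius p ^ (p * n)) * ‖ϖ‖⁻¹ ^ n * ρ ^ n := by
        gcongr
        exact norm_thCoeff_le H.norm_p H.varpi _ _
    _ = (thetaRadius p)⁻¹ ^ (p * j + m) * (thetaRadius p ^ p * ‖ϖ‖⁻¹ * ρ) ^ n := by
        rw [pow_mul, mul_pow, mul_pow]; ring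
    _ ≤ _ := by
        gcongr
        exact H.kappa_le

lemma gamTrunc_cauchy (m : ℕ) :
    GCauchy ρ κ ((thetaRadius p)⁻¹ ^ m) (gamTrunc p ϖ m) := by
  have h0 := thetaRadius_pos (p := p)
  have hterm n : GBound ρ ((thetaRadius p)⁻¹ ^ m * κ ^ n)
      (C (thCoeff p ϖ ((p * n : ℕ) - m) * ϖ⁻¹ ^ n) * fall K 1 n) := by
    simpa using H.gBound_term n m 0
  refine ⟨fun N => GBound.sum H.pos.le (by positivity) _ _ fun n _ => (hterm n).mono ?_,
    fun N M hNM => ?_⟩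
  · exact mul_le_of_le_one_right (by positivity) (pow_le_one₀ H.kappa_nonneg H.kappa_lt.le)
  · rw [gamTrunc, gamTrunc, ← sum_sdiff (range_subset_range.2 hNM), add_sub_cancel_right]
    have := H.kappa_nonneg
    refine GBound.sum H.pos.le (by positivity) _ _ fun n hn => (hterm n).mono ?_
    rw [Finset.mem_sdiff, mem_range, mem_range, not_lt] at hn
    exact mul_le_mul_of_nonneg_left (pow_le_pow_of_le_one this H.kappa_lt.le hn.2) (by positivity)

end GoodRadius

lemma linear_mul_gamTrunc (hϖ : ϖ ^ (p - 1) = -p) (h0 : ϖ ≠ 0) (m N : ℕ) :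
    (C (p : K) * X - C (m : K)) * gamTrunc p ϖ m N = C ϖ * gamTrunc p ϖ (m + 1) N +
      C (p * ϖ) * (C (thCoeff p ϖ ((p * N : ℕ) - (p * 1 + m : ℕ)) * ϖ⁻¹ ^ N) * fall K 1 N) := by
  induction N with
  | zero =>
    rw [thCoeff_of_neg (by have := hp.1.pos; push_cast; omega)]
    simp [gamTrunc]
  | succ N ih =>
    rw [gamTrunc, gamTrunc, sum_range_succ, sum_range_succ, mul_add, mul_add, ← gamTrunc,
      ← gamTrunc, ih]
    have hX := X_mul_fall (K := K) 1 N
    rw [Nat.div_one] at hX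
    have e1 : (C (p : K) * X - C (m : K)) * (C (thCoeff p ϖ ((p * N : ℕ) - m) * ϖ⁻¹ ^ N) * fall K 1 N) =
        C (thCoeff p ϖ ((p * N : ℕ) - m) * ϖ⁻¹ ^ N * (p * N - m)) * fall K 1 N +
        C (p * (thCoeff p ϖ ((p * N : ℕ) - m) * ϖ⁻¹ ^ N)) * fall K 1 (N + 1) := by grind
    rw [e1]
    have hr := thCoeff_rec hϖ (((p * N : ℕ) : ℤ) - m)
    have e2 : thCoeff p ϖ ((p * N : ℕ) - m) * ϖ⁻¹ ^ N * (p * N - m) =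
        ϖ * (thCoeff p ϖ ((p * N : ℕ) - (m + 1 : ℕ)) * ϖ⁻¹ ^ N) -
        p * ϖ * (thCoeff p ϖ ((p * N : ℕ) - (p * 1 + m : ℕ)) * ϖ⁻¹ ^ N) := by
      have i1 : ((p * N : ℕ) : ℤ) - (m + 1 : ℕ) = ((p * N : ℕ) : ℤ) - m - 1 := by push_cast; ring
      have i2 : ((p * N : ℕ) : ℤ) - (p * 1 + m : ℕ) = ((p * N : ℕ) : ℤ) - m - p := by push_cast; ring
      rw [i1, i2]
      push_cast at hr ⊢
      grind
    rw [e2]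
    have e3 : p * ϖ * (thCoeff p ϖ ((p * (N + 1) : ℕ) - (p * 1 + m : ℕ)) * ϖ⁻¹ ^ (N + 1)) =
        p * (thCoeff p ϖ ((p * N : ℕ) - m) * ϖ⁻¹ ^ N) := by grind
    have e4 : C (p * ϖ) * (C (thCoeff p ϖ ((p * (N + 1) : ℕ) - (p * 1 + m : ℕ)) * ϖ⁻¹ ^ (N + 1)) *
        fall K 1 (N + 1)) = C (p * (thCoeff p ϖ ((p * N : ℕ) - m) * ϖ⁻¹ ^ N)) * fall K 1 (N + 1) := by
      rw [← mul_assoc, ← C_mul, e3]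
    rw [e4]
    simp only [C_mul, C_sub]
    ring

lemma gamTrunc_succ_self (N : ℕ) :
    gamTrunc p ϖ p (N + 1) = C ϖ⁻¹ * (X * (gamTrunc p ϖ 0 N).comp (X - C 1)) := by
  rw [gamTrunc, sum_range_succ', gamTrunc, Polynomial.sum_comp, mul_sum, mul_sum]
  rw [thCoeff_of_neg (by have := hp.1.pos; push_cast; omega), zero_mul, C_0, zero_mul, add_zero]
  refine sum_congr rfl fun n _ => ?_
  have i3 : ((p * (n + 1) : ℕ) : ℤ) - (p : ℕ) = ((p * n : ℕ) : ℤ) - (0 : ℕ) := by push_cast; ring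
  rw [i3, fall_add 1 one_pos, mul_comp, C_comp, pow_one, pow_succ]
  simp only [C_mul]
  ring

namespace GoodRadius
variable (H : GoodRadius p ϖ ρ κ)
include H

lemma gBound_linear (n : ℕ) : GBound ρ 1 (C (p : K) * X - C (n : K)) :=
  GBound.linear H.pos H.norm_mul_le_one (norm_natCast_le_one K _)

lemma gBound_gamTrunc_mul (m N : ℕ) :
    GBound ρ ((thetaRadius p)⁻¹ ^ (p + m) * κ ^ N)
      (gamTrunc p ϖ 0 N * (fall K 1 m).comp (C (p : K) * X) - C (ϖ ^ m) * gamTrunc p ϖ m N) := by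
  have h0 := thetaRadius_pos (p := p)
  have hκ := H.kappa_nonneg
  have h1 : 1 ≤ (thetaRadius p)⁻¹ := (one_le_inv₀ h0).2 thetaRadius_lt_one.le
  induction m with
  | zero =>
    simp only [fall_zero, one_comp, pow_zero, C_1, one_mul, mul_one, sub_self]
    exact GBound.zero (by positivity)
  | succ m ih =>
    have e : gamTrunc p ϖ 0 N * (fall K 1 (m + 1)).comp (C (p : K) * X) -
        C (ϖ ^ (m + 1)) * gamTrunc p ϖ (m + 1) N =
        (gamTrunc p ϖ 0 N * (fall K 1 m).comp (C (p : K) * X) - C (ϖ ^ m) * gamTrunc p ϖ m N) *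
          (C (p : K) * X - C (m : K)) + C (ϖ ^ m * (p * ϖ)) *
        (C (thCoeff p ϖ ((p * N : ℕ) - (p * 1 + m : ℕ)) * ϖ⁻¹ ^ N) * fall K 1 N) := by
      have := linear_mul_gamTrunc H.varpi H.varpi_ne m N
      rw [fall_succ, mul_comp, sub_comp, X_comp, C_comp, Nat.div_one, pow_succ]
      grind
    rw [e]
    refine GBound.add H.pos.le ?_ ?_
    · refine ((ih.mul H.pos (H.gBound_linear m))).mono ?_
      rw [mul_one]
      gcongr
      exact Nat.le_succ m
    · have hb : GBound ρ ((thetaRadius p)⁻¹ ^ (p * 1 + m) * κ ^ N)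
          (C (thCoeff p ϖ ((p * N : ℕ) - (p * 1 + m : ℕ)) * ϖ⁻¹ ^ N) * fall K 1 N) := by
        exact H.gBound_term N m 1
      refine (hb.C_mul H.pos _).mono ?_
      refine (mul_le_of_le_one_left (by positivity) ?_).trans ?_
      · have hv := (norm_varpi_lt_one H.norm_p H.varpi).le
        rw [norm_mul, norm_mul, norm_pow]
        have := norm_natCast_le_one K p
        have h5 : ‖ϖ‖ ^ m ≤ 1 := pow_le_one₀ (norm_nonneg _) hv
        exact mul_le_one₀ h5 (by positivity) (mul_le_one₀ this (norm_nonneg _) hv)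
      · rw [mul_one]; gcongr
        exact Nat.le_succ m

end GoodRadius

end GammaSeries

section FrobMatrix
open Polynomial Filter Topology
variable {p : ℕ} [hp : Fact p.Prime] {K : Type*} [NormedField K] [IsUltrametricDist K]
  [CharZero K] [CompleteSpace K] {ϖ : K} {ρ κ : ℝ} {k : ℕ}

/-- The polynomials `∏_{i < m} γ(pⁱ s) ^ k`, with `γ` truncated at `N`. -/
noncomputable def gamPow (p : ℕ) (ϖ : K) (k m N : ℕ) : K[X] :=
  ∏ i ∈ range m, ((gamTrunc p ϖ 0 N).comp (C ((p : K) ^ i) * X)) ^ k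

lemma gamPow_one (N : ℕ) : gamPow p ϖ k 1 N = gamTrunc p ϖ 0 N ^ k := by
  simp [gamPow]

/-- The matrix of the `m`-th iterate of Frobenius in the basis `fall`. -/
noncomputable def uMat (p : ℕ) (ϖ : K) (k m a b : ℕ) : K :=
  dwLim k (gamPow p ϖ k m) (C ((p : K) ^ m) * X) a b

namespace GoodRadius
variable (H : GoodRadius p ϖ ρ κ)
include H

lemma contracts {q l : K} (hq : ‖q‖ * ρ ≤ 1) (hl : ‖l‖ ≤ 1) : Contracts ρ (C q * (X - C l)) := by
  intro n
  rw [mul_sub, sub_sub, ← C_mul, ← C_add]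
  refine GBound.linear H.pos hq ((norm_add_le_max _ _).trans (max_le ?_ ?_))
  · rw [norm_mul]
    have : ‖q‖ ≤ 1 := le_trans (le_mul_of_one_le_right (norm_nonneg _) H.one_lt.le) hq
    exact mul_le_one₀ this (norm_nonneg _) hl
  · exact norm_natCast_le_one K _

lemma norm_pow_mul_le {m : ℕ} (hm : m ≠ 0) : ‖(p : K) ^ m‖ * ρ ≤ 1 := by
  rw [norm_pow]
  refine le_trans ?_ H.norm_mul_le_one
  have := H.pos
  have h1 := norm_natCast_le_one K p
  gcongr
  exact pow_le_of_le_one (norm_nonneg _) h1 hm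

lemma contracts_pow {m : ℕ} (hm : m ≠ 0) : Contracts ρ (C ((p : K) ^ m) * X) := by
  simpa using H.contracts (H.norm_pow_mul_le hm) (l := 0) (by simp)

lemma gBound_pow_mul (m : ℕ) {l : K} (hl : ‖l‖ ≤ 1) :
    GBound ρ ρ (C ((p : K) ^ m) * (X - C l)) := by
  have h1 : ‖(p : K) ^ m‖ ≤ 1 := by
    rw [norm_pow]
    exact pow_le_one₀ (norm_nonneg _) (norm_natCast_le_one K p)
  rw [mul_sub, ← C_mul]
  refine GBound.linear H.pos (mul_le_of_le_one_left H.pos.le h1) ?_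
  rw [norm_mul]
  exact (mul_le_one₀ h1 (norm_nonneg _) hl).trans H.one_lt.le

lemma gBound_pow_mul_X (m : ℕ) : GBound ρ ρ (C ((p : K) ^ m) * X) := by
  simpa using H.gBound_pow_mul m (l := 0) (by simp)

lemma gamma_cauchy : GCauchy ρ κ 1 (gamTrunc p ϖ 0) := by
  simpa using H.gamTrunc_cauchy 0

lemma gamPow_cauchy (k m : ℕ) : GCauchy ρ κ 1 (gamPow p ϖ k m) :=
  GCauchy.prod H.pos H.kappa_nonneg _ fun i _ =>
    (H.gamma_cauchy.comp H.pos (H.gBound_pow_mul_X i)).pow H.pos H.kappa_nonneg k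

lemma tendsto_uMat (k : ℕ) {m : ℕ} (hm : m ≠ 0) (a b : ℕ) :
    Tendsto (fun N => dwMat k (gamPow p ϖ k m N) (C ((p : K) ^ m) * X) a b) atTop
      (𝓝 (uMat p ϖ k m a b)) :=
  tendsto_dwMat H.one_lt.le H.kappa_nonneg H.kappa_lt (H.gamPow_cauchy k m) (H.contracts_pow hm) a b

lemma tendsto_uMat_one (k a b : ℕ) :
    Tendsto (fun N => fallCoord k a (gamTrunc p ϖ 0 N ^ k * (fall K k b).comp (C (p : K) * X))) atTop
      (𝓝 (uMat p ϖ k 1 a b)) := by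
  have := H.tendsto_uMat k one_ne_zero a b
  simpa only [gamPow_one, pow_one, dwMat] using this

lemma norm_uMat_le (k : ℕ) {m : ℕ} (hm : m ≠ 0) (a b : ℕ) : ‖uMat p ϖ k m a b‖ ≤ ρ⁻¹ ^ a := by
  have := norm_dwLim_le (k := k) H.one_lt.le H.kappa_nonneg H.kappa_lt (H.gamPow_cauchy k m)
    (H.contracts_pow hm) a b
  rw [one_mul] at this
  exact this

lemma hasSum_uMat_succ (k : ℕ) {m : ℕ} (hm : m ≠ 0) (a b : ℕ) :
    HasSum (fun c => uMat p ϖ k m a c * uMat p ϖ k 1 c b) (uMat p ϖ k (m + 1) a b) := by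
  have e : (C ((p : K) ^ 1) * X).comp (C ((p : K) ^ m) * X) = C ((p : K) ^ (m + 1)) * X := by
    rw [pow_one, mul_comp, C_comp, X_comp, ← mul_assoc, ← C_mul, ← pow_succ']
  have := hasSum_dwLim_mul (k := k) H.one_lt H.kappa_nonneg H.kappa_lt (H.gamPow_cauchy k 1)
    (H.gamPow_cauchy k m) (H.contracts_pow one_ne_zero) (H.contracts_pow hm) (H.gBound_pow_mul_X m)
    (by rw [e]; exact H.contracts_pow (Nat.succ_ne_zero m)) a b
  rw [e] at this
  have e' : (fun N => gamPow p ϖ k m N * (gamPow p ϖ k 1 N).comp (C ((p : K) ^ m) * X)) =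
      gamPow p ϖ k (m + 1) := by
    funext N
    rw [gamPow_one, pow_comp, gamPow, gamPow, prod_range_succ]
  rw [e'] at this
  exact this

lemma uMat_horizontal (k a b : ℕ) :
    uMat p ϖ k 1 a (b + 1) + ((b / k : ℕ) : K) * uMat p ϖ k 1 a b =
      p * (((a / k : ℕ) : K) * uMat p ϖ k 1 a b + if a = 0 then 0 else uMat p ϖ k 1 (a - 1) b) := by
  have t1 := (H.tendsto_uMat_one k a (b + 1)).add ((H.tendsto_uMat_one k a b).const_mul (((b / k : ℕ) : K)))
  have t2 : Tendsto (fun N => (p : K) * (((a / k : ℕ) : K) *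
      fallCoord k a (gamTrunc p ϖ 0 N ^ k * (fall K k b).comp (C (p : K) * X)) +
      if a = 0 then 0 else fallCoord k (a - 1)
        (gamTrunc p ϖ 0 N ^ k * (fall K k b).comp (C (p : K) * X)))) atTop
      (𝓝 (p * (((a / k : ℕ) : K) * uMat p ϖ k 1 a b + if a = 0 then 0 else uMat p ϖ k 1 (a - 1) b))) := by
    refine Tendsto.const_mul _ (((H.tendsto_uMat_one k a b).const_mul _).add ?_)
    split_ifs
    · exact tendsto_const_nhds
    · exact H.tendsto_uMat_one k (a - 1) b
  refine tendsto_nhds_unique (t1.congr fun N => ?_) t2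
  have e := congrArg (fallCoord k a) (show gamTrunc p ϖ 0 N ^ k *
      (fall K k (b + 1)).comp (C (p : K) * X) + ((b / k : ℕ) : K) • (gamTrunc p ϖ 0 N ^ k *
      (fall K k b).comp (C (p : K) * X)) = (p : K) • (X * (gamTrunc p ϖ 0 N ^ k *
      (fall K k b).comp (C (p : K) * X))) by
    rw [smul_eq_C_mul, smul_eq_C_mul, fall_succ, mul_comp, sub_comp, X_comp, C_comp]
    ring)
  rwa [map_add, map_smul, map_smul, fallCoord_X_mul, smul_eq_mul, smul_eq_mul] at e

lemma uMat_eq_zero_of_lt (hk : 0 < k) {a b : ℕ} (ha : a < k) (hb : k ≤ b) :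
    uMat p ϖ k 1 a b = 0 := by
  refine tendsto_nhds_unique ((H.tendsto_uMat_one k a b).congr fun N => ?_) tendsto_const_nhds
  obtain ⟨c, rfl⟩ := Nat.exists_eq_add_of_le' hb
  rw [fall_add k hk, mul_comp, pow_comp, X_comp, mul_pow, ← C_pow]
  rw [show gamTrunc p ϖ 0 N ^ k * (C ((p : K) ^ k) * X ^ k *
    ((fall K k c).comp (X - C 1)).comp (C (p : K) * X)) = X ^ k * (gamTrunc p ϖ 0 N ^ k *
    C ((p : K) ^ k) * ((fall K k c).comp (X - C 1)).comp (C (p : K) * X)) by ring]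
  exact fallCoord_X_pow_mul k hk ha _

end GoodRadius

lemma fall_mul_self (hk : 0 < k) (l : ℕ) : fall K k (l * k) = fall K 1 l ^ k := by
  induction l with
  | zero => simp [fall_zero]
  | succ l ih =>
    rw [Nat.succ_mul, fall, prod_range_add, ← fall, ih, fall_succ, mul_pow, Nat.div_one]
    congr 1
    refine (prod_congr rfl fun i hi => ?_).trans
      ((prod_const (X - C (l : K))).trans (by rw [card_range]))
    rw [Nat.mul_comm, Nat.mul_add_div hk, Nat.div_eq_of_lt (mem_range.1 hi), add_zero]

lemma fall_add_mul (hk : 0 < k) (a l : ℕ) :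
    fall K k (a + l * k) = fall K 1 l ^ k * (fall K k a).comp (X - C (l : K)) := by
  have e : fall K k a = ∏ i ∈ range a, (X - C ((i / k : ℕ) : K)) := rfl
  rw [add_comm, fall, prod_range_add, ← fall, fall_mul_self hk, e, Polynomial.prod_comp]
  congr 1
  refine prod_congr rfl fun i _ => ?_
  rw [Nat.mul_comm, Nat.mul_add_div hk, sub_comp, X_comp, C_comp, Nat.cast_add, C_add]
  ring

lemma fallCoord_shift_mul (hk : 0 < k) (a l : ℕ) (g : K[X]) :
    fallCoord k a (fall K 1 l ^ k * g.comp (X - C (l : K))) =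
      if a < l * k then 0 else fallCoord k (a - l * k) g := by
  induction l generalizing a with
  | zero => simp [fall_zero]
  | succ l ih =>
    have e : fall K 1 (l + 1) ^ k * g.comp (X - C ((l + 1 : ℕ) : K)) =
        X ^ k * (fall K 1 l ^ k * g.comp (X - C (l : K))).comp (X - C 1) := by
      rw [fall_add 1 one_pos, pow_one, mul_comp, pow_comp, comp_assoc, mul_pow, sub_comp, X_comp,
        C_comp, Nat.cast_add, C_add, Nat.cast_one, mul_assoc, sub_sub, add_comm (C (l : K))]
    rw [e, fallCoord_shift k hk, ih, Nat.succ_mul]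
    grind

namespace GoodRadius
variable (H : GoodRadius p ϖ ρ κ)
include H

lemma uMat_add (hk : 0 < k) (a b : ℕ) : uMat p ϖ k 1 a (b + p * k) =
    (ϖ ^ (p - 1)) ^ k * if a < k then 0 else uMat p ϖ k 1 (a - k) b := by
  have t1 := (tendsto_add_atTop_iff_nat 1).2 (H.tendsto_uMat_one k a (b + p * k))
  have t2 : Tendsto (fun N => (ϖ ^ (p - 1)) ^ k * if a < k then 0 else fallCoord k (a - k)
        (gamTrunc p ϖ 0 N ^ k * (fall K k b).comp (C (p : K) * X))) atTop
      (𝓝 ((ϖ ^ (p - 1)) ^ k * if a < k then 0 else uMat p ϖ k 1 (a - k) b)) := by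
    refine Tendsto.const_mul _ ?_
    split_ifs
    · exact tendsto_const_nhds
    · exact H.tendsto_uMat_one k (a - k) b
  refine eq_of_sub_eq_zero (tendsto_nhds_unique (t1.sub t2) ?_)
  have h0 := thetaRadius_pos (p := p)
  set A := (thetaRadius p)⁻¹ ^ (p + p)
  have hlim : Tendsto (fun N => A * κ ^ (N + 1)) atTop (𝓝 0) := by
    simpa using (((tendsto_pow_atTop_nhds_zero_of_lt_one H.kappa_nonneg H.kappa_lt).comp
      (tendsto_add_atTop_nat 1)).const_mul A)
  refine squeeze_zero_norm (fun N => ?_) hlim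
  set F := gamTrunc p ϖ 0 (N + 1) * (fall K 1 p).comp (C (p : K) * X)
  set G := C (ϖ ^ (p - 1)) * (X * (gamTrunc p ϖ 0 N).comp (X - C 1))
  set J := (fall K k b).comp (C (p : K) * (X - C 1))
  have hJ : GBound ρ 1 J := by
    refine (H.contracts (q := (p : K)) (l := 1) ?_ (by simp)).gBound_fall_comp H.one_lt.le b
    exact H.norm_mul_le_one
  have e1 : gamTrunc p ϖ 0 (N + 1) ^ k * (fall K k (b + p * k)).comp (C (p : K) * X) = F ^ k * J := by
    rw [fall_add_mul hk, mul_comp, pow_comp, comp_assoc, sub_comp, X_comp, C_comp, mul_pow]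
    grind
  have e2 : (ϖ ^ (p - 1)) ^ k * (if a < k then 0 else fallCoord k (a - k)
        (gamTrunc p ϖ 0 N ^ k * (fall K k b).comp (C (p : K) * X))) = fallCoord k a (G ^ k * J) := by
    rw [← fallCoord_shift k hk, ← smul_eq_mul, ← map_smul, smul_eq_C_mul]
    congr 1
    simp only [G, J]
    rw [mul_comp, pow_comp, comp_assoc, mul_comp, X_comp, C_comp, mul_pow, mul_pow, C_pow]
    ring
  rw [e1, e2, ← map_sub, ← sub_mul]
  have hF : GBound ρ 1 F := by
    have := ((H.gamma_cauchy.bdd (N + 1)).mul H.pos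
      ((H.contracts_pow one_ne_zero).gBound_fall_comp (k := 1) H.one_lt.le p))
    simpa [F] using this
  have hG : GBound ρ 1 G := by
    have h1 := (H.gamma_cauchy.bdd N).comp H.pos (gBound_linear_nat (K := K) H.one_lt.le 1)
    have h2 := ((GBound.X (K := K).resolve_right (not_lt.2 H.pos.le)).mul H.pos h1).C_mul H.pos (ϖ ^ (p - 1))
    rw [Nat.cast_one] at h2
    refine h2.mono ?_
    rw [H.varpi, norm_neg, mul_one]
    exact H.norm_mul_le_one
  have hFG : GBound ρ (A * κ ^ (N + 1)) (F - G) := by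
    have := H.gBound_gamTrunc_mul p (N + 1)
    rw [gamTrunc_succ_self, ← mul_assoc, ← C_mul] at this
    have e : ϖ ^ p * ϖ⁻¹ = ϖ ^ (p - 1) := by
      rw [← Nat.sub_add_cancel hp.1.one_le, pow_succ, Nat.sub_add_cancel hp.1.one_le,
        mul_assoc, mul_inv_cancel₀ H.varpi_ne, mul_one]
    rwa [e] at this
  have := ((hF.pow_sub_pow H.pos hG hFG k).mul H.pos hJ).norm_fallCoord_le H.one_lt.le k a
  rw [mul_one] at this
  exact (le_mul_of_one_le_right (norm_nonneg _) (one_le_pow₀ H.one_lt.le)).trans this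

/-- In rank one the Frobenius matrix is given by the coefficients of `theta`. -/
lemma uMat_rank_one (a b : ℕ) :
    uMat p ϖ 1 1 a b = ϖ ^ b * (thCoeff p ϖ ((p * a : ℕ) - b) * ϖ⁻¹ ^ a) := by
  have t1 := H.tendsto_uMat_one 1 a b
  refine eq_of_sub_eq_zero (tendsto_nhds_unique (t1.sub_const _) ?_)
  have h0 := thetaRadius_pos (p := p)
  set A := (thetaRadius p)⁻¹ ^ (p + b)
  have hlim : Tendsto (fun N => A * κ ^ N) atTop (𝓝 0) := by
    simpa using (tendsto_pow_atTop_nhds_zero_of_lt_one H.kappa_nonneg H.kappa_lt).const_mul A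
  refine squeeze_zero_norm' ?_ hlim
  filter_upwards [eventually_gt_atTop a] with N hN
  have hb := (H.gBound_gamTrunc_mul b N).norm_fallCoord_le H.one_lt.le 1 a
  have e : fallCoord 1 a (C (ϖ ^ b) * gamTrunc p ϖ b N) =
      ϖ ^ b * (thCoeff p ϖ ((p * a : ℕ) - b) * ϖ⁻¹ ^ a) := by
    rw [← smul_eq_C_mul, map_smul, smul_eq_mul, gamTrunc, map_sum, sum_eq_single a]
    · rw [← smul_eq_C_mul, map_smul, fallCoord_fall, if_pos rfl, smul_eq_mul, mul_one]
    · intro c _ hc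
      rw [← smul_eq_C_mul, map_smul, fallCoord_fall, if_neg hc.symm, smul_zero]
    grind
  rw [map_sub, e] at hb
  rw [pow_one]
  exact (le_mul_of_one_le_right (norm_nonneg _) (one_le_pow₀ H.one_lt.le)).trans hb

/-- The trace of the `m`-th iterate of Frobenius composed with the `l`-th power of the shift. -/
lemma exists_hasSum_uMat_diag {m : ℕ} (hm : m ≠ 0) (l : ℕ) : ∃ y : K, ∀ k, 0 < k →
    HasSum (fun a => uMat p ϖ k m a (a + l * k)) (y ^ k / (1 - (p : K) ^ m)) := by
  set q := (p : K) ^ m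
  have hq : ‖q‖ < 1 := lt_of_lt_of_le (lt_mul_of_one_lt_right (by
      rw [norm_pow, H.norm_p]; have : (0 : ℝ) < p := by exact_mod_cast hp.1.pos
      positivity) H.one_lt) (H.norm_pow_mul_le hm)
  set x := q * l / (q - 1)
  have hx : ‖x‖ ≤ 1 := by
    have : ‖q - 1‖ = 1 := by
      rw [norm_sub_rev]
      have := norm_add_eq_max_of_norm_ne_norm (x := (1 : K)) (y := -q)
        (by rw [norm_neg, norm_one]; exact hq.ne')
      rw [sub_eq_add_neg, this, norm_neg, norm_one, max_eq_left hq.le]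
    rw [norm_div, this, div_one, norm_mul]
    exact mul_le_one₀ hq.le (norm_nonneg _) (norm_natCast_le_one K l)
  let h1 : ℕ → K[X] := fun N => ∏ i ∈ range m, (gamTrunc p ϖ 0 N).comp (C ((p : K) ^ i) * X)
  have hc1 : GCauchy ρ κ 1 h1 := GCauchy.prod H.pos H.kappa_nonneg _ fun i _ =>
    (H.gamma_cauchy.comp H.pos (H.gBound_pow_mul_X i))
  have hl1 : ‖(l : K)‖ ≤ 1 := norm_natCast_le_one K l
  have hc2 : GCauchy ρ κ 1 (fun N => (h1 N).comp (X - C (l : K))) :=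
    hc1.comp H.pos (gBound_linear_nat H.one_lt.le l)
  obtain ⟨z, hz⟩ : ∃ z, Tendsto (fun N => ((h1 N).comp (X - C (l : K))).eval x) atTop (𝓝 z) := by
    refine exists_tendsto_of_geom (A := 1) H.kappa_nonneg H.kappa_lt fun N M hNM => ?_
    rw [← eval_sub]
    exact (hc2.cauchy N M hNM).norm_eval_le H.pos (hx.trans H.one_lt.le)
  refine ⟨(fall K 1 l).eval x * z, fun k hk => ?_⟩
  have hc3 := (GCauchy.const H.kappa_nonneg ((gBound_fall (K := K) H.one_lt.le 1 l).pow H.pos k)).mul H.pos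
    (hc2.pow H.pos H.kappa_nonneg k)
  have hL : Contracts ρ (C q * (X - C (l : K))) := H.contracts (H.norm_pow_mul_le hm) hl1
  have key := hasSum_dwLim_diag (k := k) H.one_lt H.kappa_nonneg H.kappa_lt hq hc3 hL
    (y := ((fall K 1 l).eval x * z) ^ k) (by
      simp only [eval_mul, eval_pow, mul_pow]
      exact (hz.pow k).const_mul _)
  have e a b : dwLim k (fun N => fall K 1 l ^ k * ((h1 N).comp (X - C (l : K))) ^ k)
      (C q * (X - C (l : K))) a b = if a < l * k then 0 else uMat p ϖ k m (a - l * k) b := by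
    have t1 := tendsto_dwMat (k := k) H.one_lt.le H.kappa_nonneg H.kappa_lt hc3 hL a b
    have e1 N : dwMat k (fall K 1 l ^ k * ((h1 N).comp (X - C (l : K))) ^ k)
        (C q * (X - C (l : K))) a b = if a < l * k then 0 else
          dwMat k (gamPow p ϖ k m N) (C q * X) (a - l * k) b := by
      rw [dwMat, dwMat, ← fallCoord_shift_mul hk, mul_comp, comp_assoc, mul_comp, C_comp, X_comp,
        mul_assoc, ← pow_comp]
      simp only [h1, gamPow, ← prod_pow]
    simp only [e1] at t1
    refine tendsto_nhds_unique t1 ?_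
    split_ifs
    · exact tendsto_const_nhds
    · exact H.tendsto_uMat k hm _ b
  simp only [e] at key
  rw [← hasSum_nat_add_iff' (l * k)] at key
  rw [sum_eq_zero (fun i hi => if_pos (mem_range.1 hi)), sub_zero] at key
  simpa using key

end GoodRadius
end FrobMatrix

section CoeffSub
variable {K : Type*} [Field K]

/-- The coefficient of a power series at a difference of natural numbers. -/
noncomputable def coeffSub (f : PowerSeries K) (a b : ℕ) : K :=
  if b ≤ a then PowerSeries.coeff (a - b) f else 0

lemma coeffSub_of_le {f : PowerSeries K} {a b : ℕ} (h : b ≤ a) :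
    coeffSub f a b = PowerSeries.coeff (a - b) f := if_pos h

lemma coeffSub_of_lt {f : PowerSeries K} {a b : ℕ} (h : a < b) :
    coeffSub f a b = 0 := if_neg (not_le.2 h)

/-- The Frobenius structure iterated `m` times. -/
noncomputable def frobIter {ι : Type*} [Fintype ι] [DecidableEq ι] {p : ℕ} (hp0 : p ≠ 0)
    (B : Matrix ι ι (PowerSeries K)) : ℕ → Matrix ι ι (PowerSeries K)
  | 0 => 1
  | m + 1 => (frobIter hp0 B m).map (PowerSeries.expand p hp0) * B

end CoeffSub

section FrobSeries
open Polynomial Filter Topology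
variable {p : ℕ} [hp : Fact p.Prime] {K : Type*} [NormedField K] [IsUltrametricDist K]
  [CharZero K] [CompleteSpace K] {ϖ : K} {ρ κ : ℝ} {k : ℕ}

lemma fall_eq_X_pow {b : ℕ} (hb : b ≤ k) : fall K k b = X ^ b := by
  rw [fall, prod_congr rfl (g := fun _ => X), prod_const, card_range]
  intro i hi
  rw [Nat.div_eq_of_lt (lt_of_lt_of_le (mem_range.1 hi) hb)]; simp

lemma fallCoord_eq_coeff (hk : 0 < k) {a : ℕ} (ha : a < k) (g : K[X]) :
    fallCoord k a g = g.coeff a := by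
  have : (fallCoord k a : K[X] →ₗ[K] K) = lcoeff K a := by
    refine (fallBasis K k).ext fun b => ?_
    rw [fallBasis_apply, fallCoord_fall, lcoeff_apply]
    rcases lt_or_ge b k with h | h
    · rw [fall_eq_X_pow h.le, coeff_X_pow]
    · obtain ⟨c, rfl⟩ := Nat.exists_eq_add_of_le' h
      rw [fall_add k hk, if_neg (by omega), mul_comm, coeff_mul_X_pow', if_neg (by omega)]
  rw [this, lcoeff_apply]

lemma coeff_zero_gamTrunc (N : ℕ) : (gamTrunc p ϖ 0 (N + 1)).coeff 0 = 1 := by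
  rw [gamTrunc, finsetSum_coeff, sum_range_succ', sum_eq_zero, zero_add]
  · have : thCoeff p ϖ 0 = 1 := by
      have := thCoeff_natCast (p := p) (ϖ := ϖ) 0
      rw [Nat.cast_zero] at this
      rw [this]; exact (isZeta_theta (p := p) (ϖ := ϖ)).coeff_zero
    simp [fall_zero, this]
  · intro n _
    rw [coeff_C_mul, fall_add 1 one_pos, pow_one, coeff_X_mul_zero, mul_zero]

namespace GoodRadius
variable (H : GoodRadius p ϖ ρ κ)
include H

lemma uMat_low (hk : 0 < k) {a b : ℕ} (ha : a < k) (hab : a ≤ b) (hb : b < k) :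
    uMat p ϖ k 1 a b = if a = b then (p : K) ^ a else 0 := by
  refine tendsto_nhds_unique ((tendsto_add_atTop_iff_nat 1).2 (H.tendsto_uMat_one k a b)) ?_
  refine tendsto_const_nhds.congr fun N => ?_
  rw [fallCoord_eq_coeff hk ha, fall_eq_X_pow hb.le, X_pow_comp, mul_pow, ← C_pow, ← mul_assoc,
    coeff_mul_X_pow']
  split_ifs with h1 h2 h2
  · subst h1
    rw [Nat.sub_self, coeff_mul_C, coeff_zero_eq_eval_zero, eval_pow, ← coeff_zero_eq_eval_zero,
      coeff_zero_gamTrunc, one_pow, one_mul]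
  · omega
  · omega
  · rfl

lemma uMat_add_mul (hk : 0 < k) (a b c : ℕ) : uMat p ϖ k 1 (a + c * k) (b + c * p * k) =
    ((ϖ ^ (p - 1)) ^ k) ^ c * uMat p ϖ k 1 a b := by
  induction c with
  | zero => simp
  | succ c ih =>
    rw [show b + (c + 1) * p * k = (b + c * p * k) + p * k by ring, H.uMat_add hk, if_neg (by
      rw [Nat.succ_mul]; omega), show a + (c + 1) * k - k = a + c * k by rw [Nat.succ_mul]; omega, ih]
    ring

lemma uMat_eq_zero (hk : 0 < k) {j j' n n' : ℕ} (hj : j < k) (hn : p * n < n') :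
    uMat p ϖ k 1 (j + n * k) (j' + n' * k) = 0 := by
  obtain ⟨c, rfl⟩ := Nat.exists_eq_add_of_lt hn
  rw [show j' + (p * n + c + 1) * k = (j' + (c + 1) * k) + n * p * k by ring, H.uMat_add_mul hk,
    H.uMat_eq_zero_of_lt hk hj, mul_zero]
  rw [Nat.succ_mul]; omega

end GoodRadius

/-- The Frobenius matrix as a matrix of power series. -/
noncomputable def frobSeries (p : ℕ) (ϖ : K) (k : ℕ) : Matrix (Fin k) (Fin k) (PowerSeries K) :=
  Matrix.of fun j j' => PowerSeries.mk fun l => (ϖ ^ k) ^ l * ((ϖ ^ k)⁻¹) ^ ((p - 1) * l) *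
    uMat p ϖ k 1 (j + l * k) (j' + (p - 1) * l * k)

namespace GoodRadius
variable (H : GoodRadius p ϖ ρ κ)
include H

lemma uMat_one_eq (n n' : ℕ) (j j' : Fin k) :
    (ϖ ^ k) ^ n * uMat p ϖ k 1 (j + n * k) (j' + n' * k) =
      (ϖ ^ k) ^ n' * coeffSub (frobSeries p ϖ k j j') (p * n) n' := by
  have hk : 0 < k := j.pos
  have h0 : ϖ ^ k ≠ 0 := pow_ne_zero _ H.varpi_ne
  rcases lt_or_ge (p * n) n' with h | h
  · rw [coeffSub_of_lt h, H.uMat_eq_zero hk j.2 h]; simp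
  rw [coeffSub_of_le h, frobSeries, Matrix.of_apply, PowerSeries.coeff_mk]
  obtain ⟨l, hl⟩ := Nat.exists_eq_add_of_le h
  have hp1 := hp.1.one_le
  obtain ⟨r, rfl⟩ : ∃ r, p = r + 1 := ⟨p - 1, by omega⟩
  rw [hl, Nat.add_sub_cancel_left, Nat.add_sub_cancel]
  set w := ϖ ^ k
  rcases le_total n l with h1 | h1
  · obtain ⟨c, rfl⟩ := Nat.exists_eq_add_of_le h1
    have hn' : n' + c = r * n := by grind
    have e : r * (n + c) = n' + c * (r + 1) := by grind
    rw [show ((j : ℕ) + (n + c) * k) = (j + n * k) + c * k by ring,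
      show (j' : ℕ) + r * (n + c) * k = (j' + n' * k) + c * (r + 1) * k by rw [e]; ring,
      H.uMat_add_mul hk, Nat.add_sub_cancel, e, pow_right_comm ϖ r k]
    have : w ^ n' * (w ^ (n + c) * w⁻¹ ^ (n' + c * (r + 1)) * ((w ^ r) ^ c *
        uMat (r + 1) ϖ k 1 (j + n * k) (j' + n' * k))) = w ^ n * (w ^ (n' + c * (r + 1)) *
        w⁻¹ ^ (n' + c * (r + 1))) * uMat (r + 1) ϖ k 1 (j + n * k) (j' + n' * k) := by ring
    rw [this, ← mul_pow, mul_inv_cancel₀ h0, one_pow, mul_one]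
  · obtain ⟨c, rfl⟩ := Nat.exists_eq_add_of_le h1
    have e : n' = r * l + c * (r + 1) := by grind
    rw [show ((j : ℕ) + (l + c) * k) = (j + l * k) + c * k by ring,
      show (j' : ℕ) + n' * k = (j' + r * l * k) + c * (r + 1) * k by rw [e]; ring,
      H.uMat_add_mul hk, Nat.add_sub_cancel, e, pow_right_comm ϖ r k]
    have : w ^ (r * l + c * (r + 1)) * (w ^ l * w⁻¹ ^ (r * l) *
        uMat (r + 1) ϖ k 1 (j + l * k) (j' + r * l * k)) = w ^ (l + c) * ((w ^ r) ^ c *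
        uMat (r + 1) ϖ k 1 (j + l * k) (j' + r * l * k)) * (w ^ (r * l) * w⁻¹ ^ (r * l)) := by ring
    rw [this, ← mul_pow, mul_inv_cancel₀ h0, one_pow, mul_one]

lemma uMat_one_eq' (n n' : ℕ) (j j' : Fin k) :
    uMat p ϖ k 1 (j + n * k) (j' + n' * k) =
      ((ϖ ^ k) ^ n)⁻¹ * (ϖ ^ k) ^ n' * coeffSub (frobSeries p ϖ k j j') (p * n) n' := by
  have h0 : (ϖ ^ k) ^ n ≠ 0 := pow_ne_zero _ (pow_ne_zero _ H.varpi_ne)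
  rw [mul_assoc, ← H.uMat_one_eq, ← mul_assoc, inv_mul_cancel₀ h0, one_mul]

/-- The coefficients of the Frobenius matrix decay. -/
lemma norm_coeff_frobSeries_le (l n : ℕ) (h1 : l ≤ p * n) (h2 : p * n ≤ l + p) (j j' : Fin k) :
    ‖PowerSeries.coeff l (frobSeries p ϖ k j j')‖ ≤ (‖ϖ‖⁻¹ ^ k) ^ p * ((‖ϖ‖ / ρ) ^ k) ^ n := by
  obtain ⟨n', hn'⟩ := Nat.exists_eq_add_of_le h1
  have e := H.uMat_one_eq n n' j j'
  have h0 : 0 < ‖ϖ‖ ^ k := pow_pos H.varpi_pos k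
  have hle : ‖ϖ‖ ^ k ≤ 1 := pow_le_one₀ H.varpi_pos.le (norm_varpi_lt_one H.norm_p H.varpi).le
  rw [coeffSub_of_le (by omega), show p * n - n' = l by omega] at e
  have e2 := congrArg norm e
  rw [norm_mul, norm_mul, norm_pow, norm_pow, norm_pow (ϖ ^ k) n', norm_pow] at e2
  have hu := H.norm_uMat_le k one_ne_zero (j + n * k) (j' + n' * k)
  have hρ := H.pos
  have hu' : ‖uMat p ϖ k 1 (j + n * k) (j' + n' * k)‖ ≤ (ρ⁻¹ ^ k) ^ n := by
    refine hu.trans ?_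
    rw [← pow_mul, mul_comm k]
    exact pow_le_pow_of_le_one (by positivity) (inv_le_one_of_one_le₀ H.one_lt.le) (by omega)
  have h3 : (‖ϖ‖ ^ k) ^ p * ‖PowerSeries.coeff l (frobSeries p ϖ k j j')‖ ≤ ((‖ϖ‖ / ρ) ^ k) ^ n := by
    calc _ ≤ (‖ϖ‖ ^ k) ^ n' * ‖PowerSeries.coeff l (frobSeries p ϖ k j j')‖ :=
          mul_le_mul_of_nonneg_right (pow_le_pow_of_le_one h0.le hle (by omega)) (norm_nonneg _)
      _ ≤ (‖ϖ‖ ^ k) ^ n * (ρ⁻¹ ^ k) ^ n := by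
          rw [← e2]; exact mul_le_mul_of_nonneg_left hu' (by positivity)
      _ = _ := by rw [← mul_pow, ← mul_pow, div_eq_mul_inv]
  rw [inv_pow, inv_pow, mul_comm, ← div_eq_mul_inv, le_div_iff₀ (by positivity), mul_comm]
  exact h3

lemma coeff_zero_frobSeries {j j' : Fin k} (h : j ≤ j') :
    PowerSeries.coeff 0 (frobSeries p ϖ k j j') = if j = j' then (p : K) ^ (j : ℕ) else 0 := by
  have := H.uMat_low j.pos j.2 h j'.2
  simp [frobSeries, this, Fin.ext_iff]

lemma frobSeries_horizontal [NeZero k] (j j' : Fin k) (e : ℕ) :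
    (e : K) * PowerSeries.coeff e (frobSeries p ϖ k j j') =
      PowerSeries.coeff e ((if j' + 1 = 0 then PowerSeries.C (ϖ ^ k) * PowerSeries.X else 1) *
        frobSeries p ϖ k j (j' + 1)) - p * PowerSeries.coeff e
      ((if j = 0 then PowerSeries.C (ϖ ^ k) * PowerSeries.X ^ p else 1) *
        frobSeries p ϖ k (j - 1) j') := by
  have hk : 0 < k := j.pos
  have h0 : ϖ ^ k ≠ 0 := pow_ne_zero _ H.varpi_ne
  obtain ⟨r, rfl⟩ : ∃ r, p = r + 1 := ⟨p - 1, by have := hp.1.one_le; omega⟩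
  set w := ϖ ^ k
  have hsub : (r + 1) * e - r * e = e := by rw [Nat.succ_mul]; omega
  have hle : r * e ≤ (r + 1) * e := Nat.mul_le_mul_right _ (by omega)
  have main := H.uMat_horizontal k (j + e * k) (j' + r * e * k)
  have hdiv (i : Fin k) (n : ℕ) : ((i : ℕ) + n * k) / k = n := by
    rw [Nat.add_mul_div_right _ _ hk, Nat.div_eq_of_lt i.2, zero_add]
  rw [hdiv, hdiv, H.uMat_one_eq', coeffSub_of_le hle, hsub] at main
  have hR : uMat (r + 1) ϖ k 1 (j + e * k) (j' + r * e * k + 1) = (w ^ e)⁻¹ * w ^ (r * e) *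
      PowerSeries.coeff e ((if j' + 1 = 0 then PowerSeries.C w * PowerSeries.X else 1) *
        frobSeries (r + 1) ϖ k j (j' + 1)) := by
    by_cases h : (j' : ℕ) + 1 = k
    · have h1 : j' + 1 = 0 := by
        apply Fin.ext; rw [Fin.val_add, Fin.val_one', Nat.add_mod_mod, h]; simp
      rw [if_pos h1, h1, show (j' : ℕ) + r * e * k + 1 = (0 : Fin k) + (r * e + 1) * k by grind, H.uMat_one_eq', mul_assoc (PowerSeries.C w),
        PowerSeries.coeff_C_mul]
      rcases Nat.eq_zero_or_pos e with rfl | he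
      · rw [coeffSub_of_lt (by simp)]; simp
      · obtain ⟨f, rfl⟩ : ∃ f, e = f + 1 := ⟨e - 1, by omega⟩
        rw [PowerSeries.coeff_succ_X_mul, coeffSub_of_le (by rw [Nat.succ_mul]; omega),
          show (r + 1) * (f + 1) - (r * (f + 1) + 1) = f by rw [Nat.succ_mul]; omega, pow_succ]
        ring
    · have hv : ((j' + 1 : Fin k) : ℕ) = j' + 1 := by
        rw [Fin.val_add, Fin.val_one', Nat.add_mod_mod, Nat.mod_eq_of_lt (by have := j'.2; omega)]
      have h1 : j' + 1 ≠ 0 := fun h => by grind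
      rw [if_neg h1, one_mul, show (j' : ℕ) + r * e * k + 1 = (j' + 1 : Fin k) + r * e * k by
        rw [hv]; ring, H.uMat_one_eq', coeffSub_of_le hle, hsub]
  have hL : (if (j : ℕ) + e * k = 0 then 0 else uMat (r + 1) ϖ k 1 (j + e * k - 1) (j' + r * e * k)) =
      (w ^ e)⁻¹ * w ^ (r * e) * PowerSeries.coeff e
      ((if j = 0 then PowerSeries.C w * PowerSeries.X ^ (r + 1) else 1) *
        frobSeries (r + 1) ϖ k (j - 1) j') := by
    by_cases h : j = 0
    · subst h
      have hv : (((0 : Fin k) - 1 : Fin k) : ℕ) = k - 1 := by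
        rcases Nat.lt_or_ge 1 k with hk1 | hk1
        · rw [Fin.sub_def]
          simp only [Fin.val_one', Nat.mod_eq_of_lt hk1, Fin.val_zero, add_zero]
          simp
        omega
      rw [if_pos rfl, Fin.val_zero, zero_add, mul_assoc (PowerSeries.C w), PowerSeries.coeff_C_mul,
        PowerSeries.coeff_X_pow_mul']
      rcases Nat.eq_zero_or_pos e with rfl | he
      · simp
      · obtain ⟨f, rfl⟩ : ∃ f, e = f + 1 := ⟨e - 1, by omega⟩
        rw [if_neg (by positivity), show (f + 1) * k - 1 = ((0 : Fin k) - 1 : Fin k) + f * k by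
          rw [hv, Nat.succ_mul]; omega, H.uMat_one_eq', pow_succ w f]
        have e1 : r * (f + 1) = r * f + r := by ring
        have e2 : (r + 1) * f = r * f + f := by ring
        have e3 : (w ^ f * w)⁻¹ * w ^ (r * (f + 1)) * (w * coeffSub (frobSeries (r + 1) ϖ k (0 - 1) j')
          ((r + 1) * f) (r * (f + 1))) = (w ^ f)⁻¹ * w ^ (r * (f + 1)) *
          coeffSub (frobSeries (r + 1) ϖ k (0 - 1) j') ((r + 1) * f) (r * (f + 1)) := by
          field_simp
        by_cases hf : r + 1 ≤ f + 1
        · rw [if_pos hf, ← e3, coeffSub_of_le (by omega),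
            show (r + 1) * f - r * (f + 1) = f + 1 - (r + 1) by omega]
        · rw [if_neg hf, coeffSub_of_lt (by omega)]; simp
    · have hj : 0 < (j : ℕ) := Nat.pos_of_ne_zero fun h' => h (Fin.ext (by simpa using h'))
      have hv : ((j - 1 : Fin k) : ℕ) = j - 1 := by
        have hj2 := j.2
        rw [Fin.sub_def]
        simp only [Fin.val_one', Nat.mod_eq_of_lt (show 1 < k by omega)]
        rw [show k - 1 + (j : ℕ) = (j - 1) + k by omega, Nat.add_mod_right,
          Nat.mod_eq_of_lt (by omega)]
      rw [if_neg h, one_mul, if_neg (by omega), show (j : ℕ) + e * k - 1 = (j - 1 : Fin k) + e * k by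
        rw [hv]; omega, H.uMat_one_eq', coeffSub_of_le hle, hsub]
  rw [hR, hL] at main
  have hc : (w ^ e)⁻¹ * w ^ (r * e) ≠ 0 := by positivity
  grind

end GoodRadius
end FrobSeries

section CoeffSub
open PowerSeries
variable {K : Type*} [NormedField K]

lemma coeffSub_expand_mul {p : ℕ} (hp0 : p ≠ 0) (F G : K⟦X⟧) (A n : ℕ) :
    coeffSub (expand p hp0 F * G) (p * A) n =
      ∑ c ∈ range (A + 1), coeffSub F A c * coeffSub G (p * c) n := by
  have hpos := Nat.pos_of_ne_zero hp0
  rcases lt_or_ge (p * A) n with h | h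
  · rw [coeffSub_of_lt h]
    refine (sum_eq_zero fun c hc => ?_).symm
    rw [coeffSub_of_lt (f := G), mul_zero]
    exact lt_of_le_of_lt (Nat.mul_le_mul_left p (by grind)) h
  rw [coeffSub_of_le h, PowerSeries.coeff_mul,
    ← sum_filter_of_ne (p := fun c => n ≤ p * c) (s := range (A + 1))]
  · symm
    refine sum_of_injOn (fun c => (p * (A - c), p * c - n)) ?_ ?_ ?_ ?_
    · intro c hc c' hc' e
      simp only [coe_filter, mem_range, Set.mem_ofPred_eq] at hc hc'
      have := Nat.eq_of_mul_eq_mul_left hpos (Prod.ext_iff.1 e).1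
      omega
    · intro c hc
      simp only [coe_filter, mem_range, Set.mem_ofPred_eq] at hc
      simp only [Finset.mem_coe, HasAntidiagonal.mem_antidiagonal]
      have : p * (A - c) + p * c = p * A := by rw [← mul_add]; congr 1; omega
      omega
    · rintro ⟨x, y⟩ hxy hne
      rw [HasAntidiagonal.mem_antidiagonal] at hxy
      dsimp only at hxy
      rw [PowerSeries.coeff_expand]
      split_ifs with hd
      · exfalso
        apply hne
        obtain ⟨l, rfl⟩ := hd
        have hl : l ≤ A := Nat.le_of_mul_le_mul_left (by omega) hpos
        have e : p * (A - l) + p * l = p * A := by rw [← mul_add]; congr 1; omega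
        refine ⟨A - l, ?_, ?_⟩
        · grind
        grind
      · rw [zero_mul]
    · intro c hc
      simp only [mem_filter, mem_range] at hc
      rw [coeffSub_of_le (by omega), coeffSub_of_le hc.2, PowerSeries.coeff_expand_mul]
  · intro c _ hne
    by_contra hlt
    rw [coeffSub_of_lt (not_le.1 hlt), mul_zero] at hne
    exact hne rfl

lemma coeffSub_sum {ι : Type*} (s : Finset ι) (f : ι → K⟦X⟧) (a b : ℕ) :
    coeffSub (∑ i ∈ s, f i) a b = ∑ i ∈ s, coeffSub (f i) a b := by
  unfold coeffSub; split_ifs <;> simp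

end CoeffSub

section Iter
open Filter Topology
variable {p : ℕ} [hp : Fact p.Prime] {K : Type*} [NormedField K] [IsUltrametricDist K]
  [CharZero K] [CompleteSpace K] {ϖ : K} {ρ κ : ℝ} {k : ℕ}

lemma frobIter_one {ι : Type*} [Fintype ι] [DecidableEq ι] (hp0 : p ≠ 0)
    (B : Matrix ι ι (PowerSeries K)) : frobIter hp0 B 1 = B := by
  rw [frobIter, frobIter, Matrix.map_one _ (map_zero _) (map_one _), one_mul]

lemma coeffSub_frobIter_succ {ι : Type*} [Fintype ι] [DecidableEq ι] (hp0 : p ≠ 0)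
    (B : Matrix ι ι (PowerSeries K)) (m A n : ℕ) (j j' : ι) :
    coeffSub (frobIter hp0 B (m + 1) j j') (p * A) n = ∑ c ∈ range (A + 1), ∑ i,
      coeffSub (frobIter hp0 B m j i) A c * coeffSub (B i j') (p * c) n := by
  rw [frobIter, Matrix.mul_apply, coeffSub_sum, sum_comm]
  exact sum_congr rfl fun i _ => coeffSub_expand_mul hp0 _ _ _ _

namespace GoodRadius
variable (H : GoodRadius p ϖ ρ κ)
include H

lemma uMat_eq_frobIter {m : ℕ} (hm : m ≠ 0) (n n' : ℕ) (j j' : Fin k) :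
    uMat p ϖ k m (j + n * k) (j' + n' * k) = ((ϖ ^ k) ^ n)⁻¹ * (ϖ ^ k) ^ n' *
      coeffSub (frobIter hp.1.ne_zero (frobSeries p ϖ k) m j j') (p ^ m * n) n' := by
  have : NeZero k := ⟨j.pos.ne'⟩
  have h0 : ϖ ^ k ≠ 0 := pow_ne_zero _ H.varpi_ne
  induction m, Nat.one_le_iff_ne_zero.2 hm using Nat.le_induction generalizing n n' j j' with
  | base => rw [frobIter_one, pow_one]; exact H.uMat_one_eq' n n' j j'
  | succ m hm ih =>
    have hs := H.hasSum_uMat_succ k (show m ≠ 0 by omega) (j + n * k) (j' + n' * k)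
    rw [← (Nat.divModEquiv k).symm.hasSum_iff] at hs
    refine hs.unique ?_
    have key (x : ℕ × Fin k) : ((fun c => uMat p ϖ k m (j + n * k) c * uMat p ϖ k 1 c (j' + n' * k)) ∘
        (Nat.divModEquiv k).symm) x = ((ϖ ^ k) ^ n)⁻¹ * (ϖ ^ k) ^ n' *
        (coeffSub (frobIter hp.1.ne_zero (frobSeries p ϖ k) m j x.2) (p ^ m * n) x.1 *
          coeffSub (frobSeries p ϖ k x.2 j') (p * x.1) n') := by
      have e : (Nat.divModEquiv k).symm x = x.2 + x.1 * k := by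
        change x.1 * k + (x.2 : ℕ) = _; ring
      rw [Function.comp_apply, e, ih (by omega), H.uMat_one_eq']
      have : (ϖ ^ k) ^ x.1 ≠ 0 := pow_ne_zero _ h0
      field_simp
    simp only [funext key]
    have hsum : coeffSub (frobIter hp.1.ne_zero (frobSeries p ϖ k) (m + 1) j j') (p ^ (m + 1) * n) n' =
        ∑ x ∈ range (p ^ m * n + 1) ×ˢ univ,
          coeffSub (frobIter hp.1.ne_zero (frobSeries p ϖ k) m j x.2) (p ^ m * n) x.1 *
          coeffSub (frobSeries p ϖ k x.2 j') (p * x.1) n' := by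
      rw [pow_succ', mul_assoc, coeffSub_frobIter_succ, sum_product]
    rw [hsum]
    refine (hasSum_sum_of_ne_finset_zero fun x hx => ?_).mul_left _
    rw [coeffSub_of_lt, zero_mul]
    grind

end GoodRadius
end Iter

section Conv
open PowerSeries Filter Topology
variable {K : Type*} [NormedField K] [CompleteSpace K]

/-- Power series converging absolutely on the closed unit disc. -/
def IsConv (f : K⟦X⟧) : Prop := Summable fun n => ‖coeff n f‖

/-- Evaluation of a power series. -/
noncomputable def ev (x : K) (f : K⟦X⟧) : K := ∑' n, coeff n f * x ^ n

lemma IsConv.summable_norm {f : K⟦X⟧} (hf : IsConv f) {x : K} (hx : ‖x‖ ≤ 1) :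
    Summable fun n => ‖coeff n f * x ^ n‖ := by
  refine hf.of_nonneg_of_le (fun n => norm_nonneg _) fun n => ?_
  rw [norm_mul, norm_pow]
  exact mul_le_of_le_one_right (norm_nonneg _) (pow_le_one₀ (norm_nonneg _) hx)

lemma IsConv.hasSum {f : K⟦X⟧} (hf : IsConv f) {x : K} (hx : ‖x‖ ≤ 1) :
    HasSum (fun n => coeff n f * x ^ n) (ev x f) := (hf.summable_norm hx).of_norm.hasSum

lemma IsConv.of_le {f : K⟦X⟧} {C s : ℝ} (hs0 : 0 ≤ s) (hs : s < 1)
    (h : ∀ n, ‖coeff n f‖ ≤ C * s ^ n) : IsConv f :=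
  ((summable_geometric_of_lt_one hs0 hs).mul_left C).of_nonneg_of_le (fun _ => norm_nonneg _) h

lemma IsConv.one : IsConv (1 : K⟦X⟧) := by
  refine summable_of_ne_finset_zero (s := {0}) fun n hn => ?_
  simp_all

lemma IsConv.zero : IsConv (0 : K⟦X⟧) := by
  simp [IsConv]

lemma IsConv.add {f g : K⟦X⟧} (hf : IsConv f) (hg : IsConv g) : IsConv (f + g) := by
  refine (Summable.add hf hg).of_nonneg_of_le (fun n => norm_nonneg _) fun n => ?_
  rw [map_add]; exact norm_add_le _ _

lemma IsConv.mul {f g : K⟦X⟧} (hf : IsConv f) (hg : IsConv g) : IsConv (f * g) := by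
  have := summable_norm_sum_mul_antidiagonal_of_summable_norm hf hg
  simpa only [IsConv, PowerSeries.coeff_mul] using this

lemma IsConv.sum {ι : Type*} (s : Finset ι) {f : ι → K⟦X⟧} (hf : ∀ i ∈ s, IsConv (f i)) :
    IsConv (∑ i ∈ s, f i) :=
  sum_induction _ _ (fun _ _ => IsConv.add) IsConv.zero hf

lemma IsConv.prod {ι : Type*} (s : Finset ι) {f : ι → K⟦X⟧} (hf : ∀ i ∈ s, IsConv (f i)) :
    IsConv (∏ i ∈ s, f i) :=
  prod_induction _ _ (fun _ _ => IsConv.mul) IsConv.one hf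

lemma IsConv.expand {f : K⟦X⟧} (hf : IsConv f) {p : ℕ} (hp0 : p ≠ 0) :
    IsConv (expand p hp0 f) := by
  have hinj : Function.Injective (fun n : ℕ => p * n) := fun a b h =>
    Nat.eq_of_mul_eq_mul_left (Nat.pos_of_ne_zero hp0) h
  rw [IsConv, ← hinj.summable_iff]
  · simpa only [Function.comp_def, PowerSeries.coeff_expand_mul, IsConv] using hf
  · intro n hn
    rw [PowerSeries.coeff_expand_of_not_dvd, norm_zero]
    rintro ⟨c, rfl⟩
    exact hn ⟨c, rfl⟩

lemma ev_one (x : K) : ev x 1 = 1 := by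
  rw [ev, tsum_eq_single 0]
  · simp
  simp_all

lemma ev_add {x : K} (hx : ‖x‖ ≤ 1) {f g : K⟦X⟧} (hf : IsConv f) (hg : IsConv g) :
    ev x (f + g) = ev x f + ev x g := by
  refine ((hf.add hg).hasSum hx).unique ?_
  simpa [add_mul] using (hf.hasSum hx).add (hg.hasSum hx)

lemma ev_mul {x : K} (hx : ‖x‖ ≤ 1) {f g : K⟦X⟧} (hf : IsConv f) (hg : IsConv g) :
    ev x (f * g) = ev x f * ev x g := by
  rw [ev, ev, ev, tsum_mul_tsum_eq_tsum_sum_antidiagonal_of_summable_norm (hf.summable_norm hx)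
    (hg.summable_norm hx)]
  refine tsum_congr fun n => ?_
  rw [PowerSeries.coeff_mul, sum_mul]
  refine sum_congr rfl fun y hy => ?_
  rw [← HasAntidiagonal.mem_antidiagonal.1 hy, pow_add]; ring

lemma ev_sum {ι : Type*} (s : Finset ι) {x : K} (hx : ‖x‖ ≤ 1) {f : ι → K⟦X⟧}
    (hf : ∀ i ∈ s, IsConv (f i)) : ev x (∑ i ∈ s, f i) = ∑ i ∈ s, ev x (f i) := by
  classical
  induction s using Finset.induction_on with
  | empty => simp [ev]
  | insert a s ha ih =>
    rw [sum_insert ha, sum_insert ha, ev_add hx (hf a (by simp))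
      (IsConv.sum s fun i hi => hf i (by simp [hi])), ih fun i hi => hf i (by simp [hi])]

lemma ev_prod {ι : Type*} (s : Finset ι) {x : K} (hx : ‖x‖ ≤ 1) {f : ι → K⟦X⟧}
    (hf : ∀ i ∈ s, IsConv (f i)) : ev x (∏ i ∈ s, f i) = ∏ i ∈ s, ev x (f i) := by
  classical
  induction s using Finset.induction_on with
  | empty => simp [ev_one]
  | insert a s ha ih =>
    rw [prod_insert ha, prod_insert ha, ev_mul hx (hf a (by simp))
      (IsConv.prod s fun i hi => hf i (by simp [hi])), ih fun i hi => hf i (by simp [hi])]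

lemma ev_expand {p : ℕ} (hp0 : p ≠ 0) (x : K) (f : K⟦X⟧) :
    ev x (expand p hp0 f) = ev (x ^ p) f := by
  have hinj : Function.Injective (fun n : ℕ => p * n) := fun a b h =>
    Nat.eq_of_mul_eq_mul_left (Nat.pos_of_ne_zero hp0) h
  rw [ev, ev, ← hinj.tsum_eq]
  · simp only [PowerSeries.coeff_expand_mul, pow_mul]
  · intro n hn
    by_contra h
    apply hn
    beta_reduce
    rw [PowerSeries.coeff_expand_of_not_dvd, zero_mul]
    rintro ⟨c, rfl⟩
    exact h ⟨c, rfl⟩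

variable {ι : Type*} [Fintype ι] [DecidableEq ι]

lemma isConv_frobIter {p : ℕ} (hp0 : p ≠ 0) {B : Matrix ι ι K⟦X⟧} (hB : ∀ i j, IsConv (B i j))
    (m : ℕ) (i j : ι) : IsConv (frobIter hp0 B m i j) := by
  induction m generalizing i j with
  | zero =>
    rw [frobIter, Matrix.one_apply]
    split_ifs
    · exact IsConv.one
    · exact IsConv.zero
  | succ m ih =>
    rw [frobIter, Matrix.mul_apply]
    exact IsConv.sum _ fun l _ => ((ih i l).expand hp0).mul (hB l j)

lemma map_ev_frobIter_succ {p : ℕ} (hp0 : p ≠ 0) {B : Matrix ι ι K⟦X⟧}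
    (hB : ∀ i j, IsConv (B i j)) (m : ℕ) {x : K} (hx : ‖x‖ ≤ 1) :
    (frobIter hp0 B (m + 1)).map (ev x) = (frobIter hp0 B m).map (ev (x ^ p)) * B.map (ev x) := by
  ext i j
  rw [Matrix.map_apply, frobIter, Matrix.mul_apply, Matrix.mul_apply, ev_sum _ hx]
  · refine sum_congr rfl fun l _ => ?_
    rw [Matrix.map_apply, ev_mul hx ((isConv_frobIter hp0 hB m i l).expand hp0) (hB l j), ev_expand,
      Matrix.map_apply, Matrix.map_apply]
  · exact fun l _ => ((isConv_frobIter hp0 hB m i l).expand hp0).mul (hB l j)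

lemma map_ev_frobIter_of_pow_eq {p : ℕ} (hp0 : p ≠ 0) {B : Matrix ι ι K⟦X⟧}
    (hB : ∀ i j, IsConv (B i j)) (m : ℕ) {x : K} (hx : ‖x‖ ≤ 1) (hxp : x ^ p = x) :
    (frobIter hp0 B m).map (ev x) = B.map (ev x) ^ m := by
  induction m with
  | zero =>
    ext i j
    rw [frobIter, pow_zero, Matrix.map_apply, Matrix.one_apply, Matrix.one_apply]
    split_ifs
    · exact ev_one x
    · simp [ev]
  | succ m ih => rw [map_ev_frobIter_succ hp0 hB m hx, hxp, ih, pow_succ]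

end Conv

open Classical in
/-- The `k`-fold multiplicative convolution power of a function on a finite abelian group. -/
noncomputable def klSum {G : Type*} [CommGroup G] [Fintype G] {E : Type*} [CommRing E] (ψ : G → E)
    (k : ℕ) (x : G) : E :=
  ∑ t : Fin k → G, if ∏ i, t i = x then ∏ i, ψ (t i) else 0

section Torus
open PowerSeries
variable {G : Type*} [CommGroup G] [Fintype G] {K : Type*} [NormedField K] [CompleteSpace K]
  {τ : G →* K}

lemma pow_card_eq_one_of_hom (x : G) : τ x ^ Fintype.card G = 1 := by
  rw [← map_pow, pow_card_eq_one, map_one]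

lemma norm_hom_eq_one (x : G) : ‖τ x‖ = 1 := by
  have h := congrArg norm (pow_card_eq_one_of_hom (τ := τ) x)
  rw [norm_pow, norm_one] at h
  exact (pow_eq_one_iff_of_nonneg (norm_nonneg _) Fintype.card_ne_zero).1 h

lemma sum_hom_pow (hτ : Function.Injective τ) (n : ℕ) :
    ∑ x, τ x ^ n = if Fintype.card G ∣ n then (Fintype.card G : K) else 0 := by
  classical
  have h := sum_hom_units (τ.comp (powMonoidHom n))
  simp only [MonoidHom.comp_apply, powMonoidHom_apply, map_pow] at h
  rw [h]
  have : (τ.comp (powMonoidHom n) = 1) ↔ Fintype.card G ∣ n := by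
    have : IsCyclic G := isCyclic_of_injective_ringHom τ hτ
    rw [← Nat.card_eq_fintype_card, ← IsCyclic.exponent_eq_card, Monoid.exponent_dvd_iff_forall_pow_eq_one,
      MonoidHom.ext_iff]
    refine forall_congr' fun g => ?_
    rw [MonoidHom.comp_apply, powMonoidHom_apply, MonoidHom.one_apply, ← map_one τ, hτ.eq_iff]
  simp_all

lemma hasSum_torus (hτ : Function.Injective τ) {f : K⟦X⟧} (hf : IsConv f) (l : ℕ) :
    HasSum (fun n => (Fintype.card G : K) * coeffSub f (Fintype.card G * n) l)
      (∑ x, τ x ^ l * ev (τ x) f) := by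
  set N := Fintype.card G
  have h1 : HasSum (fun j => if N ∣ j + l then (N : K) * coeff j f else 0)
      (∑ x, τ x ^ l * ev (τ x) f) := by
    have := hasSum_sum (s := univ) fun (x : G) _ =>
      (hf.hasSum (norm_hom_eq_one (τ := τ) x).le).mul_left (τ x ^ l)
    refine this.congr_fun fun j => ?_
    have e : ∑ x, τ x ^ l * (coeff j f * τ x ^ j) = (∑ x, τ x ^ (j + l)) * coeff j f := by
      rw [sum_mul]; grind
    rw [e, sum_hom_pow hτ, ite_mul, zero_mul]
  set g : ℕ → K := fun i => if N ∣ i then (N : K) * coeffSub f i l else 0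
  have h2 : HasSum g (∑ x, τ x ^ l * ev (τ x) f) := by
    rw [← (add_left_injective l).hasSum_iff]
    · refine h1.congr_fun fun j => ?_
      simp only [g, Function.comp_apply, coeffSub_of_le (Nat.le_add_left l j), Nat.add_sub_cancel]
    · intro i hi
      simp only [g]
      rw [coeffSub_of_lt, mul_zero, ite_self]
      by_contra h
      exact hi ⟨i - l, Nat.sub_add_cancel (not_lt.1 h)⟩
  have hN : 0 < N := Fintype.card_pos
  have hinj : Function.Injective (fun n : ℕ => N * n) := fun a b h => Nat.eq_of_mul_eq_mul_left hN h
  rw [← hinj.hasSum_iff] at h2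
  · refine h2.congr_fun fun n => ?_
    simp [g]
  · intro i hi
    simp only [g]
    rw [if_neg]
    rintro ⟨c, rfl⟩
    exact hi ⟨c, rfl⟩

lemma eq_of_moments (hτ : Function.Injective τ) {F H : G → K}
    (h : ∀ l : ℕ, ∑ x, τ x ^ l * F x = ∑ x, τ x ^ l * H x) : F = H := by
  classical
  have hP (P : Polynomial K) : ∑ x, P.eval (τ x) * (F x - H x) = 0 := by
    induction P using Polynomial.induction_on' with
    | add P Q hP hQ => simp only [Polynomial.eval_add, add_mul, sum_add_distrib, hP, hQ, add_zero]
    | monomial n a =>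
      simp only [Polynomial.eval_monomial, mul_assoc, ← mul_sum]
      rw [sum_congr rfl fun x _ => mul_sub (τ x ^ n) (F x) (H x), sum_sub_distrib, h, sub_self, mul_zero]
  funext y
  have h1 := hP (∏ z ∈ univ.erase y, (Polynomial.X - Polynomial.C (τ z)))
  rw [sum_eq_single y] at h1
  · rw [Polynomial.eval_prod] at h1
    refine sub_eq_zero.1 ((mul_eq_zero.1 h1).resolve_left (prod_ne_zero_iff.2 fun z hz => ?_))
    rw [Polynomial.eval_sub, Polynomial.eval_X, Polynomial.eval_C, sub_ne_zero]
    grind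
  · intro x _ hx
    rw [Polynomial.eval_prod, prod_eq_zero (mem_erase.2 ⟨hx, mem_univ x⟩) (by simp), zero_mul]
  · simp

lemma sum_pow_mul_klSum (ψ : G → K) (k l : ℕ) :
    ∑ x, τ x ^ l * klSum ψ k x = (∑ y, τ y ^ l * ψ y) ^ k := by
  classical
  simp only [klSum, mul_sum, mul_ite, mul_zero]
  rw [sum_comm, Fintype.sum_pow]
  refine sum_congr rfl fun t _ => ?_
  rw [sum_ite_eq, if_pos (mem_univ _), prod_mul_distrib, prod_pow, map_prod]

end Torus

section TraceFormula
open Filter Topology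
variable {p : ℕ} [hp : Fact p.Prime] {K : Type*} [NormedField K] [IsUltrametricDist K]
  [CharZero K] [CompleteSpace K] {ϖ : K} {ρ κ : ℝ} {k : ℕ}
  {G : Type*} [CommGroup G] [Fintype G] {τ : G →* K}

namespace GoodRadius
variable (H : GoodRadius p ϖ ρ κ)
include H

lemma frobSeries_one (j j' : Fin 1) : frobSeries p ϖ 1 j j' = theta p ϖ := by
  have hj := Subsingleton.elim j 0
  have hj' := Subsingleton.elim j' 0
  subst hj hj'
  ext l
  have h1 := H.uMat_one_eq' l ((p - 1) * l) (0 : Fin 1) 0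
  rw [coeffSub_of_le (Nat.mul_le_mul_right _ (Nat.sub_le _ _)), ← Nat.sub_mul,
    Nat.sub_sub_self hp.1.one_le, one_mul] at h1
  have h2 := H.uMat_rank_one l ((p - 1) * l)
  have e : ((p * l : ℕ) : ℤ) - ((p - 1) * l : ℕ) = l := by
    rw [← Nat.cast_sub (Nat.mul_le_mul_right _ (Nat.sub_le _ _)), ← Nat.sub_mul,
      Nat.sub_sub_self hp.1.one_le, one_mul]
  rw [e, thCoeff_natCast] at h2
  simp only [Fin.val_zero, mul_one, zero_add, pow_one] at h1
  rw [h1] at h2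
  have h0 := H.varpi_ne
  rw [inv_pow] at h2
  refine mul_left_cancel₀ (mul_ne_zero (inv_ne_zero (pow_ne_zero l h0))
    (pow_ne_zero ((p - 1) * l) h0)) (h2.trans (by ring))

lemma norm_coeff_frobSeries_le_pow {t : ℝ} (ht0 : 0 ≤ t) (ht1 : t ≤ 1)
    (ht : t ^ p = (‖ϖ‖ / ρ) ^ k) (l : ℕ) (j j' : Fin k) :
    ‖PowerSeries.coeff l (frobSeries p ϖ k j j')‖ ≤ (‖ϖ‖⁻¹ ^ k) ^ p * t ^ l := by
  have hp0 := hp.1.pos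
  have h1 : l ≤ p * ((l + (p - 1)) / p) := by
    have := Nat.lt_mul_div_succ (l + (p - 1)) hp0
    grind
  have h2 : p * ((l + (p - 1)) / p) ≤ l + p := (Nat.mul_div_le _ _).trans (by omega)
  refine (H.norm_coeff_frobSeries_le l _ h1 h2 j j').trans ?_
  rw [← ht, ← pow_mul t]
  exact mul_le_mul_of_nonneg_left (pow_le_pow_of_le_one ht0 ht1 h1) (by positivity)

lemma isConv_frobSeries (j j' : Fin k) : IsConv (frobSeries p ϖ k j j') := by
  have hk : k ≠ 0 := j.pos.ne'
  have h0 := H.varpi_pos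
  have hρ := H.pos
  have h1 : ‖ϖ‖ / ρ < 1 := by
    rw [div_lt_one hρ]; exact (norm_varpi_lt_one H.norm_p H.varpi).trans H.one_lt
  have h2 : (‖ϖ‖ / ρ) ^ k < 1 := pow_lt_one₀ (by positivity) h1 hk
  have h3 : 0 ≤ (‖ϖ‖ / ρ) ^ k := by positivity
  have hp0 : (0 : ℝ) < (p : ℝ)⁻¹ := inv_pos.2 (by exact_mod_cast hp.1.pos)
  refine IsConv.of_le (s := ((‖ϖ‖ / ρ) ^ k) ^ (p : ℝ)⁻¹) (Real.rpow_nonneg h3 _)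
    (Real.rpow_lt_one h3 h2 hp0) fun n => H.norm_coeff_frobSeries_le_pow (Real.rpow_nonneg h3 _)
      (Real.rpow_lt_one h3 h2 hp0).le ?_ n j j'
  exact Real.rpow_inv_natCast_pow h3 hp.1.ne_zero

lemma sum_pow_mul_trace (hτ : Function.Injective τ) {m : ℕ} (hm : m ≠ 0)
    (hG : Fintype.card G = p ^ m - 1) (l : ℕ) : ∃ y : K, ∀ k, 0 < k →
    (ϖ ^ k) ^ l * ∑ x, τ x ^ l *
      ((frobIter hp.1.ne_zero (frobSeries p ϖ k) m).map (ev (τ x))).trace = -y ^ k := by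
  obtain ⟨y, hy⟩ := H.exists_hasSum_uMat_diag hm l
  refine ⟨y, fun k hk => ?_⟩
  have : NeZero k := ⟨hk.ne'⟩
  have h0 : ϖ ^ k ≠ 0 := pow_ne_zero _ H.varpi_ne
  set N := Fintype.card G
  have hpm : p ^ m = N + 1 := by have := Nat.one_le_pow m p hp.1.pos; omega
  set B := frobIter hp.1.ne_zero (frobSeries p ϖ k) m
  have hB j : IsConv (B j j) :=
    isConv_frobIter _ H.isConv_frobSeries m j j
  have h1 := hy k hk
  rw [← (Nat.divModEquiv k).symm.hasSum_iff] at h1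
  have h2 := h1.prod_fiberwise fun n => hasSum_fintype _
  have h3 := hasSum_sum (s := univ) fun (j : Fin k) _ => hasSum_torus hτ (hB j) l
  have h4 := (h2.mul_left (N : K)).unique ((h3.mul_left ((ϖ ^ k) ^ l)).congr_fun fun n => ?_)
  · simp only [Matrix.trace, Matrix.diag, Matrix.map_apply, mul_sum (s := (univ : Finset (Fin k)))]
    rw [sum_comm]
    refine h4.symm.trans ?_
    have hN : (N : K) ≠ 0 := by exact_mod_cast Fintype.card_ne_zero
    have : 1 - (p : K) ^ m = -N := by
      rw [← Nat.cast_pow, hpm]; push_cast; ring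
    rw [this]; field_simp
  · rw [mul_sum, mul_sum]
    refine sum_congr rfl fun j _ => ?_
    have e : (Nat.divModEquiv k).symm (n, j) = j + n * k := by
      change n * k + (j : ℕ) = _; ring
    rw [Function.comp_apply, e, show (j : ℕ) + n * k + l * k = j + (n + l) * k by ring,
      H.uMat_eq_frobIter hm]
    have : coeffSub (B j j) (p ^ m * n) (n + l) = coeffSub (B j j) (N * n) l := by
      rw [hpm, Nat.succ_mul]
      unfold coeffSub
      grind
    rw [this, pow_add]
    have : (ϖ ^ k) ^ n ≠ 0 := pow_ne_zero _ h0
    field_simp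
    rfl

/-- Values of the additive character of level `m` on the torus. -/
lemma trace_frobIter (hτ : Function.Injective τ) {m : ℕ} (hm : m ≠ 0)
    (hG : Fintype.card G = p ^ m - 1) (hk : 0 < k) (hk2 : Even k) (x : G) :
    ((frobIter hp.1.ne_zero (frobSeries p ϖ k) m).map (ev (τ x))).trace =
      -klSum (fun y => ((frobIter hp.1.ne_zero (frobSeries p ϖ 1) m).map (ev (τ y))).trace) k x := by
  suffices h : (fun x => ((frobIter hp.1.ne_zero (frobSeries p ϖ k) m).map (ev (τ x))).trace) =
      fun x => -klSum (fun y =>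
        ((frobIter hp.1.ne_zero (frobSeries p ϖ 1) m).map (ev (τ y))).trace) k x from
    congrFun h x
  refine eq_of_moments hτ fun l => ?_
  simp only [mul_neg, sum_neg_distrib]
  rw [sum_pow_mul_klSum]
  obtain ⟨y, hy⟩ := H.sum_pow_mul_trace hτ hm hG l
  have h1 := hy 1 one_pos
  have hk' := hy k hk
  rw [pow_one, pow_one] at h1
  have h0 : (ϖ ^ k) ^ l ≠ 0 := pow_ne_zero _ (pow_ne_zero _ H.varpi_ne)
  refine mul_left_cancel₀ h0 ?_
  rw [hk', pow_right_comm, mul_neg, ← mul_pow, h1, hk2.neg_pow]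

end GoodRadius
end TraceFormula

section Ultra
variable {K : Type*} [NormedField K] [IsUltrametricDist K]

lemma norm_hasSum_le {α : Type*} {f : α → K} {s : K} (h : HasSum f s) {C : ℝ} (hC : 0 ≤ C)
    (hf : ∀ a, ‖f a‖ ≤ C) : ‖s‖ ≤ C :=
  le_of_tendsto h.norm (Filter.Eventually.of_forall fun _ =>
    norm_sum_le_of_forall_le_of_nonneg hC fun a _ => hf a)

end Ultra

section Psi
open PowerSeries
variable {p : ℕ} [hp : Fact p.Prime] {K : Type*} [NormedField K] [IsUltrametricDist K]
  [CharZero K] [CompleteSpace K] {ϖ : K} {ρ κ : ℝ} {k : ℕ}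

/-- Values of the additive character of level `m` at Teichmüller points. -/
noncomputable def psi (p : ℕ) (ϖ : K) (m : ℕ) (x : K) : K :=
  ∏ i ∈ range m, ev (x ^ p ^ i) (theta p ϖ)

lemma theta_pow_mul_expand (hϖ : ϖ ^ (p - 1) = -p) :
    theta p ϖ ^ p * expand p hp.1.ne_zero (mk fun n => (p * ϖ) ^ n / n.factorial) =
      mk fun n => (p * ϖ) ^ n / n.factorial := by
  have hϖp : ϖ ^ p = -(p * ϖ) := by
    rw [← Nat.sub_add_cancel hp.1.one_le, pow_succ, hϖ, Nat.sub_add_cancel hp.1.one_le]; ring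
  have h := isZeta_exp_monomial one_ne_zero ((p : K) * ϖ)
  simp only [one_dvd, if_true, Nat.div_one, Nat.cast_one, one_mul] at h
  refine (((isZeta_theta (p := p) (ϖ := ϖ)).pow p).mul (expand_derivative h hp.1.ne_zero)).unique ?_
  convert h using 1
  ext n
  rw [thetaLog, map_add, map_nsmul, map_nsmul, map_add, coeff_expand]
  simp only [coeff_monomial, hϖp, nsmul_eq_mul]
  have hp1 := hp.1.one_lt
  rcases eq_or_ne n p with rfl | hn
  · rw [if_neg (by omega), if_pos rfl, if_pos (dvd_refl _), Nat.div_self (by omega), if_pos rfl,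
      if_neg (by omega)]; ring
  · rw [if_neg hn]
    have : (if p ∣ n then if n / p = 1 then (p : K) * ϖ else 0 else 0) = 0 := by
      split_ifs with h1 h2
      · exact absurd (by rw [← Nat.div_mul_cancel h1, h2, one_mul]) hn
      · rfl
      · rfl
    rw [this]
    split_ifs <;> simp

lemma theta_mul_rescale (hp2 : p ≠ 2) : theta p ϖ * rescale (-1) (theta p ϖ) = 1 := by
  have h := isZeta_theta (p := p) (ϖ := ϖ)
  refine (h.mul (h.rescale (-1))).unique ?_
  convert IsZeta.one using 1
  ext n
  rw [map_add, coeff_rescale, thetaLog, map_add, coeff_monomial, coeff_monomial, map_zero]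
  have hodd : Odd p := hp.1.odd_of_ne_two hp2
  have hp1 := hp.1.one_lt
  rcases eq_or_ne n 1 with rfl | h1
  · simp
  · rcases eq_or_ne n p with rfl | h2
    · simp [h1, hodd.neg_one_pow]
    · simp [h1, h2]

lemma ev_neg (x : K) (f : K⟦X⟧) : ev (-x) f = ev x (rescale (-1) f) := by
  unfold ev
  refine tsum_congr fun n => ?_
  rw [coeff_rescale, neg_pow]; ring

lemma psi_add (m n : ℕ) (x : K) : psi p ϖ (m + n) x = psi p ϖ m x * psi p ϖ n (x ^ p ^ m) := by
  rw [psi, prod_range_add, psi, psi]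
  simp only [pow_add, pow_mul]

lemma psi_mul {m : ℕ} {x : K} (hx : x ^ p ^ m = x) (l : ℕ) : psi p ϖ (m * l) x = psi p ϖ m x ^ l := by
  induction l with
  | zero => simp [psi]
  | succ l ih =>
    rw [Nat.mul_succ, add_comm, psi_add, hx, ih, pow_succ']

lemma eq_one_of_pow_prime (hK : ‖(p : K)‖ = (p : ℝ)⁻¹) {η : K} {r : ℝ}
    (hr : r ^ (p - 1) < (p : ℝ)⁻¹) (h : η ^ p = 1) (h1 : ‖η - 1‖ ≤ r) : η = 1 := by
  by_contra hne
  set u := η - 1 with hu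
  have hu0 : u ≠ 0 := sub_ne_zero.2 hne
  have hp0 : (0 : ℝ) < (p : ℝ)⁻¹ := inv_pos.2 (by exact_mod_cast hp.1.pos)
  have hp1 : (p : ℝ)⁻¹ < 1 := inv_lt_one_of_one_lt₀ (by exact_mod_cast hp.1.one_lt)
  have hr1 : r < 1 := by
    by_contra hge
    linarith [one_le_pow₀ (n := p - 1) (not_lt.1 hge)]
  have hul : ‖u‖ < 1 := h1.trans_lt hr1
  have e : η = u + 1 := by rw [hu]; ring
  rw [e, add_pow, sum_range_succ', pow_zero] at h
  simp only [one_pow, mul_one, Nat.choose_zero_right, Nat.cast_one] at h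
  obtain ⟨c, hc⟩ : ∃ c, p = c + 2 := ⟨p - 2, by have := hp.1.two_le; omega⟩
  have h' : ∑ i ∈ range p, u ^ (i + 1) * (p.choose (i + 1) : K) = 0 := by linear_combination h
  have h2 : ∑ i ∈ range p, u ^ i * (p.choose (i + 1) : K) = 0 := by
    refine (mul_eq_zero.1 ?_).resolve_left hu0
    rw [mul_sum, ← h']
    exact sum_congr rfl fun i _ => by ring
  have h3 : (p : K) = -∑ i ∈ range (c + 1), u ^ (i + 1) * (p.choose (i + 2) : K) := by
    rw [show range p = range (c + 1 + 1) by rw [hc], sum_range_succ'] at h2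
    rw [zero_add, Nat.choose_one_right, pow_zero, one_mul] at h2
    linear_combination h2
  have h4 : ‖(p : K)‖ ≤ max ((p : ℝ)⁻¹ * ‖u‖) (r ^ (p - 1)) := by
    rw [h3, norm_neg]
    refine norm_sum_le_of_forall_le_of_nonneg (by positivity) fun i hi => ?_
    rw [mem_range] at hi
    rw [norm_mul, norm_pow]
    rcases eq_or_ne i c with rfl | hic
    · refine le_max_of_le_right ?_
      rw [hc, show i + 2 - 1 = i + 1 by omega, Nat.choose_self, Nat.cast_one, norm_one, mul_one]
      exact pow_le_pow_left₀ (norm_nonneg _) h1 _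
    · refine le_max_of_le_left ?_
      obtain ⟨d, hd⟩ := hp.1.dvd_choose_self (k := i + 2) (by omega) (by omega)
      rw [hd, Nat.cast_mul, norm_mul, hK, pow_succ]
      have hd1 := norm_natCast_le_one K d
      have : ‖u‖ ^ i ≤ 1 := pow_le_one₀ (norm_nonneg _) hul.le
      calc ‖u‖ ^ i * ‖u‖ * ((p : ℝ)⁻¹ * ‖(d : K)‖) ≤ 1 * ‖u‖ * ((p : ℝ)⁻¹ * 1) := by gcongr
        _ = _ := by ring
  rw [hK] at h4
  exact absurd h4 (not_le.2 (max_lt (by nlinarith) hr))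

/-- `a` is congruent to `1 + ϖ s` up to an error of size `b`. -/
def Near (ϖ : K) (b : ℝ) (a s : K) : Prop := ‖a - (1 + ϖ * s)‖ ≤ b ∧ ‖s‖ ≤ 1

lemma Near.mul {b : ℝ} (hb : ‖ϖ‖ ^ 2 ≤ b) (hb1 : b ≤ 1) (hϖ1 : ‖ϖ‖ ≤ 1) {a s a' s' : K}
    (h : Near ϖ b a s) (h' : Near ϖ b a' s') : Near ϖ b (a * a') (s + s') := by
  have hb0 : 0 ≤ b := (sq_nonneg _).trans hb
  refine ⟨?_, (norm_add_le_max _ _).trans (max_le h.2 h'.2)⟩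
  have h1 (s : K) : ‖s‖ ≤ 1 → ‖1 + ϖ * s‖ ≤ 1 := fun hs =>
    (norm_add_le_max _ _).trans (max_le (by simp) (by
      rw [norm_mul]; exact mul_le_one₀ hϖ1 (norm_nonneg _) hs))
  have ha' : ‖a'‖ ≤ 1 := by
    rw [← sub_add_cancel a' (1 + ϖ * s')]
    exact (norm_add_le_max _ _).trans (max_le (h'.1.trans hb1) (h1 _ h'.2))
  have e : a * a' - (1 + ϖ * (s + s')) = (a - (1 + ϖ * s)) * a' +
      ((1 + ϖ * s) * (a' - (1 + ϖ * s')) + ϖ ^ 2 * (s * s')) := by ring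
  rw [e]
  refine (norm_add_le_max _ _).trans (max_le ?_
    ((norm_add_le_max _ _).trans (max_le ?_ ?_)))
  · rw [norm_mul]; exact (mul_le_of_le_one_right (norm_nonneg _) ha').trans h.1
  · rw [norm_mul]; exact (mul_le_of_le_one_left (norm_nonneg _) (h1 _ h.2)).trans h'.1
  · rw [norm_mul, norm_pow, norm_mul]
    exact (mul_le_of_le_one_right (by positivity) (mul_le_one₀ h.2 (norm_nonneg _) h'.2)).trans hb

lemma Near.one {b : ℝ} (hb : 0 ≤ b) : Near ϖ b 1 0 := ⟨by simpa using hb, by simp⟩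

lemma Near.prod {ι : Type*} (t : Finset ι) {b : ℝ} (hb : ‖ϖ‖ ^ 2 ≤ b) (hb1 : b ≤ 1) (hϖ1 : ‖ϖ‖ ≤ 1)
    {a s : ι → K} (h : ∀ i ∈ t, Near ϖ b (a i) (s i)) : Near ϖ b (∏ i ∈ t, a i) (∑ i ∈ t, s i) := by
  classical
  induction t using Finset.induction_on with
  | empty => simpa using Near.one ((sq_nonneg _).trans hb)
  | insert i t hi ih =>
    rw [prod_insert hi, sum_insert hi]
    exact (h i (by simp)).mul hb hb1 hϖ1 (ih fun j hj => h j (by simp [hj]))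

lemma Near.pow {b : ℝ} (hb : ‖ϖ‖ ^ 2 ≤ b) (hb1 : b ≤ 1) (hϖ1 : ‖ϖ‖ ≤ 1) {a s : K}
    (h : Near ϖ b a s) (n : ℕ) : Near ϖ b (a ^ n) (n * s) := by
  simpa using Near.prod (range n) hb hb1 hϖ1 fun _ _ => h

namespace GoodRadius
variable (H : GoodRadius p ϖ ρ κ)
include H

lemma thetaRadius_pow_lt : thetaRadius p ^ p < ‖ϖ‖ := by
  have h1 := H.kappa_le.trans_lt H.kappa_lt
  have h0 := H.varpi_pos
  have h2 : 0 < thetaRadius p ^ p * ‖ϖ‖⁻¹ := by have := thetaRadius_pos (p := p); positivity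
  have h3 : thetaRadius p ^ p * ‖ϖ‖⁻¹ < 1 := by nlinarith [H.one_lt]
  rwa [← div_eq_mul_inv, div_lt_one h0] at h3

lemma isConv_theta : IsConv (theta p ϖ) :=
  IsConv.of_le (C := 1) thetaRadius_pos.le thetaRadius_lt_one fun n => by
    rw [one_mul]; exact norm_coeff_theta_le H.norm_p H.varpi n

lemma trace_frobIter_one (m : ℕ) {x : K} (hx : ‖x‖ ≤ 1) :
    ((frobIter hp.1.ne_zero (frobSeries p ϖ 1) m).map (ev x)).trace = psi p ϖ m x := by
  rw [Matrix.trace_fin_one]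
  induction m generalizing x with
  | zero => rw [Matrix.map_apply, frobIter, Matrix.one_apply_eq, ev_one, psi, prod_range_zero]
  | succ m ih =>
    rw [map_ev_frobIter_succ _ H.isConv_frobSeries m hx, Matrix.mul_apply, Fin.sum_univ_one,
      ih (by rw [norm_pow]; exact pow_le_one₀ (norm_nonneg _) hx), Matrix.map_apply,
      H.frobSeries_one, add_comm m, psi_add, pow_one, mul_comm]
    congr 1
    rw [psi, prod_range_one, pow_zero, pow_one]

lemma psi_pow_prime {m : ℕ} {x : K} (hx : x ^ p ^ m = x) (hx1 : ‖x‖ ≤ 1) :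
    psi p ϖ m x ^ p = 1 := by
  set E : K⟦X⟧ := PowerSeries.mk fun n => (p * ϖ) ^ n / n.factorial with hE
  have hp0 : (0 : ℝ) ≤ (p : ℝ)⁻¹ := by positivity
  have hp1 : (p : ℝ)⁻¹ < 1 := inv_lt_one_of_one_lt₀ (by exact_mod_cast hp.1.one_lt)
  have hEn n : ‖coeff n E‖ ≤ (p : ℝ)⁻¹ ^ n := by
    rw [hE, coeff_mk, norm_div, norm_pow, norm_mul, H.norm_p, mul_pow]
    exact div_le_of_le_mul₀ (norm_nonneg _) (by positivity)
      (mul_le_mul_of_nonneg_left (norm_varpi_pow_le_factorial H.norm_p H.varpi n) (by positivity))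
  have hEc : IsConv E := IsConv.of_le (C := 1) hp0 hp1 fun n => by rw [one_mul]; exact hEn n
  have hne (y : K) : ‖y‖ ≤ 1 → ev y E ≠ 0 := by
    intro hy h0
    have h1 := (hEc.hasSum hy)
    have h2 := (hasSum_nat_add_iff' 1).2 h1
    have h3 := norm_hasSum_le h2 hp0 fun n => by
      rw [norm_mul, norm_pow]
      refine (mul_le_of_le_one_right (norm_nonneg _) (pow_le_one₀ (norm_nonneg _) hy)).trans
        ((hEn _).trans ?_)
      exact (pow_le_pow_of_le_one hp0 hp1.le (Nat.le_add_left 1 n)).trans (pow_one _).le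
    rw [h0] at h3
    simp [hE] at h3
    have := inv_lt_one_of_one_lt₀ (show (1 : ℝ) < p by exact_mod_cast hp.1.one_lt)
    linarith
  have hstep (y : K) : ‖y‖ ≤ 1 → ev y (theta p ϖ) ^ p * ev (y ^ p) E = ev y E := by
    intro hy
    have h := congrArg (ev y) (theta_pow_mul_expand (p := p) H.varpi)
    have hc : IsConv (theta p ϖ ^ p) := by
      have := IsConv.prod (range p) (f := fun _ => theta p ϖ) fun _ _ => H.isConv_theta
      simpa using this
    have hpw : ev y (theta p ϖ ^ p) = ev y (theta p ϖ) ^ p := by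
      have := ev_prod (range p) hy (f := fun _ => theta p ϖ) fun _ _ => H.isConv_theta
      simpa using this
    rwa [ev_mul hy hc (hEc.expand hp.1.ne_zero), ev_expand, hpw] at h
  have htel n : psi p ϖ n x ^ p * ev (x ^ p ^ n) E = ev x E := by
    induction n with
    | zero => simp [psi]
    | succ n ih =>
      have h1 := hstep (x ^ p ^ n) (by rw [norm_pow]; exact pow_le_one₀ (norm_nonneg _) hx1)
      rw [← pow_mul, ← pow_succ] at h1
      rw [psi, prod_range_succ, mul_pow, mul_assoc, h1]
      exact ih
  have h := htel m
  rw [hx] at h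
  exact mul_right_cancel₀ (hne x hx1) (h.trans (one_mul _).symm)

lemma psi_neg (hp2 : p ≠ 2) (m : ℕ) {x : K} (hx : ‖x‖ ≤ 1) : psi p ϖ m x * psi p ϖ m (-x) = 1 := by
  rw [psi, psi, ← prod_mul_distrib]
  refine prod_eq_one fun i _ => ?_
  have hy : ‖x ^ p ^ i‖ ≤ 1 := by rw [norm_pow]; exact pow_le_one₀ (norm_nonneg _) hx
  rw [((hp.1.odd_of_ne_two hp2).pow).neg_pow, ev_neg, ← ev_mul hy H.isConv_theta,
    theta_mul_rescale hp2, ev_one]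
  simpa [IsConv, coeff_rescale] using H.isConv_theta

lemma exists_near : ∃ b : ℝ, ‖ϖ‖ ^ 2 ≤ b ∧ b < ‖ϖ‖ ∧ ∀ (m : ℕ) {x : K}, ‖x‖ ≤ 1 →
    Near ϖ b (psi p ϖ m x) (∑ i ∈ range m, x ^ p ^ i) := by
  have h0 := H.varpi_pos
  have h1 := norm_varpi_lt_one H.norm_p H.varpi
  have hlt : max (‖ϖ‖ ^ 2) (thetaRadius p ^ p) < ‖ϖ‖ := max_lt (by nlinarith) H.thetaRadius_pow_lt
  refine ⟨max (‖ϖ‖ ^ 2) (thetaRadius p ^ p), le_max_left _ _, hlt, fun m x hx => ?_⟩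
  refine Near.prod _ (le_max_left _ _) (hlt.le.trans h1.le) h1.le fun i _ => ?_
  have hy : ‖x ^ p ^ i‖ ≤ 1 := by rw [norm_pow]; exact pow_le_one₀ (norm_nonneg _) hx
  refine ⟨?_, hy⟩
  have h2 := (hasSum_nat_add_iff' 2).2 (H.isConv_theta.hasSum hy)
  have hp1 := hp.1.one_lt
  rw [sum_range_succ, sum_range_one, coeff_theta_of_lt (by omega), coeff_theta_of_lt hp1] at h2
  simp only [pow_zero, Nat.factorial, Nat.cast_one, mul_one, div_one, pow_one] at h2
  refine norm_hasSum_le h2 (by positivity) fun n => ?_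
  rw [norm_mul, norm_pow]
  refine (mul_le_of_le_one_right (norm_nonneg _) (pow_le_one₀ (norm_nonneg _) hy)).trans ?_
  rcases lt_or_ge (n + 2) p with hn | hn
  · refine le_max_of_le_left ?_
    rw [coeff_theta_of_lt hn, norm_div, norm_natCast_of_not_dvd H.norm_p, div_one, norm_pow]
    · exact pow_le_pow_of_le_one h0.le h1.le (by omega)
    · rw [hp.1.dvd_factorial]; omega
  · exact le_max_of_le_right ((norm_coeff_theta_le H.norm_p H.varpi _).trans
      (pow_le_pow_of_le_one thetaRadius_pos.le thetaRadius_lt_one.le hn))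

lemma eq_of_near {b : ℝ} (hb1 : b < ‖ϖ‖) {a s a' s' : K} (h : Near ϖ b a s)
    (h' : Near ϖ b a' s') (hs : ‖s - s'‖ < 1) (ha : a ^ p = 1) (ha' : a' ^ p = 1) : a = a' := by
  have h0 := H.varpi_pos
  have hn : ‖a'‖ = 1 := by
    have := congrArg norm ha'
    rw [norm_pow, norm_one] at this
    exact (pow_eq_one_iff_of_nonneg (norm_nonneg _) hp.1.ne_zero).1 this
  have hne : a' ≠ 0 := norm_pos_iff.1 (by rw [hn]; exact one_pos)
  set r := max b (‖ϖ‖ * ‖s - s'‖)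
  have hr : r < ‖ϖ‖ := max_lt hb1 (mul_lt_of_lt_one_right h0 hs)
  have hr0 : 0 ≤ r := le_max_of_le_right (by positivity)
  have hd : ‖a - a'‖ ≤ r := by
    have e : a - a' = (a - (1 + ϖ * s)) + (-(a' - (1 + ϖ * s')) + ϖ * (s - s')) := by ring
    rw [e]
    refine (norm_add_le_max _ _).trans (max_le (le_max_of_le_left h.1)
      ((norm_add_le_max _ _).trans (max_le (le_max_of_le_left ?_)
        (le_max_of_le_right (norm_mul _ _).le))))
    rw [norm_neg]; exact h'.1
  have := eq_one_of_pow_prime (η := a / a') H.norm_p (r := r) (by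
    rw [← norm_pow_sub_one H.norm_p H.varpi]
    exact pow_lt_pow_left₀ hr hr0 (by have := hp.1.two_le; omega)) (by rw [div_pow, ha, ha', div_one]) (by
    rw [div_sub_one hne, norm_div, hn, div_one]; exact hd)
  rwa [div_eq_one_iff_eq hne] at this

lemma psi_mul_of_near {m : ℕ} {x c : K} {n : ℕ} (hx : x ^ p ^ m = x) (hx1 : ‖x‖ ≤ 1)
    (hc : c ^ p = c) (hc1 : ‖c‖ ≤ 1) (hcn : ‖c - n‖ < 1) : psi p ϖ m (c * x) = psi p ϖ m x ^ n := by
  obtain ⟨b, hb, hb1, hN⟩ := H.exists_near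
  have hϖ1 := (norm_varpi_lt_one H.norm_p H.varpi).le
  have hci i : c ^ p ^ i = c := by
    induction i with
    | zero => simp
    | succ i ih => rw [pow_succ, pow_mul, ih, hc]
  have hcx : ‖c * x‖ ≤ 1 := by rw [norm_mul]; exact mul_le_one₀ hc1 (norm_nonneg _) hx1
  refine H.eq_of_near hb1 (hN m hcx) ((hN m hx1).pow hb (hb1.le.trans hϖ1) hϖ1 n) ?_
    (H.psi_pow_prime (by rw [mul_pow, hci, hx]) hcx) (by
      rw [← pow_mul, mul_comm, pow_mul, H.psi_pow_prime hx hx1, one_pow])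
  simp only [mul_pow, hci, ← mul_sum, ← sub_mul]
  rw [norm_mul]
  exact lt_of_le_of_lt (mul_le_of_le_one_right (norm_nonneg _) (hN m hx1).2) hcn

lemma psi_one_one_ne : psi p ϖ 1 1 ≠ 1 := by
  obtain ⟨b, hb, hb1, hN⟩ := H.exists_near
  intro h
  have h2 := (hN 1 (x := 1) (by simp)).1
  rw [h] at h2
  simp at h2
  linarith

end GoodRadius

lemma exists_teichmuller [IsAlgClosed K] (hK : ‖(p : K)‖ = (p : ℝ)⁻¹) {n : ℕ} (hn : ¬ p ∣ n) :
    ∃ c : K, c ^ (p - 1) = 1 ∧ ‖c - n‖ < 1 := by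
  have hp1 : 0 < p - 1 := by have := hp.1.two_le; omega
  have : NeZero ((p - 1 : ℕ) : K) := ⟨by exact_mod_cast hp1.ne'⟩
  obtain ⟨ζ, hζ⟩ := HasEnoughRootsOfUnity.exists_primitiveRoot K (p - 1)
  have h := congrArg (Polynomial.eval (n : K)) (Polynomial.X_pow_sub_one_eq_prod hp1 hζ)
  rw [Polynomial.eval_prod] at h
  simp only [Polynomial.eval_sub, Polynomial.eval_pow, Polynomial.eval_X, Polynomial.eval_one,
    Polynomial.eval_C] at h
  have hn1 : 1 ≤ n ^ (p - 1) := Nat.one_le_pow _ _ (Nat.pos_of_ne_zero fun h0 => hn (by simp [h0]))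
  have h1 : ‖(n : K) ^ (p - 1) - 1‖ < 1 := by
    have hd : p ∣ n ^ (p - 1) - 1 := by
      have := ZMod.pow_card_sub_one_eq_one (p := p) (a := (n : ZMod p)) (by
        rwa [Ne, ZMod.natCast_eq_zero_iff])
      rw [← ZMod.natCast_eq_zero_iff, Nat.cast_sub hn1]
      simp [this]
    obtain ⟨d, hd⟩ := hd
    have e : (n : K) ^ (p - 1) - 1 = p * d := by
      rw [← Nat.cast_mul, ← hd, Nat.cast_sub hn1]
      simp
    rw [e, norm_mul, hK]
    have hp1 : (p : ℝ)⁻¹ < 1 := inv_lt_one_of_one_lt₀ (by exact_mod_cast hp.1.one_lt)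
    exact lt_of_le_of_lt (mul_le_of_le_one_right (by positivity) (norm_natCast_le_one K d)) hp1
  rw [h, norm_prod] at h1
  by_contra! hcon
  refine absurd h1 (not_lt.2 (Finset.one_le_prod fun c hc => ?_))
  rw [norm_sub_rev]
  exact hcon c ((Polynomial.mem_nthRootsFinset hp1 _).1 hc)

end Psi

section Fredholm
open Filter Topology
variable {K : Type*} [NormedField K] [IsUltrametricDist K] {C q : ℝ}
  {A : (ℕ →₀ K) →ₗ[K] (ℕ →₀ K)}

/-- The rows of the matrix of `A` decay geometrically. -/
structure RowDecay (A : (ℕ →₀ K) →ₗ[K] (ℕ →₀ K)) (C q : ℝ) : Prop where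
  one_le : 1 ≤ C
  pos : 0 < q
  lt_one : q < 1
  le : ∀ i j, ‖A (Finsupp.single i 1) j‖ ≤ C * q ^ i

lemma exists_finsupp_range (x : ℕ →₀ K) (N : ℕ) : ∃ M, N ≤ M ∧ x.support ⊆ range M := by
  refine ⟨max N (x.support.sup id + 1), le_max_left _ _, fun i hi => mem_range.2 ?_⟩
  have : i ≤ x.support.sup id := Finset.le_sup (f := id) hi
  exact lt_of_lt_of_le (Nat.lt_succ_of_le this) (le_max_right _ _)

lemma linearMap_finsupp_apply {W : Type*} [AddCommGroup W] [Module K W] (f : (ℕ →₀ K) →ₗ[K] W)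
    (x : ℕ →₀ K) {M : ℕ} (hM : x.support ⊆ range M) :
    f x = ∑ i ∈ range M, x i • f (Finsupp.single i 1) := by
  conv_lhs => rw [← Finsupp.sum_single x]
  rw [Finsupp.sum_of_support_subset _ hM _ (by simp), map_sum]
  refine Finset.sum_congr rfl fun i _ => ?_
  rw [← map_smul, Finsupp.smul_single, smul_eq_mul, mul_one]

lemma linearMap_finsupp_apply_apply (A : (ℕ →₀ K) →ₗ[K] (ℕ →₀ K)) (x : ℕ →₀ K) {M : ℕ}
    (hM : x.support ⊆ range M) (j : ℕ) :
    A x j = ∑ i ∈ range M, x i * A (Finsupp.single i 1) j := by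
  rw [linearMap_finsupp_apply A x hM, Finsupp.finsetSum_apply]
  simp

lemma RowDecay.norm_apply_le (hA : RowDecay A C q) {x : ℕ →₀ K} {B : ℝ}
    (hx : ∀ i, ‖x i‖ * q ^ i ≤ B) (j : ℕ) : ‖A x j‖ ≤ C * B := by
  have hB : 0 ≤ B := le_trans (by simp) (hx 0)
  have hC := hA.one_le
  obtain ⟨M, -, hM⟩ := exists_finsupp_range x 0
  rw [linearMap_finsupp_apply_apply A x hM]
  refine norm_sum_le_of_forall_le_of_nonneg (by positivity) fun i _ => ?_
  rw [norm_mul]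
  have hq := hA.pos
  calc ‖x i‖ * ‖A (Finsupp.single i 1) j‖ ≤ ‖x i‖ * (C * q ^ i) := by gcongr; exact hA.le i j
    _ = C * (‖x i‖ * q ^ i) := by ring
    _ ≤ C * B := by gcongr; exact hx i

lemma RowDecay.norm_apply_le' (hA : RowDecay A C q) {x : ℕ →₀ K} {B : ℝ}
    (hx : ∀ i, ‖x i‖ ≤ B) (j : ℕ) : ‖A x j‖ ≤ C * B :=
  hA.norm_apply_le (fun i => (mul_le_of_le_one_right (norm_nonneg _)
    (pow_le_one₀ hA.pos.le hA.lt_one.le)).trans (hx i)) j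

lemma RowDecay.pow_apply_le (hA : RowDecay A C q) {x : ℕ →₀ K} {B : ℝ}
    (hx : ∀ i, ‖x i‖ ≤ B) (m j : ℕ) : ‖(A ^ m) x j‖ ≤ C ^ m * B := by
  induction m generalizing j with
  | zero => simpa using hx j
  | succ m ih =>
    rw [pow_succ', Module.End.mul_apply, pow_succ', mul_assoc]
    exact hA.norm_apply_le' ih j

lemma RowDecay.pow (hA : RowDecay A C q) {m : ℕ} (hm : m ≠ 0) : RowDecay (A ^ m) (C ^ m) q := by
  obtain ⟨m, rfl⟩ := Nat.exists_eq_succ_of_ne_zero hm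
  refine ⟨one_le_pow₀ hA.one_le, hA.pos, hA.lt_one, fun i j => ?_⟩
  rw [pow_succ, Module.End.mul_apply, pow_succ, mul_assoc]
  exact hA.pow_apply_le (hA.le i) m j

/-- The `N × N` truncation of the matrix of `A`. -/
noncomputable def truncMat (A : (ℕ →₀ K) →ₗ[K] (ℕ →₀ K)) (N : ℕ) : Matrix (Fin N) (Fin N) K :=
  Matrix.of fun i j => A (Finsupp.single (i : ℕ) 1) j

lemma RowDecay.norm_truncMat_pow_sub_le (hA : RowDecay A C q) (N m : ℕ) (i j : Fin N) :
    ‖(truncMat A N ^ m) i j - (A ^ m) (Finsupp.single (i : ℕ) 1) j‖ ≤ C ^ m * q ^ N := by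
  have hC := hA.one_le
  have hq := hA.pos
  induction m generalizing j with
  | zero =>
    have : (truncMat A N ^ 0) i j - (A ^ 0) (Finsupp.single (i : ℕ) 1) j = 0 := by
      simp [Matrix.one_apply, Finsupp.single_apply, Fin.ext_iff]
    rw [this, norm_zero]; positivity
  | succ m ih =>
    set y := (A ^ m) (Finsupp.single (i : ℕ) 1) with hy
    obtain ⟨M, hNM, hM⟩ := exists_finsupp_range y N
    have h1 : (A ^ (m + 1)) (Finsupp.single (i : ℕ) 1) j =
        ∑ l ∈ range N, y l * A (Finsupp.single l 1) j +
        ∑ l ∈ Ico N M, y l * A (Finsupp.single l 1) j := by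
      rw [pow_succ', Module.End.mul_apply, linearMap_finsupp_apply_apply A _ hM,
        Finset.sum_range_add_sum_Ico _ hNM]
    have h2 : (truncMat A N ^ (m + 1)) i j - (A ^ (m + 1)) (Finsupp.single (i : ℕ) 1) j =
        ∑ l : Fin N, ((truncMat A N ^ m) i l - y l) * A (Finsupp.single (l : ℕ) 1) j -
        ∑ l ∈ Ico N M, y l * A (Finsupp.single l 1) j := by
      rw [h1, Finset.sum_range, pow_succ, Matrix.mul_apply, ← sub_sub, ← Finset.sum_sub_distrib]
      congr 1
      refine Finset.sum_congr rfl fun l _ => ?_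
      simp only [truncMat, Matrix.of_apply]; ring
    rw [h2, sub_eq_add_neg]
    refine (norm_add_le_max _ _).trans (max_le ?_ ?_)
    · refine norm_sum_le_of_forall_le_of_nonneg (by positivity) fun l _ => ?_
      rw [norm_mul, pow_succ, mul_right_comm]
      refine mul_le_mul (ih l) ((hA.le _ _).trans ?_) (norm_nonneg _) (by positivity)
      exact mul_le_of_le_one_right (by positivity) (pow_le_one₀ hq.le hA.lt_one.le)
    · rw [norm_neg]
      refine norm_sum_le_of_forall_le_of_nonneg (by positivity) fun l hl => ?_
      rw [norm_mul, pow_succ, mul_assoc]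
      refine mul_le_mul ?_ ((hA.le _ _).trans ?_) (norm_nonneg _) (by positivity)
      · have := hA.pow_apply_le (x := Finsupp.single (i : ℕ) 1) (B := 1) (fun l => ?_) m l
        · simpa using this
        · rw [Finsupp.single_apply]; split_ifs <;> simp
      · have := pow_le_pow_of_le_one hq.le hA.lt_one.le (mem_Ico.1 hl).1
        gcongr

/-- The trace of an operator on finitely supported sequences. -/
noncomputable def opTrace (A : (ℕ →₀ K) →ₗ[K] (ℕ →₀ K)) : K := ∑' i, A (Finsupp.single i 1) i

variable [CompleteSpace K]

lemma RowDecay.hasSum_opTrace (hA : RowDecay A C q) :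
    HasSum (fun i => A (Finsupp.single i 1) i) (opTrace A) := by
  apply Summable.hasSum
  refine Summable.of_norm_bounded (g := fun i => C * q ^ i)
    ((summable_geometric_of_lt_one hA.pos.le hA.lt_one).mul_left C) fun i => hA.le i i

lemma RowDecay.tendsto_trace (hA : RowDecay A C q) {m : ℕ} (hm : m ≠ 0) :
    Tendsto (fun N => (truncMat A N ^ m).trace) atTop (𝓝 (opTrace (A ^ m))) := by
  have h1 := (hA.pow hm).hasSum_opTrace.tendsto_sum_nat
  have h2 : Tendsto (fun N => (truncMat A N ^ m).trace -
      ∑ i ∈ range N, (A ^ m) (Finsupp.single i 1) i) atTop (𝓝 0) := by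
    refine squeeze_zero_norm (a := fun N => C ^ m * q ^ N) (fun N => ?_) ?_
    · rw [Finset.sum_range, Matrix.trace, ← Finset.sum_sub_distrib]
      have hC := hA.one_le
      have hq := hA.pos
      exact norm_sum_le_of_forall_le_of_nonneg (by positivity)
        fun i _ => hA.norm_truncMat_pow_sub_le N m i i
    · simpa using (tendsto_pow_atTop_nhds_zero_of_lt_one hA.pos.le hA.lt_one).const_mul (C ^ m)
  simpa using h2.add h1

end Fredholm

section FredholmDet
open Filter Topology Polynomial
variable {K : Type*} [NormedField K] [IsUltrametricDist K] {C q r : ℝ}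
  {A : (ℕ →₀ K) →ₗ[K] (ℕ →₀ K)}

lemma gBound_det {n : ℕ} (hr : 0 < r) (M : Matrix (Fin n) (Fin n) K[X]) (β : Fin n → ℝ)
    (h : ∀ i j, GBound r (β i) (M i j)) : GBound r (∏ i, β i) M.det := by
  rw [Matrix.det_apply]
  refine GBound.sum hr.le (Finset.prod_nonneg fun i _ => (h i i).nonneg) _ _ fun σ _ => ?_
  have : GBound r (∏ i, β i) (∏ i, M (σ i) i) := by
    rw [← Equiv.prod_comp σ β]
    exact GBound.prod hr _ _ _ fun i _ => h _ _
  rcases Int.units_eq_one_or (Equiv.Perm.sign σ) with h | h <;> rw [h]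
  · simpa using this
  · simpa using this.neg

/-- The Gauss norm bound at radius `r` for the characteristic series of an operator with
row decay. -/
noncomputable def detBound (C q r : ℝ) (N : ℕ) : ℝ := ∏ i ∈ range N, max 1 (r * (C * q ^ i))

lemma one_le_detBound (C q r : ℝ) (N : ℕ) : 1 ≤ detBound C q r N :=
  Finset.one_le_prod fun _ _ => le_max_left _ _

lemma detBound_le_max (hA : RowDecay A C q) (hr : 0 < r) :
    ∃ B, 1 ≤ B ∧ ∀ N, detBound C q r N ≤ B := by
  have hC := hA.one_le
  have hq := hA.pos
  obtain ⟨N₀, hN₀⟩ := exists_pow_lt_of_lt_one (x := (r * C)⁻¹) (by positivity) hA.lt_one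
  refine ⟨detBound C q r N₀, one_le_detBound _ _ _ _, fun N => ?_⟩
  have key n : detBound C q r (N₀ + n) = detBound C q r N₀ := by
    induction n with
    | zero => rfl
    | succ n ih =>
      rw [← add_assoc, detBound, Finset.prod_range_succ, ← detBound, ih, max_eq_left, mul_one]
      have : q ^ (N₀ + n) ≤ q ^ N₀ := pow_le_pow_of_le_one hq.le hA.lt_one.le (by omega)
      calc r * (C * q ^ (N₀ + n)) = r * C * q ^ (N₀ + n) := by ring
        _ ≤ r * C * (r * C)⁻¹ := by gcongr; exact this.trans hN₀.le
        _ = 1 := by field_simp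
  rw [← key N]
  have mono : Monotone (detBound C q r) := by
    refine monotone_nat_of_le_succ fun n => ?_
    rw [detBound, detBound, Finset.prod_range_succ]
    exact le_mul_of_one_le_right (zero_le_one.trans (one_le_detBound C q r n)) (le_max_left _ _)
  exact mono (by omega)

lemma RowDecay.gBound_entry (hA : RowDecay A C q) (hr : 0 < r) (N : ℕ) (i j : Fin N) :
    GBound r (max 1 (r * (C * q ^ (i : ℕ))))
      ((1 - (X : K[X]) • (truncMat A N).map Polynomial.C) i j) := by
  have e : (1 - (X : K[X]) • (truncMat A N).map Polynomial.C) i j =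
      Polynomial.C (if i = j then 1 else 0) - Polynomial.C (truncMat A N i j) * X := by
    simp only [Matrix.sub_apply, Matrix.one_apply, Matrix.smul_apply, Matrix.map_apply,
      smul_eq_mul, mul_comm X]
    split_ifs <;> simp
  rw [e]
  refine GBound.sub hr.le ((GBound.C _).mono ?_) ?_
  · refine le_trans ?_ (le_max_left _ _)
    split_ifs <;> simp
  · rcases GBound.X (ρ := r) (K := K) with h | h
    · refine (GBound.C_mul hr _ h).mono (le_trans ?_ (le_max_right _ _))
      rw [mul_comm]
      gcongr
      exact hA.le _ _
    · exact absurd hr h.not_gt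

lemma RowDecay.gBound_charpolyRev (hA : RowDecay A C q) (hr : 0 < r) (N : ℕ) :
    GBound r (detBound C q r N) (truncMat A N).charpolyRev := by
  rw [Matrix.charpolyRev, detBound, Finset.prod_range]
  exact gBound_det hr _ _ fun i j => hA.gBound_entry hr N i j

lemma RowDecay.gBound_charpolyRev_succ_sub (hA : RowDecay A C q) (hr : 0 < r) (N : ℕ) :
    GBound r (detBound C q r N * (r * (C * q ^ N)))
      ((truncMat A (N + 1)).charpolyRev - (truncMat A N).charpolyRev) := by
  set M := 1 - (X : K[X]) • (truncMat A (N + 1)).map Polynomial.C with hM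
  set u : Fin (N + 1) → K[X] := fun j => if j = Fin.last N then 1 else 0 with hu
  set w : Fin (N + 1) → K[X] := fun j => - (Polynomial.C (truncMat A (N + 1) (Fin.last N) j) * X)
    with hw
  have e1 : M = M.updateRow (Fin.last N) (u + w) := by
    rw [show u + w = M (Fin.last N) from ?_, Matrix.updateRow_eq_self]
    ext1 j
    simp only [hM, hu, hw, Pi.add_apply, Matrix.sub_apply, Matrix.one_apply, Matrix.smul_apply,
      Matrix.map_apply, smul_eq_mul, mul_comm X, eq_comm (a := j)]
    exact (sub_eq_add_neg _ _).symm
  have e2 : (M.updateRow (Fin.last N) u).det = (truncMat A N).charpolyRev := by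
    rw [Matrix.det_succ_row _ (Fin.last N), Finset.sum_eq_single (Fin.last N)]
    · rw [Matrix.charpolyRev]
      simp only [Matrix.updateRow_self, hu, if_true, mul_one]
      rw [Even.neg_one_pow ⟨_, rfl⟩, one_mul]
      congr 1
      ext1 i j
      simp [hM, truncMat, Matrix.one_apply]
    · intro j _ hj
      simp [hu, hj]
    · simp
  have e3 : (truncMat A (N + 1)).charpolyRev - (truncMat A N).charpolyRev =
      (M.updateRow (Fin.last N) w).det := by
    rw [Matrix.charpolyRev, ← hM, e1, Matrix.det_updateRow_add, e2]
    simp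
  rw [e3]
  have hC := hA.one_le
  have hq := hA.pos
  have := gBound_det (r := r) hr (M.updateRow (Fin.last N) w)
    (fun i => if i = Fin.last N then r * (C * q ^ N) else max 1 (r * (C * q ^ (i : ℕ))))
    (fun i j => ?_)
  · refine this.mono (le_of_eq ?_)
    rw [Fin.prod_univ_castSucc, detBound, Finset.prod_range]
    simp [(Fin.castSucc_lt_last _).ne]
  · split_ifs with h
    · subst h
      rw [Matrix.updateRow_self]
      apply GBound.neg
      rcases GBound.X (ρ := r) (K := K) with h | h
      · refine (GBound.C_mul hr _ h).mono ?_
        rw [mul_comm]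
        gcongr
        exact hA.le (Fin.last N : Fin (N + 1)) j
      · exact absurd hr h.not_gt
    · rw [Matrix.updateRow_ne h]
      exact hA.gBound_entry hr (N + 1) i j

variable [CompleteSpace K]

lemma RowDecay.exists_tendsto_coeff (hA : RowDecay A C q) (n : ℕ) :
    ∃ a, Tendsto (fun N => (truncMat A N).charpolyRev.coeff n) atTop (𝓝 a) := by
  obtain ⟨B, hB1, hB⟩ := detBound_le_max hA one_pos
  have hC := hA.one_le
  have hq := hA.pos
  apply cauchySeq_tendsto_of_complete
  refine cauchySeq_of_le_geometric q (B * C) hA.lt_one fun N => ?_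
  rw [dist_comm, dist_eq_norm, ← Polynomial.coeff_sub]
  have := hA.gBound_charpolyRev_succ_sub one_pos N n
  rw [one_pow, mul_one, one_mul] at this
  refine this.trans ?_
  rw [← mul_assoc]
  gcongr
  exact hB N

/-- The Fredholm determinant `det(1 - TA)` as a power series. -/
noncomputable def fredholm (A : (ℕ →₀ K) →ₗ[K] (ℕ →₀ K)) : PowerSeries K :=
  PowerSeries.mk fun n => limUnder atTop fun N => (truncMat A N).charpolyRev.coeff n

lemma RowDecay.tendsto_coeff (hA : RowDecay A C q) (n : ℕ) :
    Tendsto (fun N => (truncMat A N).charpolyRev.coeff n) atTop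
      (𝓝 (PowerSeries.coeff n (fredholm A))) := by
  rw [fredholm, PowerSeries.coeff_mk]
  exact tendsto_nhds_limUnder (hA.exists_tendsto_coeff n)

lemma RowDecay.isZeta_fredholm (hA : RowDecay A C q) :
    IsZeta (fredholm A) (-tailSeries fun m => opTrace (A ^ m)) := by
  refine ⟨?_, ?_⟩
  · rw [← PowerSeries.coeff_zero_eq_constantCoeff_apply]
    refine tendsto_nhds_unique (hA.tendsto_coeff 0) ?_
    simp only [Polynomial.coeff_zero_eq_eval_zero, Matrix.eval_charpolyRev]
    exact tendsto_const_nhds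
  · ext n
    rw [coeff_X_mul_derivative, PowerSeries.coeff_mul]
    refine tendsto_nhds_unique ((hA.tendsto_coeff n).const_mul (n : K)) ?_
    have h1 N : (n : K) * (truncMat A N).charpolyRev.coeff n =
        ∑ x ∈ antidiagonal n, PowerSeries.coeff x.1 (-tailSeries fun m => (truncMat A N ^ m).trace)
          * (truncMat A N).charpolyRev.coeff x.2 := by
      have := (isZeta_charpolyRev (truncMat A N)).coeff_rec n
      simpa using this
    simp only [h1]
    refine tendsto_finsetSum _ fun x _ => Tendsto.mul ?_ (hA.tendsto_coeff _)
    simp only [map_neg]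
    refine Tendsto.neg ?_
    rcases eq_or_ne x.1 0 with h | h
    · simp [h, coeff_tailSeries_zero]
    · simp only [coeff_tailSeries _ h]
      exact hA.tendsto_trace h

lemma RowDecay.exists_coeff_fredholm_le (hA : RowDecay A C q) (hr : 0 < r) :
    ∃ B, 1 ≤ B ∧ (∀ N, detBound C q r N ≤ B) ∧
      ∀ n, ‖PowerSeries.coeff n (fredholm A)‖ * r ^ n ≤ B := by
  obtain ⟨B, hB1, hB⟩ := detBound_le_max hA hr
  refine ⟨B, hB1, hB, fun n => ?_⟩
  refine le_of_tendsto ((hA.tendsto_coeff n).norm.mul_const (r ^ n)) (Eventually.of_forall fun N => ?_)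
  exact (hA.gBound_charpolyRev hr N n).trans (hB N)

end FredholmDet

section GaussDivision
open PowerSeries
variable {K : Type*} [NormedField K] [IsUltrametricDist K] {ρ B : ℝ}

/-- `f` converges and is bounded on the closed disc of radius `ρ`. -/
def DiscBounded (ρ : ℝ) (f : K⟦X⟧) : Prop := ∃ B, ∀ n, ‖coeff n f‖ * ρ ^ n ≤ B

lemma DiscBounded.one_sub_mul (hρ : 0 < ρ) {h : K⟦X⟧} (hh : DiscBounded ρ h) (a : K) :
    DiscBounded ρ ((1 - C a * X) * h) := by
  obtain ⟨B, hB⟩ := hh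
  have hB0 : 0 ≤ B := le_trans (by positivity) (hB 0)
  refine ⟨B + ‖a‖ * ρ * B, fun n => ?_⟩
  cases n with
  | zero => simpa using (hB 0).trans (le_add_of_nonneg_right (by positivity))
  | succ n =>
    rw [sub_mul, one_mul, map_sub, mul_assoc, coeff_C_mul, coeff_succ_X_mul]
    have h1 := hB (n + 1)
    calc ‖coeff (n + 1) h - a * coeff n h‖ * ρ ^ (n + 1)
        ≤ (‖coeff (n + 1) h‖ + ‖a‖ * ‖coeff n h‖) * ρ ^ (n + 1) := by
          gcongr; exact (norm_sub_le _ _).trans (by rw [norm_mul])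
      _ = ‖coeff (n + 1) h‖ * ρ ^ (n + 1) + ‖a‖ * ρ * (‖coeff n h‖ * ρ ^ n) := by ring
      _ ≤ _ := by gcongr; exact hB n

lemma norm_coeff_le_half (hρ : 0 < ρ) {h : K⟦X⟧} (hh : DiscBounded ρ h) {a : K} (ha : 2 ≤ ‖a‖ * ρ)
    (hf : ∀ n, ‖coeff n ((1 - C a * X) * h)‖ * ρ ^ n ≤ B) (n : ℕ) :
    ‖coeff n h‖ * ρ ^ n ≤ B / 2 := by
  obtain ⟨B', hB'⟩ := hh
  have step M : (∀ n, ‖coeff n h‖ * ρ ^ n ≤ M) → ∀ n, ‖coeff n h‖ * ρ ^ n ≤ max M B / 2 := by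
    intro hM n
    have e : a * coeff n h = coeff (n + 1) h + -coeff (n + 1) ((1 - C a * X) * h) := by
      rw [sub_mul, one_mul, map_sub, mul_assoc, coeff_C_mul, coeff_succ_X_mul]; ring
    have h1 : ‖a * coeff n h‖ * ρ ^ (n + 1) ≤ max M B := by
      rw [e]
      rcases le_max_iff.1 (norm_add_le_max (coeff (n + 1) h)
        (-coeff (n + 1) ((1 - C a * X) * h))) with h | h
      · exact (mul_le_mul_of_nonneg_right h (by positivity)).trans
          ((hM _).trans (le_max_left _ _))
      · rw [norm_neg] at h
        exact (mul_le_mul_of_nonneg_right h (by positivity)).trans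
          ((hf _).trans (le_max_right _ _))
    rw [norm_mul, pow_succ] at h1
    have h2 : 0 ≤ ‖coeff n h‖ * ρ ^ n := by positivity
    nlinarith
  have hB0 : 0 ≤ B := le_trans (by positivity) (hf 0)
  have hB'0 : 0 ≤ B' := le_trans (by positivity) (hB' 0)
  have iter (k : ℕ) : ∀ n, ‖coeff n h‖ * ρ ^ n ≤ max (B' / 2 ^ k) (B / 2) := by
    induction k with
    | zero => intro n; exact (hB' n).trans (by simp)
    | succ k ih =>
      intro n
      refine (step _ ih n).trans ?_
      rw [pow_succ]
      rcases le_total (max (B' / 2 ^ k) (B / 2)) B with h | h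
      · rw [max_eq_right h]; exact le_max_right _ _
      · rw [max_eq_left h]
        rcases max_choice (B' / 2 ^ k) (B / 2) with h' | h'
        · rw [h', div_div]; exact le_max_left _ _
        · rw [h']; exact le_trans (by linarith) (le_max_right _ _)
  have lim : Filter.Tendsto (fun k : ℕ => max (B' / 2 ^ k) (B / 2)) Filter.atTop
      (nhds (max 0 (B / 2))) := by
    refine Filter.Tendsto.max ?_ tendsto_const_nhds
    have := (tendsto_pow_atTop_nhds_zero_of_lt_one (r := (1 / 2 : ℝ)) (by norm_num)
      (by norm_num)).const_mul B'
    simpa [div_eq_mul_inv] using this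
  rw [max_eq_right (by positivity)] at lim
  exact ge_of_tendsto' lim fun k => iter k n

lemma DiscBounded.prod (hρ : 0 < ρ) {h : K⟦X⟧} (hh : DiscBounded ρ h) (s : Multiset K) :
    DiscBounded ρ ((s.map fun a => 1 - C a * X).prod * h) := by
  induction s using Multiset.induction_on with
  | empty => simpa using hh
  | cons a s ih => rw [Multiset.map_cons, Multiset.prod_cons, mul_assoc]; exact ih.one_sub_mul hρ a

lemma two_pow_card_le (hρ : 0 < ρ) {h : K⟦X⟧} (hh : DiscBounded ρ h) (h0 : coeff 0 h = 1)
    (s : Multiset K) (hs : ∀ a ∈ s, 2 ≤ ‖a‖ * ρ)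
    (hf : ∀ n, ‖coeff n ((s.map fun a => 1 - C a * X).prod * h)‖ * ρ ^ n ≤ B) :
    2 ^ s.card ≤ B := by
  have key : ∀ n, ‖coeff n h‖ * ρ ^ n ≤ B / 2 ^ s.card := by
    induction s using Multiset.induction_on generalizing B with
    | empty => simpa using hf
    | cons a s ih =>
      simp only [Multiset.map_cons, Multiset.prod_cons, mul_assoc] at hf
      have := norm_coeff_le_half hρ (hh.prod hρ s) (hs a (by simp)) hf
      intro n
      rw [Multiset.card_cons, pow_succ', ← div_div]
      exact ih (fun a ha => hs a (by simp [ha])) this n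
  have := key 0
  rw [h0, norm_one, pow_zero, mul_one, le_div_iff₀ (by positivity), one_mul] at this
  exact this

end GaussDivision

section CharpolyRoots
open Polynomial
variable {K : Type*} [Field K] [IsAlgClosed K] {n : Type*} [Fintype n] [DecidableEq n]

lemma reverse_prod_X_sub_C (s : Multiset K) :
    (s.map fun a => X - C a).prod.reverse = (s.map fun a => 1 - C a * X).prod := by
  induction s using Multiset.induction_on with
  | empty => simp [← Polynomial.C_1, -map_one]
  | cons a s ih =>
    rw [Multiset.map_cons, Multiset.prod_cons, Multiset.map_cons, Multiset.prod_cons,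
      reverse_mul_of_domain, ih]
    congr 1
    rw [sub_eq_add_neg, ← C_neg]
    have : (X + C (-a) : K[X]) = C (-a) + C 1 * X := by rw [C_1]; ring
    rw [this, add_comm, reverse_add_C, reverse_mul_X, reverse_C]
    simp [sub_eq_add_neg]

lemma charpolyRev_eq_prod (M : Matrix n n K) :
    M.charpolyRev = (M.charpoly.roots.map fun a => 1 - C a * X).prod := by
  rw [← Matrix.reverse_charpoly, ← reverse_prod_X_sub_C,
    ← (IsAlgClosed.splits M.charpoly).eq_prod_roots_of_monic M.charpoly_monic]

lemma exists_mulVec_eq_smul {M : Matrix n n K} {a : K} (ha : a ∈ M.charpoly.roots) :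
    ∃ v : n → K, v ≠ 0 ∧ M.mulVec v = a • v := by
  have h1 : (Matrix.scalar n a - M).det = 0 := by
    rw [← Matrix.eval_charpoly]
    exact (mem_roots'.1 ha).2
  obtain ⟨v, hv, h⟩ := Matrix.exists_mulVec_eq_zero_iff.2 h1
  refine ⟨v, hv, ?_⟩
  rw [Matrix.sub_mulVec, sub_eq_zero] at h
  rw [← h]
  ext i
  simp [Matrix.scalar_apply, Matrix.mulVec_diagonal]

end CharpolyRoots

section Perturbation
variable {K : Type*} [NontriviallyNormedField K] [CompleteSpace K]
  {E : Type*} [NormedAddCommGroup E] [NormedSpace K E] [CompleteSpace E]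

/-- A finite rank perturbation of a contraction that has approximate fixed vectors has a
nonzero fixed vector. -/
lemma exists_fixed_of_approx (τ F : E →L[K] E) (hτ : ‖τ‖ < 1)
    [FiniteDimensional K (LinearMap.range F.toLinearMap)]
    (h : ∀ ε > 0, ∃ v : E, ‖v‖ = 1 ∧ ‖v - (τ v + F v)‖ < ε) :
    ∃ v : E, v ≠ 0 ∧ τ v + F v = v := by
  by_contra! hcon
  set S := Units.oneSub τ hτ with hS
  set S' : E →L[K] E := (↑S⁻¹ : E →L[K] E) with hS'
  have hSS' x : S' x - τ (S' x) = x := by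
    have : (S : E →L[K] E) * S' = 1 := S.mul_inv
    have := congrArg (fun f : E →L[K] E => f x) this
    simpa [hS] using this
  have hS'S x : S' (x - τ x) = x := by
    have : S' * (S : E →L[K] E) = 1 := S.inv_mul
    have := congrArg (fun f : E →L[K] E => f x) this
    simpa [hS] using this
  let P := LinearMap.range F.toLinearMap
  let L : P →ₗ[K] E := (LinearMap.id - F.toLinearMap ∘ₗ S'.toLinearMap) ∘ₗ P.subtype
  have hL (w : P) : L w = w - F (S' w) := rfl
  have hker : LinearMap.ker L = ⊥ := by
    rw [LinearMap.ker_eq_bot']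
    intro w hw
    rw [hL, sub_eq_zero] at hw
    by_contra hw0
    refine hcon (S' w) ?_ ?_
    · intro h0
      rw [h0, map_zero] at hw
      exact hw0 (by ext; exact hw)
    · rw [← hw, add_comm, ← eq_sub_iff_add_eq]
      exact (hSS' _).symm
  obtain ⟨c, hc, hanti⟩ := LinearMap.exists_antilipschitzWith L hker
  set D := ‖S'‖ * (c * (‖F‖ * ‖S'‖) + 1) with hD
  have hD0 : 0 ≤ D := by positivity
  obtain ⟨v, hv, hve⟩ := h (1 / (D + 1)) (by positivity)
  set e := v - (τ v + F v) with he
  have h1 : v = S' (F v + e) := by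
    have := hS'S v
    rw [show v - τ v = F v + e by rw [he]; abel] at this
    exact this.symm
  have h2 : ‖F v‖ ≤ c * (‖F‖ * ‖S'‖ * ‖e‖) := by
    have h3 := hanti.le_mul_norm (map_zero L) (⟨F v, v, rfl⟩ : P)
    have h4 : L ⟨F v, v, rfl⟩ = F (S' e) := by
      rw [hL]
      change F v - F (S' (F v)) = _
      nth_rewrite 1 [h1]
      rw [map_add, map_add]; abel
    rw [h4] at h3
    refine h3.trans ?_
    gcongr
    exact (F.le_opNorm _).trans (by rw [mul_assoc]; gcongr; exact S'.le_opNorm _)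
  have h5 : ‖v‖ ≤ D * ‖e‖ := by
    calc ‖v‖ = ‖S' (F v + e)‖ := by rw [← h1]
      _ ≤ ‖S'‖ * ‖F v + e‖ := S'.le_opNorm _
      _ ≤ ‖S'‖ * (c * (‖F‖ * ‖S'‖ * ‖e‖) + ‖e‖) := by gcongr; exact (norm_add_le _ _).trans (by gcongr)
      _ = D * ‖e‖ := by rw [hD]; ring
  rw [hv] at h5
  have h6 : D * ‖e‖ ≤ D * (1 / (D + 1)) := by gcongr
  have h7 : D * (1 / (D + 1)) < 1 := by
    rw [mul_one_div, div_lt_one (by positivity)]; linarith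
  linarith

end Perturbation

section RootTracking
variable {K : Type*} [NormedField K] [IsUltrametricDist K] {r η : ℝ}

lemma ne_zero_of_one_le_mul {a : K} (h : 1 ≤ ‖a‖ * r) : a ≠ 0 := by
  rintro rfl
  norm_num at h

lemma norm_inv_le_of_one_le_mul {a : K} (h : 1 ≤ ‖a‖ * r) : ‖a⁻¹‖ ≤ r := by
  rwa [norm_inv, inv_le_iff_one_le_mul₀ (norm_pos_iff.2 (ne_zero_of_one_le_mul h)), mul_comm]

lemma exists_near_root (s : Multiset K) {t : K} (ht : ‖t‖ ≤ r) {n₀ : ℕ}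
    [DecidablePred fun a : K => 1 ≤ ‖a‖ * r]
    (hs : (s.filter fun a => 1 ≤ ‖a‖ * r).card ≤ n₀) (hη : 0 < η) (hη1 : η ≤ 1)
    (h : ‖(s.map fun a => 1 - a * t).prod‖ < η ^ n₀) :
    ∃ a ∈ s, 1 ≤ ‖a‖ * r ∧ ‖1 - a * t‖ < η := by
  by_contra! hcon
  have key : η ^ (s.filter fun a => 1 ≤ ‖a‖ * r).card ≤ ‖(s.map fun a => 1 - a * t).prod‖ := by
    clear hs h
    induction s using Multiset.induction_on with
    | empty => simp
    | cons a s ih =>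
      have ih := ih fun b hb => hcon b (by simp [hb])
      rw [Multiset.map_cons, Multiset.prod_cons, norm_mul]
      by_cases ha : 1 ≤ ‖a‖ * r
      · rw [Multiset.filter_cons_of_pos (p := fun a => 1 ≤ ‖a‖ * r) _ ha, Multiset.card_cons, pow_succ']
        exact mul_le_mul (hcon a (by simp) ha) ih (by positivity) (norm_nonneg _)
      · rw [Multiset.filter_cons_of_neg (p := fun a => 1 ≤ ‖a‖ * r) _ ha]
        have h1 : ‖a * t‖ < 1 := by
          rw [norm_mul]
          exact (mul_le_mul_of_nonneg_left ht (norm_nonneg _)).trans_lt (not_le.1 ha)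
        rwa [sub_eq_add_neg, norm_add_eq_max_of_norm_ne_norm (by simpa using h1.ne'), norm_one,
          norm_neg, max_eq_left h1.le, one_mul]
  exact absurd (key.trans_lt h) (not_lt.2 (pow_le_pow_of_le_one hη.le hη1 hs))

lemma exists_tracked_seq {α : Type*} (P : ℕ → α → Prop) (Q : ℕ → α → α → Prop) {a : α}
    (ha : P 0 a) (h : ∀ n x, P n x → ∃ y, P (n + 1) y ∧ Q n x y) :
    ∃ f : ℕ → α, (∀ n, P n (f n)) ∧ ∀ n, Q n (f n) (f (n + 1)) := by
  choose! g hg using h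
  refine ⟨fun n => Nat.rec a (fun n x => g n x) n, ?_⟩
  have h1 n : P n (Nat.rec (motive := fun _ => α) a (fun n x => g n x) n) := by
    induction n with
    | zero => exact ha
    | succ n ih => exact (hg n _ ih).1
  exact ⟨h1, fun n => (hg n _ (h1 n)).2⟩

end RootTracking

section Eigenvalues
open Filter Topology
variable {K : Type*} [NormedField K] [IsUltrametricDist K] [CompleteSpace K] [IsAlgClosed K]
  {C q r : ℝ} {A : (ℕ →₀ K) →ₗ[K] (ℕ →₀ K)}

open Classical in
lemma RowDecay.exists_card_roots_le (hA : RowDecay A C q) (hr : 0 < r) :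
    ∃ n₀, ∀ N, ((truncMat A N).charpoly.roots.filter fun a => 1 ≤ ‖a‖ * r).card ≤ n₀ := by
  obtain ⟨B, hB1, hB⟩ := detBound_le_max hA (r := 2 * r) (by positivity)
  refine ⟨⌈B⌉₊, fun N => ?_⟩
  set s := (truncMat A N).charpoly.roots with hs
  have h1 : ((truncMat A N).charpolyRev : PowerSeries K) =
      ((s.filter fun a => 1 ≤ ‖a‖ * r).map fun a => 1 - PowerSeries.C a * PowerSeries.X).prod *
      (((s.filter fun a => ¬ 1 ≤ ‖a‖ * r).map fun a => 1 - PowerSeries.C a * PowerSeries.X).prod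
        * 1) := by
    rw [mul_one, ← Multiset.prod_add, ← Multiset.map_add, Multiset.filter_add_not,
      charpolyRev_eq_prod, ← Polynomial.coeToPowerSeries.ringHom_apply, map_multiset_prod,
      Multiset.map_map]
    simp [Function.comp_def, hs]
  have h2 : DiscBounded (2 * r) (1 : PowerSeries K) :=
    ⟨1, fun n => by rw [PowerSeries.coeff_one]; split_ifs with h <;> simp [h]⟩
  have h3 := two_pow_card_le (B := B) (ρ := 2 * r) (by positivity)
    (h2.prod (by positivity) (s.filter fun a => ¬ 1 ≤ ‖a‖ * r)) ?_
    (s.filter fun a => 1 ≤ ‖a‖ * r) ?_ ?_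
  · exact Nat.lt_two_pow_self.le.trans (by exact_mod_cast h3.trans (Nat.le_ceil B))
  · simp [map_multiset_prod]
  · exact fun a ha => by linarith [(Multiset.mem_filter.1 ha).2]
  · intro n
    rw [← h1, Polynomial.coeff_coe]
    exact (hA.gBound_charpolyRev (by positivity) N n).trans (hB N)

lemma RowDecay.exists_eigenvalue_seq (hA : RowDecay A C q) (hr : 0 < r) {n : ℕ}
    (hn : 1 < ‖PowerSeries.coeff n (fredholm A)‖ * r ^ n) :
    ∃ (N₁ : ℕ) (l : ℕ → K) (t : K), (∀ k, l k ∈ (truncMat A (N₁ + k)).charpoly.roots) ∧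
      (∀ k, 1 ≤ ‖l k‖ * r) ∧ Tendsto (fun k => (l k)⁻¹) atTop (𝓝 t) := by
  classical
  have hC := hA.one_le
  have hq := hA.pos
  obtain ⟨n₀, hn₀⟩ := hA.exists_card_roots_le hr
  obtain ⟨B, hB1, hB⟩ := detBound_le_max hA hr
  obtain ⟨s, hs0, hs1, hsq⟩ : ∃ s : ℝ, 0 < s ∧ s < 1 ∧ s ^ (n₀ + 1) = q := by
    refine ⟨q ^ ((1 : ℝ) / (n₀ + 1 : ℕ)), by positivity, ?_, ?_⟩
    · exact Real.rpow_lt_one hq.le hA.lt_one (by positivity)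
    · rw [← Real.rpow_natCast, ← Real.rpow_mul hq.le, one_div, inv_mul_cancel₀ (by positivity),
        Real.rpow_one]
  have hev : ∀ᶠ N in atTop, B * (r * C) * s ^ N < 1 ∧
      1 < ‖(truncMat A N).charpolyRev.coeff n‖ * r ^ n := by
    refine Eventually.and ?_ (((hA.tendsto_coeff n).norm.mul_const (r ^ n)).eventually_const_lt hn)
    exact ((tendsto_pow_atTop_nhds_zero_of_lt_one hs0.le hs1).const_mul _).eventually_lt_const
      (by simp)
  obtain ⟨N₁, hN₁⟩ := eventually_atTop.1 hev
  have start : ∃ a, a ∈ (truncMat A (N₁ + 0)).charpoly.roots ∧ 1 ≤ ‖a‖ * r := by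
    by_contra! hcon
    have h2 : GBound r 1 (truncMat A N₁).charpolyRev := by
      rw [charpolyRev_eq_prod]
      have h3 : ∀ a ∈ (truncMat A N₁).charpoly.roots, ‖a‖ * r ≤ 1 := fun a ha => (hcon a ha).le
      generalize (truncMat A N₁).charpoly.roots = s at h3
      induction s using Multiset.induction_on with
      | empty => simpa using GBound.one
      | cons a s ih =>
        rw [Multiset.map_cons, Multiset.prod_cons, ← one_mul (1 : ℝ)]
        refine GBound.mul hr ?_ (ih fun b hb => h3 b (by simp [hb]))
        refine GBound.one.sub hr.le ?_
        rcases GBound.X (ρ := r) (K := K) with h | h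
        · exact (GBound.C_mul hr _ h).mono (h3 a (by simp))
        · exact absurd hr h.not_gt
    exact (h2 n).not_gt (hN₁ N₁ le_rfl).2
  obtain ⟨a, ha⟩ := start
  have step : ∀ k x, (x ∈ (truncMat A (N₁ + k)).charpoly.roots ∧ 1 ≤ ‖x‖ * r) →
      ∃ y, (y ∈ (truncMat A (N₁ + (k + 1))).charpoly.roots ∧ 1 ≤ ‖y‖ * r) ∧
        ‖1 - y * x⁻¹‖ < s ^ (N₁ + k) := by
    rintro k x ⟨hx, hxr⟩
    have ht := norm_inv_le_of_one_le_mul hxr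
    have e0 M : (truncMat A M).charpolyRev.eval x⁻¹ =
        (((truncMat A M).charpoly.roots).map fun a => 1 - a * x⁻¹).prod := by
      rw [charpolyRev_eq_prod, Polynomial.eval_multiset_prod, Multiset.map_map]
      simp
    have e1 : (truncMat A (N₁ + k)).charpolyRev.eval x⁻¹ = 0 := by
      rw [e0]
      exact Multiset.prod_eq_zero (Multiset.mem_map.2
        ⟨x, hx, by rw [mul_inv_cancel₀ (ne_zero_of_one_le_mul hxr), sub_self]⟩)
    have e2 : ‖(truncMat A (N₁ + k + 1)).charpolyRev.eval x⁻¹‖ ≤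
        detBound C q r (N₁ + k) * (r * (C * q ^ (N₁ + k))) := by
      have := (hA.gBound_charpolyRev_succ_sub hr (N₁ + k)).norm_eval_le hr ht
      rwa [Polynomial.eval_sub, e1, sub_zero] at this
    obtain ⟨y, hy, hyr, hyx⟩ := exists_near_root (η := s ^ (N₁ + k)) _ ht (hn₀ (N₁ + k + 1))
      (by positivity) (pow_le_one₀ hs0.le hs1.le) (by
        rw [← e0]
        refine e2.trans_lt ?_
        have h1 := (hN₁ (N₁ + k) (by omega)).1
        have h2 : q ^ (N₁ + k) = s ^ ((N₁ + k) * n₀) * s ^ (N₁ + k) := by rw [← hsq]; ring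
        rw [h2, ← pow_mul]
        calc detBound C q r (N₁ + k) * (r * (C * (s ^ ((N₁ + k) * n₀) * s ^ (N₁ + k))))
            = detBound C q r (N₁ + k) * (r * C) * s ^ (N₁ + k) * s ^ ((N₁ + k) * n₀) := by ring
          _ ≤ B * (r * C) * s ^ (N₁ + k) * s ^ ((N₁ + k) * n₀) := by gcongr; exact hB _
          _ < 1 * s ^ ((N₁ + k) * n₀) := by gcongr
          _ = _ := one_mul _)
    exact ⟨y, ⟨hy, hyr⟩, hyx⟩
  obtain ⟨l, hl, hll⟩ := exists_tracked_seq _ _ ha step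
  have hcau : CauchySeq fun k => (l k)⁻¹ := by
    refine cauchySeq_of_le_geometric s (r * s ^ N₁) hs1 fun k => ?_
    have h0 := ne_zero_of_one_le_mul (hl (k + 1)).2
    have h1 : (l k)⁻¹ - (l (k + 1))⁻¹ = -((l (k + 1))⁻¹ * (1 - l (k + 1) * (l k)⁻¹)) := by
      field_simp; ring
    rw [dist_eq_norm, h1, norm_neg, norm_mul, mul_assoc, ← pow_add]
    exact mul_le_mul (norm_inv_le_of_one_le_mul (hl (k + 1)).2) (hll k).le (norm_nonneg _) hr.le
  obtain ⟨t, ht⟩ := cauchySeq_tendsto_of_complete hcau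
  exact ⟨N₁, l, t, fun k => (hl k).1, fun k => (hl k).2, ht⟩

end Eigenvalues

section Eigenvectors
open Finsupp Filter Topology BoundedContinuousFunction
variable {K : Type*} [NontriviallyNormedField K] [IsUltrametricDist K]
  {C q r : ℝ} {A : (ℕ →₀ K) →ₗ[K] (ℕ →₀ K)}

lemma norm_linearCombination_le {v : ℕ → K} {B D : ℝ} (hD : 0 ≤ D) (hv : ∀ i, ‖v i‖ ≤ D)
    {x : ℕ →₀ K} (hB : 0 ≤ B) (hx : ∀ j, ‖x j‖ ≤ B) : ‖linearCombination K v x‖ ≤ B * D := by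
  rw [linearCombination_apply, Finsupp.sum]
  refine norm_sum_le_of_forall_le_of_nonneg (by positivity) fun j _ => ?_
  rw [smul_eq_mul, norm_mul]
  exact mul_le_mul (hx j) (hv j) (norm_nonneg _) hB

lemma RowDecay.norm_tail_le (hA : RowDecay A C q) (M : ℕ) (v : ℕ →ᵇ K) (i : ℕ) :
    ‖if M ≤ i then linearCombination K v (A (single i 1)) else 0‖ ≤
      C * q ^ M * ‖v‖ := by
  have hC := hA.one_le
  have hq := hA.pos
  split_ifs with h
  · refine (norm_linearCombination_le (norm_nonneg v) v.norm_coe_le_norm (by positivity)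
      (hA.le i)).trans ?_
    have := pow_le_pow_of_le_one hq.le hA.lt_one.le h
    gcongr
  · rw [norm_zero]; positivity

/-- The transpose of `A` acting on bounded sequences, with the first `M` output coordinates
removed. -/
noncomputable def RowDecay.tailOp (hA : RowDecay A C q) (M : ℕ) : (ℕ →ᵇ K) →L[K] (ℕ →ᵇ K) :=
  LinearMap.mkContinuous
    { toFun := fun v => ofNormedAddCommGroupDiscrete
        (fun i => if M ≤ i then linearCombination K v (A (single i 1)) else 0)
        (C * q ^ M * ‖v‖) (hA.norm_tail_le M v)
      map_add' := fun v w => by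
        ext i
        simp only [coe_ofNormedAddCommGroupDiscrete, BoundedContinuousFunction.coe_add, Pi.add_apply]
        split_ifs
        · simp [linearCombination_apply, Finsupp.sum, mul_add, Finset.sum_add_distrib]
        · simp
      map_smul' := fun c v => by
        ext i
        simp only [coe_ofNormedAddCommGroupDiscrete, BoundedContinuousFunction.coe_smul, RingHom.id_apply]
        split_ifs
        · simp [linearCombination_apply, Finsupp.sum, Finset.mul_sum, mul_left_comm]
        · simp }
    (C * q ^ M) fun v => by
      have hC := hA.one_le
      have hq := hA.pos
      exact norm_ofNormedAddCommGroup_le _ (by positivity)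
        (hA.norm_tail_le M v)

lemma RowDecay.tailOp_apply (hA : RowDecay A C q) (M : ℕ) (v : ℕ →ᵇ K) (i : ℕ) :
    hA.tailOp M v i = if M ≤ i then linearCombination K v (A (single i 1)) else 0 := rfl

lemma RowDecay.norm_tailOp_le (hA : RowDecay A C q) (M : ℕ) : ‖hA.tailOp M‖ ≤ C * q ^ M := by
  have hC := hA.one_le
  have hq := hA.pos
  exact LinearMap.mkContinuous_norm_le _ (by positivity) _

lemma finiteDimensional_range_of_support (F : (ℕ →ᵇ K) →ₗ[K] (ℕ →ᵇ K)) (M : ℕ)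
    (h : ∀ v i, M ≤ i → F v i = 0) : FiniteDimensional K (LinearMap.range F) := by
  let ev : LinearMap.range F →ₗ[K] (Fin M → K) :=
    { toFun := fun v i => (v : ℕ →ᵇ K) i
      map_add' := fun _ _ => rfl
      map_smul' := fun _ _ => rfl }
  refine FiniteDimensional.of_injective ev ?_
  rw [injective_iff_map_eq_zero]
  rintro ⟨w, v, rfl⟩ hw
  ext i
  by_cases hi : i < M
  · exact congrFun hw ⟨i, hi⟩
  · exact h v i (not_lt.1 hi)

variable [CompleteSpace K] [IsAlgClosed K]

lemma RowDecay.exists_approx (hA : RowDecay A C q) {N : ℕ} {l t : K}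
    (hl : l ∈ (truncMat A N).charpoly.roots) (hl0 : l ≠ 0) :
    ∃ v : ℕ →ᵇ K, ‖v‖ = 1 ∧
      ‖v - t • hA.tailOp 0 v‖ ≤ max (‖l⁻¹ - t‖ * C) (‖t‖ * (C * q ^ N)) := by
  have hC := hA.one_le
  have hq := hA.pos
  obtain ⟨u, hu0, hu⟩ := exists_mulVec_eq_smul hl
  obtain ⟨i₀, hi₀⟩ := Function.ne_iff.1 hu0
  have : Nonempty (Fin N) := ⟨i₀⟩
  obtain ⟨i₁, hi₁⟩ := Finite.exists_max fun i => ‖u i‖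
  have hi₁0 : 0 < ‖u i₁‖ := lt_of_lt_of_le (norm_pos_iff.2 hi₀) (hi₁ i₀)
  set c := (u i₁)⁻¹ with hc
  have hbd (i : Fin N) : ‖c * u i‖ ≤ 1 := by
    rw [norm_mul, hc, norm_inv, inv_mul_le_iff₀ hi₁0, mul_one]; exact hi₁ i
  set f : ℕ → K := fun i => if h : i < N then c * u ⟨i, h⟩ else 0 with hf
  have hf1 i : ‖f i‖ ≤ 1 := by
    simp only [hf]; split_ifs with h
    · exact hbd _
    · simp
  set v : ℕ →ᵇ K := ofNormedAddCommGroupDiscrete f 1 hf1 with hv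
  have hvf i : v i = f i := rfl
  have hvn : ‖v‖ = 1 := by
    apply le_antisymm
    · exact norm_ofNormedAddCommGroup_le _ zero_le_one _
    · have h1 : f i₁ = 1 := by
        simp only [hf, i₁.2, dif_pos, hc]
        exact inv_mul_cancel₀ (norm_pos_iff.1 hi₁0)
      have := v.norm_coe_le_norm i₁
      rwa [hvf, h1, norm_one] at this
  refine ⟨v, hvn, ?_⟩
  rw [norm_le (le_max_of_le_left (by positivity))]
  intro i
  have hUle : ‖linearCombination K v (A (single i 1))‖ ≤ C * q ^ i := by
    have := norm_linearCombination_le zero_le_one hf1 (by positivity) (hA.le i)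
    rwa [mul_one] at this
  have e0 : (v - t • hA.tailOp 0 v) i =
      v i - t * linearCombination K v (A (single i 1)) := by
    simp [hA.tailOp_apply]
  rw [e0]
  by_cases hi : i < N
  · have e1 : linearCombination K v (A (single i 1)) = l * v i := by
      obtain ⟨M, hNM, hM⟩ := exists_finsupp_range (A (single i 1)) N
      rw [linearCombination_apply, Finsupp.sum_of_support_subset _ hM _ (by simp),
        ← sum_range_add_sum_Ico _ hNM, Finset.sum_eq_zero (s := Ico N M), add_zero,
        Finset.sum_range]
      · have := congrFun hu ⟨i, hi⟩
        simp only [Matrix.mulVec, dotProduct, truncMat, Matrix.of_apply, Pi.smul_apply,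
          smul_eq_mul] at this
        rw [hvf]
        simp only [hf, hi, dif_pos, mul_left_comm l c, ← this, Finset.mul_sum, smul_eq_mul, hvf]
        refine Finset.sum_congr rfl fun j _ => ?_
        simp only [j.2, dif_pos]; ring
      · exact fun j hj => by simp [hvf, hf, not_lt.2 (mem_Ico.1 hj).1]
    refine le_trans ?_ (le_max_left _ _)
    rw [show v i = l⁻¹ * linearCombination K v (A (single i 1)) by rw [e1]; field_simp, ← sub_mul,
      norm_mul]
    gcongr
    exact hUle.trans (mul_le_of_le_one_right (by positivity) (pow_le_one₀ hq.le hA.lt_one.le))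
  · refine le_trans ?_ (le_max_right _ _)
    rw [show v i = 0 by simp [hvf, hf, hi], zero_sub, norm_neg, norm_mul]
    gcongr
    have := pow_le_pow_of_le_one hq.le hA.lt_one.le (not_lt.1 hi)
    exact hUle.trans (by gcongr)

lemma RowDecay.exists_eigenfunctional (hA : RowDecay A C q) (hr : 0 < r) {n : ℕ}
    (hn : 1 < ‖PowerSeries.coeff n (fredholm A)‖ * r ^ n) :
    ∃ φ : (ℕ →₀ K) →ₗ[K] K, (∃ B, ∀ i, ‖φ (single i 1)‖ ≤ B) ∧ φ ≠ 0 ∧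
      ∃ l : K, 1 ≤ ‖l‖ * r ∧ φ ∘ₗ A = l • φ := by
  have hC := hA.one_le
  have hq := hA.pos
  obtain ⟨N₁, l, t, hl, hlr, hlt⟩ := hA.exists_eigenvalue_seq hr hn
  have htr : ‖t‖ ≤ r := le_of_tendsto' hlt.norm fun k => norm_inv_le_of_one_le_mul (hlr k)
  obtain ⟨M, hM⟩ := exists_pow_lt_of_lt_one (x := (r * C)⁻¹) (by positivity) hA.lt_one
  set τ := t • hA.tailOp M with hτ
  set F := t • (hA.tailOp 0 - hA.tailOp M) with hF
  have hτF v : τ v + F v = t • hA.tailOp 0 v := by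
    simp only [hτ, hF, _root_.smul_apply, _root_.sub_apply]
    rw [← smul_add]; simp
  have hτ1 : ‖τ‖ < 1 := by
    calc ‖τ‖ ≤ ‖t‖ * ‖hA.tailOp M‖ := by rw [hτ]; exact norm_smul_le t (hA.tailOp M)
      _ ≤ r * (C * q ^ M) := by gcongr; exact hA.norm_tailOp_le M
      _ = r * C * q ^ M := by ring
      _ < r * C * (r * C)⁻¹ := by gcongr
      _ = 1 := by field_simp
  have : FiniteDimensional K (LinearMap.range F.toLinearMap) := by
    refine finiteDimensional_range_of_support _ M fun v i hi => ?_
    simp [hF, hA.tailOp_apply, hi]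
  obtain ⟨v, hv0, hv⟩ := exists_fixed_of_approx τ F hτ1 (by
    intro ε hε
    have h1 : Tendsto (fun k => max (‖(l k)⁻¹ - t‖ * C) (‖t‖ * (C * q ^ (N₁ + k)))) atTop
        (𝓝 (max (0 * C) (‖t‖ * (C * 0)))) := by
      refine Tendsto.max ((tendsto_iff_norm_sub_tendsto_zero.1 hlt).mul_const C)
        (Tendsto.const_mul _ (Tendsto.const_mul _ ?_))
      exact (tendsto_pow_atTop_nhds_zero_of_lt_one hq.le hA.lt_one).comp
        (tendsto_add_atTop_nat N₁ |>.congr fun k => add_comm _ _)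
    simp only [zero_mul, mul_zero, max_self] at h1
    obtain ⟨k, hk⟩ := (h1.eventually_lt_const hε).exists
    obtain ⟨v, hv1, hv2⟩ := hA.exists_approx (t := t) (hl k) (ne_zero_of_one_le_mul (hlr k))
    exact ⟨v, hv1, by rw [hτF]; exact hv2.trans_lt hk⟩)
  rw [hτF] at hv
  have ht0 : t ≠ 0 := by rintro rfl; simp [hv0.symm] at hv
  refine ⟨linearCombination K v, ⟨‖v‖, fun i => ?_⟩, ?_, t⁻¹, ?_, ?_⟩
  · simpa using v.norm_coe_le_norm i
  · exact fun h => hv0 (by ext i; simpa using LinearMap.congr_fun h (single i 1))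
  · rw [norm_inv, inv_mul_eq_div, one_le_div (norm_pos_iff.2 ht0)]; exact htr
  · ext i
    have h1 := congrArg (fun w : ℕ →ᵇ K => w i) hv
    simp only [BoundedContinuousFunction.coe_smul, hA.tailOp_apply, Nat.zero_le, if_true, smul_eq_mul] at h1
    simp [← h1, ht0]

end Eigenvectors

section Deflation
open Module
variable {K : Type*} [Field K] {V : Type*} [AddCommGroup V] [Module K V]

lemma exists_dual_family {ι : Type*} [Fintype ι] [DecidableEq ι] {b : ι → Dual K V}
    (hb : LinearIndependent K b) : ∃ x : ι → V, ∀ i j, b i (x j) = if i = j then 1 else 0 := by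
  let f : V →ₗ[K] (ι → K) := LinearMap.pi b
  have hf : LinearMap.range f = ⊤ := by
    by_contra h
    obtain ⟨g, hg0, hg⟩ := Submodule.exists_le_ker_of_lt_top _ (lt_top_iff_ne_top.2 h)
    apply hg0
    have h1 : ∑ i, g (Pi.single i 1) • b i = 0 := by
      ext x
      have h2 : g (f x) = 0 := hg ⟨x, rfl⟩
      rw [LinearMap.pi_apply_eq_sum_univ g (f x)] at h2
      have h4 (i : ι) : (fun j => if i = j then (1 : K) else 0) = Pi.single i 1 := by
        ext j; simp [Pi.single_apply, eq_comm]
      simpa [f, mul_comm, h4] using h2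
    ext i
    simpa using Fintype.linearIndependent_iff.1 hb _ h1 i
  choose x hx using fun j => LinearMap.range_eq_top.1 hf (Pi.single j 1)
  exact ⟨x, fun i j => by simpa [f, Pi.single_apply] using congrFun (hx j) i⟩

end Deflation

section SlopeSpace
open Polynomial Module
variable {K : Type*} [NormedField K] {V : Type*} [AddCommGroup V] [Module K V] {r : ℝ}
  {T : End K V} {Y E : Submodule K V}

/-- A finite dimensional subspace of `Y` on which `T` acts with eigenvalues of norm at least
`1 / r`. -/
structure SlopeSpace (T : End K V) (Y : Submodule K V) (r : ℝ) (E : Submodule K V) :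
    Prop where
  le_bdd : E ≤ Y
  finite : FiniteDimensional K E
  stable : ∀ φ ∈ E, T φ ∈ E
  slope : ∃ P : K[X], P ≠ 0 ∧ (∀ a, P.IsRoot a → 1 ≤ ‖a‖ * r) ∧ ∀ φ ∈ E, aeval T P φ = 0

lemma SlopeSpace.bot : SlopeSpace T Y r ⊥ where
  le_bdd := bot_le
  finite := inferInstance
  stable := by simp
  slope := ⟨1, one_ne_zero, by simp, by simp⟩

lemma SlopeSpace.sup {E' : Submodule K V} (h : SlopeSpace T Y r E)
    (h' : SlopeSpace T Y r E') : SlopeSpace T Y r (E ⊔ E') where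
  le_bdd := sup_le h.le_bdd h'.le_bdd
  finite := have := h.finite; have := h'.finite; Submodule.finiteDimensional_sup E E'
  stable φ hφ := by
    obtain ⟨x, hx, y, hy, rfl⟩ := Submodule.mem_sup.1 hφ
    rw [map_add]
    exact Submodule.add_mem_sup (h.stable x hx) (h'.stable y hy)
  slope := by
    obtain ⟨P, hP0, hP, hPE⟩ := h.slope
    obtain ⟨P', hP0', hP', hPE'⟩ := h'.slope
    refine ⟨P * P', mul_ne_zero hP0 hP0', fun a ha => ?_, fun φ hφ => ?_⟩
    · exact (root_mul.1 ha).elim (hP a) (hP' a)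
    · obtain ⟨x, hx, y, hy, rfl⟩ := Submodule.mem_sup.1 hφ
      rw [map_add, map_mul, End.mul_apply _ _ y, hPE' y hy, ← map_mul, mul_comm, map_mul,
        End.mul_apply, hPE x hx, map_zero, map_zero, add_zero]

lemma SlopeSpace.sup_span (h : SlopeSpace T Y r E)
    {φ : V} (hφ : φ ∈ Y) {l : K} (hl : 1 ≤ ‖l‖ * r)
    (he : T φ - l • φ ∈ E) : SlopeSpace T Y r (E ⊔ K ∙ φ) where
  le_bdd := sup_le h.le_bdd (by simpa [Submodule.span_le] using hφ)
  finite := have := h.finite; Submodule.finiteDimensional_sup E _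
  stable ψ hψ := by
    obtain ⟨x, hx, y, hy, rfl⟩ := Submodule.mem_sup.1 hψ
    obtain ⟨c, rfl⟩ := Submodule.mem_span_singleton.1 hy
    have : T (x + c • φ) = (T x + c • (T φ - l • φ)) + (c * l) • φ := by
      rw [map_add, map_smul, smul_sub, smul_smul]; abel
    rw [this]
    exact Submodule.add_mem_sup (E.add_mem (h.stable x hx) (E.smul_mem c he))
      (Submodule.smul_mem _ _ (Submodule.mem_span_singleton_self φ))
  slope := by
    obtain ⟨P, hP0, hP, hPE⟩ := h.slope
    refine ⟨P * (X - C l), mul_ne_zero hP0 (X_sub_C_ne_zero l), fun a ha => ?_,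
      fun ψ hψ => ?_⟩
    · exact (root_mul.1 ha).elim (hP a) fun h => root_X_sub_C.1 h ▸ hl
    · obtain ⟨x, hx, y, hy, rfl⟩ := Submodule.mem_sup.1 hψ
      obtain ⟨c, rfl⟩ := Submodule.mem_span_singleton.1 hy
      rw [map_mul, End.mul_apply]
      apply hPE
      have : aeval T (X - C l) (x + c • φ) =
          (T x - l • x) + c • (T φ - l • φ) := by
        simp only [map_sub, aeval_X, aeval_C, LinearMap.sub_apply, map_add, map_smul,
          Module.algebraMap_end_apply]
      rw [this]
      exact E.add_mem (E.sub_mem (h.stable x hx) (E.smul_mem l hx)) (E.smul_mem c he)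

/-- The operator `T` on a stable subspace. -/
noncomputable def SlopeSpace.op (h : SlopeSpace T Y r E) : End K E := T.restrict h.stable

lemma SlopeSpace.coe_op (h : SlopeSpace T Y r E) (φ : E) : (h.op φ : V) = T φ := rfl

lemma SlopeSpace.slope_of_hasEigenvalue (h : SlopeSpace T Y r E) {l : K}
    (hl : End.HasEigenvalue h.op l) : 1 ≤ ‖l‖ * r := by
  obtain ⟨P, hP0, hP, hPE⟩ := h.slope
  obtain ⟨φ, hφ⟩ := hl.exists_hasEigenvector
  apply hP
  have h1 : End.HasEigenvector T l (φ : V) := by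
    refine ⟨End.mem_eigenspace_iff.2 ?_, fun h0 => hφ.2 (by ext1; exact h0)⟩
    rw [← h.coe_op, hφ.apply_eq_smul]; rfl
  have h2 := End.aeval_apply_of_hasEigenvector (p := P) h1
  rw [hPE φ φ.2] at h2
  exact (smul_eq_zero.1 h2.symm).resolve_right h1.2

lemma SlopeSpace.slope_of_mem_roots (h : SlopeSpace T Y r E) [FiniteDimensional K E] {l : K}
    (hl : l ∈ h.op.charpoly.roots) : 1 ≤ ‖l‖ * r :=
  h.slope_of_hasEigenvalue ((End.hasEigenvalue_iff_isRoot_charpoly _ _).2 (mem_roots'.1 hl).2)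

lemma SlopeSpace.surjective_op (h : SlopeSpace T Y r E) : Function.Surjective h.op := by
  have := h.finite
  refine (LinearMap.injective_iff_surjective (V := E)).1 (LinearMap.ker_eq_bot.1 ?_)
  by_contra hk
  have := h.slope_of_hasEigenvalue (l := 0) (by rwa [End.hasEigenvalue_iff, End.eigenspace_zero])
  norm_num at this

end SlopeSpace

section Deflate
open Polynomial Module
variable {K : Type*} [NontriviallyNormedField K] [IsUltrametricDist K] [CompleteSpace K]
  [IsAlgClosed K] [CharZero K]
  {C q r : ℝ} {A : (ℕ →₀ K) →ₗ[K] (ℕ →₀ K)}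

/-- The functional attached to a sequence. -/
noncomputable def pairing (K : Type*) [Field K] : (ℕ → K) ≃ₗ[K] ((ℕ →₀ K) →ₗ[K] K) :=
  Finsupp.llift K K K ℕ

lemma pairing_single {K : Type*} [Field K] (v : ℕ → K) (i : ℕ) (a : K) :
    pairing K v (Finsupp.single i a) = a * v i := by
  simp [pairing]

/-- The action of the transpose of an operator on sequences. -/
noncomputable def seqOp {K : Type*} [Field K] (A : (ℕ →₀ K) →ₗ[K] (ℕ →₀ K)) :
    End K (ℕ → K) where
  toFun v i := pairing K v (A (Finsupp.single i 1))
  map_add' v w := by ext i; simp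
  map_smul' c v := by ext i; simp

lemma pairing_seqOp {K : Type*} [Field K] (A : (ℕ →₀ K) →ₗ[K] (ℕ →₀ K)) (v : ℕ → K) :
    pairing K (seqOp A v) = pairing K v ∘ₗ A := by
  ext i
  simp [pairing_single, seqOp]

/-- The space of bounded sequences. -/
def bddSeq (K : Type*) [NormedField K] : Submodule K (ℕ → K) where
  carrier := {v | ∃ B, ∀ i, ‖v i‖ ≤ B}
  add_mem' := by
    rintro v w ⟨B, hB⟩ ⟨B', hB'⟩
    exact ⟨B + B', fun i => (norm_add_le _ _).trans (add_le_add (hB i) (hB' i))⟩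
  zero_mem' := ⟨0, by simp⟩
  smul_mem' := by
    rintro c v ⟨B, hB⟩
    exact ⟨‖c‖ * B, fun i => by
      rw [Pi.smul_apply, norm_smul]; exact mul_le_mul_of_nonneg_left (hB i) (norm_nonneg c)⟩

lemma pairing_seqOp_pow {K : Type*} [Field K] (A : (ℕ →₀ K) →ₗ[K] (ℕ →₀ K)) (v : ℕ → K)
    (m : ℕ) (x : ℕ →₀ K) : pairing K ((seqOp A ^ m) v) x = pairing K v ((A ^ m) x) := by
  induction m generalizing x with
  | zero => rfl
  | succ m ih =>
    rw [pow_succ', End.mul_apply, pairing_seqOp, LinearMap.comp_apply, ih, pow_succ,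
      End.mul_apply]

lemma coe_op_pow {K : Type*} [NormedField K] {A : (ℕ →₀ K) →ₗ[K] (ℕ →₀ K)} {r : ℝ}
    {Y E : Submodule K (ℕ → K)} (h : SlopeSpace (seqOp A) Y r E) (v : E) (m : ℕ) :
    (((h.op ^ m) v : E) : ℕ → K) = (seqOp A ^ m) v := by
  induction m with
  | zero => rfl
  | succ m ih => rw [pow_succ', pow_succ', End.mul_apply, End.mul_apply, ← ih]; rfl

lemma RowDecay.exists_deflation (hA : RowDecay A C q)
    {E : Submodule K (ℕ → K)} (hE : SlopeSpace (seqOp A) (bddSeq K) r E) [FiniteDimensional K E] :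
    ∃ A' C', RowDecay A' C' q ∧
      fredholm A = ((hE.op.charpoly.roots.map
        fun a => 1 - PowerSeries.C a * PowerSeries.X).prod) * fredholm A' ∧
      ∀ v : ℕ → K, v ≠ 0 → ∀ l : K, l ≠ 0 → pairing K v ∘ₗ A' = l • pairing K v →
        v ∉ E ∧ seqOp A v - l • v ∈ E := by
  classical
  have hC := hA.one_le
  have hq := hA.pos
  obtain ⟨n, ⟨b⟩⟩ : ∃ n, Nonempty (Basis (Fin n) K E) := ⟨_, ⟨finBasis K E⟩⟩
  obtain ⟨x, hx⟩ := exists_dual_family (b := fun i => pairing K (b i))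
    (b.linearIndependent.map' ((pairing K).toLinearMap ∘ₗ E.subtype) (LinearMap.ker_eq_bot.2
      ((pairing K).injective.comp E.subtype_injective)))
  let e : End K (ℕ →₀ K) := ∑ j, (pairing K (b j)).smulRight (x j)
  have he y : e y = ∑ j, pairing K (b j) y • x j := by simp [e]
  have hrepr (v : E) l : b.repr v l = pairing K v (x l) := by
    conv_rhs => rw [← b.sum_repr v]
    simp [hx, -Basis.sum_repr]
  have hEe : ∀ v ∈ E, ∀ y, pairing K v (e y) = pairing K v y := by
    intro v hv y
    have h1 := congrArg Subtype.val (b.sum_repr ⟨v, hv⟩)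
    simp only [hrepr] at h1
    rw [he, map_sum]
    conv_rhs => rw [← h1]
    simp [mul_comm]
  have hEA v (hv : v ∈ E) y : pairing K v (A (e y)) = pairing K v (A y) := by
    simpa [pairing_seqOp] using hEe _ (hE.stable _ hv) y
  let A' : End K (ℕ →₀ K) := A ∘ₗ (1 - e)
  have hA' y : A' y = A y - ∑ j, pairing K (b j) y • A (x j) := by
    simp [A', he, map_sum]
  have heA y : e (A (y - e y)) = 0 := by
    rw [he]
    exact sum_eq_zero fun j _ => by simp [hEA _ (b j).2]
  have hpow m (hm : m ≠ 0) y : (A' ^ m) y = (A ^ m) (y - e y) := by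
    induction m, Nat.one_le_iff_ne_zero.2 hm using Nat.le_induction generalizing y with
    | base => simp [A']
    | succ m h ih =>
      rw [pow_succ, End.mul_apply, ih (by omega), pow_succ, End.mul_apply,
        show A' y = A (y - e y) from rfl, heA, sub_zero]
  have hdec j : ∃ D, 0 ≤ D ∧ ∀ i l, ‖pairing K (b j) (Finsupp.single i 1) *
      A (x j) l‖ ≤ D * q ^ i := by
    obtain ⟨ψ, hψ⟩ := hE.surjective_op (b j)
    obtain ⟨B, hB⟩ := hE.le_bdd ψ.2
    have hB0 : 0 ≤ B := (norm_nonneg _).trans (hB 0)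
    obtain ⟨B', hB'⟩ : ∃ B', ∀ l, ‖x j l‖ ≤ B' := by
      obtain ⟨B', hB'⟩ := ((x j).finite_range.image norm).bddAbove
      exact ⟨B', fun l => hB' ⟨_, ⟨l, rfl⟩, rfl⟩⟩
    have hB'0 : 0 ≤ B' := (norm_nonneg _).trans (hB' 0)
    refine ⟨C * B * (C * B'), by positivity, fun i l => ?_⟩
    rw [norm_mul, mul_right_comm]
    refine mul_le_mul ?_ (hA.norm_apply_le' hB' l) (norm_nonneg _) (by positivity)
    rw [← hψ, hE.coe_op, pairing_seqOp, LinearMap.comp_apply]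
    have h2 : pairing K (ψ : ℕ → K) = Finsupp.linearCombination K (ψ : ℕ → K) := by
      ext i; simp [pairing_single]
    rw [h2, mul_right_comm]
    exact norm_linearCombination_le hB0 hB (by positivity) (hA.le i)
  choose D hD0 hD using hdec
  have hA'dec : RowDecay A' (C + ∑ j, D j) q := by
    refine ⟨le_add_of_le_of_nonneg hC (sum_nonneg fun j _ => hD0 j), hq, hA.lt_one,
      fun i l => ?_⟩
    rw [hA', Finsupp.sub_apply, Finsupp.finsetSum_apply, add_mul, sum_mul]
    exact (norm_sub_le _ _).trans (add_le_add (hA.le i l) ((norm_sum_le _ _).trans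
      (sum_le_sum fun j _ => hD j i l)))
  refine ⟨A', _, hA'dec, ?_, ?_⟩
  · set M := LinearMap.toMatrix b b hE.op with hM
    have htr m (hm : m ≠ 0) : opTrace (A ^ m) = opTrace (A' ^ m) + (M ^ m).trace := by
      refine (hA.pow hm).hasSum_opTrace.unique ?_
      have h1 i : (A ^ m) (Finsupp.single i 1) i = (A' ^ m) (Finsupp.single i 1) i +
          ∑ j, pairing K (b j) (Finsupp.single i 1) * (A ^ m) (x j) i := by
        simp [hpow m hm, he]
      simp only [h1]
      refine (hA'dec.pow hm).hasSum_opTrace.add ?_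
      have h2 : (M ^ m).trace = ∑ j, pairing K (b j) ((A ^ m) (x j)) := by
        rw [hM, LinearMap.toMatrix_pow, Matrix.trace]
        simp only [Matrix.diag_apply, LinearMap.toMatrix_apply, hrepr, coe_op_pow, pairing_seqOp_pow]
      rw [h2]
      refine hasSum_sum fun j _ => ?_
      obtain ⟨N, -, hN⟩ := exists_finsupp_range ((A ^ m) (x j)) 0
      rw [linearMap_finsupp_apply _ _ hN]
      have h3 := hasSum_sum_of_ne_finset_zero (L := SummationFilter.unconditional ℕ) (s := range N)
        (f := fun i => pairing K (b j) (Finsupp.single i 1) * (A ^ m) (x j) i) (fun i hi => by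
          rw [Finsupp.notMem_support_iff.1 fun h => hi (hN h), mul_zero])
      simpa [mul_comm] using h3
    have h1 : (hE.op.charpoly.roots.map
        fun a => 1 - PowerSeries.C a * PowerSeries.X).prod = (M.charpolyRev : PowerSeries K) := by
      rw [charpolyRev_eq_prod, ← Polynomial.coeToPowerSeries.ringHom_apply, map_multiset_prod,
        Multiset.map_map, hM, LinearMap.charpoly_toMatrix]
      congr 2
      ext1
      simp
    rw [h1]
    refine hA.isZeta_fredholm.unique ?_
    convert (isZeta_charpolyRev M).mul hA'dec.isZeta_fredholm using 1
    ext m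
    rcases eq_or_ne m 0 with rfl | hm
    · simp
    · simp only [map_add, map_neg, coeff_tailSeries _ hm, htr m hm]; ring
  · intro v hv l hl h
    have h0 y : pairing K v (A (y - e y)) = l * pairing K v y := LinearMap.congr_fun h y
    refine ⟨fun hvE => hv ?_, ?_⟩
    · apply (pairing K).injective
      refine LinearMap.ext fun y => ?_
      simpa [hEA v hvE, hl] using (h0 y).symm
    · have h1 : seqOp A v - l • v = ∑ j, pairing K v (A (x j)) • (b j : ℕ → K) := by
        apply (pairing K).injective
        refine LinearMap.ext fun y => ?_
        simp [pairing_seqOp, ← h0 y, he, mul_comm]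
      rw [h1]
      exact E.sum_mem fun j _ => E.smul_mem _ (b j).2

lemma SlopeSpace.finrank_le (hA : RowDecay A C q) (hr : 0 < r) :
    ∃ n₀ : ℕ, ∀ E : Submodule K (ℕ → K), SlopeSpace (seqOp A) (bddSeq K) r E →
      finrank K E ≤ n₀ := by
  obtain ⟨B, hB1, -, hB⟩ := hA.exists_coeff_fredholm_le (r := 2 * r) (by positivity)
  refine ⟨⌈B⌉₊, fun E hE => ?_⟩
  have := hE.finite
  obtain ⟨A', C', hA', hdet, -⟩ := hA.exists_deflation hE
  obtain ⟨B', -, -, hB'⟩ := hA'.exists_coeff_fredholm_le (r := 2 * r) (by positivity)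
  have h1 := two_pow_card_le (ρ := 2 * r) (B := B) (by positivity) ⟨B', hB'⟩
    hA'.isZeta_fredholm.coeff_zero hE.op.charpoly.roots
    (fun a ha => by linarith [hE.slope_of_mem_roots ha]) (by rw [← hdet]; exact hB)
  have h2 : hE.op.charpoly.roots.card = finrank K E := by
    rw [← (IsAlgClosed.splits _).natDegree_eq_card_roots, LinearMap.charpoly_natDegree]
  rw [h2] at h1
  exact Nat.lt_two_pow_self.le.trans (by exact_mod_cast h1.trans (Nat.le_ceil B))

/-- There is a largest slope space, and the characteristic series of `A` factors accordingly. -/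
lemma RowDecay.exists_slopeSpace (hA : RowDecay A C q) (hr : 0 < r) :
    ∃ (E : Submodule K (ℕ → K)) (hE : SlopeSpace (seqOp A) (bddSeq K) r E)
      (_ : FiniteDimensional K E) (g : PowerSeries K),
      (∀ E', SlopeSpace (seqOp A) (bddSeq K) r E' → E' ≤ E) ∧ PowerSeries.coeff 0 g = 1 ∧
      (∀ n, ‖PowerSeries.coeff n g‖ * r ^ n ≤ 1) ∧
      fredholm A = ((hE.op.charpoly.roots.map fun a => 1 - PowerSeries.C a * PowerSeries.X).prod) * g
      := by
  obtain ⟨n₀, hn₀⟩ := SlopeSpace.finrank_le hA hr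
  obtain ⟨E, hE, hmax⟩ : ∃ E, SlopeSpace (seqOp A) (bddSeq K) r E ∧
      ∀ E', SlopeSpace (seqOp A) (bddSeq K) r E' → finrank K E' ≤ finrank K E := by
    let S : Set ℕ := {n | ∃ E, SlopeSpace (seqOp A) (bddSeq K) r E ∧ finrank K E = n}
    have hSb : BddAbove S := ⟨n₀, by rintro _ ⟨E, hE, rfl⟩; exact hn₀ E hE⟩
    obtain ⟨E, hE, hEn⟩ := Nat.sSup_mem (s := S) ⟨_, ⊥, SlopeSpace.bot, rfl⟩ hSb
    exact ⟨E, hE, fun E' hE' => by rw [hEn]; exact le_csSup hSb ⟨E', hE', rfl⟩⟩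
  have hfin := hE.finite
  have hmax' E' (hE' : SlopeSpace (seqOp A) (bddSeq K) r E') : E' ≤ E := by
    have h1 := hE.sup hE'
    have := h1.finite
    exact left_eq_sup.1 (Submodule.eq_of_le_of_finrank_le le_sup_left (hmax _ h1))
  obtain ⟨A', C', hA', hdet, hno⟩ := hA.exists_deflation hE
  refine ⟨E, hE, hfin, fredholm A', hmax', hA'.isZeta_fredholm.coeff_zero, fun n => ?_, hdet⟩
  by_contra! hn
  obtain ⟨φ, hφ, hφ0, l, hl, hφl⟩ := hA'.exists_eigenfunctional hr hn
  obtain ⟨v, rfl⟩ := (pairing K).surjective φ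
  have hl0 : l ≠ 0 := ne_zero_of_one_le_mul hl
  obtain ⟨h1, h2⟩ := hno v (by rintro rfl; simp at hφ0) l hl0 hφl
  exact h1 (hmax' _ (hE.sup_span (hφ.imp fun B hB => by simpa [pairing_single] using hB) hl h2)
    (Submodule.mem_sup_right (Submodule.mem_span_singleton_self v)))

end Deflate

section Horizontal
open Polynomial
variable {K : Type*} [NormedField K] {V : Type*} [AddCommGroup V] [Module K V] {r : ℝ}
  {T N : Module.End K V} {Y E : Submodule K V} {a : K}

lemma pow_sub_smul_comm (hcomm : ∀ v, T (N v) = a • N (T v)) (l : K) (n : ℕ) (v : V) :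
    ((T - (a * l) • (1 : Module.End K V)) ^ n) (N v) = a ^ n • N (((T - l • (1 : Module.End K V)) ^ n) v) := by
  induction n generalizing v with
  | zero => simp
  | succ n ih =>
    have h1 : (T - (a * l) • (1 : Module.End K V)) (N v) = a • N ((T - l • (1 : Module.End K V)) v) := by
      simp [hcomm, smul_sub, mul_smul]
    rw [pow_succ, Module.End.mul_apply, h1, map_smul, ih, pow_succ, pow_succ, Module.End.mul_apply,
      smul_smul, mul_comm a]

lemma SlopeSpace.coe_sub_pow (h : SlopeSpace T Y r E) (l : K) (n : ℕ) (v : E) :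
    (((h.op - l • 1) ^ n) v : V) = ((T - l • (1 : Module.End K V)) ^ n) (v : V) := by
  induction n generalizing v with
  | zero => rfl
  | succ n ih => rw [pow_succ, pow_succ, Module.End.mul_apply, Module.End.mul_apply, ih]; rfl

/-- The generalized eigenspace of `T` in a slope space. -/
noncomputable def SlopeSpace.gen (h : SlopeSpace T Y r E) (l : K) : Submodule K V :=
  (h.op.maxGenEigenspace l).map E.subtype

lemma SlopeSpace.mem_gen (h : SlopeSpace T Y r E) {l : K} {v : V} :
    v ∈ h.gen l ↔ v ∈ E ∧ ∃ n, ((T - l • (1 : Module.End K V)) ^ n) v = 0 := by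
  rw [gen, Submodule.mem_map]
  constructor
  · rintro ⟨w, hw, rfl⟩
    obtain ⟨n, hn⟩ := (Module.End.mem_maxGenEigenspace _ _ _).1 hw
    refine ⟨w.2, n, ?_⟩
    have := congrArg Subtype.val hn
    rwa [h.coe_sub_pow] at this
  · rintro ⟨hv, n, hn⟩
    refine ⟨⟨v, hv⟩, (Module.End.mem_maxGenEigenspace _ _ _).2 ⟨n, ?_⟩, rfl⟩
    apply Subtype.ext
    rw [h.coe_sub_pow]
    exact hn

lemma SlopeSpace.gen_le (h : SlopeSpace T Y r E) (l : K) : h.gen l ≤ E :=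
  fun _ hv => (h.mem_gen.1 hv).1

lemma SlopeSpace.exists_pow_gen (h : SlopeSpace T Y r E) (l : K) :
    ∃ n, ∀ v ∈ h.gen l, ((T - l • (1 : Module.End K V)) ^ n) v = 0 := by
  have := h.finite
  refine ⟨Module.finrank K E, ?_⟩
  rintro _ ⟨w, hw, rfl⟩
  change w ∈ h.op.maxGenEigenspace l at hw
  rw [Module.End.maxGenEigenspace_eq_genEigenspace_finrank, Module.End.mem_genEigenspace_nat,
    LinearMap.mem_ker] at hw
  have := congrArg Subtype.val hw
  rwa [h.coe_sub_pow] at this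

lemma SlopeSpace.count_roots (h : SlopeSpace T Y r E) [FiniteDimensional K E] [DecidableEq K]
    (l : K) : (LinearMap.charpoly h.op).roots.count l = Module.finrank K (h.gen l) := by
  rw [Polynomial.count_roots, ← LinearMap.finrank_maxGenEigenspace_eq, gen]
  exact (Submodule.finrank_map_subtype_eq E _).symm

lemma SlopeSpace.map_gen_le (h : SlopeSpace T Y r E)
    (hmax : ∀ E', SlopeSpace T Y r E' → E' ≤ E) (hY : ∀ v ∈ Y, N v ∈ Y)
    (hcomm : ∀ v, T (N v) = a • N (T v)) {l : K} (hl : 1 ≤ ‖a * l‖ * r) :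
    (h.gen l).map N ≤ h.gen (a * l) := by
  have := h.finite
  obtain ⟨n, hn⟩ := h.exists_pow_gen l
  have hN : ∀ v ∈ h.gen l, ((T - (a * l) • (1 : Module.End K V)) ^ n) (N v) = 0 := fun v hv => by
    rw [pow_sub_smul_comm hcomm, hn v hv, map_zero, smul_zero]
  have hT : ∀ v ∈ h.gen l, T v ∈ h.gen l := by
    intro v hv
    obtain ⟨hv, m, hm⟩ := h.mem_gen.1 hv
    refine h.mem_gen.2 ⟨h.stable v hv, m, ?_⟩
    have : Commute ((T - l • (1 : Module.End K V)) ^ m) T :=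
      Commute.pow_left ((Commute.refl T).sub_left ((Commute.one_left T).smul_left l)) m
    rw [← Module.End.mul_apply, this.eq, Module.End.mul_apply, hm, map_zero]
  have hfin : FiniteDimensional K (h.gen l) := Submodule.finiteDimensional_of_le (h.gen_le l)
  have hW : SlopeSpace T Y r ((h.gen l).map N) := by
    refine ⟨?_, inferInstance, ?_, (X - Polynomial.C (a * l)) ^ n,
      pow_ne_zero _ (X_sub_C_ne_zero _), ?_, ?_⟩
    · rintro _ ⟨v, hv, rfl⟩
      exact hY v (h.le_bdd (h.gen_le l hv))
    · rintro _ ⟨v, hv, rfl⟩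
      rw [hcomm]
      exact Submodule.smul_mem _ _ ⟨_, hT v hv, rfl⟩
    · intro b hb
      have : b - a * l = 0 := by
        by_contra h0
        have h1 : eval b ((X - Polynomial.C (a * l)) ^ n) = 0 := hb
        rw [eval_pow, eval_sub, eval_X, eval_C] at h1
        exact pow_ne_zero n h0 h1
      rw [sub_eq_zero.1 this]; exact hl
    · rintro _ ⟨v, hv, rfl⟩
      have h1 : aeval T ((X - Polynomial.C (a * l)) ^ n) = (T - (a * l) • (1 : Module.End K V)) ^ n := by
        rw [map_pow, map_sub, aeval_X, aeval_C, Algebra.algebraMap_eq_smul_one]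
      rw [h1]
      exact hN v hv
  rintro _ ⟨v, hv, rfl⟩
  exact h.mem_gen.2 ⟨hmax _ hW ⟨v, hv, rfl⟩, n, hN v hv⟩

lemma SlopeSpace.finrank_gen_le (h : SlopeSpace T Y r E)
    (hmax : ∀ E', SlopeSpace T Y r E' → E' ≤ E) (hY : ∀ v ∈ Y, N v ∈ Y)
    (ha : a ≠ 0) (hcomm : ∀ v, T (N v) = a • N (T v)) {k : ℕ}
    (hk : ∀ W : Submodule K V, FiniteDimensional K W → W ≤ Y → W ≤ LinearMap.ker N →
      Module.finrank K W ≤ k) {J : Finset K} [DecidableEq K]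
    (hJ : ∀ v ∈ Y, N v = 0 → ∀ l : K, l ≠ 0 → T v = l • v → v ≠ 0 → l ∈ J)
    {l : K} (hl : 1 ≤ ‖a * l‖ * r) :
    Module.finrank K (h.gen l) ≤ Module.finrank K (h.gen (a * l)) + if l ∈ J then k else 0 := by
  have hl0 : l ≠ 0 := by
    rintro rfl
    rw [mul_zero, norm_zero, zero_mul] at hl
    linarith
  have := h.finite
  have hfin l : FiniteDimensional K (h.gen l) :=
    Submodule.finiteDimensional_of_le (h.gen_le l)
  rw [← LinearMap.finrank_range_add_finrank_ker (N.domRestrict (h.gen l))]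
  refine add_le_add ?_ ?_
  · rw [LinearMap.range_domRestrict]
    exact Submodule.finrank_mono (h.map_gen_le hmax hY hcomm hl)
  · set W := LinearMap.ker (N.domRestrict (h.gen l)) with hW
    have hmem : ∀ v ∈ W.map (h.gen l).subtype, v ∈ h.gen l ∧ N v = 0 := by
      rintro _ ⟨w, hw, rfl⟩
      exact ⟨w.2, by simpa [hW] using hw⟩
    rw [← Submodule.finrank_map_subtype_eq]
    split_ifs with hlJ
    · exact hk _ inferInstance (fun v hv => h.le_bdd (h.gen_le l (hmem v hv).1))
        fun v hv => (hmem v hv).2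
    · rw [Nat.le_zero, Submodule.finrank_eq_zero, Submodule.eq_bot_iff]
      intro v hv
      by_contra hv0
      obtain ⟨hvl, hNv⟩ := hmem v hv
      obtain ⟨hvE, hex⟩ := h.mem_gen.1 hvl
      classical
      obtain ⟨n, hn, hn'⟩ : ∃ n, ((T - l • (1 : Module.End K V)) ^ n) v = 0 ∧
          ∀ m < n, ((T - l • (1 : Module.End K V)) ^ m) v ≠ 0 :=
        ⟨Nat.find hex, Nat.find_spec hex, fun m => Nat.find_min hex⟩
      cases n with
      | zero => exact hv0 hn
      | succ n =>
        refine hlJ (hJ (((T - l • (1 : Module.End K V)) ^ n) v) ?_ ?_ l hl0 ?_ (hn' n n.lt_succ_self))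
        · rw [← h.coe_sub_pow l n ⟨v, hvE⟩]
          exact h.le_bdd (Subtype.mem _)
        · have h1 := pow_sub_smul_comm hcomm l n v
          rw [hNv, map_zero] at h1
          exact (smul_eq_zero.1 h1.symm).resolve_left (pow_ne_zero n ha)
        · rw [pow_succ', Module.End.mul_apply] at hn
          exact sub_eq_zero.1 hn

end Horizontal

section Division
open PowerSeries
variable {K : Type*} [NormedField K] [IsUltrametricDist K] {r : ℝ}

lemma norm_coeff_mul_le_one (hr : 0 < r) {f g : K⟦X⟧} (hf : ∀ n, ‖coeff n f‖ * r ^ n ≤ 1)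
    (hg : ∀ n, ‖coeff n g‖ * r ^ n ≤ 1) (n : ℕ) : ‖coeff n (f * g)‖ * r ^ n ≤ 1 := by
  rw [coeff_mul, ← le_div_iff₀ (by positivity)]
  refine norm_sum_le_of_forall_le_of_nonneg (by positivity) fun x hx => ?_
  rw [le_div_iff₀ (by positivity), norm_mul, ← HasAntidiagonal.mem_antidiagonal.1 hx, pow_add,
    mul_mul_mul_comm]
  exact mul_le_one₀ (hf _) (by positivity) (hg _)

lemma DiscBounded.of_mul (hr : 0 < r) {w h : K⟦X⟧} (h0 : coeff 0 h = 1)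
    (hh : ∀ n, ‖coeff n h‖ * r ^ n ≤ 1) (hw : DiscBounded r (w * h)) : DiscBounded r w := by
  obtain ⟨B, hB⟩ := hw
  have hB0 : 0 ≤ B := le_trans (by positivity) (hB 0)
  refine ⟨B, fun n => ?_⟩
  induction n using Nat.strong_induction_on with
  | _ n ih =>
    have h1 : coeff n w = coeff n (w * h) -
        ∑ x ∈ (antidiagonal n).erase (n, 0), coeff x.1 w * coeff x.2 h := by
      rw [coeff_mul, ← Finset.add_sum_erase _ _ (HasAntidiagonal.mem_antidiagonal (a := (n, 0)).2
        (add_zero n)), h0, mul_one, add_sub_cancel_right]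
    rw [h1, ← le_div_iff₀ (by positivity), sub_eq_add_neg]
    refine (norm_add_le_max _ _).trans (max_le ?_ ?_)
    · rw [le_div_iff₀ (by positivity)]; exact hB n
    · rw [norm_neg]
      refine norm_sum_le_of_forall_le_of_nonneg (by positivity) fun x hx => ?_
      obtain ⟨hx0, hx⟩ := Finset.mem_erase.1 hx
      have hx1 := HasAntidiagonal.mem_antidiagonal.1 hx
      have hlt : x.1 < n := by
        rcases Nat.eq_zero_or_pos x.2 with h2 | h2
        · exact absurd (Prod.ext (by simpa [h2] using hx1) h2) hx0
        · omega
      rw [le_div_iff₀ (by positivity), norm_mul, ← hx1, pow_add, mul_mul_mul_comm]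
      have h3 := ih x.1 hlt
      calc _ ≤ B * 1 := mul_le_mul h3 (hh _) (by positivity) hB0
        _ = B := mul_one B

lemma norm_coeff_prod_le_one (hr : 0 < r) (s : Multiset K) (hs : ∀ a ∈ s, ‖a‖ * r ≤ 1) :
    coeff 0 (s.map fun a => 1 - C a * (X : K⟦X⟧)).prod = 1 ∧
      ∀ n, ‖coeff n (s.map fun a => 1 - C a * (X : K⟦X⟧)).prod‖ * r ^ n ≤ 1 := by
  induction s using Multiset.induction_on with
  | empty =>
    refine ⟨by simp, fun n => ?_⟩
    rcases eq_or_ne n 0 with rfl | hn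
    · simp
    · simp [coeff_one, hn]
  | cons a s ih =>
    obtain ⟨h0, h1⟩ := ih fun b hb => hs b (Multiset.mem_cons_of_mem hb)
    rw [Multiset.map_cons, Multiset.prod_cons]
    refine ⟨by simp only [coeff_zero_eq_constantCoeff, map_mul] at h0 ⊢; rw [h0]; simp,
      norm_coeff_mul_le_one hr (fun n => ?_) h1⟩
    match n with
    | 0 => simp
    | 1 => simpa [coeff_one, coeff_X] using hs a (Multiset.mem_cons_self a s)
    | n + 2 => simp [coeff_one]

lemma rescale_prod (c : K) (s : Multiset K) :
    rescale c (s.map fun a => 1 - C a * (X : K⟦X⟧)).prod =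
      ((s.map (c * ·)).map fun a => 1 - C a * (X : K⟦X⟧)).prod := by
  rw [map_multiset_prod, Multiset.map_map, Multiset.map_map]
  congr 2
  ext1 a
  simp only [Function.comp_apply, map_sub, map_one, map_mul, rescale_X]
  have h1 : rescale c (C a) = (C a : K⟦X⟧) := by
    ext n
    rcases eq_or_ne n 0 with rfl | hn <;> simp [coeff_C, *]
  rw [h1]
  ring

end Division

section Zeta
open PowerSeries
variable {K : Type*} [NontriviallyNormedField K] [IsUltrametricDist K] [CompleteSpace K]
  [IsAlgClosed K] [CharZero K]
  {C' q r : ℝ} {A : (ℕ →₀ K) →ₗ[K] (ℕ →₀ K)}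

/-- If `N` is an operator on sequences satisfying `T N = a N T` with small kernel on bounded
sequences, then `det (1 - A X) / det (1 - a A X)` has few poles. -/
lemma RowDecay.discBounded_zeta (hA : RowDecay A C' q) {N : Module.End K (ℕ → K)} {a : K}
    (ha : a ≠ 0) (ha1 : ‖a‖ ≤ 1) (hY : ∀ v ∈ bddSeq K, N v ∈ bddSeq K)
    (hcomm : ∀ v, seqOp A (N v) = a • N (seqOp A v)) {k : ℕ}
    (hk : ∀ W : Submodule K (ℕ → K), FiniteDimensional K W → W ≤ bddSeq K → W ≤ LinearMap.ker N →
      Module.finrank K W ≤ k) {J : Finset K}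
    (hJ : ∀ v ∈ bddSeq K, N v = 0 → ∀ l : K, l ≠ 0 → seqOp A v = l • v → v ≠ 0 → l ∈ J)
    {Z : K⟦X⟧} (hZ : Z * rescale a (fredholm A) = fredholm A) (hr : 0 < r) :
    DiscBounded r (Z * ((k • J.val.map (a * ·)).map fun b => 1 - C b * X).prod) := by
  classical
  obtain ⟨E, hE, hfin, g, hmax, hg0, hg, hdet⟩ := hA.exists_slopeSpace hr
  set s := (LinearMap.charpoly hE.op).roots with hs
  let L : Multiset K → K⟦X⟧ := fun s => (s.map fun b => 1 - C b * X).prod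
  have hLadd s t : L (s + t) = L s * L t := by simp [L]
  set s₁ := s.filter fun b => 1 ≤ ‖a * b‖ * r with hs₁
  set s₂ := s.filter fun b => ¬ 1 ≤ ‖a * b‖ * r with hs₂
  have hss : s₁ + s₂ = s := Multiset.filter_add_not _ s
  set Q := k • J.val.map (a * ·) with hQ
  have hinj : Function.Injective (a * ·) := mul_right_injective₀ ha
  have hle : s₁.map (a * ·) ≤ s + Q := by
    rw [Multiset.le_iff_count]
    intro b
    obtain ⟨l, rfl⟩ : ∃ l, b = a * l := ⟨a⁻¹ * b, (mul_inv_cancel_left₀ ha b).symm⟩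
    have h1 : (s₁.map (a * ·)).count (a * l) = s₁.count l := Multiset.count_map_eq_count' _ _ hinj l
    have h2 : (J.val.map (a * ·)).count (a * l) = J.val.count l :=
      Multiset.count_map_eq_count' _ _ hinj l
    rw [h1, Multiset.count_add, hQ, Multiset.count_nsmul, h2, hs₁, Multiset.count_filter]
    split_ifs with hl
    · have h3 := hE.finrank_gen_le hmax hY ha hcomm hk hJ hl
      rw [hs, hE.count_roots, hE.count_roots]
      refine h3.trans (Nat.add_le_add_left ?_ _)
      split_ifs with hlJ
      · rw [Multiset.count_eq_one_of_mem J.nodup hlJ, mul_one]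
      · exact Nat.zero_le _
    · exact Nat.zero_le _
  obtain ⟨t, ht⟩ := Multiset.le_iff_exists_add.1 hle
  have hL0 : L (s₁.map (a * ·)) ≠ 0 := by
    intro h
    have h1 := congrArg (coeff 0) h
    simp only [L, coeff_zero_eq_constantCoeff, map_multiset_prod, Multiset.map_map] at h1
    simp at h1
  obtain ⟨h20, h21⟩ := norm_coeff_prod_le_one hr (s₂.map (a * ·)) (by
    intro b hb
    obtain ⟨c, hc, rfl⟩ := Multiset.mem_map.1 hb
    exact (not_le.1 (Multiset.mem_filter.1 hc).2).le)
  have hkey : (Z * L Q) * (L (s₂.map (a * ·)) * rescale a g) = L t * g := by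
    apply mul_left_cancel₀ hL0
    rw [hdet, map_mul, rescale_prod, ← hss, Multiset.map_add] at hZ
    change Z * (L (s₁.map (a * ·) + s₂.map (a * ·)) * rescale a g) = L (s₁ + s₂) * g at hZ
    rw [hLadd, hss] at hZ
    have h4 : L s * L Q = L (s₁.map (a * ·)) * L t := by rw [← hLadd, ← hLadd, ht]
    linear_combination L Q * hZ + g * h4
  refine DiscBounded.of_mul hr (h := L (s₂.map (a * ·)) * rescale a g) ?_ ?_ ?_
  · simp only [coeff_zero_eq_constantCoeff, map_mul] at h20 hg0 ⊢
    rw [← coeff_zero_eq_constantCoeff_apply (rescale a g), coeff_rescale, pow_zero, one_mul,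
      coeff_zero_eq_constantCoeff_apply, hg0, mul_one]
    exact h20
  · refine norm_coeff_mul_le_one hr h21 fun n => ?_
    rw [coeff_rescale, norm_mul, norm_pow, mul_assoc]
    exact mul_le_one₀ (pow_le_one₀ (norm_nonneg a) ha1) (by positivity) (hg n)
  · rw [hkey]
    exact DiscBounded.prod hr ⟨1, hg⟩ t

end Zeta

section CharacterSums
variable {p : ℕ} [hp : Fact p.Prime] {K : Type*} [NormedField K] [IsUltrametricDist K]

lemma norm_add_pow_prime_sub_le (hK : ‖(p : K)‖ = (p : ℝ)⁻¹) {x y : K} (hx : ‖x‖ ≤ 1)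
    (hy : ‖y‖ ≤ 1) : ‖(x + y) ^ p - (x ^ p + y ^ p)‖ ≤ (p : ℝ)⁻¹ := by
  rw [add_pow_prime_eq hp.1, add_sub_cancel_left, norm_mul, norm_mul, norm_mul, hK, mul_assoc,
    mul_assoc]
  have hpow (z : K) (n : ℕ) : ‖z‖ ≤ 1 → ‖z ^ n‖ ≤ 1 := fun hz => by
    rw [norm_pow]; exact pow_le_one₀ (norm_nonneg _) hz
  refine mul_le_of_le_one_right (by positivity) (mul_le_one₀ hx (by positivity)
    (mul_le_one₀ hy (by positivity)
      (norm_sum_le_of_forall_le_of_nonneg zero_le_one fun i _ => ?_)))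
  rw [norm_mul, norm_mul]
  exact mul_le_one₀ (mul_le_one₀ (hpow _ _ hx) (norm_nonneg _) (hpow _ _ hy)) (norm_nonneg _)
    (norm_natCast_le_one K _)

lemma norm_sum_pow_prime_sub_le (hK : ‖(p : K)‖ = (p : ℝ)⁻¹) {α : Type*} (s : Finset α)
    {x : α → K} (hx : ∀ i, ‖x i‖ ≤ 1) :
    ‖(∑ i ∈ s, x i) ^ p - ∑ i ∈ s, x i ^ p‖ ≤ (p : ℝ)⁻¹ := by
  classical
  induction s using Finset.induction_on with
  | empty => simp [zero_pow hp.1.ne_zero]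
  | insert a s ha ih =>
    rw [sum_insert ha, sum_insert ha]
    have h1 := norm_add_pow_prime_sub_le hK (hx a)
      (norm_sum_le_of_forall_le_of_nonneg zero_le_one fun i (_ : i ∈ s) => hx i)
    have h2 := (norm_add_le_max _ _).trans (max_le h1 ih)
    refine (le_of_eq (congrArg norm ?_)).trans h2
    ring

/-- A sum of roots of unity of order prime to `p` is either a unit or divisible by `p`. -/
lemma norm_sum_roots_le (hK : ‖(p : K)‖ = (p : ℝ)⁻¹) {k : ℕ} (hk : ¬ p ∣ k) {α : Type*}
    (s : Finset α) {x : α → K} (hx : ∀ i, x i ^ k = 1) (h1 : ‖∑ i ∈ s, x i‖ < 1) :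
    ‖∑ i ∈ s, x i‖ ≤ (p : ℝ)⁻¹ := by
  have hk0 : k ≠ 0 := by rintro rfl; simp at hk
  have hx1 i : ‖x i‖ = 1 :=
    (pow_eq_one_iff_of_nonneg (norm_nonneg _) hk0).1 (by rw [← norm_pow, hx, norm_one])
  have hbd : ∀ i, ‖∑ r ∈ s, x r ^ p ^ i‖ ≤ max (‖∑ r ∈ s, x r‖ ^ p ^ i) (p : ℝ)⁻¹ := by
    have hp1 : (p : ℝ)⁻¹ ≤ 1 := inv_le_one_of_one_le₀ (by exact_mod_cast hp.1.one_le)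
    intro i
    induction i with
    | zero => simp
    | succ i ih =>
      have h2 := norm_sum_pow_prime_sub_le hK s (x := fun r => x r ^ p ^ i)
        fun r => by rw [norm_pow, hx1, one_pow]
      have h3 : ‖(∑ r ∈ s, x r ^ p ^ i) ^ p‖ ≤ max (‖∑ r ∈ s, x r‖ ^ p ^ (i + 1)) (p : ℝ)⁻¹ := by
        rw [norm_pow]
        refine (pow_le_pow_left₀ (norm_nonneg _) ih p).trans ?_
        rcases le_total (‖∑ r ∈ s, x r‖ ^ p ^ i) (p : ℝ)⁻¹ with h | h
        · rw [max_eq_right h]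
          exact le_max_of_le_right (pow_le_of_le_one (by positivity) hp1 hp.1.ne_zero)
        · rw [max_eq_left h, ← pow_mul, ← pow_succ]
          exact le_max_left _ _
      have h4 : ∑ r ∈ s, x r ^ p ^ (i + 1)
          = (∑ r ∈ s, x r ^ p ^ i) ^ p
            + -((∑ r ∈ s, x r ^ p ^ i) ^ p - ∑ r ∈ s, (x r ^ p ^ i) ^ p) := by
        simp only [← pow_mul, ← pow_succ]; ring
      rw [h4]
      refine (norm_add_le_max _ _).trans (max_le h3 ?_)
      rw [norm_neg]
      exact h2.trans (le_max_right _ _)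
  have hcop : p.Coprime k := (Nat.Prime.coprime_iff_not_dvd hp.1).2 hk
  have hf : k ∣ p ^ k.totient - 1 := (Nat.modEq_iff_dvd' (Nat.one_le_pow _ _ hp.1.pos)).1
    (Nat.ModEq.pow_totient hcop).symm
  obtain ⟨c, hc⟩ := hf
  have hp1 := Nat.one_le_pow k.totient p hp.1.pos
  have hper r : x r ^ p ^ k.totient = x r := by
    rw [show p ^ k.totient = k * c + 1 by omega, pow_succ, pow_mul, hx, one_pow, one_mul]
  have h5 := hbd k.totient
  simp only [hper] at h5
  rcases le_max_iff.1 h5 with h | h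
  · by_cases h0 : ‖∑ r ∈ s, x r‖ = 0
    · rw [h0]; positivity
    · have h6 : 1 < p ^ k.totient :=
        Nat.one_lt_pow (Nat.totient_pos.2 (Nat.pos_of_ne_zero hk0)).ne' hp.1.one_lt
      exact absurd h (not_le.2 (pow_lt_self_of_lt_one₀
        (lt_of_le_of_ne (norm_nonneg _) (Ne.symm h0)) h1 h6))
  · exact h

end CharacterSums

section FormalSolutions
open PowerSeries
variable {p : ℕ} [hp : Fact p.Prime] {K : Type*} [NormedField K] [IsUltrametricDist K]

/-- The increments in the recursion for the formal solution at infinity. -/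
noncomputable def solStep (k : ℕ) (ζ : K) (n : ℕ) (u : ℕ → K) (i : ℕ) : K :=
  ∑ j ∈ range i, -(ζ⁻¹ * ((n : K) - j + ((k : K) - 1) / 2) * u j / k)

/-- The normalised coefficients of the formal solution at infinity attached to the
`k`-th root of unity `ζ`. -/
noncomputable def solCoeff (k : ℕ) (ζ : K) : ℕ → ℕ → K
  | 0 => fun _ => 1
  | n + 1 => fun i => solStep k ζ n (solCoeff k ζ n) i
      - (∑ j ∈ range k, (((n + 1 : ℕ) : K) - j + ((k : K) - 1) / 2) *
          solStep k ζ n (solCoeff k ζ n) j) / (k * ((n + 1 : ℕ) : K))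

variable {k : ℕ} {ζ : K}

lemma sum_weights (h2 : (2 : K) ≠ 0) (n : ℕ) :
    ∑ j ∈ range k, ((n : K) - j + ((k : K) - 1) / 2) = k * n := by
  rw [sum_add_distrib, sum_sub_distrib, sum_const, sum_const, card_range, nsmul_eq_mul,
    nsmul_eq_mul]
  have h := Finset.sum_range_id_mul_two k
  have h' : (∑ j ∈ range k, (j : K)) * 2 = k * (k - 1) := by
    rcases Nat.eq_zero_or_pos k with rfl | hk
    · simp
    · have := congrArg (Nat.cast : ℕ → K) h
      push_cast [Nat.cast_sub hk] at this
      exact this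
  field_simp
  linear_combination -h'

lemma sum_solCoeff [CharZero K] (hk : k ≠ 0) (n : ℕ) :
    ∑ j ∈ range k, ((n : K) - j + ((k : K) - 1) / 2) * solCoeff k ζ n j = 0 := by
  cases n with
  | zero => simpa [solCoeff] using sum_weights (K := K) (k := k) two_ne_zero 0
  | succ n =>
    have hk' : (k : K) ≠ 0 := Nat.cast_ne_zero.2 hk
    have hn : ((n + 1 : ℕ) : K) ≠ 0 := Nat.cast_ne_zero.2 n.succ_ne_zero
    simp only [solCoeff, mul_sub, sum_sub_distrib, ← sum_mul]
    rw [sum_weights two_ne_zero, mul_div_cancel₀ _ (mul_ne_zero hk' hn), ← sum_sub_distrib]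
    exact sum_eq_zero fun j _ => sub_self _

lemma solStep_card [CharZero K] (hk : k ≠ 0) (n : ℕ) :
    solStep k ζ n (solCoeff k ζ n) k = 0 := by
  have h := sum_solCoeff (ζ := ζ) hk n
  rw [solStep, sum_neg_distrib]
  have : ∀ j : ℕ, ζ⁻¹ * ((n : K) - j + ((k : K) - 1) / 2) * solCoeff k ζ n j / k
      = ζ⁻¹ / k * (((n : K) - j + ((k : K) - 1) / 2) * solCoeff k ζ n j) := fun j => by ring
  simp only [this, ← mul_sum, h, mul_zero, neg_zero]

lemma solCoeff_succ (n i : ℕ) :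
    solCoeff k ζ (n + 1) (i + 1) - solCoeff k ζ (n + 1) i
      = -(ζ⁻¹ * ((n : K) - i + ((k : K) - 1) / 2) * solCoeff k ζ n i / k) := by
  simp only [solCoeff, solStep, sum_range_succ]
  ring

lemma solCoeff_card [CharZero K] (hk : k ≠ 0) (n : ℕ) :
    solCoeff k ζ n k = solCoeff k ζ n 0 := by
  cases n with
  | zero => rfl
  | succ n =>
    have h : solStep k ζ n (solCoeff k ζ n) 0 = 0 := by simp [solStep]
    simp only [solCoeff, solStep_card hk, h]

lemma norm_solCoeff_le [CharZero K] (hk1 : ‖(k : K)‖ = 1) (h2 : ‖(2 : K)‖ = 1) (hζ : ‖ζ‖ = 1)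
    (n i : ℕ) : ‖solCoeff k ζ n i‖ * ‖(n.factorial : K)‖ ≤ 1 := by
  have hw (n j : ℕ) : ‖(n : K) - j + ((k : K) - 1) / 2‖ ≤ 1 := by
    refine (norm_add_le_max _ _).trans (max_le ?_ ?_)
    · rw [sub_eq_add_neg]
      refine (norm_add_le_max _ _).trans (max_le
        (norm_natCast_le_one K n) ?_)
      rw [norm_neg]
      exact norm_natCast_le_one K j
    · rw [norm_div, h2, div_one, sub_eq_add_neg]
      refine (norm_add_le_max _ _).trans (max_le hk1.le (by simp))
  induction n generalizing i with
  | zero => simp [solCoeff]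
  | succ n ih =>
    have hn : (0 : ℝ) < ‖(n.factorial : K)‖ :=
      norm_pos_iff.2 (Nat.cast_ne_zero.2 n.factorial_ne_zero)
    have hn1 : (0 : ℝ) < ‖((n + 1 : ℕ) : K)‖ := norm_pos_iff.2 (Nat.cast_ne_zero.2 n.succ_ne_zero)
    have hs i : ‖solStep k ζ n (solCoeff k ζ n) i‖ ≤ ‖(n.factorial : K)‖⁻¹ := by
      refine norm_sum_le_of_forall_le_of_nonneg (by positivity) fun j _ => ?_
      rw [norm_neg, norm_div, hk1, div_one, norm_mul, norm_mul, norm_inv, hζ, inv_one, one_mul]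
      have := (le_div_iff₀ hn).2 (ih j)
      rw [one_div] at this
      exact (mul_le_of_le_one_left (norm_nonneg _) (hw n j)).trans this
    have hle : ‖((n + 1 : ℕ) : K)‖ ≤ 1 := norm_natCast_le_one K _
    rw [Nat.factorial_succ, Nat.cast_mul, norm_mul, ← le_div_iff₀ (by positivity), one_div, mul_inv]
    simp only [solCoeff]
    rw [sub_eq_add_neg]
    refine (norm_add_le_max _ _).trans (max_le ?_ ?_)
    · exact (hs i).trans (le_mul_of_one_le_left (by positivity) ((one_le_inv₀ hn1).2 hle))
    · rw [norm_neg, norm_div, norm_mul, hk1, one_mul, div_eq_inv_mul]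
      refine mul_le_mul_of_nonneg_left ?_ (by positivity)
      refine norm_sum_le_of_forall_le_of_nonneg (by positivity) fun j _ => ?_
      rw [norm_mul]
      exact (mul_le_of_le_one_left (norm_nonneg _) (hw (n + 1) j)).trans (hs j)

/-- The formal solution at infinity of the hyper-Kloosterman equation attached to `ζ`. -/
noncomputable def formalSol (k : ℕ) (ζ : K) (i : Fin k) : K⟦X⟧ :=
  PowerSeries.mk fun n => ζ ^ (i : ℕ) * solCoeff k ζ n i

lemma coeff_formalSol_add_one [CharZero K] [NeZero k] (hζ : ζ ^ k = 1) (n : ℕ) (i : Fin k) :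
    coeff n (formalSol k ζ (i + 1)) = ζ ^ ((i : ℕ) + 1) * solCoeff k ζ n (i + 1) := by
  have hk : k ≠ 0 := NeZero.ne k
  rw [formalSol, coeff_mk]
  by_cases h : (i : ℕ) + 1 = k
  · have h0 : ((i + 1 : Fin k) : ℕ) = 0 := by
      rw [Fin.val_add, Fin.val_one', Nat.add_mod_mod, h, Nat.mod_self]
    rw [h0, h, hζ, solCoeff_card hk, pow_zero]
  · have h0 : ((i + 1 : Fin k) : ℕ) = i + 1 := by
      rw [Fin.val_add, Fin.val_one', Nat.add_mod_mod, Nat.mod_eq_of_lt]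
      have := i.2
      omega
    rw [h0]

lemma formalSol_eq [CharZero K] [NeZero k] (hζ : ζ ^ k = 1) (i : Fin k) :
    X * (X * d⁄dX K (formalSol k ζ i))
      = C (((i : ℕ) : K) - ((k : K) - 1) / 2) * X * formalSol k ζ i
        - C (k : K) * formalSol k ζ (i + 1) + C (k * ζ) * formalSol k ζ i := by
  have hk : (k : K) ≠ 0 := Nat.cast_ne_zero.2 (NeZero.ne k)
  have hζ0 : ζ ≠ 0 := by
    rintro rfl
    rw [zero_pow (NeZero.ne k)] at hζ
    exact zero_ne_one hζ
  ext n
  rw [map_add, map_sub, mul_assoc, coeff_C_mul, coeff_C_mul, coeff_C_mul,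
    coeff_formalSol_add_one hζ]
  cases n with
  | zero =>
    rw [coeff_zero_X_mul, coeff_zero_X_mul, formalSol, coeff_mk]
    simp only [solCoeff]
    ring
  | succ n =>
    rw [coeff_succ_X_mul, coeff_succ_X_mul, coeff_X_mul_derivative]
    have h := solCoeff_succ (k := k) (ζ := ζ) n i
    simp only [formalSol, coeff_mk]
    rw [eq_add_of_sub_eq h]
    field_simp
    ring

variable {R : ℕ}

/-- Products of formal solutions. -/
noncomputable def formalSolProd (k : ℕ) (ζ : Fin R → K) (I : Fin R → Fin k) : K⟦X⟧ :=
  ∏ r, formalSol k (ζ r) (I r)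

lemma formalSolProd_eq [CharZero K] [NeZero k] {ζ : Fin R → K} (hζ : ∀ r, ζ r ^ k = 1)
    (I : Fin R → Fin k) :
    X * (X * d⁄dX K (formalSolProd k ζ I))
      = C ((∑ r, ((I r : ℕ) : K)) - R * (((k : K) - 1) / 2)) * X * formalSolProd k ζ I
        - C (k : K) * ∑ r, formalSolProd k ζ (I + Pi.single r 1)
        + C (k * ∑ r, ζ r) * formalSolProd k ζ I := by
  have h1 r : formalSolProd k ζ (I + Pi.single r 1)
      = (∏ s ∈ univ.erase r, formalSol k (ζ s) (I s)) * formalSol k (ζ r) (I r + 1) := by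
    rw [formalSolProd, ← prod_erase_mul _ _ (mem_univ r)]
    congr 1
    · refine prod_congr rfl fun s hs => ?_
      rw [Pi.add_apply, Pi.single_eq_of_ne (ne_of_mem_erase hs), add_zero]
    · rw [Pi.add_apply, Pi.single_eq_same]
  have h2 r : formalSolProd k ζ I
      = (∏ s ∈ univ.erase r, formalSol k (ζ s) (I s)) * formalSol k (ζ r) (I r) := by
    rw [formalSolProd, ← prod_erase_mul _ _ (mem_univ r)]
  have h3 : X * (X * d⁄dX K (formalSolProd k ζ I))
      = ∑ r, (∏ s ∈ univ.erase r, formalSol k (ζ s) (I s)) *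
          (X * (X * d⁄dX K (formalSol k (ζ r) (I r)))) := by
    rw [formalSolProd, derivation_prod, mul_sum, mul_sum]
    refine sum_congr rfl fun r _ => ?_
    rw [smul_eq_mul]
    ring
  have h4 r : (∏ s ∈ univ.erase r, formalSol k (ζ s) (I s)) *
          (X * (X * d⁄dX K (formalSol k (ζ r) (I r))))
      = C (((I r : ℕ) : K) - ((k : K) - 1) / 2) * X * formalSolProd k ζ I
        - C (k : K) * formalSolProd k ζ (I + Pi.single r 1)
        + C (k * ζ r) * formalSolProd k ζ I := by
    rw [h1 r, h2 r, formalSol_eq (hζ r)]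
    ring
  rw [h3]
  simp only [h4, sum_add_distrib, sum_sub_distrib, ← sum_mul, ← mul_sum, ← map_sum]
  simp [mul_sum]

end FormalSolutions

section Purity
open PowerSeries Filter Topology
variable {p : ℕ} [hp : Fact p.Prime] {K : Type*} [NormedField K] [IsUltrametricDist K] {ϖ : K}
  {R k : ℕ}

lemma norm_coeff_formalSolProd_le [CharZero K] (hK : ‖(p : K)‖ = (p : ℝ)⁻¹)
    (hϖ : ϖ ^ (p - 1) = -p) (hp2 : p ≠ 2) (hk : ¬ p ∣ k) {ζ : Fin R → K} (hζ : ∀ r, ζ r ^ k = 1)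
    (I : Fin R → Fin k) (n : ℕ) : ‖coeff n (formalSolProd k ζ I)‖ * ‖ϖ‖ ^ n ≤ 1 := by
  have h2 : ‖(2 : K)‖ = 1 := by
    exact_mod_cast norm_natCast_of_not_dvd (K := K) hK (n := 2)
      (fun h => hp2 ((Nat.prime_dvd_prime_iff_eq hp.1 Nat.prime_two).1 h))
  have hone r : ‖ζ r‖ = 1 := norm_eq_one_of_pow (hζ r) (by rintro rfl; simp at hk)
  rw [formalSolProd]
  induction univ (α := Fin R) using Finset.induction_on generalizing n with
  | empty =>
    rw [prod_empty, coeff_one]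
    split_ifs with h <;> simp [h]
  | insert r s hr ih =>
    rw [prod_insert hr]
    refine norm_coeff_mul_le_one (norm_varpi_pos hK hϖ) (fun n => ?_) ih n
    rw [formalSol, coeff_mk, norm_mul, norm_pow, hone, one_pow, one_mul]
    exact (mul_le_mul_of_nonneg_left (norm_varpi_pow_le_factorial hK hϖ n) (norm_nonneg _)).trans
      (norm_solCoeff_le (norm_natCast_of_not_dvd hK hk) h2 (hone r) n _)

lemma coeff_zero_formalSolProd (ζ : Fin R → K) (I : Fin R → Fin k) :
    coeff 0 (formalSolProd k ζ I) = ∏ r, ζ r ^ (I r : ℕ) := by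
  simp [formalSolProd, map_prod, formalSol, solCoeff, ← coeff_zero_eq_constantCoeff_apply]

/-- The terms of the pairing of a solution at the origin with a formal solution at infinity. -/
noncomputable def twist (k : ℕ) (ζ : Fin R → K) (W : ℕ → (Fin R → Fin k) → K) (D n : ℕ) : K :=
  ∑ I, coeff n (formalSolProd k ζ I) * W (D + n) I

variable {W : ℕ → (Fin R → Fin k) → K}

lemma sum_twist [CharZero K] [NeZero k] {ζ : Fin R → K} (hζ : ∀ r, ζ r ^ k = 1) {d : K}
    (hd : d = R * (((k : K) - 1) / 2))
    (hW : ∀ D I, (((D + 1 : ℕ) : K) - ∑ r, ((I r : ℕ) : K)) * W (D + 1) I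
      + k * ∑ r, W D (I - Pi.single r 1) = 0) (D N : ℕ) :
    (((D + 1 : ℕ) : K) - d) * ∑ n ∈ range (N + 1), twist k ζ W (D + 1) n
      + ∑ I, ((N : K) - ∑ r, ((I r : ℕ) : K) + d) * coeff N (formalSolProd k ζ I) * W (D + 1 + N) I
      = -(k * (∑ r, ζ r) * ∑ n ∈ range (N + 1), twist k ζ W D n) := by
  have hstep (n : ℕ) : (((D + 1 : ℕ) : K) - d) * twist k ζ W (D + 1) n
      + ∑ I, ((n : K) - ∑ r, ((I r : ℕ) : K) + d) * coeff n (formalSolProd k ζ I)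
          * W (D + 1 + n) I
      = -(k * ∑ I, (∑ r, coeff n (formalSolProd k ζ (I + Pi.single r 1))) * W (D + n) I) := by
    have h1 : ∑ I, (∑ r, coeff n (formalSolProd k ζ (I + Pi.single r 1))) * W (D + n) I
        = ∑ I, coeff n (formalSolProd k ζ I) * ∑ r, W (D + n) (I - Pi.single r 1) := by
      simp only [sum_mul, mul_sum]
      rw [sum_comm, sum_comm (s := univ (α := Fin R → Fin k))]
      exact sum_congr rfl fun r _ =>
        Fintype.sum_equiv (Equiv.addRight (Pi.single r 1)) _ _ (by simp)
    rw [h1, twist, mul_sum, ← sum_add_distrib, mul_sum, ← sum_neg_distrib]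
    refine sum_congr rfl fun I _ => ?_
    have h2 := hW (D + n) I
    rw [show D + n + 1 = D + 1 + n by ring] at h2
    push_cast at h2 ⊢
    linear_combination coeff n (formalSolProd k ζ I) * h2
  have hzero I : ∑ r, coeff 0 (formalSolProd k ζ (I + Pi.single r 1))
      = (∑ r, ζ r) * coeff 0 (formalSolProd k ζ I) := by
    have h := congrArg (coeff 0) (formalSolProd_eq hζ I)
    rw [coeff_zero_X_mul, map_add, map_sub, mul_assoc, coeff_C_mul, coeff_C_mul, coeff_C_mul,
      coeff_zero_X_mul, map_sum] at h
    apply mul_left_cancel₀ (Nat.cast_ne_zero.2 (NeZero.ne k) : (k : K) ≠ 0)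
    linear_combination h
  have hsucc n I : (k : K) * ∑ r, coeff (n + 1) (formalSolProd k ζ (I + Pi.single r 1))
      = k * (∑ r, ζ r) * coeff (n + 1) (formalSolProd k ζ I)
        - ((n : K) - ∑ r, ((I r : ℕ) : K) + d) * coeff n (formalSolProd k ζ I) := by
    have h := congrArg (coeff (n + 1)) (formalSolProd_eq hζ I)
    rw [coeff_succ_X_mul, coeff_X_mul_derivative, map_add, map_sub, mul_assoc, coeff_C_mul,
      coeff_C_mul, coeff_C_mul, coeff_succ_X_mul, map_sum] at h
    rw [hd]
    linear_combination h
  generalize (∑ r, ζ r) = σ at *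
  induction N with
  | zero =>
    rw [sum_range_one, sum_range_one, hstep 0]
    simp only [hzero, twist, mul_sum, mul_assoc]
  | succ N ih =>
    rw [sum_range_succ, sum_range_succ (fun n => twist k ζ W D n), mul_add, add_assoc,
      hstep (N + 1), mul_add, neg_add, ← ih, twist, mul_sum, mul_sum, add_assoc]
    congr 1
    rw [mul_sum, ← sum_neg_distrib, ← sum_neg_distrib, ← sum_add_distrib]
    refine sum_congr rfl fun I _ => ?_
    rw [show D + (N + 1) = D + 1 + N by ring]
    linear_combination -(W (D + 1 + N) I) * hsucc N I

lemma sum_root_pow_mul_inv [NeZero k] {ω : K} (hω : IsPrimitiveRoot ω k) (a b : Fin k) :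
    ∑ j : Fin k, (ω ^ (j : ℕ)) ^ (a : ℕ) * ((ω ^ (j : ℕ)) ^ (b : ℕ))⁻¹
      = if a = b then (k : K) else 0 := by
  have hω0 : ω ≠ 0 := hω.ne_zero (NeZero.ne k)
  have h1 (j : Fin k) : (ω ^ (j : ℕ)) ^ (a : ℕ) * ((ω ^ (j : ℕ)) ^ (b : ℕ))⁻¹
      = (ω ^ (a : ℕ) * (ω ^ (b : ℕ))⁻¹) ^ (j : ℕ) := by
    rw [mul_pow, inv_pow, pow_right_comm, pow_right_comm ω _ b]
  simp only [h1]
  rw [Fin.sum_univ_eq_sum_range (fun j => (ω ^ (a : ℕ) * (ω ^ (b : ℕ))⁻¹) ^ j)]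
  split_ifs with h
  · subst h
    simp [mul_inv_cancel₀ (pow_ne_zero _ hω0)]
  · have hz : ω ^ (a : ℕ) * (ω ^ (b : ℕ))⁻¹ ≠ 1 := by
      rw [Ne, mul_inv_eq_one₀ (pow_ne_zero _ hω0)]
      exact fun h' => h (Fin.ext (hω.pow_inj a.2 b.2 h'))
    rw [geom_sum_eq hz]; simp [mul_pow, pow_right_comm _ _ k, hω.pow_eq_one]

lemma norm_le_of_fourier_le [NeZero k] (hk1 : ‖(k : K)‖ = 1) {ω : K} (hω : IsPrimitiveRoot ω k)
    {F : (Fin R → Fin k) → K} {b : ℝ} (hb : 0 ≤ b)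
    (h : ∀ J : Fin R → Fin k, ‖∑ I, (∏ r, (ω ^ (J r : ℕ)) ^ (I r : ℕ)) * F I‖ ≤ b)
    (I : Fin R → Fin k) : ‖F I‖ ≤ b := by
  have hω1 : ‖ω‖ = 1 := norm_eq_one_of_pow hω.pow_eq_one (NeZero.ne k)
  have horth (I' : Fin R → Fin k) :
      ∑ J : Fin R → Fin k, ∏ r, ((ω ^ (J r : ℕ)) ^ (I' r : ℕ) * ((ω ^ (J r : ℕ)) ^ (I r : ℕ))⁻¹)
        = if I' = I then (k : K) ^ R else 0 := by
    have h1 := prod_univ_sum (fun _ : Fin R => (univ : Finset (Fin k)))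
      fun r j => (ω ^ (j : ℕ)) ^ (I' r : ℕ) * ((ω ^ (j : ℕ)) ^ (I r : ℕ))⁻¹
    rw [Fintype.piFinset_univ] at h1
    simp only [← h1, sum_root_pow_mul_inv hω]
    split_ifs with hI
    · subst hI; simp
    · obtain ⟨r, hr⟩ := Function.ne_iff.1 hI
      exact prod_eq_zero (mem_univ r) (if_neg hr)
  have key : (k : K) ^ R * F I = ∑ J : Fin R → Fin k, (∏ r, ((ω ^ (J r : ℕ)) ^ (I r : ℕ))⁻¹) *
      ∑ I', (∏ r, (ω ^ (J r : ℕ)) ^ (I' r : ℕ)) * F I' := by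
    simp only [mul_sum]
    rw [sum_comm]
    have (I' : Fin R → Fin k) : ∑ J : Fin R → Fin k, (∏ r, ((ω ^ (J r : ℕ)) ^ (I r : ℕ))⁻¹) *
        ((∏ r, (ω ^ (J r : ℕ)) ^ (I' r : ℕ)) * F I')
        = (if I' = I then (k : K) ^ R else 0) * F I' := by
      rw [← horth, sum_mul]
      exact sum_congr rfl fun J _ => by rw [prod_mul_distrib]; ring
    simp only [this, ite_mul, zero_mul, sum_ite_eq', mem_univ, if_true]
  have h3 : ‖(k : K) ^ R * F I‖ ≤ b := by
    rw [key]
    exact norm_sum_le_of_forall_le_of_nonneg hb fun J _ => by simpa [norm_prod, hω1] using h J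
  simpa [hk1] using h3

/-- Solutions of the recurrence with sufficiently fast decay and sufficiently high order of
vanishing at the origin are zero. -/
lemma eq_zero_of_recurrence [CompleteSpace K] [IsAlgClosed K] [CharZero K] [NeZero k]
    (hK : ‖(p : K)‖ = (p : ℝ)⁻¹) (hϖ : ϖ ^ (p - 1) = -p) (hp2 : p ≠ 2) (hk : ¬ p ∣ k) {d : ℕ}
    (hd : (d : K) = R * (((k : K) - 1) / 2))
    (hW : ∀ D I, (((D + 1 : ℕ) : K) - ∑ r, ((I r : ℕ) : K)) * W (D + 1) I
      + k * ∑ r, W D (I - Pi.single r 1) = 0)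
    {l ρ B : ℝ} (hl1 : 1 < ‖ϖ‖ * l) (hlρ : l < ρ) (hlp : l < p * ‖ϖ‖)
    (hB : ∀ D I, ‖W D I‖ * ρ ^ D ≤ B) (h0 : ∀ D ≤ d, ∀ I, W D I = 0) (D : ℕ) (I : Fin R → Fin k) :
    W D I = 0 := by
  by_contra hne
  have hϖ0 := norm_varpi_pos hK hϖ
  have hϖ1 := norm_varpi_lt_one hK hϖ
  have hk1 : ‖(k : K)‖ = 1 := norm_natCast_of_not_dvd hK hk
  have hp0 : (0 : ℝ) < p := by exact_mod_cast hp.1.pos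
  have hl : 1 < l := by nlinarith
  have hl0 : 0 < l := by linarith
  have hρ0 : 0 < ρ := by linarith
  -- a maximal term
  obtain ⟨D₀, I₀, hmax⟩ : ∃ D₀ I₀, ∀ D I, ‖W D I‖ * l ^ D ≤ ‖W D₀ I₀‖ * l ^ D₀ := by
    have ht : Tendsto (fun n => B * (l / ρ) ^ n) atTop (𝓝 0) := by
      simpa using (tendsto_pow_atTop_nhds_zero_of_lt_one (by positivity)
        ((div_lt_one hρ0).2 hlρ)).const_mul B
    have hpos : 0 < ‖W D I‖ * l ^ D := by have := norm_pos_iff.2 hne; positivity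
    obtain ⟨N, hN⟩ := eventually_atTop.1 (ht.eventually_lt_const hpos)
    have hN' : ∀ n ≥ N, ∀ I', ‖W n I'‖ * l ^ n < ‖W D I‖ * l ^ D := fun n hn I' => by
      refine lt_of_le_of_lt ?_ (hN n hn)
      rw [div_pow, mul_div_assoc', le_div_iff₀ (by positivity)]
      nlinarith [hB n I', pow_pos hl0 n]
    have hDN : D < N := not_le.1 fun h => lt_irrefl _ (hN' D h I)
    obtain ⟨x, hx, hx'⟩ := exists_max_image (range N ×ˢ (univ : Finset (Fin R → Fin k)))
      (fun x => ‖W x.1 x.2‖ * l ^ x.1) ⟨(D, I), by simp [hDN]⟩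
    refine ⟨x.1, x.2, fun n I' => ?_⟩
    by_cases hn : n < N
    · exact hx' (n, I') (by simp [hn])
    · exact (hN' n (not_lt.1 hn) I').le.trans (hx' (D, I) (by simp [hDN]))
  set M := ‖W D₀ I₀‖ * l ^ D₀ with hM
  have hM0 : 0 < M := lt_of_lt_of_le (by have := norm_pos_iff.2 hne; positivity) (hmax D I)
  have hD₀ : d < D₀ := not_le.1 fun h => by simp [hM, h0 D₀ h] at hM0
  have hWle D I : ‖W D I‖ ≤ M / l ^ D := (le_div_iff₀ (by positivity)).2 (hmax D I)
  set t := (‖ϖ‖ * l)⁻¹ with ht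
  have ht0 : 0 < t := by positivity
  have ht1 : t < 1 := inv_lt_one_of_one_lt₀ hl1
  -- choose the twist that detects the maximal term
  have : NeZero (k : K) := ⟨Nat.cast_ne_zero.2 (NeZero.ne k)⟩
  obtain ⟨ω, hω⟩ := HasEnoughRootsOfUnity.exists_primitiveRoot K k
  obtain ⟨J, -, hJ⟩ := exists_max_image (univ : Finset (Fin R → Fin k))
    (fun J => ‖∑ I, (∏ r, (ω ^ (J r : ℕ)) ^ (I r : ℕ)) * W D₀ I‖) ⟨I₀, mem_univ _⟩
  have hJ₀ := norm_le_of_fourier_le hk1 hω (norm_nonneg _) (fun J' => hJ J' (mem_univ _)) I₀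
  have hMeq : M / l ^ D₀ = ‖W D₀ I₀‖ := by rw [hM]; field_simp
  rw [← hMeq] at hJ₀
  set ζ : Fin R → K := fun r => ω ^ (J r : ℕ) with hζdef
  have hζ r : ζ r ^ k = 1 := by rw [hζdef, ← pow_mul, mul_comm, pow_mul, hω.pow_eq_one, one_pow]
  have htw0 : twist k ζ W D₀ 0 = ∑ I, (∏ r, (ω ^ (J r : ℕ)) ^ (I r : ℕ)) * W D₀ I := by
    simp only [twist, coeff_zero_formalSolProd, add_zero, hζdef]
  rw [← htw0] at hJ₀
  -- the twisted sequence
  have hterm D n I : ‖coeff n (formalSolProd k ζ I) * W (D + n) I‖ ≤ M / l ^ D * t ^ n := by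
    have h1 := norm_coeff_formalSolProd_le hK hϖ hp2 hk hζ I n
    rw [norm_mul]
    calc _ ≤ (1 / ‖ϖ‖ ^ n) * (M / l ^ (D + n)) :=
          mul_le_mul ((le_div_iff₀ (by positivity)).2 h1) (hWle _ _) (norm_nonneg _) (by positivity)
      _ = _ := by rw [ht, inv_pow, mul_pow, pow_add]; field_simp
  have htw D n : ‖twist k ζ W D n‖ ≤ M / l ^ D * t ^ n :=
    norm_sum_le_of_forall_le_of_nonneg (by positivity) fun I _ => hterm D n I
  set v : ℕ → K := fun D => ∑' n, twist k ζ W D n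
  have hsum D : HasSum (twist k ζ W D) (v D) :=
    (Summable.of_norm_bounded ((summable_geometric_of_lt_one ht0.le ht1).mul_left _)
      (htw D)).hasSum
  have hvle D : ‖v D‖ ≤ M / l ^ D :=
    norm_hasSum_le (hsum D) (by positivity) fun n => (htw D n).trans
      (mul_le_of_le_one_right (by positivity) (pow_le_one₀ ht0.le ht1.le))
  have hrec D : (((D + 1 : ℕ) : K) - d) * v (D + 1) = -(k * (∑ r, ζ r) * v D) := by
    have hlim D : Tendsto (fun N => ∑ n ∈ range (N + 1), twist k ζ W D n) atTop (𝓝 (v D)) :=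
      (hsum D).tendsto_sum_nat.comp (tendsto_add_atTop_nat 1)
    have herr : Tendsto (fun N : ℕ => ∑ I, ((N : K) - ∑ r, ((I r : ℕ) : K) + d)
        * coeff N (formalSolProd k ζ I) * W (D + 1 + N) I) atTop (𝓝 0) := by
      rw [tendsto_zero_iff_norm_tendsto_zero]
      refine squeeze_zero (fun _ => norm_nonneg _) (g := fun N => M / l ^ (D + 1) * t ^ N)
        (fun N => ?_) (by
        simpa using (tendsto_pow_atTop_nhds_zero_of_lt_one ht0.le ht1).const_mul (M / l ^ (D + 1)))
      refine norm_sum_le_of_forall_le_of_nonneg (by positivity) fun I _ => ?_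
      rw [mul_assoc, norm_mul]
      refine (mul_le_of_le_one_left (norm_nonneg _) ?_).trans (hterm (D + 1) N I)
      exact_mod_cast norm_intCast_le_one K ((N : ℤ) - ∑ r, ((I r : ℕ) : ℤ) + d)
    have h1 := ((hlim (D + 1)).const_mul (((D + 1 : ℕ) : K) - d)).add herr
    have h2 := ((hlim D).const_mul (k * ∑ r, ζ r)).neg
    simpa using tendsto_nhds_unique (h1.congr fun N => sum_twist hζ hd hW D N) h2
  have hlow : M / l ^ D₀ ≤ ‖v D₀‖ := by
    have hrest := (hasSum_nat_add_iff' 1).2 (hsum D₀)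
    rw [sum_range_one] at hrest
    have h1 : ‖v D₀ - twist k ζ W D₀ 0‖ ≤ M / l ^ D₀ * t :=
      norm_hasSum_le hrest (by positivity) fun n => (htw D₀ (n + 1)).trans
        (mul_le_mul_of_nonneg_left (by
          rw [pow_succ]; exact mul_le_of_le_one_left ht0.le (pow_le_one₀ ht0.le ht1.le))
          (by positivity))
    have h2 : M / l ^ D₀ * t < M / l ^ D₀ := mul_lt_of_lt_one_right (by positivity) ht1
    have h4 := norm_add_le_max (v D₀) (-(v D₀ - twist k ζ W D₀ 0))
    rw [norm_neg, ← sub_eq_add_neg, sub_sub_cancel] at h4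
    exact (le_max_iff.1 (hJ₀.trans h4)).resolve_right fun h => (h.trans h1).not_gt h2
  have hσ1 : ‖∑ r, ζ r‖ ≤ 1 := norm_sum_le_of_forall_le_of_nonneg zero_le_one
    fun r _ => (norm_eq_one_of_pow (hζ r) (NeZero.ne k)).le
  have hrecn D : ‖((D + 1 : ℕ) : K) - d‖ * ‖v (D + 1)‖ = ‖∑ r, ζ r‖ * ‖v D‖ := by
    have := congrArg norm (hrec D)
    rwa [norm_mul, norm_neg, norm_mul, norm_mul, hk1, one_mul] at this
  rcases hσ1.lt_or_eq with hσ | hσ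
  · have hσp := norm_sum_roots_le hK hk univ hζ hσ
    have hind (s : ℕ) : ‖v (d + s)‖ * ‖(s.factorial : K)‖ ≤ (p : ℝ)⁻¹ ^ s * (M / l ^ d) := by
      induction s with
      | zero => simpa using hvle d
      | succ s ih =>
        have h1 := hrecn (d + s)
        have h2 : ((d + s + 1 : ℕ) : K) - d = ((s + 1 : ℕ) : K) := by push_cast; ring
        rw [h2] at h1
        rw [Nat.factorial_succ, Nat.cast_mul, norm_mul]
        calc ‖v (d + (s + 1))‖ * (‖((s + 1 : ℕ) : K)‖ * ‖(s.factorial : K)‖)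
            = ‖((s + 1 : ℕ) : K)‖ * ‖v (d + s + 1)‖ * ‖(s.factorial : K)‖ := by
              rw [← add_assoc]; ring
          _ = ‖∑ r, ζ r‖ * (‖v (d + s)‖ * ‖(s.factorial : K)‖) := by rw [h1]; ring
          _ ≤ (p : ℝ)⁻¹ * ((p : ℝ)⁻¹ ^ s * (M / l ^ d)) :=
              mul_le_mul hσp ih (by positivity) (by positivity)
          _ = _ := by rw [pow_succ]; ring
    obtain ⟨s, rfl⟩ := Nat.exists_eq_add_of_lt hD₀
    rw [add_assoc] at hlow
    have h1 := hind (s + 1)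
    have h2 : M / l ^ (d + (s + 1)) * ‖ϖ‖ ^ (s + 1) ≤ (p : ℝ)⁻¹ ^ (s + 1) * (M / l ^ d) :=
      (mul_le_mul hlow (norm_varpi_pow_le_factorial hK hϖ (s + 1)) (by positivity)
        (norm_nonneg _)).trans h1
    have h3 : l ^ (s + 1) < (p * ‖ϖ‖) ^ (s + 1) := pow_lt_pow_left₀ hlp hl0.le (by omega)
    have h4 : M / l ^ (d + (s + 1)) * ‖ϖ‖ ^ (s + 1)
        = (p : ℝ)⁻¹ ^ (s + 1) * (M / l ^ d) * ((p * ‖ϖ‖) ^ (s + 1) / l ^ (s + 1)) := by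
      rw [pow_add, mul_pow, inv_pow]; field_simp
    rw [h4] at h2
    have h5 : 1 < (p * ‖ϖ‖) ^ (s + 1) / l ^ (s + 1) := (one_lt_div (by positivity)).2 h3
    have h6 : 0 < (p : ℝ)⁻¹ ^ (s + 1) * (M / l ^ d) := by positivity
    nlinarith
  · have h1 := hrecn D₀
    rw [hσ, one_mul] at h1
    have h2 : ‖v D₀‖ ≤ M / l ^ (D₀ + 1) := by
      rw [← h1]
      exact (mul_le_of_le_one_left (norm_nonneg _) (by
        exact_mod_cast norm_intCast_le_one K ((D₀ + 1 : ℕ) - d : ℤ))).trans (hvle (D₀ + 1))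
    have h3 : M / l ^ (D₀ + 1) < M / l ^ D₀ := by
      rw [pow_succ, ← div_div]
      exact div_lt_self (by positivity) hl
    linarith

end Purity

section Connection
variable {R k : ℕ}

/-- The weight of a multi-index. -/
def weight (I : Fin R → Fin k) : ℕ := ∑ r, (I r : ℕ)

lemma val_sub_one_add_one [NeZero k] (i : Fin k) :
    ((i - 1 : Fin k) : ℕ) + 1 = if i = 0 then k else i := by
  obtain ⟨k', rfl⟩ := Nat.exists_eq_succ_of_ne_zero (NeZero.ne k)
  have h := Fin.coe_sub_one i
  split_ifs with hi
  · rw [if_pos hi] at h; omega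
  · rw [if_neg hi] at h
    have : (i : ℕ) ≠ 0 := fun h0 => hi (Fin.ext (by simpa using h0))
    omega

lemma weight_sub_single [NeZero k] (I : Fin R → Fin k) (r : Fin R) :
    weight (I - Pi.single r 1) + 1 = weight I + if I r = 0 then k else 0 := by
  rw [weight, weight, ← sum_erase_add _ _ (mem_univ r), ← sum_erase_add _ _ (mem_univ r)]
  have h1 : ∑ s ∈ univ.erase r, (((I - Pi.single r 1 : Fin R → Fin k) s : Fin k) : ℕ)
      = ∑ s ∈ univ.erase r, (I s : ℕ) := sum_congr rfl fun s hs => by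
    rw [Pi.sub_apply, Pi.single_eq_of_ne (ne_of_mem_erase hs), sub_zero]
  rw [h1, Pi.sub_apply, Pi.single_eq_same, add_assoc, val_sub_one_add_one]
  split_ifs with h
  · simp [h]
  · rw [add_zero]

variable {K : Type*} [Field K] {ϖ : K}

/-- The connection operator on tensor powers, in coordinates. -/
noncomputable def conn [NeZero k] (ϖ : K) : Module.End K (ℕ × (Fin R → Fin k) → K) where
  toFun v x := (x.1 : K) * v x + ∑ r, if x.2 r = 0 then
    (if x.1 = 0 then 0 else ϖ ^ k * v (x.1 - 1, x.2 - Pi.single r 1))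
    else v (x.1, x.2 - Pi.single r 1)
  map_add' u v := by
    funext x
    simp only [Pi.add_apply, mul_add]
    rw [add_add_add_comm, ← sum_add_distrib]
    congr 1
    refine sum_congr rfl fun r _ => ?_
    split_ifs <;> simp
  map_smul' a v := by
    funext x
    simp only [Pi.smul_apply, smul_eq_mul, RingHom.id_apply, mul_add, mul_sum]
    congr 1
    · ring
    · refine sum_congr rfl fun r _ => ?_
      split_ifs <;> ring

lemma conn_apply [NeZero k] (v : ℕ × (Fin R → Fin k) → K) (n : ℕ) (I : Fin R → Fin k) :
    conn ϖ v (n, I) = (n : K) * v (n, I) + ∑ r, if I r = 0 then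
      (if n = 0 then 0 else ϖ ^ k * v (n - 1, I - Pi.single r 1)) else v (n, I - Pi.single r 1) :=
  rfl

open Classical in
/-- The coordinates of `v` regraded by total weight. -/
noncomputable def regrade (ϖ : K) (v : ℕ × (Fin R → Fin k) → K) (D : ℕ) (I : Fin R → Fin k) : K :=
  if ∃ n, D = k * n + weight I then ((ϖ ^ k) ^ ((D - weight I) / k))⁻¹ * v ((D - weight I) / k, I)
  else 0

lemma regrade_add_weight [NeZero k] (v : ℕ × (Fin R → Fin k) → K) (n : ℕ) (I : Fin R → Fin k) :
    regrade ϖ v (k * n + weight I) I = ((ϖ ^ k) ^ n)⁻¹ * v (n, I) := by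
  rw [regrade, if_pos ⟨n, rfl⟩, Nat.add_sub_cancel,
    Nat.mul_div_cancel_left n (Nat.pos_of_ne_zero (NeZero.ne k))]

lemma regrade_of_ne (v : ℕ × (Fin R → Fin k) → K) {D : ℕ} {I : Fin R → Fin k}
    (h : ∀ n, D ≠ k * n + weight I) : regrade ϖ v D I = 0 :=
  if_neg fun ⟨n, hn⟩ => h n hn

lemma regrade_recurrence [NeZero k] (hϖ : ϖ ≠ 0) {v : ℕ × (Fin R → Fin k) → K}
    (hv : conn ϖ v = 0) (D : ℕ) (I : Fin R → Fin k) :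
    (((D + 1 : ℕ) : K) - ∑ r, ((I r : ℕ) : K)) * regrade ϖ v (D + 1) I
      + k * ∑ r, regrade ϖ v D (I - Pi.single r 1) = 0 := by
  have hk0 : 0 < k := Nat.pos_of_ne_zero (NeZero.ne k)
  by_cases hD : ∃ n, D + 1 = k * n + weight I
  · obtain ⟨n, hn⟩ := hD
    have h := congrFun hv (n, I)
    rw [conn_apply, Pi.zero_apply] at h
    have hr r : regrade ϖ v D (I - Pi.single r 1) = ((ϖ ^ k) ^ n)⁻¹ * (if I r = 0 then
        (if n = 0 then 0 else ϖ ^ k * v (n - 1, I - Pi.single r 1))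
        else v (n, I - Pi.single r 1)) := by
      have hw := weight_sub_single I r
      split_ifs at hw ⊢ with hI hn0
      · subst hn0
        rw [mul_zero]
        refine regrade_of_ne v fun m hm => ?_
        have : k * m ≥ 0 := Nat.zero_le _
        rw [mul_zero, zero_add] at hn
        omega
      · obtain ⟨m, rfl⟩ := Nat.exists_eq_succ_of_ne_zero hn0
        rw [show D = k * m + weight (I - Pi.single r 1) by
          rw [Nat.succ_eq_add_one, mul_add, mul_one] at hn; omega, regrade_add_weight,
          Nat.succ_eq_add_one, Nat.add_sub_cancel, pow_succ]
        field_simp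
      · rw [show D = k * n + weight (I - Pi.single r 1) by omega, regrade_add_weight]
    have hc : ((D + 1 : ℕ) : K) - ∑ r, ((I r : ℕ) : K) = k * n := by
      rw [hn, weight]; push_cast; ring
    rw [hc, hn, regrade_add_weight]
    simp only [hr, ← mul_sum]
    linear_combination k * ((ϖ ^ k) ^ n)⁻¹ * h
  · push Not at hD
    rw [regrade_of_ne v hD, mul_zero, zero_add]
    rw [sum_eq_zero, mul_zero]
    intro r _
    refine regrade_of_ne v fun m hm => ?_
    have hw := weight_sub_single I r
    split_ifs at hw with hI
    · exact hD (m + 1) (by rw [mul_add, mul_one]; omega)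
    · exact hD m (by omega)

lemma regrade_eq_zero [CharZero K] [NeZero k] (hϖ : ϖ ≠ 0) {v : ℕ × (Fin R → Fin k) → K}
    (hv : conn ϖ v = 0) {d : ℕ} (h0 : ∀ I, weight I ≤ d → v (0, I) = 0) :
    ∀ D ≤ d, ∀ I, regrade ϖ v D I = 0 := by
  have hw : ∀ D ≤ d, ∀ I, D = weight I → regrade ϖ v D I = 0 := fun D hD I h => by
    rw [show D = k * 0 + weight I by omega, regrade_add_weight, h0 I (h ▸ hD), mul_zero]
  intro D
  induction D with
  | zero =>
    intro hD I
    by_cases h : 0 = weight I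
    · exact hw 0 hD I h
    · exact regrade_of_ne v fun n hn => h (by omega)
  | succ D ih =>
    intro hD I
    by_cases h : D + 1 = weight I
    · exact hw _ hD I h
    · have h1 := regrade_recurrence hϖ hv D I
      rw [sum_eq_zero (fun r _ => ih (by omega) _), mul_zero, add_zero] at h1
      refine (mul_eq_zero.1 h1).resolve_left fun h2 => h ?_
      rw [sub_eq_zero, ← Nat.cast_sum] at h2
      exact Nat.cast_injective h2

lemma eq_zero_of_regrade [NeZero k] (hϖ : ϖ ≠ 0) {v : ℕ × (Fin R → Fin k) → K}
    (h : ∀ D I, regrade ϖ v D I = 0) : v = 0 := by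
  funext x
  have h1 := h (k * x.1 + weight x.2) x.2
  rw [regrade_add_weight] at h1
  exact (mul_eq_zero.1 h1).resolve_left (inv_ne_zero (pow_ne_zero _ (pow_ne_zero _ hϖ)))

/-- A horizontal section is determined by its value at the origin. -/
lemma eq_zero_of_conn_eq_zero [CharZero K] [NeZero k] (hϖ : ϖ ≠ 0)
    {v : ℕ × (Fin R → Fin k) → K} (hv : conn ϖ v = 0) (h0 : ∀ I, v (0, I) = 0) : v = 0 :=
  eq_zero_of_regrade hϖ fun D => regrade_eq_zero hϖ hv (fun I _ => h0 I) D le_rfl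

end Connection

section Decay
variable {p : ℕ} [hp : Fact p.Prime] {K : Type*} [NormedField K] [IsUltrametricDist K] {ϖ : K}
  {R k : ℕ}

lemma eq_zero_of_conn_eq_zero_of_decay [CompleteSpace K] [IsAlgClosed K] [CharZero K] [NeZero k]
    (hK : ‖(p : K)‖ = (p : ℝ)⁻¹) (hϖ : ϖ ^ (p - 1) = -p) (hp2 : p ≠ 2) (hk : ¬ p ∣ k) {d : ℕ}
    (hd : (d : K) = R * (((k : K) - 1) / 2)) {l ρ B : ℝ} (hl1 : 1 < ‖ϖ‖ * l) (hlρ : l < ρ)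
    (hlp : l < p * ‖ϖ‖) {v : ℕ × (Fin R → Fin k) → K} (hv : conn ϖ v = 0)
    (hB : ∀ x, ‖v x‖ * ((ρ / ‖ϖ‖) ^ k) ^ x.1 ≤ B) (h0 : ∀ I, weight I ≤ d → v (0, I) = 0) :
    v = 0 := by
  have hϖ0 := norm_varpi_pos hK hϖ
  have hϖ1 := norm_varpi_lt_one hK hϖ
  have hne : ϖ ≠ 0 := norm_pos_iff.1 hϖ0
  have hρ : 1 < ρ := by nlinarith
  have hρ0 : 0 < ρ := by linarith
  have hB0 : 0 ≤ B := le_trans (by positivity) (hB (0, 0))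
  refine eq_zero_of_regrade hne (eq_zero_of_recurrence hK hϖ hp2 hk hd
    (regrade_recurrence hne hv) hl1 hlρ hlp (B := B * ρ ^ (R * k)) (fun D I => ?_)
    (regrade_eq_zero hne hv h0))
  by_cases hD : ∃ n, D = k * n + weight I
  · obtain ⟨n, rfl⟩ := hD
    rw [regrade_add_weight, norm_mul, norm_inv, norm_pow, norm_pow, pow_add, ← mul_assoc]
    refine mul_le_mul ?_ (pow_le_pow_right₀ hρ.le ?_) (by positivity) hB0
    · refine le_trans (le_of_eq ?_) (hB (n, I))
      rw [div_pow, div_pow, pow_mul]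
      field_simp
    · calc weight I ≤ ∑ _r : Fin R, k := sum_le_sum fun r _ => (I r).2.le
        _ = R * k := by simp
  · push Not at hD
    rw [regrade_of_ne v hD, norm_zero, zero_mul]
    positivity

end Decay

section TensorPower
variable {R k : ℕ} {A : Type*} [CommRing A]

/-- The `R`-fold tensor power of a matrix. -/
def tensorMat (R : ℕ) (B : Matrix (Fin k) (Fin k) A) :
    Matrix (Fin R → Fin k) (Fin R → Fin k) A :=
  Matrix.of fun I J => ∏ r, B (I r) (J r)

lemma tensorMat_apply (B : Matrix (Fin k) (Fin k) A) (I J : Fin R → Fin k) :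
    tensorMat R B I J = ∏ r, B (I r) (J r) := rfl

lemma tensorMat_one : tensorMat R (1 : Matrix (Fin k) (Fin k) A) = 1 := by
  ext I J
  rw [tensorMat_apply, Matrix.one_apply]
  split_ifs with h
  · subst h; simp
  · obtain ⟨r, hr⟩ := Function.ne_iff.1 h
    exact prod_eq_zero (mem_univ r) (Matrix.one_apply_ne hr)

lemma tensorMat_mul (B C : Matrix (Fin k) (Fin k) A) :
    tensorMat R (B * C) = tensorMat R B * tensorMat R C := by
  ext I J
  rw [tensorMat_apply, Matrix.mul_apply]
  simp only [Matrix.mul_apply, tensorMat_apply, ← prod_mul_distrib]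
  rw [prod_univ_sum (fun _ => univ) (fun r j => B (I r) j * C j (J r)), Fintype.piFinset_univ]

lemma tensorMat_map {A' : Type*} [CommRing A'] (B : Matrix (Fin k) (Fin k) A) (f : A →+* A') :
    tensorMat R (B.map f) = (tensorMat R B).map f := by
  ext I J
  simp [tensorMat_apply, map_prod]

lemma trace_tensorMat (B : Matrix (Fin k) (Fin k) A) :
    (tensorMat R B).trace = B.trace ^ R := by
  have h := prod_univ_sum (fun _ : Fin R => (univ : Finset (Fin k))) (fun _ j => B j j)
  rw [Fintype.piFinset_univ, prod_const, card_univ, Fintype.card_fin] at h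
  exact h.symm

lemma frobIter_tensorMat {K : Type*} [Field K] {p : ℕ} (hp0 : p ≠ 0)
    (B : Matrix (Fin k) (Fin k) (PowerSeries K)) (m : ℕ) :
    frobIter hp0 (tensorMat R B) m = tensorMat R (frobIter hp0 B m) := by
  induction m with
  | zero => rw [frobIter, frobIter, tensorMat_one]
  | succ m ih =>
    rw [frobIter, frobIter, ih, tensorMat_mul]
    congr 1
    exact (tensorMat_map _ (PowerSeries.expand p hp0 :
      PowerSeries K →ₐ[K] PowerSeries K).toRingHom).symm

end TensorPower

section Horizontal
open PowerSeries
variable {R k : ℕ} [NeZero k] {K : Type*} [Field K]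

/-- Compatibility of a Frobenius matrix with the connection. -/
def Horizontal (p : ℕ) (b : K) (B : Matrix (Fin k) (Fin k) K⟦X⟧) : Prop :=
  ∀ j j', X * d⁄dX K (B j j') = (if j' + 1 = 0 then C b * X else 1) * B j (j' + 1)
    - C (p : K) * ((if j = 0 then C b * X ^ p else 1) * B (j - 1) j')

lemma tensorMat_horizontal {p : ℕ} {b : K} {B : Matrix (Fin k) (Fin k) K⟦X⟧}
    (hB : Horizontal p b B) (I J : Fin R → Fin k) :
    X * d⁄dX K (tensorMat R B I J)
      = ∑ r, (if J r + 1 = 0 then C b * X else 1) * tensorMat R B I (J + Pi.single r 1)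
        - C (p : K) * ∑ r, (if I r = 0 then C b * X ^ p else 1)
          * tensorMat R B (I - Pi.single r 1) J := by
  have h1 r : tensorMat R B I (J + Pi.single r 1)
      = (∏ s ∈ univ.erase r, B (I s) (J s)) * B (I r) (J r + 1) := by
    rw [tensorMat_apply, ← prod_erase_mul _ _ (mem_univ r), Pi.add_apply, Pi.single_eq_same]
    congr 1
    refine prod_congr rfl fun s hs => ?_
    rw [Pi.add_apply, Pi.single_eq_of_ne (ne_of_mem_erase hs), add_zero]
  have h2 r : tensorMat R B (I - Pi.single r 1) J
      = (∏ s ∈ univ.erase r, B (I s) (J s)) * B (I r - 1) (J r) := by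
    rw [tensorMat_apply, ← prod_erase_mul _ _ (mem_univ r), Pi.sub_apply, Pi.single_eq_same]
    congr 1
    refine prod_congr rfl fun s hs => ?_
    rw [Pi.sub_apply, Pi.single_eq_of_ne (ne_of_mem_erase hs), sub_zero]
  rw [tensorMat_apply, derivation_prod, mul_sum, mul_sum, ← sum_sub_distrib]
  refine sum_congr rfl fun r _ => ?_
  rw [h1, h2, smul_eq_mul, mul_left_comm, hB]
  ring

end Horizontal

section CoeffSubShift
open PowerSeries
variable {K : Type*} [Field K]

lemma coeffSub_add (f g : K⟦X⟧) (a m : ℕ) :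
    coeffSub (f + g) a m = coeffSub f a m + coeffSub g a m := by
  unfold coeffSub; split_ifs <;> simp

lemma coeffSub_sub (f g : K⟦X⟧) (a m : ℕ) :
    coeffSub (f - g) a m = coeffSub f a m - coeffSub g a m := by
  unfold coeffSub; split_ifs <;> simp

lemma coeffSub_C_mul (c : K) (f : K⟦X⟧) (a m : ℕ) :
    coeffSub (C c * f) a m = c * coeffSub f a m := by
  unfold coeffSub; split_ifs <;> simp

lemma coeffSub_sum' {ι : Type*} (s : Finset ι) (f : ι → K⟦X⟧) (a b : ℕ) :
    coeffSub (∑ i ∈ s, f i) a b = ∑ i ∈ s, coeffSub (f i) a b := by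
  unfold coeffSub; split_ifs <;> simp

lemma coeffSub_X_mul_derivative (f : K⟦X⟧) (a m : ℕ) :
    coeffSub (X * d⁄dX K f) a m = ((a : K) - m) * coeffSub f a m := by
  unfold coeffSub
  split_ifs with h
  · rw [coeff_X_mul_derivative, Nat.cast_sub h]
  · simp

lemma coeffSub_X_pow_mul (f : K⟦X⟧) (s a m : ℕ) :
    coeffSub (X ^ s * f) a m = coeffSub f a (m + s) := by
  unfold coeffSub
  by_cases h : m + s ≤ a
  · rw [if_pos (by omega), if_pos h, coeff_X_pow_mul', if_pos (by omega)]
    congr 2; omega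
  · rw [if_neg h]
    split_ifs with h'
    · rw [coeff_X_pow_mul', if_neg (by omega)]
    · rfl

lemma coeffSub_add_add (f : K⟦X⟧) (s a m : ℕ) :
    coeffSub f (a + s) (m + s) = coeffSub f a m := by
  unfold coeffSub
  simp only [add_le_add_iff_right, Nat.add_sub_add_right]

lemma sum_coeffSub_mul_shift (f : K⟦X⟧) (b : K) (v : ℕ → K) (N : ℕ) :
    ∑ m ∈ range (N + 1), coeffSub f N m * (if m = 0 then 0 else b * v (m - 1))
      = ∑ m ∈ range (N + 1), coeffSub (C b * X * f) N m * v m := by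
  rw [sum_range_succ', sum_range_succ, if_pos rfl, mul_zero, add_zero]
  have h0 : coeffSub (C b * X * f) N N = 0 := by
    rw [mul_assoc, coeffSub_C_mul, ← pow_one (X : K⟦X⟧), coeffSub_X_pow_mul,
      coeffSub_of_lt (Nat.lt_succ_self N), mul_zero]
  rw [h0, zero_mul, add_zero]
  refine sum_congr rfl fun m _ => ?_
  rw [if_neg (Nat.succ_ne_zero m), mul_assoc (C b), coeffSub_C_mul, ← pow_one (X : K⟦X⟧),
    coeffSub_X_pow_mul, Nat.add_sub_cancel]
  ring

lemma sum_coeffSub_eq_of_le (f : K⟦X⟧) (v : ℕ → K) {a N : ℕ} (h : a ≤ N) :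
    ∑ m ∈ range (N + 1), coeffSub f a m * v m = ∑ m ∈ range (a + 1), coeffSub f a m * v m := by
  symm
  refine sum_subset (range_subset_range.2 (by omega)) fun m _ hm => ?_
  rw [coeffSub_of_lt (by simpa using hm), zero_mul]

lemma sum_coeffSub_X_pow_mul {p : ℕ} (hp0 : p ≠ 0) (f : K⟦X⟧) (b : K) (v : ℕ → K) (n : ℕ) :
    ∑ m ∈ range (p * n + 1), coeffSub (C b * X ^ p * f) (p * n) m * v m
      = if n = 0 then 0 else
        b * ∑ m ∈ range (p * (n - 1) + 1), coeffSub f (p * (n - 1)) m * v m := by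
  have h (m : ℕ) : coeffSub (C b * X ^ p * f) (p * n) m = b * coeffSub f (p * n) (m + p) := by
    rw [mul_assoc, coeffSub_C_mul, coeffSub_X_pow_mul]
  simp only [h]
  split_ifs with hn
  · refine sum_eq_zero fun m _ => ?_
    rw [coeffSub_of_lt, mul_zero, zero_mul]
    rw [hn, mul_zero]; omega
  · have e : p * n = p * (n - 1) + p := by
      obtain ⟨l, rfl⟩ := Nat.exists_eq_succ_of_ne_zero hn
      rw [Nat.succ_eq_add_one, Nat.add_sub_cancel, Nat.mul_succ]
    simp only [e, coeffSub_add_add, mul_assoc]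
    rw [← mul_sum, sum_coeffSub_eq_of_le _ _ (Nat.le_add_right _ _)]

end CoeffSubShift

section FrobOp
open PowerSeries
variable {R k : ℕ} [NeZero k] {K : Type*} [Field K] {p : ℕ}

/-- The Dwork operator attached to a matrix of power series, acting on coordinates. -/
noncomputable def frobOp {ι : Type*} [Fintype ι] (p : ℕ) (T : Matrix ι ι K⟦X⟧)
    (v : ℕ × ι → K) (x : ℕ × ι) : K :=
  ∑ J, ∑ m ∈ range (p * x.1 + 1), coeffSub (T x.2 J) (p * x.1) m * v (m, J)

lemma frobOp_conn (hp0 : p ≠ 0) {ϖ : K} {B : Matrix (Fin k) (Fin k) K⟦X⟧}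
    (hB : Horizontal p (ϖ ^ k) B) (v : ℕ × (Fin R → Fin k) → K) :
    frobOp p (tensorMat R B) (conn ϖ v) = (p : K) • conn ϖ (frobOp p (tensorMat R B) v) := by
  funext ⟨n, I⟩
  set T := tensorMat R B with hT
  have hcs (m : ℕ) (J : Fin R → Fin k) : ((p * n : ℕ) - (m : K)) * coeffSub (T I J) (p * n) m
      = ∑ r, coeffSub ((if J r + 1 = 0 then C (ϖ ^ k) * X else 1) * T I (J + Pi.single r 1))
          (p * n) m
        - p * ∑ r, coeffSub ((if I r = 0 then C (ϖ ^ k) * X ^ p else 1) * T (I - Pi.single r 1) J)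
          (p * n) m := by
    rw [← coeffSub_X_mul_derivative, hT, tensorMat_horizontal hB, coeffSub_sub, coeffSub_C_mul,
      coeffSub_sum', coeffSub_sum']
  have hA (r : Fin R) : ∑ J, ∑ m ∈ range (p * n + 1), coeffSub (T I J) (p * n) m *
        (if J r = 0 then (if m = 0 then 0 else ϖ ^ k * v (m - 1, J - Pi.single r 1))
          else v (m, J - Pi.single r 1))
      = ∑ J, ∑ m ∈ range (p * n + 1), coeffSub ((if J r + 1 = 0 then C (ϖ ^ k) * X else 1) *
        T I (J + Pi.single r 1)) (p * n) m * v (m, J) := by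
    rw [← Equiv.sum_comp (Equiv.addRight (Pi.single r 1 : Fin R → Fin k))]
    refine sum_congr rfl fun J _ => ?_
    simp only [Equiv.coe_addRight, Pi.add_apply, Pi.single_eq_same, add_sub_cancel_right]
    split_ifs with h
    · exact sum_coeffSub_mul_shift _ _ (fun m => v (m, J)) _
    · rw [one_mul]
  have hB' (r : Fin R) : ∑ J, ∑ m ∈ range (p * n + 1),
        coeffSub ((if I r = 0 then C (ϖ ^ k) * X ^ p else 1) * T (I - Pi.single r 1) J) (p * n) m
          * v (m, J)
      = if I r = 0 then (if n = 0 then 0 else ϖ ^ k * frobOp p T v (n - 1, I - Pi.single r 1))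
          else frobOp p T v (n, I - Pi.single r 1) := by
    split_ifs with h h0
    · refine sum_eq_zero fun J _ => ?_
      rw [sum_coeffSub_X_pow_mul hp0 _ _ (fun m => v (m, J)), if_pos h0]
    · rw [frobOp, mul_sum]
      refine sum_congr rfl fun J _ => ?_
      rw [sum_coeffSub_X_pow_mul hp0 _ _ (fun m => v (m, J)), if_neg h0]
    · simp only [one_mul]
      rfl
  have h1 : frobOp p T (conn ϖ v) (n, I)
      = ∑ J, ∑ m ∈ range (p * n + 1), m * (coeffSub (T I J) (p * n) m * v (m, J))
        + ∑ r, ∑ J, ∑ m ∈ range (p * n + 1), coeffSub (T I J) (p * n) m *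
        (if J r = 0 then (if m = 0 then 0 else ϖ ^ k * v (m - 1, J - Pi.single r 1))
          else v (m, J - Pi.single r 1)) := by
    rw [frobOp, sum_comm (s := univ (α := Fin R)), ← sum_add_distrib]
    refine sum_congr rfl fun J _ => ?_
    rw [sum_comm (s := univ (α := Fin R)), ← sum_add_distrib]
    refine sum_congr rfl fun m _ => ?_
    rw [conn_apply, mul_add, mul_sum]
    ring
  have h2 : frobOp p T v (n, I) = ∑ J, ∑ m ∈ range (p * n + 1),
      coeffSub (T I J) (p * n) m * v (m, J) := rfl
  rw [h1, Pi.smul_apply, conn_apply, smul_eq_mul, mul_add, sum_congr rfl fun r _ => hA r,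
    sum_congr rfl fun r _ => (hB' r).symm, ← sub_eq_zero]
  have h3 : ∑ J, ∑ m ∈ range (p * n + 1),
      (((p * n : ℕ) - (m : K)) * coeffSub (T I J) (p * n) m) * v (m, J)
      = (p * n : ℕ) * frobOp p T v (n, I)
        - ∑ J, ∑ m ∈ range (p * n + 1), m * (coeffSub (T I J) (p * n) m * v (m, J)) := by
    rw [h2, mul_sum, ← sum_sub_distrib]
    refine sum_congr rfl fun J _ => ?_
    rw [mul_sum, ← sum_sub_distrib]
    refine sum_congr rfl fun m _ => ?_
    ring
  have h4 : ∑ J, ∑ m ∈ range (p * n + 1),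
      (((p * n : ℕ) - (m : K)) * coeffSub (T I J) (p * n) m) * v (m, J)
      = ∑ r, ∑ J, ∑ m ∈ range (p * n + 1), coeffSub ((if J r + 1 = 0 then C (ϖ ^ k) * X else 1) *
          T I (J + Pi.single r 1)) (p * n) m * v (m, J)
        - p * ∑ r, ∑ J, ∑ m ∈ range (p * n + 1),
        coeffSub ((if I r = 0 then C (ϖ ^ k) * X ^ p else 1) * T (I - Pi.single r 1) J) (p * n) m
          * v (m, J) := by
    rw [sum_comm (s := univ (α := Fin R)), sum_comm (s := univ (α := Fin R)), mul_sum,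
      ← sum_sub_distrib]
    refine sum_congr rfl fun J _ => ?_
    rw [sum_comm (s := univ (α := Fin R)), sum_comm (s := univ (α := Fin R)), mul_sum,
      ← sum_sub_distrib]
    refine sum_congr rfl fun m _ => ?_
    rw [hcs, sub_mul, sum_mul, mul_assoc, sum_mul]
  rw [h4] at h3
  push_cast at h3
  linear_combination h3

end FrobOp

section FrobSeries
open PowerSeries
variable {p : ℕ} [hp : Fact p.Prime] {K : Type*} [NormedField K] [IsUltrametricDist K]
  [CharZero K] [CompleteSpace K] {ϖ : K} {ρ κ : ℝ} {k : ℕ}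

lemma GoodRadius.horizontal_frobSeries (H : GoodRadius p ϖ ρ κ) [NeZero k] :
    Horizontal p (ϖ ^ k) (frobSeries p ϖ k) := by
  intro j j'
  ext e
  rw [coeff_X_mul_derivative, H.frobSeries_horizontal, map_sub, coeff_C_mul]

end FrobSeries

section Index
variable (ι : Type*) [Fintype ι] [Nonempty ι]

/-- An enumeration of `ℕ × ι` along which the first coordinate increases. -/
noncomputable def idx : ℕ ≃ ℕ × ι :=
  (Nat.divModEquiv (Fintype.card ι)).trans
    (Equiv.prodCongr (Equiv.refl ℕ) (Fintype.equivFin ι).symm)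

lemma idx_fst (i : ℕ) : (idx ι i).1 = i / Fintype.card ι := rfl

end Index

section DworkOp
open PowerSeries
variable {ι : Type*} [Fintype ι] [Nonempty ι] [DecidableEq ι] {K : Type*} [NormedField K]
  [IsUltrametricDist K] [CompleteSpace K] [CharZero K] {p : ℕ} [hp : Fact p.Prime]

/-- A row of the scaled Dwork operator. -/
noncomputable def dworkRow (c : K) (f : ι → K⟦X⟧) (a n : ℕ) : ℕ →₀ K :=
  ∑ x ∈ range (a + 1) ×ˢ univ,
    Finsupp.single ((idx ι).symm x) (c ^ n * (c ^ x.1)⁻¹ * coeffSub (f x.2) a x.1)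

lemma dworkRow_apply (c : K) (f : ι → K⟦X⟧) (a n j : ℕ) :
    dworkRow c f a n j = c ^ n * (c ^ (idx ι j).1)⁻¹ * coeffSub (f (idx ι j).2) a (idx ι j).1 := by
  rw [dworkRow, Finsupp.finsetSum_apply]
  simp only [Finsupp.single_apply, Equiv.symm_apply_eq]
  rw [sum_ite_eq']
  split_ifs with h
  · rfl
  · rw [coeffSub_of_lt, mul_zero]
    simpa [Nat.lt_succ_iff] using h

/-- The scaled Dwork operator on finitely supported sequences. -/
noncomputable def dworkOp (p : ℕ) (c : K) (T : Matrix ι ι K⟦X⟧) : (ℕ →₀ K) →ₗ[K] (ℕ →₀ K) :=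
  Finsupp.linearCombination K fun i =>
    dworkRow c (T (idx ι i).2) (p * (idx ι i).1) (idx ι i).1

lemma dworkOp_single (c : K) (T : Matrix ι ι K⟦X⟧) (i : ℕ) (a : K) :
    dworkOp p c T (Finsupp.single i a)
      = a • dworkRow c (T (idx ι i).2) (p * (idx ι i).1) (idx ι i).1 := by
  rw [dworkOp, Finsupp.linearCombination_single]

lemma dworkOp_pow_single (hp0 : p ≠ 0) {c : K} (hc : c ≠ 0) (T : Matrix ι ι K⟦X⟧) (m i : ℕ) :
    (dworkOp p c T ^ m) (Finsupp.single i 1)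
      = dworkRow c (frobIter hp0 T m (idx ι i).2) (p ^ m * (idx ι i).1) (idx ι i).1 := by
  have hc' (n : ℕ) : c ^ n ≠ 0 := pow_ne_zero n hc
  induction m with
  | zero =>
    ext j
    rw [dworkRow_apply, pow_zero, pow_zero, one_mul, Module.End.one_apply, Finsupp.single_apply,
      frobIter, Matrix.one_apply]
    by_cases h : i = j
    · rw [if_pos h, h, if_pos rfl, coeffSub_of_le le_rfl, Nat.sub_self, coeff_one, if_pos rfl,
        mul_one, mul_inv_cancel₀ (hc' _)]
    · rw [if_neg h]
      split_ifs with h2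
      · rcases lt_or_ge (idx ι i).1 (idx ι j).1 with h3 | h3
        · rw [coeffSub_of_lt h3, mul_zero]
        · rw [coeffSub_of_le h3, coeff_one, if_neg, mul_zero]
          intro h4
          exact h ((idx ι).injective (Prod.ext (by omega) h2))
      · simp [coeffSub]
  | succ m ih =>
    rw [pow_succ', Module.End.mul_apply, ih]
    ext j
    rw [dworkRow_apply, pow_succ', mul_assoc p, coeffSub_frobIter_succ, dworkRow, map_sum,
      Finsupp.finsetSum_apply, ← sum_product', mul_sum]
    refine sum_congr rfl fun x _ => ?_
    rw [dworkOp_single, Finsupp.smul_apply, dworkRow_apply, Equiv.apply_symm_apply, smul_eq_mul]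
    have := hc' x.1
    field_simp

/-- Passage from coordinates indexed by `ℕ × ι` to scaled sequences. -/
noncomputable def scaleEquiv {c : K} (hc : c ≠ 0) : (ℕ × ι → K) ≃ₗ[K] (ℕ → K) where
  toFun v i := c ^ (idx ι i).1 * v (idx ι i)
  map_add' u v := by funext i; simp [mul_add]
  map_smul' a v := by funext i; simp [mul_left_comm]
  invFun w x := (c ^ x.1)⁻¹ * w ((idx ι).symm x)
  left_inv v := by
    funext x
    simp only [Equiv.apply_symm_apply]
    rw [inv_mul_cancel_left₀ (pow_ne_zero _ hc)]
  right_inv w := by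
    funext i
    simp only [Equiv.symm_apply_apply]
    rw [mul_inv_cancel_left₀ (pow_ne_zero _ hc)]

lemma scaleEquiv_apply {c : K} (hc : c ≠ 0) (v : ℕ × ι → K) (i : ℕ) :
    scaleEquiv hc v i = c ^ (idx ι i).1 * v (idx ι i) := rfl

lemma scaleEquiv_symm_apply {c : K} (hc : c ≠ 0) (w : ℕ → K) (x : ℕ × ι) :
    (scaleEquiv hc).symm w x = (c ^ x.1)⁻¹ * w ((idx ι).symm x) := rfl

lemma seqOp_scaleEquiv {c : K} (hc : c ≠ 0) (T : Matrix ι ι K⟦X⟧) (v : ℕ × ι → K) :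
    seqOp (dworkOp p c T) (scaleEquiv hc v) = scaleEquiv hc (frobOp p T v) := by
  funext i
  change pairing K (scaleEquiv hc v) (dworkOp p c T (Finsupp.single i 1)) = _
  rw [dworkOp_single, one_smul, dworkRow, map_sum, scaleEquiv_apply, frobOp, sum_comm,
    ← sum_product', mul_sum]
  refine sum_congr rfl fun x _ => ?_
  rw [pairing_single, scaleEquiv_apply, Equiv.apply_symm_apply]
  have := pow_ne_zero x.1 hc
  field_simp

lemma norm_dworkRow_le (hp0 : p ≠ 0) {c : K} (hc : 1 < ‖c‖) {T : Matrix ι ι K⟦X⟧} {M : ℝ}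
    (hT : ∀ l I J, ‖coeff l (T I J)‖ ≤ M * ‖c‖⁻¹ ^ l) (i j : ℕ) :
    ‖dworkRow c (T (idx ι i).2) (p * (idx ι i).1) (idx ι i).1 j‖
      ≤ M * (‖c‖⁻¹ ^ (p - 1)) ^ (idx ι i).1 := by
  have hc0 : 0 < ‖c‖ := one_pos.trans hc
  obtain ⟨I⟩ := ‹Nonempty ι›
  have hM : 0 ≤ M := by simpa using (norm_nonneg _).trans (hT 0 I I)
  rw [dworkRow_apply]
  rcases lt_or_ge (p * (idx ι i).1) (idx ι j).1 with h | h
  · rw [coeffSub_of_lt h, mul_zero, norm_zero]; positivity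
  · rw [coeffSub_of_le h, norm_mul, norm_mul, norm_inv, norm_pow, norm_pow]
    refine (mul_le_mul_of_nonneg_left (hT _ _ _) (by positivity)).trans (le_of_eq ?_)
    set n := (idx ι i).1
    set n' := (idx ι j).1
    have e : p * n = (p - 1) * n + n := by
      obtain ⟨q, rfl⟩ := Nat.exists_eq_succ_of_ne_zero hp0
      rw [Nat.succ_eq_add_one, Nat.add_sub_cancel]; ring
    have e2 : ‖c‖⁻¹ ^ (p * n - n') * ‖c‖⁻¹ ^ n' = (‖c‖⁻¹ ^ (p - 1)) ^ n * ‖c‖⁻¹ ^ n := by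
      rw [← pow_add, Nat.sub_add_cancel h, e, pow_add, pow_mul]
    have e3 : ‖c‖ ^ n * ‖c‖⁻¹ ^ n = 1 := by rw [← mul_pow, mul_inv_cancel₀ hc0.ne', one_pow]
    rw [← inv_pow]
    linear_combination ‖c‖ ^ n * M * e2 + M * (‖c‖⁻¹ ^ (p - 1)) ^ n * e3

lemma exists_rowDecay_dworkOp (hp2 : 2 ≤ p) {c : K} (hc : 1 < ‖c‖) {T : Matrix ι ι K⟦X⟧} {M : ℝ}
    (hT : ∀ l I J, ‖coeff l (T I J)‖ ≤ M * ‖c‖⁻¹ ^ l) :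
    ∃ C q, RowDecay (dworkOp p c T) C q := by
  have hc0 : 0 < ‖c‖ := one_pos.trans hc
  have hM : 0 ≤ M := by
    obtain ⟨I⟩ := ‹Nonempty ι›
    simpa using (norm_nonneg _).trans (hT 0 I I)
  set L := Fintype.card ι with hL
  have hL0 : L ≠ 0 := Fintype.card_ne_zero
  set t := ‖c‖⁻¹ ^ (p - 1) with ht
  have ht0 : 0 < t := by positivity
  have ht1 : t < 1 := pow_lt_one₀ (by positivity) (inv_lt_one_of_one_lt₀ hc) (by omega)
  set s := t ^ ((L : ℝ)⁻¹) with hs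
  have hs0 : 0 < s := Real.rpow_pos_of_pos ht0 _
  have hs1 : s < 1 := Real.rpow_lt_one ht0.le ht1 (by positivity)
  have hsL : s ^ L = t := Real.rpow_inv_natCast_pow ht0.le hL0
  refine ⟨max 1 (M * t⁻¹), s, le_max_left _ _, hs0, hs1, fun i j => ?_⟩
  rw [dworkOp_single, one_smul]
  refine (norm_dworkRow_le (by omega) hc hT i j).trans ?_
  have h1 : t ^ (idx ι i).1 ≤ t⁻¹ * s ^ i := by
    rw [inv_mul_eq_div, le_div_iff₀ ht0, ← pow_succ, ← hsL, ← pow_mul]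
    refine pow_le_pow_of_le_one hs0.le hs1.le ?_
    rw [idx_fst]
    exact (Nat.lt_mul_div_succ i (Nat.pos_of_ne_zero hL0)).le
  calc M * t ^ (idx ι i).1 ≤ M * (t⁻¹ * s ^ i) := mul_le_mul_of_nonneg_left h1 hM
    _ = M * t⁻¹ * s ^ i := by ring
    _ ≤ _ := mul_le_mul_of_nonneg_right (le_max_right _ _) (by positivity)

end DworkOp

section TraceFormula
open PowerSeries
variable {ι : Type*} [Fintype ι] [Nonempty ι] [DecidableEq ι] {p : ℕ}
  [hp : Fact p.Prime] {K : Type*} [NontriviallyNormedField K] [IsUltrametricDist K] [CompleteSpace K] [CharZero K]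
  {G : Type*} [CommGroup G] [Fintype G] {τ : G →* K}

lemma opTrace_dworkOp_pow (hp0 : p ≠ 0) {c : K} (hc : c ≠ 0) {T : Matrix ι ι K⟦X⟧}
    (hT : ∀ I J, IsConv (T I J)) {C q : ℝ} (hA : RowDecay (dworkOp p c T) C q)
    (hτ : Function.Injective τ) {m : ℕ} (hm : m ≠ 0) (hG : Fintype.card G = p ^ m - 1) :
    (Fintype.card G : K) * opTrace (dworkOp p c T ^ m)
      = ∑ x, ((frobIter hp0 T m).map (ev (τ x))).trace := by
  have h1 := (hA.pow hm).hasSum_opTrace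
  rw [← (idx ι).symm.hasSum_iff] at h1
  have h2 := (h1.mul_left (Fintype.card G : K)).prod_fiberwise fun n =>
    hasSum_fintype (fun I : ι => _)
  have h3 := hasSum_sum (s := univ) fun (I : ι) _ =>
    hasSum_torus hτ (isConv_frobIter hp0 hT m I I) 0
  have h4 : ∑ I, ∑ x, τ x ^ 0 * ev (τ x) (frobIter hp0 T m I I)
      = ∑ x, ((frobIter hp0 T m).map (ev (τ x))).trace := by
    rw [sum_comm]
    simp [Matrix.trace]
  rw [h4] at h3
  refine h2.unique (h3.congr_fun fun n => ?_)
  refine sum_congr rfl fun I _ => ?_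
  rw [Function.comp_apply, dworkOp_pow_single hp0 hc, dworkRow_apply, Equiv.apply_symm_apply,
    mul_inv_cancel₀ (pow_ne_zero _ hc), one_mul]
  have hpm : 1 ≤ p ^ m := Nat.one_le_pow _ _ (Nat.pos_of_ne_zero hp0)
  have e : p ^ m * n = Fintype.card G * n + n := by
    rw [hG, ← Nat.succ_mul]; congr 1; omega
  dsimp only
  rw [e, coeffSub_of_le (Nat.le_add_left _ _), coeffSub_of_le (Nat.zero_le _), Nat.add_sub_cancel,
    Nat.sub_zero]

end TraceFormula

section Bounds
open PowerSeries
variable {K : Type*} [NormedField K] [IsUltrametricDist K] {t : ℝ}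

lemma norm_coeff_mul_le_mul (ht : 0 ≤ t) {f g : K⟦X⟧} {M M' : ℝ} (hM : 0 ≤ M) (hM' : 0 ≤ M')
    (hf : ∀ n, ‖coeff n f‖ ≤ M * t ^ n) (hg : ∀ n, ‖coeff n g‖ ≤ M' * t ^ n) (n : ℕ) :
    ‖coeff n (f * g)‖ ≤ M * M' * t ^ n := by
  rw [coeff_mul]
  refine norm_sum_le_of_forall_le_of_nonneg (by positivity) fun x hx => ?_
  rw [norm_mul, ← HasAntidiagonal.mem_antidiagonal.1 hx, pow_add, mul_mul_mul_comm]
  exact mul_le_mul (hf _) (hg _) (norm_nonneg _) (by positivity)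

lemma norm_coeff_tensorMat_le {k : ℕ} (R : ℕ) (ht : 0 ≤ t) {B : Matrix (Fin k) (Fin k) K⟦X⟧}
    {M : ℝ} (hM : 0 ≤ M) (hB : ∀ n i j, ‖coeff n (B i j)‖ ≤ M * t ^ n) (n : ℕ)
    (I J : Fin R → Fin k) : ‖coeff n (tensorMat R B I J)‖ ≤ M ^ R * t ^ n := by
  have h (s : Finset (Fin R)) : ∀ n, ‖coeff n (∏ r ∈ s, B (I r) (J r))‖ ≤ M ^ #s * t ^ n := by
    induction s using Finset.induction_on with
    | empty =>
      intro n
      rw [prod_empty, coeff_one, card_empty, pow_zero, one_mul]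
      split_ifs with hn
      · rw [hn, norm_one, pow_zero]
      · rw [norm_zero]; positivity
    | insert r s hr ih =>
      rw [prod_insert hr, card_insert_of_notMem hr, pow_succ']
      exact norm_coeff_mul_le_mul ht hM (by positivity) (fun n => hB n _ _) ih
  simpa [tensorMat_apply] using h univ n

end Bounds

section ScaledConn
variable {R k : ℕ} [NeZero k] {K : Type*} [NormedField K] [IsUltrametricDist K]
  [CompleteSpace K] [CharZero K] {ϖ c : K}

/-- The connection operator on scaled sequences. -/
noncomputable def scaledConn (R k : ℕ) [NeZero k] (ϖ : K) {c : K} (hc : c ≠ 0) :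
    Module.End K (ℕ → K) :=
  (scaleEquiv (ι := Fin R → Fin k) hc).toLinearMap ∘ₗ conn ϖ ∘ₗ
    (scaleEquiv (ι := Fin R → Fin k) hc).symm.toLinearMap

lemma scaledConn_apply (hc : c ≠ 0) (w : ℕ → K) : scaledConn R k ϖ hc w
    = scaleEquiv hc (conn ϖ ((scaleEquiv (ι := Fin R → Fin k) hc).symm w)) := rfl

lemma scaledConn_mem_bddSeq (hc : c ≠ 0) {w : ℕ → K} (hw : w ∈ bddSeq K) :
    scaledConn R k ϖ hc w ∈ bddSeq K := by
  obtain ⟨B, hB⟩ := hw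
  have hB0 : 0 ≤ B := (norm_nonneg _).trans (hB 0)
  refine ⟨B + ∑ _r : Fin R, (‖ϖ ^ k‖ * ‖c‖ * B + B), fun i => ?_⟩
  rw [scaledConn_apply, scaleEquiv_apply]
  obtain ⟨n, I⟩ := idx (Fin R → Fin k) i
  have hcn : c ^ n ≠ 0 := pow_ne_zero n hc
  rw [conn_apply, mul_add, mul_sum]
  refine (norm_add_le _ _).trans (add_le_add ?_ ((norm_sum_le _ _).trans
    (sum_le_sum fun r _ => ?_)))
  · rw [scaleEquiv_symm_apply, mul_left_comm, mul_inv_cancel_left₀ hcn, norm_mul]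
    calc _ ≤ 1 * B := mul_le_mul (norm_natCast_le_one K n) (hB _)
          (norm_nonneg _) zero_le_one
      _ = B := one_mul B
  · have h0 : 0 ≤ ‖ϖ ^ k‖ * ‖c‖ * B := by positivity
    split_ifs with h1 h2
    · rw [mul_zero, norm_zero]; positivity
    · have e : c ^ n = c * c ^ (n - 1) := by rw [← pow_succ', Nat.sub_add_cancel (by omega)]
      have hcn' : c ^ (n - 1) ≠ 0 := pow_ne_zero _ hc
      rw [scaleEquiv_symm_apply, e]
      dsimp only
      rw [show c * c ^ (n - 1) * (ϖ ^ k * ((c ^ (n - 1))⁻¹ *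
        w ((idx (Fin R → Fin k)).symm (n - 1, I - Pi.single r 1))))
        = ϖ ^ k * c * w ((idx (Fin R → Fin k)).symm (n - 1, I - Pi.single r 1)) by field_simp,
        norm_mul, norm_mul]
      exact (mul_le_mul_of_nonneg_left (hB _) (by positivity)).trans (by linarith)
    · rw [scaleEquiv_symm_apply, mul_inv_cancel_left₀ hcn]
      exact (hB _).trans (by linarith)

lemma finrank_le_of_le_ker_scaledConn (hϖ : ϖ ≠ 0) (hc : c ≠ 0) {W : Submodule K (ℕ → K)}
    (hW : W ≤ LinearMap.ker (scaledConn R k ϖ hc)) : Module.finrank K W ≤ k ^ R := by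
  let E := scaleEquiv (ι := Fin R → Fin k) hc
  let f : (ℕ → K) →ₗ[K] ((Fin R → Fin k) → K) :=
    LinearMap.funLeft K K (fun I => ((0 : ℕ), I)) ∘ₗ E.symm.toLinearMap
  have hinj : Function.Injective (f ∘ₗ W.subtype) := by
    rw [injective_iff_map_eq_zero]
    intro w hw
    have h1 : conn ϖ (E.symm (w : ℕ → K)) = 0 := by
      have := LinearMap.mem_ker.1 (hW w.2)
      rw [scaledConn_apply] at this
      exact E.map_eq_zero_iff.1 this
    have h2 := eq_zero_of_conn_eq_zero hϖ h1 fun I => congrFun hw I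
    exact Subtype.ext (E.symm.map_eq_zero_iff.1 h2)
  refine (LinearMap.finrank_le_finrank_of_injective hinj).trans (le_of_eq ?_)
  rw [Module.finrank_fintype_fun_eq_card, Fintype.card_fun, Fintype.card_fin, Fintype.card_fin]

end ScaledConn

section Eigen
open PowerSeries
variable {R k : ℕ} {K : Type*} [NormedField K] [IsUltrametricDist K]
  [CompleteSpace K] [CharZero K] {ϖ c : K} {p : ℕ}

lemma norm_frobOp_le {ι : Type*} [Fintype ι] (hc : 1 < ‖c‖) {T : Matrix ι ι K⟦X⟧}
    {M B : ℝ} (hM : 0 ≤ M) (hB : 0 ≤ B) (hT : ∀ l I J, ‖coeff l (T I J)‖ ≤ M * ‖c‖⁻¹ ^ l)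
    {u : ℕ × ι → K} (hu : ∀ x, ‖u x‖ ≤ B * ‖c‖⁻¹ ^ x.1) (x : ℕ × ι) :
    ‖frobOp p T u x‖ ≤ M * B * ‖c‖⁻¹ ^ (p * x.1) := by
  refine norm_sum_le_of_forall_le_of_nonneg (by positivity) fun J _ =>
    norm_sum_le_of_forall_le_of_nonneg (by positivity) fun m hm => ?_
  have hm' : m ≤ p * x.1 := by simpa [Nat.lt_succ_iff] using hm
  rw [coeffSub_of_le hm', norm_mul]
  refine (mul_le_mul (hT _ _ _) (hu _) (norm_nonneg _) (by positivity)).trans (le_of_eq ?_)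
  rw [mul_mul_mul_comm, ← pow_add, Nat.sub_add_cancel hm']

lemma eigenvalue_eq_pow_weight {B : Matrix (Fin k) (Fin k) K⟦X⟧}
    (hB : ∀ i j, i ≤ j → coeff 0 (B i j) = if i = j then (p : K) ^ (i : ℕ) else 0)
    {u : ℕ × (Fin R → Fin k) → K} {μ : K} (hu : frobOp p (tensorMat R B) u = μ • u)
    {I : Fin R → Fin k} (hI : u (0, I) ≠ 0)
    (hmin : ∀ J, u (0, J) ≠ 0 → weight I ≤ weight J) : μ = (p : K) ^ weight I := by
  have h1 := congrFun hu (0, I)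
  rw [Pi.smul_apply, smul_eq_mul, frobOp, sum_eq_single I] at h1
  · simp only [mul_zero, zero_add, sum_range_one, coeffSub_of_le le_rfl, Nat.sub_zero] at h1
    rw [← mul_right_cancel₀ hI h1, tensorMat_apply, coeff_zero_eq_constantCoeff, map_prod, weight,
      ← prod_pow_eq_pow_sum]
    refine prod_congr rfl fun r _ => ?_
    rw [← coeff_zero_eq_constantCoeff_apply, hB _ _ le_rfl, if_pos rfl]
  · intro J _ hJ
    simp only [mul_zero, zero_add, sum_range_one, coeffSub_of_le le_rfl, Nat.sub_zero]
    by_contra hne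
    have h2 := right_ne_zero_of_mul hne
    have h3 := left_ne_zero_of_mul hne
    rw [tensorMat_apply, coeff_zero_eq_constantCoeff, map_prod] at h3
    have h4 r : J r ≤ I r := by
      by_contra hlt
      refine h3 (prod_eq_zero (mem_univ r) ?_)
      rw [← coeff_zero_eq_constantCoeff_apply, hB _ _ (not_le.1 hlt).le, if_neg]
      rintro e
      exact hlt e.ge
    have h5 : weight J < weight I := by
      obtain ⟨r, hr⟩ := Function.ne_iff.1 hJ
      exact sum_lt_sum (fun r _ => h4 r) ⟨r, mem_univ r, lt_of_le_of_ne (h4 r)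
        fun e => hr (Fin.ext e)⟩
    exact absurd (hmin J h2) (not_le.2 h5)
  · simp

end Eigen

section Zeta
open PowerSeries
variable {p : ℕ} [hp : Fact p.Prime] {K : Type*} [NontriviallyNormedField K]
  [IsUltrametricDist K] [CompleteSpace K] [IsAlgClosed K] [CharZero K] {ϖ c : K} {ρ κ l r : ℝ}
  {R k d : ℕ}

lemma GoodRadius.trace_tensor (H : GoodRadius p ϖ ρ κ) (hk0 : 0 < k) (hk2 : Even k)
    (hR : Even R) {G : Type*} [CommGroup G] [Fintype G] {τ : G →* K} (hτ : Function.Injective τ)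
    {m : ℕ} (hm : m ≠ 0) (hG : Fintype.card G = p ^ m - 1) (x : G) :
    ((frobIter hp.1.ne_zero (tensorMat R (frobSeries p ϖ k)) m).map (ev (τ x))).trace
      = klSum (fun y => psi p ϖ m (τ y)) k x ^ R := by
  have hx : ‖τ x‖ ≤ 1 := (norm_hom_eq_one x).le
  have h3 : (frobIter hp.1.ne_zero (tensorMat R (frobSeries p ϖ k)) m).map (ev (τ x))
      = tensorMat R ((frobIter hp.1.ne_zero (frobSeries p ϖ k) m).map (ev (τ x))) := by
    ext I J
    rw [frobIter_tensorMat, Matrix.map_apply, tensorMat_apply, tensorMat_apply,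
      ev_prod _ hx fun r _ =>
        isConv_frobIter hp.1.ne_zero (fun i j => H.isConv_frobSeries i j) m _ _]
    rfl
  rw [h3, trace_tensorMat, H.trace_frobIter hτ hm hG hk0 hk2 x, hR.neg_pow]
  congr 2
  funext y
  exact H.trace_frobIter_one m (norm_hom_eq_one (τ := τ) y).le

lemma GoodRadius.eigenvalue_mem (H : GoodRadius p ϖ ρ κ) [NeZero k] (hp2 : p ≠ 2)
    (hpk : ¬ p ∣ k) (hd : 2 * d = R * (k - 1))
    (hl1 : 1 < ‖ϖ‖ * l) (hlρ : l < ρ) (hlp : l < p * ‖ϖ‖)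
    (hc1 : 1 < ‖c‖) (hc : ‖c‖ ^ p = (ρ / ‖ϖ‖) ^ k) {M : ℝ} (hM0 : 0 ≤ M)
    (hTb : ∀ n I J, ‖coeff n (tensorMat R (frobSeries p ϖ k) I J)‖ ≤ M * ‖c‖⁻¹ ^ n)
    {u : ℕ × (Fin R → Fin k) → K} {b : ℝ} (hb0 : 0 ≤ b) (hub : ∀ x, ‖u x‖ ≤ b * ‖c‖⁻¹ ^ x.1)
    (hcu : conn ϖ u = 0) {μ : K} (hμ : μ ≠ 0)
    (hfu : frobOp p (tensorMat R (frobSeries p ϖ k)) u = μ • u) (hu0 : u ≠ 0) :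
    ∃ j ≤ d, μ = (p : K) ^ j := by
  classical
  have hk0 : 0 < k := Nat.pos_of_ne_zero (NeZero.ne k)
  have hcn : 0 < ‖c‖ := one_pos.trans hc1
  have hub' x : ‖u x‖ * ((ρ / ‖ϖ‖) ^ k) ^ x.1 ≤ ‖μ‖⁻¹ * (M * b) := by
    have h1 := norm_frobOp_le (p := p) hc1 (by positivity) hb0 hTb hub x
    rw [hfu, Pi.smul_apply, norm_smul] at h1
    have hμ' : 0 < ‖μ‖ := norm_pos_iff.2 hμ
    rw [← hc, ← pow_mul, le_inv_mul_iff₀ hμ', ← mul_assoc]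
    rw [inv_pow, ← div_eq_mul_inv, le_div_iff₀ (by positivity)] at h1
    exact h1
  have hdK : (d : K) = R * (((k : K) - 1) / 2) := by
    have : ((2 * d : ℕ) : K) = ((R * (k - 1) : ℕ) : K) := by rw [hd]
    push_cast [Nat.cast_sub (show 1 ≤ k from hk0)] at this
    linear_combination this / 2
  have hex : ∃ I, weight I ≤ d ∧ u (0, I) ≠ 0 := by
    by_contra! hcon
    exact hu0 (eq_zero_of_conn_eq_zero_of_decay H.norm_p H.varpi hp2 hpk hdK hl1 hlρ hlp hcu
      hub' hcon)
  obtain ⟨I₁, hI₁d, hI₁⟩ := hex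
  obtain ⟨I, hI, hmin⟩ := exists_min_image (univ.filter fun I => u (0, I) ≠ 0) weight
    ⟨I₁, by simpa using hI₁⟩
  rw [mem_filter] at hI
  exact ⟨weight I, (hmin I₁ (by simpa using hI₁)).trans hI₁d,
    eigenvalue_eq_pow_weight (fun i j hij => H.coeff_zero_frobSeries hij) hfu hI.2
      fun J hJ => hmin J (by simpa using hJ)⟩

lemma prod_pow_prime_factor [DecidableEq K] (q : ℕ) (hq : 2 ≤ q) (s d : ℕ) :
    ∏ j ∈ range (d + 1), (1 - C ((q : K) ^ (j + 1)) * X : K⟦X⟧) ^ s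
      = ((s • ((range (d + 1)).image fun j => (q : K) ^ j).val.map ((q : K) * ·)).map
          fun b => 1 - C b * X).prod := by
  have hinj : Set.InjOn (fun j : ℕ => (q : K) ^ j) (range (d + 1)) := fun a _ b _ h => by
    have h' : ((q ^ a : ℕ) : K) = ((q ^ b : ℕ) : K) := by push_cast; exact h
    exact Nat.pow_right_injective hq (Nat.cast_injective h')
  rw [Multiset.map_nsmul, Multiset.prod_nsmul, prod_pow, Multiset.map_map]
  congr 1
  refine Eq.trans ?_ (prod_image (f := fun b => (1 - C ((q : K) * b) * X : K⟦X⟧)) hinj).symm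
  exact prod_congr rfl fun j _ => by rw [pow_succ']

/-- The zeta function of the moments of Kloosterman sums has few poles. -/
lemma GoodRadius.discBounded_klSum (H : GoodRadius p ϖ ρ κ) (hp2 : p ≠ 2) (hk0 : 0 < k)
    (hk2 : Even k) (hpk : ¬ p ∣ k) (hR : Even R) (hd : 2 * d = R * (k - 1))
    (hl1 : 1 < ‖ϖ‖ * l) (hlρ : l < ρ) (hlp : l < p * ‖ϖ‖)
    (hc1 : 1 < ‖c‖) (hc : ‖c‖ ^ p = (ρ / ‖ϖ‖) ^ k) {S : ℕ → K}
    (hS : ∀ m, m ≠ 0 → ∃ (G : Subgroup Kˣ) (_ : Fintype G), Fintype.card G = p ^ m - 1 ∧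
      S m = ∑ x : G, klSum (fun y : G => psi p ϖ m ((y : Kˣ) : K)) k x ^ R)
    {Z : K⟦X⟧} (hZ : IsZeta Z (tailSeries S)) (hr : 0 < r) :
    DiscBounded r (Z * ∏ j ∈ range (d + 1), (1 - C ((p : K) ^ (j + 1)) * X) ^ (k ^ R)) := by
  classical
  have : NeZero k := ⟨hk0.ne'⟩
  have hp0 := hp.1.ne_zero
  have hpK : (p : K) ≠ 0 := Nat.cast_ne_zero.2 hp0
  have hc0 : c ≠ 0 := norm_pos_iff.1 (one_pos.trans hc1)
  have hϖ := H.varpi_pos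
  have hρ := H.pos
  have hTb : ∀ n I J, ‖coeff n (tensorMat R (frobSeries p ϖ k) I J)‖
      ≤ ((‖ϖ‖⁻¹ ^ k) ^ p) ^ R * ‖c‖⁻¹ ^ n :=
    norm_coeff_tensorMat_le R (by positivity) (by positivity) fun n i j => by
      refine H.norm_coeff_frobSeries_le_pow (by positivity) (inv_le_one_of_one_le₀ hc1.le) ?_ n i j
      rw [inv_pow, hc, ← inv_pow, inv_div]
  have hTc I J : IsConv (tensorMat R (frobSeries p ϖ k) I J) := by
    rw [tensorMat_apply]
    exact IsConv.prod _ fun r _ => H.isConv_frobSeries _ _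
  obtain ⟨C', q, hA⟩ := exists_rowDecay_dworkOp hp.1.two_le hc1 hTb
  have hopS m : m ≠ 0 → S m = ((p : K) ^ m - 1) *
      opTrace (dworkOp p c (tensorMat R (frobSeries p ϖ k)) ^ m) := by
    intro hm
    obtain ⟨G, hGf, hG, hSm⟩ := hS m hm
    let τ : G →* K := (Units.coeHom K).comp G.subtype
    have hτ : Function.Injective τ := fun x y h => Subtype.ext (Units.ext h)
    have h1 := opTrace_dworkOp_pow hp0 hc0 hTc hA hτ hm hG
    have h2 : (Fintype.card G : K) = (p : K) ^ m - 1 := by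
      rw [hG, Nat.cast_sub (Nat.one_le_pow _ _ hp.1.pos)]; simp
    rw [← h2, h1, hSm]
    exact sum_congr rfl fun x _ => (H.trace_tensor hk0 hk2 hR hτ hm hG x).symm
  generalize hAdef : dworkOp p c (tensorMat R (frobSeries p ϖ k)) = A at hA hopS
  have hZ' : Z * rescale (p : K) (fredholm A) = fredholm A := by
    refine (hZ.mul (hA.isZeta_fredholm.rescale (p : K))).unique ?_
    have e : tailSeries S + rescale (p : K) (-tailSeries fun m => opTrace (A ^ m))
        = -tailSeries fun m => opTrace (A ^ m) := by
      ext m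
      rw [map_add, coeff_rescale, map_neg]
      rcases eq_or_ne m 0 with rfl | hm
      · simp [coeff_tailSeries_zero]
      · rw [coeff_tailSeries _ hm, coeff_tailSeries _ hm, hopS m hm]; ring
    rw [e]
    exact hA.isZeta_fredholm
  have hconv v : seqOp A v = scaleEquiv hc0 (frobOp p (tensorMat R (frobSeries p ϖ k))
      ((scaleEquiv hc0).symm v)) := by
    rw [← seqOp_scaleEquiv hc0, LinearEquiv.apply_symm_apply, hAdef]
  rw [prod_pow_prime_factor p hp.1.two_le]
  refine hA.discBounded_zeta (N := scaledConn R k ϖ hc0) hpK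
    (norm_natCast_le_one K p)
    (fun v hv => scaledConn_mem_bddSeq hc0 hv) (fun v => ?_)
    (fun W _ _ hW => finrank_le_of_le_ker_scaledConn H.varpi_ne hc0 hW) ?_ hZ' hr
  · rw [hconv, hconv, scaledConn_apply, scaledConn_apply, LinearEquiv.symm_apply_apply,
      frobOp_conn hp0 H.horizontal_frobSeries, map_smul, LinearEquiv.symm_apply_apply]
  · intro v hv hNv μ hμ hev hv0
    obtain ⟨b, hb⟩ := hv
    have hb0 : 0 ≤ b := (norm_nonneg _).trans (hb 0)
    obtain ⟨j, hj, hμj⟩ := H.eigenvalue_mem (u := (scaleEquiv (ι := Fin R → Fin k) hc0).symm v)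
      hp2 hpk hd hl1 hlρ hlp hc1 hc (by positivity) hTb hb0 (fun x => by
        rw [scaleEquiv_symm_apply, norm_mul, norm_inv, norm_pow, mul_comm, inv_pow]
        exact mul_le_mul_of_nonneg_right (hb _) (by positivity))
      (by
        rw [scaledConn_apply] at hNv
        exact (scaleEquiv hc0).map_eq_zero_iff.1 hNv) hμ
      (by
        rw [hconv] at hev
        rw [← (scaleEquiv hc0).symm_apply_apply (frobOp p _ _), hev, map_smul])
      (fun h => hv0 ((scaleEquiv hc0).symm.map_eq_zero_iff.1 h))
    exact mem_image.2 ⟨j, mem_range.2 (Nat.lt_succ_of_le hj), hμj.symm⟩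

end Zeta

section Convolution
variable {G : Type*} [CommGroup G] [Fintype G] {E : Type*} [CommRing E] (k : ℕ)

lemma map_klSum {E' : Type*} [CommRing E'] (φ : E →+* E') (ψ : G → E) (x : G) :
    φ (klSum ψ k x) = klSum (fun y => φ (ψ y)) k x := by
  simp only [klSum, map_sum, apply_ite φ, map_prod, map_zero]

lemma klSum_scale (ψ : G → E) (c x : G) :
    klSum (fun y => ψ (c * y)) k x = klSum ψ k (c ^ k * x) := by
  classical
  refine Fintype.sum_equiv (Equiv.mulLeft (fun _ : Fin k => c)) _ _ fun t => ?_
  refine if_congr ?_ rfl rfl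
  simp [prod_mul_distrib]

lemma sum_klSum_scale (ψ : G → E) (c : G) (R : ℕ) :
    ∑ x, klSum (fun y => ψ (c * y)) k x ^ R = ∑ x, klSum ψ k x ^ R := by
  simp only [klSum_scale]
  exact Equiv.sum_comp (Equiv.mulLeft (c ^ k)) fun x => klSum ψ k x ^ R

lemma sum_klSum_pow (ψ : G → E) (R : ℕ) [DecidableEq G] : ∑ x, klSum ψ k x ^ R =
    ∑ P : G × (Fin R → Fin k → G), ∏ r, if ∏ i, P.2 r i = P.1 then ∏ i, ψ (P.2 r i) else 0 := by
  rw [Fintype.sum_prod_type]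
  refine sum_congr rfl fun x _ => ?_
  rw [klSum, Fintype.sum_pow]
  exact sum_congr rfl fun T _ => prod_congr rfl fun r _ => by congr

lemma klSum_of_injective {G' : Type*} [CommGroup G'] [Fintype G'] {ι : G →* G'}
    (hι : Function.Injective ι) {ψ : G' → E} (hψ : ∀ y ∉ Set.range ι, ψ y = 0) (x : G) :
    klSum ψ k (ι x) = klSum (fun y => ψ (ι y)) k x := by
  refine (Fintype.sum_of_injective (fun (t : Fin k → G) i => ι (t i))
    (fun t t' h => funext fun i => hι (congrFun h i)) _ _ (fun t ht => ?_) fun t => ?_).symm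
  · obtain ⟨i, hi⟩ : ∃ i, t i ∉ Set.range ι := by
      by_contra! h
      choose s hs using h
      exact ht ⟨s, funext hs⟩
    rw [prod_eq_zero (mem_univ i) (hψ _ hi), ite_self]
  · rw [← map_prod, hι.eq_iff]

lemma klSum_eq_zero_of_notMem {G' : Type*} [CommGroup G'] [Fintype G'] {ι : G →* G'}
    {ψ : G' → E} (hψ : ∀ y ∉ Set.range ι, ψ y = 0) {x : G'} (hx : x ∉ Set.range ι) :
    klSum ψ k x = 0 := by
  classical
  refine sum_eq_zero fun t _ => ite_eq_right_iff.2 fun ht => ?_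
  by_contra h
  have h' i : t i ∈ Set.range ι := by
    by_contra hi
    exact h (prod_eq_zero (mem_univ i) (hψ _ hi))
  exact hx (ht ▸ (MonoidHom.range ι).prod_mem fun i _ => h' i)

lemma norm_klSum_le {E : Type*} [NormedField E] {ψ : G → E} (hψ : ∀ y, ‖ψ y‖ = 1) (x : G) :
    ‖klSum ψ k x‖ ≤ (Fintype.card G : ℝ) ^ k := by
  rw [klSum]
  have h : ∑ _t : Fin k → G, (1 : ℝ) = (Fintype.card G : ℝ) ^ k := by simp
  refine h ▸ norm_sum_le_of_le _ fun t _ => ?_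
  split_ifs
  · simp [norm_prod, hψ]
  · simp

end Convolution

section Dynamics
variable {Ω : Type*} [Fintype Ω] [DecidableEq Ω] {K : Type*} [Field K]

/-- The weighted transition matrix of a self-map. -/
def dynMat (F : Ω → Ω) (w : Ω → K) : Matrix Ω Ω K := Matrix.of fun P Q => if F P = Q then w P else 0

lemma dynMat_pow_apply (F : Ω → Ω) (w : Ω → K) (m : ℕ) (P Q : Ω) :
    (dynMat F w ^ m) P Q = if F^[m] P = Q then ∏ i ∈ range m, w (F^[i] P) else 0 := by
  induction m generalizing Q with
  | zero => simp [Matrix.one_apply]; rfl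
  | succ m ih =>
    rw [pow_succ, Matrix.mul_apply]
    simp only [ih]
    simp only [dynMat, Matrix.of_apply, ite_mul, zero_mul]
    rw [sum_ite_eq, if_pos (mem_univ _), mul_ite, mul_zero, Function.iterate_succ_apply',
      prod_range_succ]

lemma trace_dynMat_pow (F : Ω → Ω) (w : Ω → K) (m : ℕ) :
    (dynMat F w ^ m).trace = ∑ P, if F^[m] P = P then ∏ i ∈ range m, w (F^[i] P) else 0 := by
  simp only [Matrix.trace, Matrix.diag, dynMat_pow_apply]

lemma isIntegral_coeff_charpoly [IsAlgClosed K] {M : Matrix Ω Ω K} {N : ℕ} (hN : N ≠ 0)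
    (h : M ^ (N + N) = M ^ N) (i : ℕ) : IsIntegral ℤ (M.charpoly.coeff i) := by
  refine Polynomial.isIntegral_coeff_of_factors _ (by rw [M.charpoly_monic.leadingCoeff]; exact isIntegral_one)
    (IsAlgClosed.splits _) (fun x hx => ?_) i
  have h1 : minpoly K M ∣ Polynomial.X ^ (N + N) - Polynomial.X ^ N :=
    minpoly.dvd _ _ (by simp [h])
  have h3 : Module.End.HasEigenvalue (Matrix.toLin' M) x := by
    rw [Module.End.hasEigenvalue_iff_isRoot_charpoly, Matrix.charpoly_toLin']
    exact hx
  have h2 : (minpoly K M).IsRoot x := by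
    rw [← Matrix.minpoly_toLin']
    exact Module.End.isRoot_of_hasEigenvalue h3
  have h4 := h2.dvd h1
  refine ⟨Polynomial.X ^ (N + N) - Polynomial.X ^ N, ?_, by simpa using h4⟩
  exact Polynomial.monic_X_pow_sub ((Polynomial.degree_X_pow_le N).trans_lt
    (by exact_mod_cast (by lia : N < N + N)))

open PowerSeries in
lemma isIntegral_coeff_inv {f : K⟦X⟧} (h0 : coeff 0 f = 1) (hf : ∀ n, IsIntegral ℤ (coeff n f))
    (n : ℕ) : IsIntegral ℤ (coeff n f⁻¹) := by
  induction n using Nat.strong_induction_on with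
  | _ n ih =>
    rw [coeff_inv, ← coeff_zero_eq_constantCoeff_apply, h0, inv_one]
    split_ifs
    · exact isIntegral_one
    · refine isIntegral_one.neg.mul (IsIntegral.sum _ fun x _ => ?_)
      split_ifs with hx
      · exact (hf _).mul (ih _ hx)
      · exact isIntegral_zero

open PowerSeries in
lemma isIntegral_coeff_inv_charpolyRev [IsAlgClosed K] {M : Matrix Ω Ω K} {N : ℕ} (hN : N ≠ 0)
    (h : M ^ (N + N) = M ^ N) (i : ℕ) : IsIntegral ℤ (coeff i (M.charpolyRev : K⟦X⟧)⁻¹) := by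
  refine isIntegral_coeff_inv (isZeta_charpolyRev M).coeff_zero (fun n => ?_) i
  rw [Polynomial.coeff_coe, ← Matrix.reverse_charpoly, Polynomial.coeff_reverse]
  exact isIntegral_coeff_charpoly hN h _

end Dynamics

section TorusDef
variable (p : ℕ) [hp : Fact p.Prime] (K : Type*) [NormedField K] (m : ℕ)

/-- The group of nonzero Teichmüller representatives of the field with `p ^ m` elements. -/
def torus : Subgroup Kˣ := rootsOfUnity (p ^ m - 1) K

lemma neZero_pow_sub_one [NeZero m] : NeZero (p ^ m - 1) :=
  ⟨Nat.sub_ne_zero_of_lt (Nat.one_lt_pow (NeZero.ne m) hp.1.one_lt)⟩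

noncomputable instance [NeZero m] : Fintype (torus p K m) :=
  have := neZero_pow_sub_one p m
  have : Finite (torus p K m) := inferInstanceAs (Finite (rootsOfUnity (p ^ m - 1) K))
  Fintype.ofFinite _

variable {p K m}

lemma mem_torus_iff {y : Kˣ} : y ∈ torus p K m ↔ y ^ p ^ m = y := by
  rw [torus, _root_.mem_rootsOfUnity, ← mul_eq_right (b := y), ← pow_succ,
    Nat.sub_add_cancel (Nat.one_le_pow _ _ hp.1.pos)]

lemma torus_pow (y : torus p K m) : y ^ p ^ m = y :=
  Subtype.ext (mem_torus_iff.1 y.2)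

lemma torus_coe_pow (y : torus p K m) : ((y : Kˣ) : K) ^ p ^ m = ((y : Kˣ) : K) :=
  congrArg Units.val (mem_torus_iff.1 y.2)

lemma norm_torus [CompleteSpace K] [NeZero m] (y : torus p K m) : ‖((y : Kˣ) : K)‖ = 1 :=
  norm_hom_eq_one (τ := (Units.coeHom K).comp (torus p K m).subtype) y

lemma torus_pow_injective [NeZero m] (j : ℕ) :
    Function.Injective fun y : torus p K m => y ^ p ^ j := by
  have h : Function.Injective fun y : torus p K m => y ^ p := fun y z h => by
    have h' := congrArg (· ^ p ^ (m - 1)) h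
    simp only [← pow_mul, ← pow_succ', Nat.sub_add_cancel (NeZero.one_le (n := m))] at h'
    rwa [torus_pow, torus_pow] at h'
  induction j with
  | zero => simpa using! Function.injective_id
  | succ j ih => simpa only [pow_succ, pow_mul] using! h.comp ih

lemma card_torus [IsAlgClosed K] [CharZero K] [NeZero m] :
    Fintype.card (torus p K m) = p ^ m - 1 := by
  have := neZero_pow_sub_one p m
  have : NeZero ((p ^ m - 1 : ℕ) : K) := ⟨Nat.cast_ne_zero.2 (NeZero.ne _)⟩
  obtain ⟨ζ, hζ⟩ := HasEnoughRootsOfUnity.exists_primitiveRoot K (p ^ m - 1)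
  rw [← Nat.card_eq_fintype_card]
  exact hζ.card_rootsOfUnity

end TorusDef

section Integrality
open PowerSeries
variable {p : ℕ} [hp : Fact p.Prime] {K : Type*} [NormedField K] [IsUltrametricDist K]
  [CharZero K] [CompleteSpace K] {ϖ : K} {ρ κ : ℝ} {k R : ℕ}

/-- The Dwork splitting of the additive character on the torus. -/
noncomputable def psiT (ϖ : K) (m : ℕ) (y : torus p K m) : K := psi p ϖ m ((y : Kˣ) : K)

variable (p K k R) in
/-- The index set of the moments of `k`-fold convolutions. -/
abbrev MomentIdx (m : ℕ) := torus p K m × (Fin R → Fin k → torus p K m)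

/-- The Frobenius self-map. -/
def momentFrob {M : ℕ} (P : MomentIdx p K k R M) : MomentIdx p K k R M :=
  (P.1 ^ p, fun r i => P.2 r i ^ p)

lemma momentFrob_iterate {M : ℕ} (m : ℕ) (P : MomentIdx p K k R M) :
    momentFrob^[m] P = (P.1 ^ p ^ m, fun r i => P.2 r i ^ p ^ m) := by
  induction m with
  | zero => simp
  | succ m ih => rw [Function.iterate_succ_apply', ih]; simp only [momentFrob, ← pow_mul, ← pow_succ]

open Classical in
/-- The weight whose orbit products are the terms of the moments. -/
noncomputable def momentWeight (ϖ : K) {M : ℕ} (P : MomentIdx p K k R M) : K :=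
  ∏ r, if ∏ i, P.2 r i = P.1 then ∏ i, ev (((P.2 r i : torus p K M) : Kˣ) : K) (theta p ϖ) else 0

open Classical in
lemma prod_momentWeight {M : ℕ} [NeZero M] {m : ℕ} (hm : m ≠ 0) (P : MomentIdx p K k R M) :
    ∏ j ∈ range m, momentWeight ϖ (momentFrob^[j] P) =
      ∏ r, if ∏ i, P.2 r i = P.1 then ∏ i, psi p ϖ m (((P.2 r i : torus p K M) : Kˣ) : K) else 0 := by
  simp only [momentWeight, momentFrob_iterate]
  rw [prod_comm]
  refine prod_congr rfl fun r _ => ?_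
  have h j : (∏ i, P.2 r i ^ p ^ j = P.1 ^ p ^ j) ↔ ∏ i, P.2 r i = P.1 := by
    rw [prod_pow]
    exact (torus_pow_injective j).eq_iff
  simp only [h]
  split_ifs
  · rw [prod_comm]
    simp [psi]
  · simp [hm]

lemma sum_klSum_torus {m M : ℕ} [NeZero m] [NeZero M] (hmM : m ∣ M) (hR : R ≠ 0) :
    (∑ x : torus p K m, klSum (psiT ϖ m) k x ^ R) =
      ∑ x : torus p K M, klSum (fun y : torus p K M => open Classical in
        if y ^ p ^ m = y then psi p ϖ m ((y : Kˣ) : K) else 0) k x ^ R := by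
  classical
  have hle : torus p K m ≤ torus p K M :=
    rootsOfUnity_le_of_dvd (Nat.pow_sub_one_dvd_pow_sub_one p hmM)
  let ι := Subgroup.inclusion hle
  have hι : Function.Injective ι := Subgroup.inclusion_injective hle
  have hmem y : y ∉ Set.range ι → (if y ^ p ^ m = y then psi p ϖ m ((y : Kˣ) : K) else 0) = 0 :=
    fun hy => if_neg fun h => hy ⟨⟨y, mem_torus_iff.2 (congrArg Subtype.val h)⟩, rfl⟩
  refine Fintype.sum_of_injective ι hι _ _ (fun x hx => ?_) fun x => ?_
  · rw [klSum_eq_zero_of_notMem k hmem hx, zero_pow hR]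
  · rw [klSum_of_injective k hι hmem]
    congr 2
    funext y
    rw [if_pos (by rw [← map_pow, torus_pow])]
    rfl

open Classical in
lemma trace_dynMat_moment {m M : ℕ} [NeZero m] [NeZero M] (hmM : m ∣ M) (hR : R ≠ 0) :
    (dynMat (momentFrob (p := p) (K := K) (k := k) (R := R) (M := M)) (momentWeight ϖ) ^ m).trace =
      ∑ x : torus p K m, klSum (psiT ϖ m) k x ^ R := by
  rw [sum_klSum_torus hmM hR, sum_klSum_pow, trace_dynMat_pow]
  refine sum_congr rfl fun P _ => ?_
  rw [prod_momentWeight (NeZero.ne m), momentFrob_iterate]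
  by_cases hT : ∀ r i, P.2 r i ^ p ^ m = P.2 r i
  · simp only [hT, if_true]
    split_ifs with h
    · rfl
    · obtain ⟨r⟩ : Nonempty (Fin R) := ⟨⟨0, Nat.pos_of_ne_zero hR⟩⟩
      refine (prod_eq_zero (mem_univ r) (if_neg fun e => h ?_)).symm
      rw [← e, ← prod_pow]
      exact Prod.ext ((prod_congr rfl fun i _ => hT r i).trans e) rfl
  · rw [if_neg fun h => hT fun r i => congrFun (congrFun (congrArg Prod.snd h) r) i]
    push Not at hT
    obtain ⟨r, i, hi⟩ := hT
    refine (prod_eq_zero (mem_univ r) ?_).symm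
    rw [prod_eq_zero (mem_univ i) (if_neg hi), ite_self]

open Classical in
lemma GoodRadius.dynMat_moment_pow (H : GoodRadius p ϖ ρ κ) {M : ℕ} [NeZero M] {l : ℕ}
    (hl : l ≠ 0) : dynMat (momentFrob (p := p) (K := K) (k := k) (R := R) (M := M))
      (momentWeight ϖ) ^ (M * (p * l)) =
      Matrix.diagonal fun P => ∏ r, if ∏ i, P.2 r i = P.1 then 1 else 0 := by
  ext P Q
  rw [dynMat_pow_apply, prod_momentWeight (mul_ne_zero (NeZero.ne M) (mul_ne_zero hp.1.ne_zero hl)),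
    Matrix.diagonal_apply, momentFrob_iterate]
  have h1 (y : torus p K M) : psi p ϖ (M * (p * l)) ((y : Kˣ) : K) = 1 := by
    rw [psi_mul (torus_coe_pow y), pow_mul, H.psi_pow_prime (torus_coe_pow y) (norm_torus y).le, one_pow]
  have h2 (y : torus p K M) : y ^ p ^ (M * (p * l)) = y := by
    generalize p * l = n
    induction n with
    | zero => simp
    | succ n ih => rw [mul_add, mul_one, pow_add, pow_mul, ih, torus_pow]
  simp only [h1, h2, prod_const_one]

lemma GoodRadius.isIntegral_coeff_zeta [IsAlgClosed K] (H : GoodRadius p ϖ ρ κ) (hR : R ≠ 0)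
    {S : ℕ → K} (hS : ∀ m [NeZero m], S m = ∑ x : torus p K m, klSum (psiT ϖ m) k x ^ R)
    {Z : K⟦X⟧} (hZ : IsZeta Z (tailSeries S)) (n : ℕ) : IsIntegral ℤ (coeff n Z) := by
  classical
  have : NeZero n.factorial := ⟨n.factorial_ne_zero⟩
  set A := dynMat (momentFrob (p := p) (K := K) (k := k) (R := R) (M := n.factorial))
    (momentWeight ϖ) with hA
  rw [hZ.coeff_congr (isZeta_charpolyRev A).inv n fun m hm => ?_]
  · refine isIntegral_coeff_inv_charpolyRev (N := n.factorial * (p * 1))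
      (mul_ne_zero (NeZero.ne _) (by simp [hp.1.ne_zero])) ?_ n
    rw [← mul_add, ← mul_add, H.dynMat_moment_pow (by simp), H.dynMat_moment_pow (by simp)]
  · rw [neg_neg]
    rcases eq_or_ne m 0 with rfl | h0
    · rw [coeff_tailSeries_zero, coeff_tailSeries_zero]
    · have : NeZero m := ⟨h0⟩
      rw [coeff_tailSeries _ h0, coeff_tailSeries _ h0, hS, hA,
        trace_dynMat_moment (Nat.dvd_factorial (Nat.pos_of_ne_zero h0) hm) hR]

end Integrality

section Rationality
variable {p : ℕ} [hp : Fact p.Prime] {K : Type*} [NormedField K] [IsUltrametricDist K]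
  [CharZero K] [CompleteSpace K] {ϖ : K} {ρ κ : ℝ} {k R : ℕ}
  {F : Type*} [Field F] [Algebra ℚ F] [IsCyclotomicExtension {p} ℚ F] (f : F →+* K) (g : F →+* ℂ)

/-- The additive character on the torus with values in the cyclotomic field. -/
noncomputable def psiF (ϖ : K) (m : ℕ) (y : torus p K m) : F := Function.invFun f (psiT ϖ m y)

lemma exists_neg_one_torus (hp2 : p ≠ 2) (m : ℕ) : ∃ c : torus p K m, ((c : Kˣ) : K) = -1 :=
  ⟨⟨-1, mem_torus_iff.2 ((hp.1.odd_of_ne_two hp2).pow.neg_one_pow)⟩, by simp⟩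

namespace GoodRadius
variable (H : GoodRadius p ϖ ρ κ) {m : ℕ} [NeZero m]
include H

lemma map_psiF (y : torus p K m) : f (psiF f ϖ m y) = psiT ϖ m y := by
  refine Function.invFun_eq ?_
  have hζ := (IsCyclotomicExtension.zeta_spec p ℚ F).map_of_injective f.injective
  obtain ⟨i, -, hi⟩ := hζ.eq_pow_of_pow_eq_one (H.psi_pow_prime (torus_coe_pow y) (norm_torus y).le)
  exact ⟨IsCyclotomicExtension.zeta p ℚ F ^ i, by rw [map_pow]; exact hi⟩

lemma psiF_pow_prime (y : torus p K m) : psiF f ϖ m y ^ p = 1 :=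
  f.injective (by
    rw [map_pow, H.map_psiF, map_one]
    exact H.psi_pow_prime (torus_coe_pow y) (norm_torus y).le)

lemma psiF_neg (hp2 : p ≠ 2) {c : torus p K m} (hc : ((c : Kˣ) : K) = -1) (y : torus p K m) :
    psiF f ϖ m (c * y) = (psiF f ϖ m y)⁻¹ := by
  refine eq_inv_of_mul_eq_one_right (f.injective ?_)
  rw [map_mul, H.map_psiF, H.map_psiF, map_one]
  simpa [psiT, hc] using H.psi_neg hp2 m (norm_torus y).le

lemma exists_psiF_scale [IsAlgClosed K] {n : ℕ} (hn : ¬p ∣ n) :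
    ∃ c : torus p K m, ∀ y, psiF f ϖ m (c * y) = psiF f ϖ m y ^ n := by
  obtain ⟨c, hc, hcn⟩ := exists_teichmuller H.norm_p hn
  have hcp : c ^ p = c := by
    rw [← Nat.sub_add_cancel hp.1.one_le, pow_succ, hc, one_mul]
  have hc0 : c ≠ 0 := by
    rintro rfl
    rw [zero_pow (Nat.sub_ne_zero_of_lt hp.1.one_lt)] at hc
    exact zero_ne_one hc
  have hcm : c ^ p ^ m = c := by
    generalize m = m
    induction m with
    | zero => simp
    | succ m ih => rw [pow_succ, pow_mul, ih, hcp]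
  refine ⟨⟨Units.mk0 c hc0, mem_torus_iff.2 (Units.ext (by simpa using hcm))⟩, fun y => f.injective ?_⟩
  rw [map_pow, H.map_psiF, H.map_psiF]
  have hc1 : ‖c‖ = 1 := (pow_eq_one_iff_of_nonneg (norm_nonneg _)
    (Nat.sub_ne_zero_of_lt hp.1.one_lt)).1 (by rw [← norm_pow, hc, norm_one])
  exact H.psi_mul_of_near (torus_coe_pow y) (norm_torus y).le hcp hc1.le hcn

lemma exists_rat_moment [IsAlgClosed K] : ∃ s : ℚ,
    ∑ x : torus p K m, klSum (psiF f ϖ m) k x ^ R = algebraMap ℚ F s := by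
  have := IsCyclotomicExtension.finiteDimensional {p} ℚ F
  have := IsCyclotomicExtension.isGalois {p} ℚ F
  have hζ := IsCyclotomicExtension.zeta_spec p ℚ F
  set ζ := IsCyclotomicExtension.zeta p ℚ F
  suffices h : (∑ x : torus p K m, klSum (psiF f ϖ m) k x ^ R) ∈ (⊥ : IntermediateField ℚ F) from
    (IntermediateField.mem_bot.1 h).imp fun _ => Eq.symm
  refine (IsGalois.mem_bot_iff_fixed _).2 fun σ => ?_
  obtain ⟨n, -, hn⟩ := hζ.eq_pow_of_pow_eq_one (ξ := σ ζ) (by rw [← map_pow, hζ.pow_eq_one, map_one])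
  have hpn : ¬p ∣ n := fun h => by
    rw [(hζ.pow_eq_one_iff_dvd n).2 h] at hn
    exact hζ.ne_one hp.1.one_lt (σ.injective (by rw [← hn, map_one]))
  obtain ⟨c, hc⟩ := H.exists_psiF_scale f (m := m) hpn
  refine Eq.trans ?_ (sum_klSum_scale k (psiF f ϖ m) c R)
  rw [map_sum]
  refine sum_congr rfl fun x _ => ?_
  rw [map_pow]
  congr 1
  refine (map_klSum k (σ : F →+* F) _ x).trans ?_
  congr 1
  funext y
  obtain ⟨i, -, hi⟩ := hζ.eq_pow_of_pow_eq_one (H.psiF_pow_prime f y)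
  rw [hc, ← hi, RingHom.coe_coe, map_pow, ← hn, pow_right_comm]

lemma klSum_complex_eq_re (hp2 : p ≠ 2) (hk2 : Even k) (x : torus p K m) :
    g (klSum (psiF f ϖ m) k x) = ((g (klSum (psiF f ϖ m) k x)).re : ℂ) := by
  obtain ⟨c, hc⟩ := exists_neg_one_torus (K := K) hp2 m
  refine (Complex.conj_eq_iff_re.1 ?_).symm
  rw [map_klSum, map_klSum]
  have h y : (starRingEnd ℂ) (g (psiF f ϖ m y)) = g (psiF f ϖ m (c * y)) := by
    rw [H.psiF_neg f hp2 hc, map_inv₀, Complex.inv_eq_conj]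
    exact (pow_eq_one_iff_of_nonneg (norm_nonneg _) hp.1.ne_zero).1
      (by rw [← norm_pow, ← map_pow, H.psiF_pow_prime, map_one, norm_one])
  have hck : c ^ k = 1 := Subtype.ext (Units.ext (by simp [hc, hk2.neg_one_pow]))
  simp only [h]
  rw [klSum_scale k (fun y => g (psiF f ϖ m y)) c x, hck, one_mul]

lemma norm_klSum_complex_le [IsAlgClosed K] (x : torus p K m) :
    ‖g (klSum (psiF f ϖ m) k x)‖ ≤ ((p : ℝ) ^ m) ^ k := by
  rw [map_klSum]
  refine (norm_klSum_le k (fun y => (pow_eq_one_iff_of_nonneg (norm_nonneg _) hp.1.ne_zero).1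
      (by rw [← norm_pow, ← map_pow, H.psiF_pow_prime, map_one, norm_one])) x).trans ?_
  rw [card_torus]
  exact pow_le_pow_left₀ (by positivity) (by exact_mod_cast Nat.sub_le _ _) k

end GoodRadius

/-- The moments are rational, with the expected archimedean size. -/
lemma GoodRadius.exists_rat_moments [IsAlgClosed K] (H : GoodRadius p ϖ ρ κ) (hp2 : p ≠ 2)
    (hk2 : Even k) (hR : Even R) :
    ∃ s : ℕ → ℚ, ∀ m [NeZero m],
      ((s m : K) = ∑ x : torus p K m, klSum (psiT ϖ m) k x ^ R) ∧
      (∀ x : torus p K m, ‖g (klSum (psiF f ϖ m) k x)‖ ^ R ≤ s m) ∧ 0 ≤ s m ∧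
      (s m : ℝ) ≤ ((p : ℝ) ^ (k * R + 1)) ^ m := by
  choose! s hs using fun (m : ℕ) (hm : NeZero m) =>
    H.exists_rat_moment f (m := m) (k := k) (R := R)
  refine ⟨s, fun m hm => ?_⟩
  have hC : ((s m : ℝ)) = ∑ x : torus p K m, ‖g (klSum (psiF f ϖ m) k x)‖ ^ R := by
    have h := congrArg g (hs m hm)
    rw [eq_ratCast, map_ratCast, map_sum] at h
    apply Complex.ofReal_injective
    push_cast
    rw [← h]
    refine sum_congr rfl fun x _ => ?_
    rw [map_pow, H.klSum_complex_eq_re f g hp2 hk2 x, Complex.norm_real, ← Complex.ofReal_pow,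
      ← Complex.ofReal_pow, Real.norm_eq_abs, hR.pow_abs]
  have h0 : 0 ≤ (s m : ℝ) := hC ▸ sum_nonneg fun _ _ => by positivity
  refine ⟨?_, fun x => ?_, by exact_mod_cast h0, ?_⟩
  · have h := congrArg f (hs m hm)
    rw [eq_ratCast, map_ratCast, map_sum] at h
    rw [← h]
    refine sum_congr rfl fun x _ => ?_
    rw [map_pow, map_klSum]
    exact congrArg (fun ψ => klSum ψ k x ^ R) (funext fun y => H.map_psiF f y)
  · rw [hC]
    exact single_le_sum (f := fun x => ‖g (klSum (psiF f ϖ m) k x)‖ ^ R) (fun _ _ => by positivity)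
      (mem_univ x)
  · rw [hC]
    refine (sum_le_card_nsmul _ _ ((((p : ℝ) ^ m) ^ k) ^ R) fun x _ =>
      pow_le_pow_left₀ (norm_nonneg _) (H.norm_klSum_complex_le f g x) R).trans ?_
    rw [card_univ, card_torus, nsmul_eq_mul, ← pow_mul, ← pow_mul, ← pow_mul]
    calc ((p ^ m - 1 : ℕ) : ℝ) * (p : ℝ) ^ (m * (k * R)) ≤ (p : ℝ) ^ m * (p : ℝ) ^ (m * (k * R)) := by
          gcongr
          exact_mod_cast Nat.sub_le _ _
      _ = (p : ℝ) ^ ((k * R + 1) * m) := by rw [← pow_add]; congr 1; ring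

end Rationality

section Archimedean
open PowerSeries
variable {E : Type*} [NormedField E] {r : ℝ} {f : E⟦X⟧}

lemma map_tailSeries {A B : Type*} [Field A] [Field B] (φ : A →+* B) (s : ℕ → A) :
    map φ (tailSeries s) = tailSeries fun m => φ (s m) := by
  ext m
  rcases eq_or_ne m 0 with rfl | hm
  · rw [coeff_map, coeff_tailSeries_zero, coeff_tailSeries_zero, map_zero]
  · rw [coeff_map, coeff_tailSeries _ hm, coeff_tailSeries _ hm]

lemma coeff_succ_mul_one_sub (f : E⟦X⟧) (b : E) (n : ℕ) :
    coeff (n + 1) (f * (1 - C b * X)) = coeff (n + 1) f - b * coeff n f := by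
  rw [mul_sub, mul_one, map_sub, mul_left_comm, ← smul_eq_C_mul, map_smul, coeff_succ_mul_X,
    smul_eq_mul]

lemma DiscBounded.mul_one_sub (hr : 0 < r) (hf : DiscBounded r f) (b : E) :
    DiscBounded r (f * (1 - C b * X)) := by
  obtain ⟨B, hB⟩ := hf
  have hB0 : 0 ≤ B := (mul_nonneg (norm_nonneg _) (by positivity)).trans (hB 0)
  refine ⟨B + ‖b‖ * r * B, fun n => ?_⟩
  rcases n with - | n
  · simpa [mul_sub] using (hB 0).trans (le_add_of_nonneg_right (by positivity))
  · rw [coeff_succ_mul_one_sub]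
    calc _ ≤ (‖coeff (n + 1) f‖ + ‖b‖ * ‖coeff n f‖) * r ^ (n + 1) := by
          gcongr
          exact (norm_sub_le _ _).trans_eq (by rw [norm_mul])
      _ = ‖coeff (n + 1) f‖ * r ^ (n + 1) + ‖b‖ * r * (‖coeff n f‖ * r ^ n) := by ring
      _ ≤ _ := by gcongr <;> apply hB

lemma DiscBounded.of_mul_one_sub (hr : 0 < r) {b : E} (hb : ‖b‖ * r < 1)
    (h : DiscBounded r (f * (1 - C b * X))) : DiscBounded r f := by
  obtain ⟨B, hB⟩ := h
  have hB0 : 0 ≤ B := (mul_nonneg (norm_nonneg _) (by positivity)).trans (hB 0)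
  have hb0 := norm_nonneg b
  have h1 : 0 < 1 - ‖b‖ * r := by linarith
  refine ⟨B / (1 - ‖b‖ * r), fun n => ?_⟩
  induction n with
  | zero =>
    have := hB 0
    simp only [mul_sub, mul_one, map_sub, coeff_zero_eq_constantCoeff, map_mul,
      constantCoeff_X, mul_zero, sub_zero] at this ⊢
    refine this.trans ((le_div_iff₀ h1).2 ?_)
    nlinarith [mul_nonneg hb0 hr.le]
  | succ n ih =>
    have h2 := hB (n + 1)
    rw [coeff_succ_mul_one_sub] at h2
    calc _ ≤ (‖coeff (n + 1) f - b * coeff n f‖ + ‖b‖ * ‖coeff n f‖) * r ^ (n + 1) := by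
          gcongr
          rw [← norm_mul]
          simpa using norm_add_le (coeff (n + 1) f - b * coeff n f) (b * coeff n f)
      _ = ‖coeff (n + 1) f - b * coeff n f‖ * r ^ (n + 1) + ‖b‖ * r * (‖coeff n f‖ * r ^ n) := by ring
      _ ≤ B + ‖b‖ * r * (B / (1 - ‖b‖ * r)) := by gcongr
      _ = _ := by field_simp; ring

lemma DiscBounded.mul_one_sub_pow (hr : 0 < r) (hf : DiscBounded r f) (b : E) (e : ℕ) :
    DiscBounded r (f * (1 - C b * X) ^ e) := by
  induction e with
  | zero => simpa using hf
  | succ e ih => rw [pow_succ, ← mul_assoc]; exact ih.mul_one_sub hr b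

lemma DiscBounded.of_mul_one_sub_pow (hr : 0 < r) {b : E} (hb : ‖b‖ * r < 1) (e : ℕ)
    (h : DiscBounded r (f * (1 - C b * X) ^ e)) : DiscBounded r f := by
  induction e with
  | zero => simpa using h
  | succ e ih => rw [pow_succ, ← mul_assoc] at h; exact ih (h.of_mul_one_sub hr hb)

lemma discBounded_of_eventually_zero {N : ℕ} (h : ∀ n, N ≤ n → coeff n f = 0) :
    DiscBounded r f := by
  refine ⟨∑ i ∈ range N, |‖coeff i f‖ * r ^ i|, fun n => ?_⟩
  rcases lt_or_ge n N with hn | hn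
  · exact (le_abs_self _).trans (single_le_sum (f := fun i => |‖coeff i f‖ * r ^ i|)
      (fun _ _ => abs_nonneg _) (mem_range.2 hn))
  · rw [h n hn, norm_zero, zero_mul]
    exact sum_nonneg fun _ _ => abs_nonneg _

lemma coeff_le_pow_of_isZeta {Z : ℚ⟦X⟧} {s : ℕ → ℚ} (hZ : IsZeta Z (tailSeries s)) {A : ℚ}
    (hs : ∀ m, m ≠ 0 → 0 ≤ s m ∧ s m ≤ A ^ m) (hA : 0 ≤ A) (n : ℕ) :
    0 ≤ coeff n Z ∧ coeff n Z ≤ A ^ n ∧ (n ≠ 0 → s n ≤ n * coeff n Z) := by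
  have ht m : 0 ≤ coeff m (tailSeries s) ∧ coeff m (tailSeries s) ≤ if m = 0 then 0 else A ^ m := by
    rcases eq_or_ne m 0 with rfl | hm
    · simp [coeff_tailSeries_zero]
    · rw [coeff_tailSeries _ hm, if_neg hm]; exact hs m hm
  induction n using Nat.strong_induction_on with
  | _ n ih =>
    rcases eq_or_ne n 0 with rfl | hn
    · simp [hZ.coeff_zero]
    have hn' : (0 : ℚ) < n := by exact_mod_cast Nat.pos_of_ne_zero hn
    have hrec := hZ.coeff_rec n
    have hz : ∀ x ∈ antidiagonal n, 0 ≤ coeff x.1 (tailSeries s) * coeff x.2 Z := fun x hx => by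
      rcases eq_or_ne x.1 0 with h0 | h0
      · rw [h0, coeff_tailSeries_zero, zero_mul]
      · exact mul_nonneg (ht _).1 (ih _ (by have := mem_antidiagonal.1 hx; lia)).1
    refine ⟨?_, ?_, fun _ => ?_⟩
    · refine nonneg_of_mul_nonneg_right (a := (n : ℚ)) ?_ hn'
      rw [hrec]
      exact sum_nonneg hz
    · refine le_of_mul_le_mul_left ?_ hn'
      rw [hrec]
      calc _ ≤ ∑ x ∈ antidiagonal n, if x.1 = 0 then 0 else A ^ n := sum_le_sum fun x hx => by
            rcases eq_or_ne x.1 0 with h0 | h0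
            · rw [h0, coeff_tailSeries_zero, zero_mul, if_pos rfl]
            · have hx' := mem_antidiagonal.1 hx
              have h1 := (ht x.1).2
              rw [if_neg h0] at h1 ⊢
              rw [← hx', pow_add]
              have h2 := ih x.2 (by lia)
              exact mul_le_mul h1 h2.2.1 h2.1 (by positivity)
        _ = n * A ^ n := by
            rw [Nat.sum_antidiagonal_eq_sum_range_succ_mk, sum_range_succ']
            simp
    · rw [hrec]
      refine le_trans ?_ (single_le_sum hz (a := (n, 0)) (mem_antidiagonal.2 (add_zero n)))
      rw [coeff_tailSeries _ hn, hZ.coeff_zero, mul_one]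

end Archimedean

section Growth
open PowerSeries
variable {p : ℕ} [hp : Fact p.Prime] {K : Type*} [NormedField K] [IsUltrametricDist K]

lemma one_le_abs_mul_norm (hK : ‖(p : K)‖ = (p : ℝ)⁻¹) {w : ℤ} (hw : w ≠ 0) :
    1 ≤ |(w : ℝ)| * ‖(w : K)‖ := by
  have h1 : ‖(w : K)‖ = ‖(w.natAbs : K)‖ := by
    rcases Int.natAbs_eq w with h | h <;> rw [h] <;> simp
  rw [h1, norm_natCast_eq hK (Int.natAbs_ne_zero.2 hw), ← Int.cast_abs, ← Nat.cast_natAbs,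
    inv_pow, ← div_eq_mul_inv, one_le_div (by have := hp.1.pos; positivity)]
  exact_mod_cast Nat.le_of_dvd (Int.natAbs_pos.2 hw) pow_padicValNat_dvd

lemma eventually_zero_of_discBounded (hK : ‖(p : K)‖ = (p : ℝ)⁻¹) {W : ℤ⟦X⟧} {t r : ℝ}
    (ht : 0 < t) (hr : 0 < r) (hrt : 1 < t * r) (h1 : DiscBounded t (map (Int.castRingHom ℝ) W))
    (h2 : DiscBounded r (map (Int.castRingHom K) W)) : ∃ N, ∀ n, N ≤ n → coeff n W = 0 := by
  obtain ⟨B, hB⟩ := h1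
  obtain ⟨B', hB'⟩ := h2
  obtain ⟨N, hN⟩ := Filter.eventually_atTop.1 ((tendsto_pow_atTop_atTop_of_one_lt hrt).eventually_gt_atTop (B * B'))
  refine ⟨N, fun n hn => ?_⟩
  by_contra hw
  refine (hN n hn).not_ge ?_
  have e1 := hB n
  have e2 := hB' n
  simp only [coeff_map, eq_intCast] at e1 e2
  calc (t * r) ^ n ≤ (|((coeff n W : ℤ) : ℝ)| * ‖((coeff n W : ℤ) : K)‖) * (t * r) ^ n :=
        le_mul_of_one_le_left (by positivity) (one_le_abs_mul_norm hK hw)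
    _ = (‖((coeff n W : ℤ) : ℝ)‖ * t ^ n) * (‖((coeff n W : ℤ) : K)‖ * r ^ n) := by
        rw [mul_pow, Real.norm_eq_abs]; ring
    _ ≤ B * B' := mul_le_mul e1 e2 (by positivity) ((by positivity : (0:ℝ) ≤ _).trans e1)

lemma map_mul_prod_one_sub {A : Type*} [CommRing A] (Z : ℤ⟦X⟧) (n e : ℕ) :
    map (Int.castRingHom A) (Z * ∏ j ∈ range n, (1 - C ((p : ℤ) ^ (j + 1)) * X) ^ e) =
      map (Int.castRingHom A) Z * ∏ j ∈ range n, (1 - C ((p : A) ^ (j + 1)) * X) ^ e := by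
  simp [map_prod]

lemma discBounded_of_int (hK : ‖(p : K)‖ = (p : ℝ)⁻¹) {Z : ℤ⟦X⟧} {t r : ℝ} (ht : 0 < t)
    (hZ : DiscBounded t (map (Int.castRingHom ℝ) Z)) {d e : ℕ}
    (h : ∀ r' : ℝ, 0 < r' → DiscBounded r'
      (map (Int.castRingHom K) Z * ∏ j ∈ range (d + 1), (1 - C ((p : K) ^ (j + 1)) * X) ^ e))
    (hr : 0 < r) (hrd : (p : ℝ) ^ (d + 1) * r < 1) : DiscBounded r (map (Int.castRingHom ℝ) Z) := by
  have h1 n : DiscBounded t (map (Int.castRingHom ℝ)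
      (Z * ∏ j ∈ range n, (1 - C ((p : ℤ) ^ (j + 1)) * X) ^ e)) := by
    rw [map_mul_prod_one_sub]
    induction n with
    | zero => simpa using hZ
    | succ n ih => rw [prod_range_succ, ← mul_assoc]; exact ih.mul_one_sub_pow ht _ _
  have hr' : 0 < 2 * t⁻¹ := by positivity
  obtain ⟨N, hN⟩ := eventually_zero_of_discBounded hK ht hr' (by field_simp; norm_num) (h1 (d + 1))
    (by rw [map_mul_prod_one_sub]; exact h _ hr')
  have h2 : DiscBounded r (map (Int.castRingHom ℝ)
      (Z * ∏ j ∈ range (d + 1), (1 - C ((p : ℤ) ^ (j + 1)) * X) ^ e)) :=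
    discBounded_of_eventually_zero fun n hn => by rw [coeff_map, hN n hn, map_zero]
  rw [map_mul_prod_one_sub] at h2
  have hp1 : (1 : ℝ) ≤ p := by exact_mod_cast hp.1.one_le
  suffices ∀ n, n ≤ d + 1 → DiscBounded r (map (Int.castRingHom ℝ) Z *
      ∏ j ∈ range n, (1 - C ((p : ℝ) ^ (j + 1)) * X) ^ e) → DiscBounded r (map (Int.castRingHom ℝ) Z) from
    this _ le_rfl h2
  intro n hn h3
  induction n with
  | zero => simpa using h3
  | succ n ih =>
    rw [prod_range_succ, ← mul_assoc] at h3
    refine ih (by lia) (h3.of_mul_one_sub_pow hr ?_ e)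
    rw [norm_pow, Real.norm_natCast]
    exact lt_of_le_of_lt (by gcongr) hrd

end Growth

section Moments
open PowerSeries
variable {p : ℕ} [hp : Fact p.Prime] {K : Type*} [NontriviallyNormedField K] [IsUltrametricDist K]
  [CompleteSpace K] [IsAlgClosed K] [CharZero K] {ϖ c : K} {ρ κ l : ℝ} {k R d : ℕ}
  {F : Type*} [Field F] [Algebra ℚ F] [IsCyclotomicExtension {p} ℚ F] (f : F →+* K) (g : F →+* ℂ)

lemma GoodRadius.exists_norm_klSum_pow_le (H : GoodRadius p ϖ ρ κ) (hp2 : p ≠ 2) (hk0 : 0 < k)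
    (hk2 : Even k) (hpk : ¬p ∣ k) (hR : Even R) (hR0 : R ≠ 0) (hd : 2 * d = R * (k - 1))
    (hl1 : 1 < ‖ϖ‖ * l) (hlρ : l < ρ) (hlp : l < p * ‖ϖ‖) (hc1 : 1 < ‖c‖)
    (hc : ‖c‖ ^ p = (ρ / ‖ϖ‖) ^ k) {r : ℝ} (hr : 0 < r) (hrd : (p : ℝ) ^ (d + 1) * r < 1) :
    ∃ B : ℝ, ∀ m [NeZero m] (x : torus p K m),
      ‖g (klSum (psiF f ϖ m) k x)‖ ^ R * r ^ m ≤ B * m := by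
  obtain ⟨s, hs⟩ := H.exists_rat_moments f g hp2 hk2 hR
  obtain ⟨Z, hZ⟩ := exists_isZeta (S := tailSeries s) (coeff_tailSeries_zero s)
  have hZK : IsZeta (map (Rat.castHom K) Z) (tailSeries fun m => (s m : K)) := by
    simpa only [map_tailSeries, eq_ratCast] using hZ.map (Rat.castHom K)
  have hint n : ∃ z : ℤ, (z : ℚ) = coeff n Z := by
    have h := H.isIntegral_coeff_zeta hR0 (fun m _ => (hs m).1) hZK n
    rw [coeff_map] at h
    exact IsIntegrallyClosed.isIntegral_iff.1
      ((isIntegral_algHom_iff ((Rat.castHom K).toIntAlgHom) (Rat.castHom K).injective).1 h)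
  choose z hz using hint
  set A : ℚ := (p : ℚ) ^ (k * R + 1)
  have hA0 : 0 < A := by have := hp.1.pos; positivity
  have hzA := coeff_le_pow_of_isZeta hZ (A := A) (fun m hm => by
    have : NeZero m := ⟨hm⟩
    refine ⟨(hs m).2.2.1, ?_⟩
    have := (hs m).2.2.2
    simp only [A]
    exact_mod_cast this) hA0.le
  have hmk n : ((coeff n (PowerSeries.mk z) : ℤ) : ℚ) = coeff n Z := by rw [coeff_mk, hz]
  have hnorm n : ‖coeff n (map (Int.castRingHom ℝ) (PowerSeries.mk z))‖ = ((coeff n Z : ℚ) : ℝ) := by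
    rw [coeff_map, eq_intCast, ← hmk, Rat.cast_intCast, Real.norm_of_nonneg]
    have := (hzA n).1
    rw [← hmk] at this
    exact_mod_cast this
  have hA0' : (0 : ℝ) < A := by exact_mod_cast hA0
  have h1 : DiscBounded (A : ℝ)⁻¹ (map (Int.castRingHom ℝ) (PowerSeries.mk z)) := by
    refine ⟨1, fun n => ?_⟩
    rw [hnorm, inv_pow, ← div_eq_mul_inv, div_le_one (by positivity)]
    exact_mod_cast (hzA n).2.1
  have hmapK : map (Int.castRingHom K) (PowerSeries.mk z) = map (Rat.castHom K) Z := by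
    ext n
    rw [coeff_map, coeff_map, ← hmk, eq_intCast, map_intCast]
  obtain ⟨B, hB⟩ := discBounded_of_int H.norm_p (inv_pos.2 hA0') h1 (d := d) (e := k ^ R)
    (fun r' hr' => by
      rw [hmapK]
      refine H.discBounded_klSum hp2 hk0 hk2 hpk hR hd hl1 hlρ hlp hc1 hc (fun m hm => ?_) hZK hr'
      have : NeZero m := ⟨hm⟩
      exact ⟨torus p K m, inferInstance, card_torus, (hs m).1⟩) hr hrd
  refine ⟨B, fun m _ x => ?_⟩
  have h2 : (s m : ℝ) ≤ m * ((coeff m Z : ℚ) : ℝ) := by exact_mod_cast (hzA m).2.2 (NeZero.ne m)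
  have h3 := hB m
  rw [hnorm] at h3
  calc _ ≤ (m * ((coeff m Z : ℚ) : ℝ)) * r ^ m := by
        gcongr
        exact ((hs m).2.1 x).trans h2
    _ = m * (((coeff m Z : ℚ) : ℝ) * r ^ m) := by ring
    _ ≤ B * m := by rw [mul_comm B]; gcongr

end Moments

section Roots
open PowerSeries
variable {L : ℂ⟦X⟧} {s : ℕ → ℂ} {k : ℕ} {β B : ℝ}

lemma discBounded_inv_of_isZeta (hL : IsZeta L (tailSeries s)) (hβ : 0 < β)
    (hs : ∀ m, m ≠ 0 → ‖s m‖ ≤ B * β ^ m) {r : ℝ} (hr : 0 < r) (hrβ : β * r < 1) :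
    DiscBounded r L⁻¹ := by
  obtain ⟨N, hN⟩ := exists_nat_ge B
  have h1 := ((isZeta_one_sub β).pow N).inv
  set h : ℝ⟦X⟧ := ((1 - C β * X) ^ N)⁻¹ with hh
  have h2 : DiscBounded r h := by
    refine DiscBounded.of_mul_one_sub_pow hr (b := β) (by rwa [Real.norm_of_nonneg hβ.le]) N ?_
    rw [hh, PowerSeries.inv_mul_cancel _ (by simp)]
    exact discBounded_of_eventually_zero (N := 1) fun n hn => by
      rw [coeff_one, if_neg (by lia)]
  have ht m : ‖coeff m (-tailSeries s)‖ ≤ coeff m (-(N • -tailSeries fun m => β ^ m)) := by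
    rw [map_neg, norm_neg, smul_neg, neg_neg, map_nsmul, nsmul_eq_mul]
    rcases eq_or_ne m 0 with rfl | hm
    · simp [coeff_tailSeries_zero]
    · rw [coeff_tailSeries _ hm, coeff_tailSeries _ hm]
      exact (hs m hm).trans (by gcongr)
  have hle n : ‖coeff n L⁻¹‖ ≤ coeff n h := by
    induction n using Nat.strong_induction_on with
    | _ n ih =>
      rcases eq_or_ne n 0 with rfl | hn
      · rw [hL.inv.coeff_zero, h1.coeff_zero, norm_one]
      have hn' : (0 : ℝ) < n := by exact_mod_cast Nat.pos_of_ne_zero hn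
      refine le_of_mul_le_mul_left ?_ hn'
      rw [h1.coeff_rec n, ← Complex.norm_natCast n, ← norm_mul, hL.inv.coeff_rec n]
      refine norm_sum_le_of_le _ fun x hx => ?_
      rw [norm_mul]
      rcases eq_or_ne x.1 0 with h0 | h0
      · simp [h0]
      · exact mul_le_mul (ht _) (ih _ (by have := mem_antidiagonal.1 hx; lia)) (norm_nonneg _)
          ((norm_nonneg _).trans (ht _))
  obtain ⟨M, hM⟩ := h2
  exact ⟨M, fun n => le_trans (by gcongr; exact (hle n).trans (le_abs_self _)) (hM n)⟩

lemma one_le_of_eval_trunc_eq_zero (hL : IsZeta L (tailSeries s)) (hk : ∀ n, k < n → coeff n L = 0)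
    (hβ : 0 < β) (hs : ∀ m, m ≠ 0 → ‖s m‖ ≤ B * β ^ m) {z : ℂ}
    (hz : (trunc (k + 1) L).eval z = 0) : 1 ≤ β * ‖z‖ := by
  by_contra! hlt
  obtain ⟨r, hzr, hr1⟩ := exists_between ((lt_div_iff₀' hβ).2 hlt)
  have hr : 0 < r := (norm_nonneg z).trans_lt hzr
  obtain ⟨M, hM⟩ := discBounded_inv_of_isZeta hL hβ hs hr ((lt_div_iff₀' hβ).1 hr1)
  have hE : IsConv (rescale z L⁻¹) := by
    refine Summable.of_nonneg_of_le (fun _ => norm_nonneg _) (fun n => ?_)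
      ((summable_geometric_of_lt_one (by positivity) ((div_lt_one hr).2 hzr)).mul_left M)
    rw [coeff_rescale, norm_mul, norm_pow, div_pow, mul_div_assoc', le_div_iff₀ (by positivity)]
    nlinarith [hM n, norm_nonneg (coeff n L⁻¹), pow_nonneg (norm_nonneg z) n]
  have hP : ∀ n ∉ range (k + 1), coeff n (rescale z L) = 0 := fun n hn => by
    rw [coeff_rescale, hk n (by simpa using hn), mul_zero]
  have hLc : IsConv (rescale z L) :=
    summable_of_ne_finset_zero (s := range (k + 1)) fun n hn => by rw [hP n hn, norm_zero]
  have h1 : ev 1 (rescale z L) = 0 := by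
    rw [ev, tsum_eq_sum (s := range (k + 1)) fun n hn => by rw [hP n hn, zero_mul], ← hz,
      Polynomial.eval_eq_sum_range' (natDegree_trunc_lt L k)]
    refine sum_congr rfl fun n hn => ?_
    rw [coeff_rescale, coeff_trunc, if_pos (mem_range.1 hn), one_pow, mul_one, mul_comm]
  have h2 := ev_mul (x := (1 : ℂ)) (by simp) hLc hE
  rw [← map_mul, PowerSeries.mul_inv_cancel _ (by rw [hL.const]; exact one_ne_zero), map_one, ev_one, h1,
    zero_mul] at h2
  exact one_ne_zero h2

lemma norm_one_le_of_isZeta (hL : IsZeta L (tailSeries s)) (hk : ∀ n, k < n → coeff n L = 0)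
    (hβ : 0 < β) (hs : ∀ m, m ≠ 0 → ‖s m‖ ≤ B * β ^ m) : ‖s 1‖ ≤ k * β := by
  set P := trunc (k + 1) L
  have hP0 : P.eval 0 = 1 := by
    rw [← Polynomial.coeff_zero_eq_eval_zero, coeff_trunc, if_pos k.succ_pos, hL.coeff_zero]
  have hP1 : P.derivative.eval 0 = s 1 := by
    rw [← Polynomial.coeff_zero_eq_eval_zero, Polynomial.coeff_derivative, coeff_trunc]
    have h := hL.coeff_rec 1
    rw [Nat.sum_antidiagonal_eq_sum_range_succ_mk] at h
    simp [sum_range_succ, coeff_tailSeries_zero, hL.coeff_zero, coeff_tailSeries s one_ne_zero,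
      -coeff_zero_eq_constantCoeff] at h
    rcases Nat.eq_zero_or_pos k with rfl | h0
    · simp [← h, hk 1 one_pos]
    · simp [h0, h]
  have h := (IsAlgClosed.splits P).eval_derivative_div_eval_of_ne_zero (x := 0) (by simp [hP0])
  rw [hP0, hP1, div_one] at h
  rw [h]
  refine (norm_multiset_sum_le _).trans ?_
  rw [Multiset.map_map]
  refine (Multiset.sum_le_card_nsmul _ β fun y hy => ?_).trans ?_
  · obtain ⟨z, hz, rfl⟩ := Multiset.mem_map.1 hy
    have h1 := one_le_of_eval_trunc_eq_zero hL hk hβ hs (Polynomial.isRoot_of_mem_roots hz)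
    have hz0 : 0 < ‖z‖ := by
      by_contra! h0
      nlinarith
    simpa [inv_le_iff_one_le_mul₀ hz0] using h1
  · rw [Multiset.card_map, nsmul_eq_mul]
    gcongr
    exact (Polynomial.card_roots' P).trans (Nat.lt_succ_iff.1 (natDegree_trunc_lt L k))

lemma exists_norm_le_of_pow_le {R : ℕ} (hR : R ≠ 0) {r : ℝ} (hr : 0 < r) (hβ : 0 < β)
    (hβr : 1 < β ^ R * r) (h : ∀ m, m ≠ 0 → ‖s m‖ ^ R * r ^ m ≤ B * m) :
    ∃ B', ∀ m, m ≠ 0 → ‖s m‖ ≤ B' * β ^ m := by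
  have hq : 0 < β ^ R * r := by positivity
  obtain ⟨M, hM⟩ := (tendsto_self_mul_const_pow_of_lt_one (inv_nonneg.2 hq.le)
    (inv_lt_one_of_one_lt₀ hβr)).bddAbove_range
  refine ⟨max 1 (|B| * M), fun m hm => ?_⟩
  rw [← div_le_iff₀ (by positivity)]
  rcases le_total (‖s m‖ / β ^ m) 1 with h1 | h1
  · exact h1.trans (le_max_left _ _)
  refine (le_self_pow₀ h1 hR).trans (le_trans ?_ (le_max_right _ _))
  have h2 : (m : ℝ) * (β ^ R * r)⁻¹ ^ m ≤ M := hM ⟨m, rfl⟩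
  calc (‖s m‖ / β ^ m) ^ R = (‖s m‖ ^ R * r ^ m) * (β ^ R * r)⁻¹ ^ m := by
        rw [div_pow, inv_pow, mul_pow, ← pow_mul, ← pow_mul, mul_comm R m]
        field_simp
    _ ≤ (|B| * m) * (β ^ R * r)⁻¹ ^ m := by
        refine mul_le_mul_of_nonneg_right ((h m hm).trans ?_) (by positivity)
        exact mul_le_mul_of_nonneg_right (le_abs_self B) (Nat.cast_nonneg m)
    _ ≤ |B| * M := by rw [mul_assoc]; gcongr

end Roots

section Weights
open PowerSeries
variable {p : ℕ} [hp : Fact p.Prime] {K : Type*} [NontriviallyNormedField K] [IsUltrametricDist K]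
  [CompleteSpace K] [IsAlgClosed K] [CharZero K] {ϖ c : K} {ρ κ l : ℝ} {k : ℕ}
  {F : Type*} [Field F] [Algebra ℚ F] [IsCyclotomicExtension {p} ℚ F] (f : F →+* K) (g : F →+* ℂ)

variable (p K) in
lemma torus_one_le (m : ℕ) : torus p K 1 ≤ torus p K m :=
  rootsOfUnity_le_of_dvd (Nat.pow_sub_one_dvd_pow_sub_one p (one_dvd m))

lemma coeff_charpolyRev_eq_zero {A : Type*} [CommRing A] (M : Matrix (Fin k) (Fin k) A) {n : ℕ}
    (hn : k < n) : coeff n (M.charpolyRev : A⟦X⟧) = 0 := by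
  cases subsingleton_or_nontrivial A
  · exact Subsingleton.elim _ _
  rw [Polynomial.coeff_coe, ← Matrix.reverse_charpoly]
  refine Polynomial.coeff_eq_zero_of_natDegree_lt ((Polynomial.reverse_natDegree_le _).trans_lt ?_)
  rwa [Matrix.charpoly_natDegree_eq_dim, Fintype.card_fin]

namespace GoodRadius
variable (H : GoodRadius p ϖ ρ κ)
include H

lemma map_klSum_psiF (hk0 : 0 < k) (hk2 : Even k) {m : ℕ} [hm : NeZero m] (x : torus p K 1) :
    f (klSum (psiF f ϖ m) k (Subgroup.inclusion (torus_one_le p K m) x)) =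
      -(((frobSeries p ϖ k).map (ev ((x : Kˣ) : K))) ^ m).trace := by
  have hx := norm_torus x
  have h := H.trace_frobIter (τ := (Units.coeHom K).comp (torus p K m).subtype)
    (Units.val_injective.comp Subtype.val_injective) hm.out card_torus hk0 hk2
    (Subgroup.inclusion (torus_one_le p K m) x)
  rw [← map_ev_frobIter_of_pow_eq hp.1.ne_zero H.isConv_frobSeries m hx.le
    (by simpa using torus_coe_pow x), map_klSum]
  refine Eq.trans ?_ (neg_eq_iff_eq_neg.2 h).symm
  congr 1
  funext y
  rw [H.map_psiF]
  exact (H.trace_frobIter_one m (norm_torus y).le).symm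

lemma exists_isZeta_klSum (hk0 : 0 < k) (hk2 : Even k) (x : torus p K 1) :
    ∃ (L : ℂ⟦X⟧) (s : ℕ → ℂ), IsZeta L (tailSeries s) ∧ (∀ n, k < n → coeff n L = 0) ∧
      ∀ m [NeZero m], s m = g (klSum (psiF f ϖ m) k (Subgroup.inclusion (torus_one_le p K m) x)) := by
  have : CharZero F := charZero_of_injective_algebraMap (algebraMap ℚ F).injective
  classical
  set s : ℕ → F := fun m => if h : m = 0 then 0 else
    have : NeZero m := ⟨h⟩
    klSum (psiF f ϖ m) k (Subgroup.inclusion (torus_one_le p K m) x) with hs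
  have hsm : ∀ m [NeZero m],
      s m = klSum (psiF f ϖ m) k (Subgroup.inclusion (torus_one_le p K m) x) := fun m hm => by
    simp only [hs, dif_neg hm.out]
  obtain ⟨L, hL⟩ := exists_isZeta (S := tailSeries s) (coeff_tailSeries_zero s)
  refine ⟨map g L, fun m => g (s m), ?_, fun n hn => ?_, fun m _ => by simp only [hsm]⟩
  · simpa only [map_tailSeries] using hL.map g
  have h1 : map f L = (((frobSeries p ϖ k).map (ev ((x : Kˣ) : K))).charpolyRev : K⟦X⟧) := by
    refine (hL.map f).unique ?_
    convert isZeta_charpolyRev ((frobSeries p ϖ k).map (ev ((x : Kˣ) : K))) using 1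
    rw [map_tailSeries]
    ext m
    rcases eq_or_ne m 0 with rfl | hm
    · rw [map_neg, coeff_tailSeries_zero, coeff_tailSeries_zero, neg_zero]
    · have : NeZero m := ⟨hm⟩
      rw [map_neg, coeff_tailSeries _ hm, coeff_tailSeries _ hm, hsm, H.map_klSum_psiF f hk0 hk2]
  have h2 : f (coeff n L) = 0 := by rw [← coeff_map, h1, coeff_charpolyRev_eq_zero _ hn]
  rw [coeff_map, (map_eq_zero f).1 h2, map_zero]

lemma norm_klSum_le_of_lt (hp2 : p ≠ 2) (hk0 : 0 < k)
    (hk2 : Even k) (hpk : ¬p ∣ k) (hl1 : 1 < ‖ϖ‖ * l) (hlρ : l < ρ) (hlp : l < p * ‖ϖ‖)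
    (hc1 : 1 < ‖c‖) (hc : ‖c‖ ^ p = (ρ / ‖ϖ‖) ^ k) (x : torus p K 1) {β : ℝ} (hβ : 0 < β)
    (hβp : (p : ℝ) ^ (k - 1) < β ^ 2) : ‖g (klSum (psiF f ϖ 1) k x)‖ ≤ k * β := by
  have hp0 : (0 : ℝ) < p := by exact_mod_cast hp.1.pos
  obtain ⟨L, s, hL, hn, hs⟩ := H.exists_isZeta_klSum f g hk0 hk2 x
  obtain ⟨n, hn'⟩ := pow_unbounded_of_one_lt (p : ℝ)
    ((one_lt_div (by positivity)).2 hβp)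
  have hn0 : n ≠ 0 := by
    rintro rfl
    rw [pow_zero] at hn'
    exact absurd hn' (not_lt.2 (by exact_mod_cast hp.1.one_le))
  rw [div_pow, lt_div_iff₀ (by positivity), ← pow_mul, ← pow_mul, ← pow_succ'] at hn'
  obtain ⟨r, hr1, hr2⟩ := exists_between ((inv_lt_inv₀ (by positivity) (by positivity)).2 hn')
  have hr : 0 < r := lt_trans (by positivity) hr1
  obtain ⟨B, hB⟩ := H.exists_norm_klSum_pow_le f g (d := (k - 1) * n) (R := 2 * n) hp2 hk0 hk2 hpk
    (even_two_mul n) (by lia) (by ring) hl1 hlρ hlp hc1 hc hr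
    (by rwa [mul_comm, ← lt_inv_mul_iff₀' (by positivity), mul_one])
  obtain ⟨B', hB'⟩ := exists_norm_le_of_pow_le (s := s) (β := β) (B := B)
    (mul_ne_zero two_ne_zero hn0) hr hβ
    (by rwa [mul_comm, ← inv_lt_iff_one_lt_mul₀ (by positivity)]) fun m hm => by
      have : NeZero m := ⟨hm⟩
      rw [hs]
      exact hB m _
  have h := norm_one_le_of_isZeta hL hn hβ hB'
  rwa [hs] at h

/-- The bound for hyper-Kloosterman sums, over the torus of Teichmüller representatives. -/
lemma norm_klSum_le (hp2 : p ≠ 2) (hk0 : 0 < k)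
    (hk2 : Even k) (hpk : ¬p ∣ k) (hl1 : 1 < ‖ϖ‖ * l) (hlρ : l < ρ) (hlp : l < p * ‖ϖ‖)
    (hc1 : 1 < ‖c‖) (hc : ‖c‖ ^ p = (ρ / ‖ϖ‖) ^ k) (x : torus p K 1) :
    ‖g (klSum (psiF f ϖ 1) k x)‖ ≤ k * √((p : ℝ) ^ (k - 1)) := by
  have hk : (0 : ℝ) < k := by exact_mod_cast hk0
  rw [← div_le_iff₀' hk]
  refine le_of_forall_gt_imp_ge_of_dense fun β hβ => ?_
  rw [div_le_iff₀' hk]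
  exact H.norm_klSum_le_of_lt f g hp2 hk0 hk2 hpk hl1 hlρ hlp hc1 hc x
    ((Real.sqrt_nonneg _).trans_lt hβ)
    ((Real.sqrt_lt' ((Real.sqrt_nonneg _).trans_lt hβ)).1 hβ)

end GoodRadius

end Weights

section Teichmuller
variable {p : ℕ} [hp : Fact p.Prime] {K : Type*} [NormedField K] [IsUltrametricDist K]

lemma norm_natCast_sub_natCast_lt_one (hK : ‖(p : K)‖ = (p : ℝ)⁻¹) {a b : ℕ}
    (h : (a : ZMod p) = b) : ‖(a : K) - b‖ < 1 := by
  have h1 : ((a - b : ℤ) : ZMod p) = 0 := by push_cast; rw [h, sub_self]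
  obtain ⟨d, hd⟩ := (ZMod.intCast_zmod_eq_zero_iff_dvd _ p).1 h1
  have e : (a : K) - b = p * d := by exact_mod_cast congrArg (Int.cast (R := K)) hd
  have hp1 : (p : ℝ)⁻¹ < 1 := inv_lt_one_of_one_lt₀ (by exact_mod_cast hp.1.one_lt)
  rw [e, norm_mul, hK]
  exact lt_of_le_of_lt
    (mul_le_of_le_one_right (by positivity) (norm_intCast_le_one K d)) hp1

lemma norm_sub_lt_one_trans {x y z : K} (h1 : ‖x - y‖ < 1) (h2 : ‖y - z‖ < 1) : ‖x - z‖ < 1 := by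
  rw [← sub_add_sub_cancel x y z]
  exact (norm_add_le_max _ _).trans_lt (max_lt h1 h2)

lemma norm_mul_sub_mul_lt_one {a b c d : K} (ha : ‖a‖ ≤ 1) (hd : ‖d‖ ≤ 1) (h1 : ‖a - c‖ < 1)
    (h2 : ‖b - d‖ < 1) : ‖a * b - c * d‖ < 1 := by
  refine norm_sub_lt_one_trans (y := a * d) ?_ ?_
  · rw [← mul_sub, norm_mul]
    exact (mul_le_of_le_one_left (norm_nonneg _) ha).trans_lt h2
  · rw [← sub_mul, norm_mul]
    exact (mul_le_of_le_one_right (norm_nonneg _) hd).trans_lt h1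

lemma eq_one_of_norm_sub_one_lt (hK : ‖(p : K)‖ = (p : ℝ)⁻¹) {u : K} (hu : u ^ (p - 1) = 1)
    (h : ‖u - 1‖ < 1) : u = 1 := by
  by_contra hne
  have hu1 : ‖u‖ ≤ 1 := by
    rw [← sub_add_cancel u 1]
    exact (norm_add_le_max _ _).trans (max_le h.le norm_one.le)
  have h0 : ∑ i ∈ range (p - 1), u ^ i = 0 := by
    have := geom_sum_mul u (p - 1)
    rw [hu, sub_self] at this
    exact (mul_eq_zero.1 this).resolve_right (sub_ne_zero.2 hne)
  have hi (i : ℕ) : ‖u ^ i - 1‖ < 1 := by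
    induction i with
    | zero => simp
    | succ i ih =>
      have := norm_mul_sub_mul_lt_one (b := u) (c := 1) (d := 1)
        (by rw [norm_pow]; exact pow_le_one₀ (norm_nonneg _) hu1) norm_one.le ih h
      rwa [mul_one, ← pow_succ] at this
  have h1 : ‖∑ i ∈ range (p - 1), (u ^ i - 1)‖ < 1 := by
    obtain ⟨i, -, hi'⟩ := exists_norm_finsetSum_le (range (p - 1)) fun i => u ^ i - 1
    exact hi'.trans_lt (hi i)
  rw [sum_sub_distrib, h0, zero_sub, norm_neg, sum_const, card_range, nsmul_one,
    norm_natCast_of_not_dvd hK (Nat.not_dvd_of_pos_of_lt (Nat.sub_pos_of_lt hp.1.one_lt)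
      (Nat.sub_lt hp.1.pos one_pos))] at h1
  exact lt_irrefl _ h1

variable [CompleteSpace K] [IsAlgClosed K] [CharZero K]

lemma exists_teichmullerHom (hK : ‖(p : K)‖ = (p : ℝ)⁻¹) :
    ∃ w : (ZMod p)ˣ →* torus p K 1, Function.Bijective w ∧
      ∀ a, ‖(((w a : torus p K 1) : Kˣ) : K) - ((a : ZMod p).val : ℕ)‖ < 1 := by
  have h (a : (ZMod p)ˣ) : ∃ c : torus p K 1, ‖((c : Kˣ) : K) - ((a : ZMod p).val : ℕ)‖ < 1 := by
    have ha : ¬p ∣ (a : ZMod p).val := fun hd => a.ne_zero (by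
      rwa [← ZMod.natCast_eq_zero_iff, ZMod.natCast_zmod_val] at hd)
    obtain ⟨c, hc, hca⟩ := exists_teichmuller hK ha
    have hc0 : c ≠ 0 := fun h => by
      rw [h, zero_pow (Nat.sub_pos_of_lt hp.1.one_lt).ne'] at hc
      exact zero_ne_one hc
    refine ⟨⟨Units.mk0 c hc0, ?_⟩, hca⟩
    rw [torus, pow_one, _root_.mem_rootsOfUnity]
    exact Units.ext (by simpa using hc)
  choose w hw using h
  have hval (y : torus p K 1) : ‖((y : Kˣ) : K)‖ = 1 := norm_torus y
  have hinj (y z : torus p K 1) : ‖((y : Kˣ) : K) - ((z : Kˣ) : K)‖ < 1 → y = z := fun hyz => by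
    have h1 : (((y / z : torus p K 1) : Kˣ) : K) ^ (p - 1) = 1 := by
      have : ((y / z : torus p K 1) : Kˣ) ∈ rootsOfUnity (p ^ 1 - 1) K := (y / z).2
      rw [pow_one, _root_.mem_rootsOfUnity] at this
      rw [← Units.val_pow_eq_pow_val, this, Units.val_one]
    have h2 : ‖(((y / z : torus p K 1) : Kˣ) : K) - 1‖ < 1 := by
      have hz : ((z : Kˣ) : K) ≠ 0 := Units.ne_zero _
      rw [Subgroup.coe_div, Units.val_div_eq_div_val, div_sub_one hz, norm_div, hval, div_one]
      exact hyz
    have h3 := eq_one_of_norm_sub_one_lt hK h1 h2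
    exact div_eq_one.1 (Subtype.ext (Units.ext h3))
  have hw1 : ∀ n : ℕ, ‖(n : K)‖ ≤ 1 := norm_natCast_le_one K
  refine ⟨MonoidHom.mk' w fun a b => hinj _ _ ?_, ?_, hw⟩
  · refine norm_sub_lt_one_trans (hw _) (norm_sub_lt_one_trans
      (y := ((a : ZMod p).val : K) * ((b : ZMod p).val : K)) ?_ ?_)
    · rw [← Nat.cast_mul]
      exact norm_natCast_sub_natCast_lt_one hK (by simp)
    · rw [Subgroup.coe_mul, Units.val_mul]
      exact norm_mul_sub_mul_lt_one (hw1 _) (hval _).le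
        (by rw [norm_sub_rev]; exact hw a) (by rw [norm_sub_rev]; exact hw b)
  · refine (Fintype.bijective_iff_injective_and_card _).2 ⟨fun a b hab => ?_, ?_⟩
    · have hab' : w a = w b := hab
      have h1 : ‖((a : ZMod p).val : K) - ((b : ZMod p).val : ℕ)‖ < 1 := by
        refine norm_sub_lt_one_trans (y := ((w a : Kˣ) : K)) ?_ ?_
        · rw [norm_sub_rev]; exact hw a
        · rw [hab']; exact hw b
      by_contra hne
      wlog hlt : (b : ZMod p).val ≤ (a : ZMod p).val generalizing a b
      · exact this b a hab.symm hab'.symm (by rwa [norm_sub_rev]) (Ne.symm hne) (le_of_not_ge hlt)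
      rw [← Nat.cast_sub hlt, norm_natCast_of_not_dvd hK] at h1
      · exact lt_irrefl _ h1
      · refine Nat.not_dvd_of_pos_of_lt (Nat.sub_pos_of_lt (hlt.lt_of_ne fun h => hne ?_))
          ((Nat.sub_le _ _).trans_lt (ZMod.val_lt _))
        exact Units.ext (ZMod.val_injective p h.symm)
    · rw [card_torus, pow_one, ZMod.card_units_eq_totient, Nat.totient_prime hp.1]

end Teichmuller

section Padic
open PadicComplex
variable {p : ℕ} [hp : Fact p.Prime]

lemma norm_padicComplex_prime : ‖(p : ℂ_[p])‖ = (p : ℝ)⁻¹ := by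
  rw [← Padic.norm_p, ← PadicComplex.norm_extends']
  simp

lemma exists_goodRadius (hp11 : 11 ≤ p) : ∃ (ϖ : ℂ_[p]) (κ : ℝ),
    GoodRadius p ϖ ((p : ℝ) ^ (3 / 4 : ℝ)) κ := by
  have hp1 : (1 : ℝ) < p := by exact_mod_cast hp.1.one_lt
  have hp11' : (11 : ℝ) ≤ p := by exact_mod_cast hp11
  obtain ⟨ϖ, hϖ⟩ := IsAlgClosed.exists_pow_nat_eq (-(p : ℂ_[p])) (Nat.sub_pos_of_lt hp.1.one_lt)
  refine ⟨ϖ, _, norm_padicComplex_prime, hϖ, Real.one_lt_rpow hp1 (by norm_num), ?_, le_rfl, ?_⟩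
  · conv_rhs => rw [← Real.rpow_one (p : ℝ)]
    exact Real.rpow_le_rpow_of_exponent_le hp1.le (by norm_num)
  · rw [norm_varpi_eq norm_padicComplex_prime hϖ, thetaRadius, ← Real.rpow_natCast,
      ← Real.rpow_mul (by positivity), ← Real.rpow_neg (by positivity),
      ← Real.rpow_add (by positivity), ← Real.rpow_add (by positivity)]
    refine Real.rpow_lt_one_of_one_lt_of_neg hp1 ?_
    have h1 : (p : ℝ)⁻¹ ≤ 11⁻¹ := by gcongr
    have h2 : 1 / ((p : ℝ) - 1) ≤ 1 / 10 := by
      refine one_div_le_one_div_of_le (by norm_num) (by linarith)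
    have h3 : -(((p : ℝ) - 1) / p ^ 2) * p = -1 + (p : ℝ)⁻¹ := by field_simp; ring
    rw [h3]
    linarith

/-- **Deligne's bound** for hyper-Kloosterman sums with an even number of variables. -/
lemma norm_klSum_zmod_le (hp11 : 11 ≤ p) {k : ℕ} (hk0 : 0 < k) (hk2 : Even k) (hkp : k < p)
    (x : (ZMod p)ˣ) :
    ‖klSum (fun y : (ZMod p)ˣ => eFun (((y : ZMod p).val : ℝ) / p)) k x‖ ≤
      k * √((p : ℝ) ^ (k - 1)) := by
  have hp1 : (1 : ℝ) < p := by exact_mod_cast hp.1.one_lt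
  have hp11' : (11 : ℝ) ≤ p := by exact_mod_cast hp11
  obtain ⟨ϖ, κ, H⟩ := exists_goodRadius (p := p) hp11
  have hn := norm_varpi_eq H.norm_p H.varpi
  have hn0 : 0 < ‖ϖ‖ := by rw [hn]; positivity
  have hn1 : ‖ϖ‖ < 1 := norm_varpi_lt_one H.norm_p H.varpi
  have h2 : 1 / ((p : ℝ) - 1) ≤ 1 / 10 := one_div_le_one_div_of_le (by norm_num) (by linarith)
  obtain ⟨w, hw, hwa⟩ := exists_teichmullerHom H.norm_p
  obtain ⟨c, hc⟩ := IsAlgClosed.exists_pow_nat_eq (((p : ℂ_[p]) ^ 3 * ϖ ^ 4)⁻¹ ^ k)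
    (Nat.mul_pos hp.1.pos four_pos)
  have hc' : ‖c‖ ^ p = ((p : ℝ) ^ (3 / 4 : ℝ) / ‖ϖ‖) ^ k := by
    refine (pow_left_inj₀ (by positivity) (by positivity) four_ne_zero).1 ?_
    rw [← pow_mul, ← norm_pow, hc, norm_pow, norm_inv, norm_mul, norm_pow, norm_pow, H.norm_p,
      ← pow_mul, mul_comm k 4, pow_mul, div_pow, ← Real.rpow_natCast ((p : ℝ) ^ _) 4,
      ← Real.rpow_mul (by positivity)]
    norm_num
    field_simp
  have hc1 : 1 < ‖c‖ := by
    refine (one_lt_pow_iff_of_nonneg (norm_nonneg _) hp.1.ne_zero).1 ?_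
    rw [hc']
    exact one_lt_pow₀ ((one_lt_div hn0).2 (hn1.trans H.one_lt)) hk0.ne'
  have : NeZero ((p : ℕ) : ℚ) := ⟨by exact_mod_cast hp.1.ne_zero⟩
  have : IsCyclotomicExtension {p} ℚ (CyclotomicField p ℚ) :=
    CyclotomicField.isCyclotomicExtension p ℚ
  set ζ := IsCyclotomicExtension.zeta p ℚ (CyclotomicField p ℚ)
  have hζ : IsPrimitiveRoot ζ p := IsCyclotomicExtension.zeta_spec p ℚ (CyclotomicField p ℚ)
  have hirr := Polynomial.cyclotomic.irreducible_rat hp.1.pos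
  have hz : IsPrimitiveRoot (psi p ϖ 1 1) p :=
    IsPrimitiveRoot.iff_orderOf.2
      (orderOf_eq_prime (H.psi_pow_prime (by simp) (by simp)) H.psi_one_one_ne)
  have hemb : ∀ {C : Type} [Field C] [Algebra ℚ C] {z : C}, IsPrimitiveRoot z p →
      ∃ f : CyclotomicField p ℚ →+* C, f ζ = z := fun {C} _ _ z hz => by
    refine ⟨((hζ.embeddingsEquivPrimitiveRoots C hirr).symm
      ⟨z, (mem_primitiveRoots hp.1.pos).2 hz⟩ : CyclotomicField p ℚ →ₐ[ℚ] C), ?_⟩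
    have := hζ.embeddingsEquivPrimitiveRoots_apply_coe C hirr
      ((hζ.embeddingsEquivPrimitiveRoots C hirr).symm ⟨z, (mem_primitiveRoots hp.1.pos).2 hz⟩)
    rw [Equiv.apply_symm_apply] at this
    exact this.symm
  obtain ⟨f, hf⟩ := hemb hz
  obtain ⟨g, hg⟩ := hemb (Complex.isPrimitiveRoot_exp p hp.1.ne_zero)
  have hpsi (a : (ZMod p)ˣ) : g (psiF f ϖ 1 (w a)) = eFun (((a : ZMod p).val : ℝ) / p) := by
    have e : psiF f ϖ 1 (w a) = ζ ^ (a : ZMod p).val := by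
      refine f.injective ?_
      rw [H.map_psiF, map_pow, hf, psiT]
      have := H.psi_mul_of_near (m := 1) (x := 1) (by simp) (by simp)
        (by simpa using torus_coe_pow (w a)) (norm_torus (w a)).le (hwa a)
      rwa [mul_one] at this
    rw [e, map_pow, hg, eFun, ← Complex.exp_nat_mul]
    congr 1
    push_cast
    ring
  have h := H.norm_klSum_le f g (l := (p : ℝ) ^ (1 / 2 : ℝ)) (by lia) hk0 hk2
    (Nat.not_dvd_of_pos_of_lt hk0 hkp)
    (by
      rw [hn, ← Real.rpow_add (by positivity)]
      exact Real.one_lt_rpow hp1 (by linarith))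
    (Real.rpow_lt_rpow_of_exponent_lt hp1 (by norm_num))
    (by
      rw [hn]
      nth_rewrite 2 [← Real.rpow_one (p : ℝ)]
      rw [← Real.rpow_add (by positivity)]
      exact Real.rpow_lt_rpow_of_exponent_lt hp1 (by linarith))
    hc1 hc' (w x)
  rwa [klSum_of_injective k hw.1 (fun y hy => absurd (hw.2 y) hy), map_klSum, funext hpsi] at h

end Padic

section GaussSums

lemma eFun_val_div {N : ℕ} [NeZero N] (a : ZMod N) :
    eFun ((a.val : ℝ) / N) = ZMod.stdAddChar a := by
  rw [ZMod.stdAddChar_apply, ZMod.toCircle_apply, eFun]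
  congr 1
  push_cast
  ring

lemma epsChar_eq {N : ℕ} [NeZero N] (χ : DirichletCharacter ℂ N) :
    epsChar χ = (√N : ℂ)⁻¹ * gaussSum χ ZMod.stdAddChar := by
  simp only [epsChar, eFun_val_div, gaussSum]

lemma prodChar_apply {q D : ℕ} [NeZero q] [NeZero D] (χ : DirichletCharacter ℂ q)
    (ψ : DirichletCharacter ℂ D) (n : ℕ) :
    prodChar χ ψ (n : ZMod (q * D)) = χ (n : ZMod q) * ψ (n : ZMod D) := by
  by_cases h : IsUnit (n : ZMod (q * D))
  · obtain ⟨u, hu⟩ := h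
    rw [prodChar, MulChar.mul_apply, ← hu, changeLevel_eq_cast_of_dvd, changeLevel_eq_cast_of_dvd,
      hu, ZMod.cast_natCast (dvd_mul_right q D), ZMod.cast_natCast (dvd_mul_left D q)]
  · rw [MulChar.map_nonunit _ h]
    rw [ZMod.isUnit_iff_coprime, Nat.coprime_mul_iff_right, not_and_or, ← ZMod.isUnit_iff_coprime,
      ← ZMod.isUnit_iff_coprime] at h
    rcases h with h | h <;> simp [MulChar.map_nonunit _ h]

lemma gaussSum_prodChar {q D : ℕ} [NeZero q] [NeZero D] (hqD : q.Coprime D)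
    (χ : DirichletCharacter ℂ q) (ψ : DirichletCharacter ℂ D) :
    gaussSum (prodChar χ ψ) ZMod.stdAddChar = χ D * gaussSum χ ZMod.stdAddChar *
      (ψ q * gaussSum ψ ZMod.stdAddChar) := by
  have hD : IsUnit (D : ZMod q) := (ZMod.isUnit_iff_coprime D q).2 hqD.symm
  have hq : IsUnit (q : ZMod D) := (ZMod.isUnit_iff_coprime q D).2 hqD
  set F : ZMod q × ZMod D → ZMod (q * D) := fun x => ((x.1.val * D + x.2.val * q : ℕ) : ZMod (q * D))
  have h1 : ∀ x : ZMod q × ZMod D, ((x.1.val * D + x.2.val * q : ℕ) : ZMod q) = x.1 * D := by simp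
  have h2 : ∀ x : ZMod q × ZMod D, ((x.1.val * D + x.2.val * q : ℕ) : ZMod D) = x.2 * q := by simp
  have hF : Function.Bijective F := by
    refine (Fintype.bijective_iff_injective_and_card F).2 ⟨fun x y hxy => ?_, by simp [ZMod.card]⟩
    have e1 := congrArg (ZMod.castHom (dvd_mul_right q D) (ZMod q)) hxy
    have e2 := congrArg (ZMod.castHom (dvd_mul_left D q) (ZMod D)) hxy
    simp only [F, map_natCast, h1, h2] at e1 e2
    exact Prod.ext (hD.mul_right_cancel e1) (hq.mul_right_cancel e2)
  rw [mul_mul_mul_comm]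
  simp only [gaussSum]
  rw [sum_mul_sum, ← sum_product', univ_product_univ, mul_sum]
  refine (Fintype.sum_bijective F hF _ _ fun x => ?_).symm
  have h3 : (ZMod.stdAddChar (F x) : ℂ) = ZMod.stdAddChar x.1 * ZMod.stdAddChar x.2 := by
    have e1 : F x = (((x.1.val * D + x.2.val * q : ℕ) : ℤ) : ZMod (q * D)) := by simp only [F, Int.cast_natCast]
    rw [e1, ZMod.stdAddChar_coe, ZMod.stdAddChar_apply, ZMod.stdAddChar_apply, ZMod.toCircle_apply,
      ZMod.toCircle_apply, ← Complex.exp_add]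
    have hq0 : (q : ℂ) ≠ 0 := by exact_mod_cast NeZero.ne q
    have hD0 : (D : ℂ) ≠ 0 := by exact_mod_cast NeZero.ne D
    congr 1
    push_cast
    field_simp
  rw [h3]
  simp only [F]
  rw [prodChar_apply, h1, h2, map_mul, map_mul]
  ring

lemma epsChar_mul_epsChar_prodChar {q D : ℕ} [NeZero q] [NeZero D] (hqD : q.Coprime D)
    (χ : DirichletCharacter ℂ q) (ψ : DirichletCharacter ℂ D) :
    epsChar χ * epsChar (prodChar χ ψ) = (ψ q * epsChar ψ) * (χ D * epsChar χ ^ 2) := by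
  rw [epsChar_eq, epsChar_eq, epsChar_eq, gaussSum_prodChar hqD, Nat.cast_mul,
    Real.sqrt_mul (Nat.cast_nonneg q), ofReal_mul, mul_inv]
  ring

variable {q : ℕ} [hq : Fact q.Prime]

lemma norm_epsChar {χ : DirichletCharacter ℂ q} (hχ : χ ≠ 1) : ‖epsChar χ‖ = 1 := by
  have h := gaussSum_mul_gaussSum_eq_card hχ (ZMod.isPrimitive_stdAddChar q)
  rw [← star_gaussSum_eq, ZMod.card, Complex.star_def, Complex.mul_conj, Complex.normSq_eq_norm_sq] at h
  have h' : ‖gaussSum χ (ZMod.stdAddChar (N := q))‖ ^ 2 = q := by exact_mod_cast h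
  have hq0 : (0 : ℝ) < √q := Real.sqrt_pos.2 (by exact_mod_cast hq.1.pos)
  rw [epsChar_eq, norm_mul, norm_inv, Complex.norm_real, Real.norm_of_nonneg hq0.le, ← h',
    Real.sqrt_sq (norm_nonneg _)] at *
  exact inv_mul_cancel₀ hq0.ne'

lemma gaussSum_pow (χ : DirichletCharacter ℂ q) (k : ℕ) :
    gaussSum χ ZMod.stdAddChar ^ k = ∑ x : (ZMod q)ˣ, χ x *
      klSum (fun y : (ZMod q)ˣ => eFun (((y : ZMod q).val : ℝ) / q)) k x := by
  classical
  have h1 : gaussSum χ ZMod.stdAddChar =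
      ∑ y : (ZMod q)ˣ, χ y * eFun (((y : ZMod q).val : ℝ) / q) := by
    rw [gaussSum]
    refine (Fintype.sum_of_injective (fun y : (ZMod q)ˣ => (y : ZMod q)) Units.val_injective _ _
      (fun a ha => ?_) fun y => by rw [eFun_val_div]).symm
    rw [MulChar.map_nonunit _ (fun ⟨u, hu⟩ => ha ⟨u, hu⟩), zero_mul]
  rw [h1, Fintype.sum_pow]
  simp only [klSum, mul_sum]
  rw [sum_comm]
  refine sum_congr rfl fun t _ => ?_
  simp only [mul_ite, mul_zero, sum_ite_eq, mem_univ, if_true, prod_mul_distrib]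
  rw [Units.coe_prod, map_prod]

lemma sum_mul_gaussSum_pow (b : (ZMod q)ˣ) (k : ℕ) :
    ∑ χ : DirichletCharacter ℂ q, χ b * gaussSum χ ZMod.stdAddChar ^ k = (q - 1 : ℂ) *
      klSum (fun y : (ZMod q)ˣ => eFun (((y : ZMod q).val : ℝ) / q)) k b⁻¹ := by
  classical
  simp only [gaussSum_pow, mul_sum, ← mul_assoc, ← map_mul]
  rw [sum_comm]
  simp only [← sum_mul, sum_characters_eq, Nat.totient_prime hq.1]
  rw [sum_eq_single b⁻¹]
  · rw [Units.mul_inv, if_pos rfl, Nat.cast_sub hq.1.one_le, Nat.cast_one]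
  · intro x _ hx
    rw [if_neg, zero_mul]
    rw [← Units.val_mul, Units.val_eq_one, mul_eq_one_iff_inv_eq]
    exact Ne.symm hx
  · exact fun h => absurd (mem_univ _) h

lemma gaussSum_one : gaussSum (1 : DirichletCharacter ℂ q) ZMod.stdAddChar = -1 := by
  have h := AddChar.sum_eq_zero_of_ne_one (ZMod.isPrimitive_stdAddChar q one_ne_zero)
  rw [AddChar.mulShift_one] at h
  rw [gaussSum, ← add_eq_zero_iff_eq_neg, ← h, ← sum_erase_add _ _ (mem_univ (0 : ZMod q)),
    ← sum_erase_add univ (fun x => (ZMod.stdAddChar x : ℂ)) (mem_univ (0 : ZMod q))]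
  rw [MulChar.map_zero, zero_mul, add_zero, AddChar.map_zero_eq_one]
  congr 1
  refine sum_congr rfl fun x hx => ?_
  rw [MulChar.one_apply (isUnit_iff_ne_zero.2 (ne_of_mem_erase hx)), one_mul]

/-- The moments of the root numbers are small. -/
lemma norm_sum_pow_le (hq11 : 11 ≤ q) (b : (ZMod q)ˣ) {n : ℕ} (hn : n ≠ 0) (hnq : 2 * n < q) :
    ‖∑ χ ∈ univ.erase (1 : DirichletCharacter ℂ q), (χ b * epsChar χ ^ 2) ^ n‖ ≤ 3 * n * √q := by
  have hq1 : (1 : ℝ) ≤ q := by exact_mod_cast hq.1.one_le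
  have hs : (0 : ℝ) < √q := Real.sqrt_pos.2 (by linarith)
  have hs1 : 1 ≤ √(q : ℝ) := Real.one_le_sqrt.2 hq1
  have hss : (√q : ℂ) ^ 2 = q := by rw [← ofReal_pow, Real.sq_sqrt (by positivity)]; simp
  have h1 (χ : DirichletCharacter ℂ q) : (χ b * epsChar χ ^ 2) ^ n =
      ((q : ℂ) ^ n)⁻¹ * (χ ((b ^ n : (ZMod q)ˣ) : ZMod q) * gaussSum χ ZMod.stdAddChar ^ (2 * n)) := by
    rw [epsChar_eq, mul_pow, mul_pow _ _ 2, inv_pow, hss, mul_pow _ _ n, inv_pow,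
      Units.val_pow_eq_pow_val, map_pow, pow_mul]
    ring
  have h2 := sum_erase_add univ (fun χ : DirichletCharacter ℂ q => (χ b * epsChar χ ^ 2) ^ n)
    (mem_univ 1)
  rw [← eq_sub_iff_add_eq] at h2
  rw [h2]
  simp only [h1]
  rw [← mul_sum, sum_mul_gaussSum_pow, gaussSum_one, ← mul_sub, norm_mul, norm_inv, norm_pow,
    Complex.norm_natCast, inv_mul_le_iff₀ (by positivity)]
  refine (norm_sub_le _ _).trans ?_
  have h3 := norm_klSum_zmod_le hq11 (k := 2 * n) (by lia) (even_two_mul n) hnq (b ^ n)⁻¹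
  have h4 : √((q : ℝ) ^ (2 * n - 1)) * √q = q ^ n := by
    rw [← Real.sqrt_mul (by positivity), ← pow_succ, show 2 * n - 1 + 1 = n * 2 by lia, pow_mul,
      Real.sqrt_sq (by positivity)]
  have h5 : ‖(q - 1 : ℂ)‖ ≤ √q * √q := by
    rw [Real.mul_self_sqrt (by positivity), ← Nat.cast_one, ← Nat.cast_sub hq.1.one_le, Complex.norm_natCast]
    exact_mod_cast Nat.sub_le _ _
  have h6 : ‖(1 : DirichletCharacter ℂ q) ((b ^ n : (ZMod q)ˣ) : ZMod q) * (-1) ^ (2 * n)‖ = 1 := by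
    rw [MulChar.one_apply_coe]
    simp
  rw [h6, norm_mul]
  have hn1 : (1 : ℝ) ≤ n := by exact_mod_cast Nat.one_le_iff_ne_zero.2 hn
  have hqn : (1 : ℝ) ≤ q ^ n := one_le_pow₀ hq1
  calc ‖(q - 1 : ℂ)‖ * _ + 1 ≤ √q * √q * ((2 * n : ℕ) * √((q : ℝ) ^ (2 * n - 1))) + 1 :=
        add_le_add (mul_le_mul h5 h3 (norm_nonneg _) (by positivity)) le_rfl
    _ = q ^ n * (2 * n * √q) + 1 := by rw [← h4]; push_cast; ring
    _ ≤ q ^ n * (2 * n * √q) + q ^ n * (n * √q) := by gcongr; nlinarith [mul_le_mul hn1 hs1 zero_le_one (by positivity)]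
    _ = q ^ n * (3 * n * √q) := by ring

end GaussSums

section Counting
variable {ι : Type*} {T : Finset ι} {f : ι → ℂ} {u : ℂ} {N : ℕ} {A η : ℝ}

lemma norm_pow_sub_one_le {z : ℂ} (hz : ‖z‖ = 1) (n : ℕ) : ‖z ^ n - 1‖ ≤ n * ‖z - 1‖ := by
  rw [← geom_sum_mul, norm_mul]
  gcongr
  refine (norm_sum_le _ _).trans ?_
  simp [norm_pow, hz]

lemma half_le_norm_geom_sum {z : ℂ} (hz : ‖z‖ = 1) (h : N * ‖z - 1‖ ≤ 1) :
    (N : ℝ) / 2 ≤ ‖∑ n ∈ range N, z ^ n‖ := by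
  have h1 : ‖∑ n ∈ range N, (z ^ n - 1)‖ ≤ (N : ℝ) / 2 := by
    refine (norm_sum_le_of_le _ fun n _ => norm_pow_sub_one_le hz n).trans ?_
    rw [← sum_mul]
    have h2 : (∑ i ∈ range N, (i : ℝ)) * 2 = N * (N - 1) := by
      rcases Nat.eq_zero_or_pos N with rfl | hN
      · simp
      · have h' : ((N - 1 : ℕ) : ℝ) = N - 1 := by simp_all
        rw [← h']
        rw [← Nat.cast_sum, ← Nat.cast_mul, ← Nat.cast_ofNat, ← Nat.cast_mul,
          Finset.sum_range_id_mul_two N]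
    have h3 : 0 ≤ ‖z - 1‖ := norm_nonneg _
    nlinarith
  rw [sum_sub_distrib, sum_const, card_range, nsmul_one] at h1
  have h2 := norm_sub_norm_le (N : ℂ) (∑ n ∈ range N, z ^ n)
  rw [Complex.norm_natCast, norm_sub_rev] at h2
  linarith

lemma norm_sum_pow_mul_conj_pow_le (hf : ∀ i ∈ T, ‖f i‖ = 1)
    (hA : ∀ n, n ≠ 0 → n < N → ‖∑ i ∈ T, f i ^ n‖ ≤ A) {n m : ℕ} (hn : n < N) (hm : m < N)
    (hnm : n ≠ m) : ‖∑ i ∈ T, f i ^ n * (starRingEnd ℂ) (f i) ^ m‖ ≤ A := by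
  wlog hlt : m < n generalizing n m
  · rw [← Complex.norm_conj, map_sum]
    simp only [map_mul, map_pow, Complex.conj_conj]
    grind
  have h : ∑ i ∈ T, f i ^ n * (starRingEnd ℂ) (f i) ^ m = ∑ i ∈ T, f i ^ (n - m) := by
    refine sum_congr rfl fun i hi => ?_
    have h1 : f i * (starRingEnd ℂ) (f i) = 1 := by
      rw [Complex.mul_conj, Complex.normSq_eq_norm_sq, hf i hi]
      simp
    rw [← Nat.sub_add_cancel hlt.le, pow_add, mul_assoc, ← mul_pow, h1, one_pow, mul_one,
      Nat.add_sub_cancel]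
  rw [h]
  exact hA _ (by lia) (by lia)

lemma sum_norm_sq_le (hf : ∀ i ∈ T, ‖f i‖ = 1) (hA0 : 0 ≤ A)
    (hA : ∀ n, n ≠ 0 → n < N → ‖∑ i ∈ T, f i ^ n‖ ≤ A) :
    ∑ i ∈ T, ‖∑ n ∈ range N, f i ^ n‖ ^ 2 ≤ N * #T + N ^ 2 * A := by
  have h1 : ((∑ i ∈ T, ‖∑ n ∈ range N, f i ^ n‖ ^ 2 : ℝ) : ℂ) =
      ∑ n ∈ range N, ∑ m ∈ range N, ∑ i ∈ T, f i ^ n * (starRingEnd ℂ) (f i) ^ m := by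
    rw [ofReal_sum]
    simp only [sum_comm (s := range N) (t := T)]
    refine sum_congr rfl fun i _ => ?_
    rw [ofReal_pow, ← Complex.mul_conj', map_sum, sum_mul_sum]
    simp only [map_pow]
  have h2 : ∑ i ∈ T, ‖∑ n ∈ range N, f i ^ n‖ ^ 2 = ‖((∑ i ∈ T, ‖∑ n ∈ range N, f i ^ n‖ ^ 2 : ℝ) : ℂ)‖ := by
    rw [Complex.norm_real, Real.norm_of_nonneg (by positivity)]
  rw [h2, h1]
  calc _ ≤ ∑ n ∈ range N, ∑ m ∈ range N, ((if n = m then (#T : ℝ) else 0) + A) := by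
        refine norm_sum_le_of_le _ fun n hn => norm_sum_le_of_le _ fun m hm => ?_
        split_ifs with h
        · have h1 : ‖∑ i ∈ T, f i ^ n * (starRingEnd ℂ) (f i) ^ m‖ ≤ ∑ i ∈ T, (1 : ℝ) :=
            norm_sum_le_of_le _ fun i hi => by simp [hf i hi]
          exact h1.trans (by simpa using hA0)
        · rw [zero_add]
          exact norm_sum_pow_mul_conj_pow_le hf hA (mem_range.1 hn) (mem_range.1 hm) h
    _ = N * #T + N ^ 2 * A := by
        simp only [sum_add_distrib, sum_ite_eq, mem_range, sum_const, card_range, nsmul_eq_mul]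
        rw [sum_congr rfl fun n hn => if_pos (mem_range.1 hn)]
        simp only [sum_const, card_range, nsmul_eq_mul]
        ring

lemma card_le_of_moments (hf : ∀ i ∈ T, ‖f i‖ = 1) (hA0 : 0 ≤ A)
    (hA : ∀ n, n ≠ 0 → n < N → ‖∑ i ∈ T, f i ^ n‖ ≤ A) (hN : N ≠ 0) {S : Finset ι} (hS : S ⊆ T)
    (hu : ‖u‖ = 1) (hSu : ∀ i ∈ S, N * ‖f i - u‖ ≤ 1) : (#S : ℝ) ≤ 4 * (#T / N + A) := by
  have hN0 : (0 : ℝ) < N := by positivity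
  have hu0 : u ≠ 0 := norm_ne_zero_iff.1 (by rw [hu]; exact one_ne_zero)
  have h1 := sum_norm_sq_le (f := fun i => f i * u⁻¹) (T := T) (N := N) (A := A)
    (fun i hi => by simp_all) hA0 (fun n hn hnN => by
      simp only [mul_pow, ← sum_mul]
      simp_all)
  have h2 : #S * ((N : ℝ) / 2) ^ 2 ≤ ∑ i ∈ T, ‖∑ n ∈ range N, (f i * u⁻¹) ^ n‖ ^ 2 := by
    rw [← nsmul_eq_mul]
    refine (card_nsmul_le_sum S _ _ fun i hi => ?_).trans
      (sum_le_sum_of_subset_of_nonneg hS fun _ _ _ => by positivity)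
    gcongr
    refine half_le_norm_geom_sum (by aesop) ?_
    have e : f i * u⁻¹ - 1 = (f i - u) * u⁻¹ := by grind
    simp_all
  have h3 : (#S : ℝ) * N ^ 2 ≤ 4 * (#T / N + A) * N ^ 2 := by
    have : 4 * (#T / N + A) * N ^ 2 = 4 * (N * #T + N ^ 2 * A) := by field_simp
    linarith
  simp_all

end Counting

section Final
variable {q : ℕ} [hq : Fact q.Prime]

lemma card_filter_le (b : (ZMod q)ˣ) (hq11 : 11 ≤ q) {S : Finset (DirichletCharacter ℂ q)}
    (hS : ∀ χ ∈ S, χ ≠ 1) {η : ℝ} (hη : 0 < η) (hη1 : η ≤ 1) {u : ℂ} (hu : ‖u‖ = 1)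
    (hSu : ∀ χ ∈ S, ‖χ b * epsChar χ ^ 2 - u‖ ≤ η) :
    (#S : ℝ) ≤ 20 * (η * q + (q : ℝ) ^ (3 / 4 : ℝ)) := by
  have hq0 : (0 : ℝ) < q := by exact_mod_cast hq.1.pos
  have hq1 : (1 : ℝ) ≤ q := by exact_mod_cast hq.1.one_le
  set M := min ((q : ℝ) ^ (1 / 4 : ℝ)) η⁻¹ with hM
  have hM1 : 1 ≤ M := le_min (Real.one_le_rpow hq1 (by norm_num)) ((one_le_inv₀ hη).2 hη1)
  have hM4 : M ≤ (q : ℝ) ^ (1 / 4 : ℝ) := min_le_left _ _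
  set N := ⌊M⌋₊
  have hN1 : 1 ≤ N := Nat.one_le_floor_iff _ |>.2 hM1
  have hNM : (N : ℝ) ≤ M := Nat.floor_le (by linarith)
  have hMN : M ≤ 2 * N := by
    have h1 := Nat.lt_floor_add_one M
    have h2 : (1 : ℝ) ≤ N := by exact_mod_cast hN1
    linarith
  have hs : √(q : ℝ) = (q : ℝ) ^ (1 / 2 : ℝ) := Real.sqrt_eq_rpow _
  have hNs : 3 * (N : ℝ) * √q ≤ 3 * (q : ℝ) ^ (3 / 4 : ℝ) := by
    rw [show (3 / 4 : ℝ) = 1 / 4 + 1 / 2 by norm_num, Real.rpow_add hq0, hs, mul_assoc]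
    gcongr
    exact hNM.trans hM4
  have hN4 : (N : ℝ) ^ (4 : ℕ) ≤ (q : ℝ) := by
    calc (N : ℝ) ^ (4 : ℕ) ≤ ((q : ℝ) ^ (1 / 4 : ℝ)) ^ (4 : ℕ) := by gcongr; exact hNM.trans hM4
      _ = (q : ℝ) := by rw [← Real.rpow_natCast, ← Real.rpow_mul hq0.le]; norm_num
  have hN4' : N ^ 4 ≤ q := by exact_mod_cast hN4
  have h := card_le_of_moments (T := univ.erase (1 : DirichletCharacter ℂ q)) (N := N)
    (A := 3 * N * √q) (f := fun χ => χ b * epsChar χ ^ 2) (u := u) (S := S)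
    (fun χ hχ => by
      rw [norm_mul, norm_pow, norm_epsChar (ne_of_mem_erase hχ), one_pow, mul_one]
      exact χ.unit_norm_eq_one b) (by positivity)
    (fun n hn hnN => by
      refine (norm_sum_pow_le hq11 b hn ?_).trans (by gcongr)
      by_cases hn2 : n ≤ 5
      · omega
      · have h1 : 6 ^ 3 ≤ N ^ 3 := Nat.pow_le_pow_left (by lia) 3
        nlinarith)
    (by lia) (fun χ hχ => mem_erase.2 ⟨hS χ hχ, mem_univ _⟩) hu fun χ hχ => by
      calc (N : ℝ) * _ ≤ η⁻¹ * η := by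
            gcongr
            · grind
            · exact hSu χ hχ
        _ = 1 := inv_mul_cancel₀ hη.ne'
  have hT : (#(univ.erase (1 : DirichletCharacter ℂ q)) : ℝ) ≤ q := by
    have h1 : #(univ : Finset (DirichletCharacter ℂ q)) = q.totient := by
      rw [card_univ, ← Nat.card_eq_fintype_card, card_eq_totient_of_hasEnoughRootsOfUnity]
    exact_mod_cast ((card_erase_le).trans h1.le).trans (Nat.totient_le q)
  have hTN : (#(univ.erase (1 : DirichletCharacter ℂ q)) : ℝ) / N ≤
      2 * (η * q + (q : ℝ) ^ (3 / 4 : ℝ)) := by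
    have hNpos : (0 : ℝ) < N := by exact_mod_cast hN1
    have h1 : (N : ℝ)⁻¹ ≤ 2 * (η + (q : ℝ) ^ (-(1 / 4) : ℝ)) := by
      rw [inv_le_iff_one_le_mul₀ hNpos]
      have h2 : 1 ≤ M * (η + (q : ℝ) ^ (-(1 / 4) : ℝ)) := by
        rcases min_choice ((q : ℝ) ^ (1 / 4 : ℝ)) η⁻¹ with h | h
        · rw [hM, h, mul_add, ← Real.rpow_add hq0]
          norm_num
          positivity
        · rw [hM, h, mul_add, inv_mul_cancel₀ hη.ne']
          have : 0 ≤ η⁻¹ * (q : ℝ) ^ (-(1 / 4) : ℝ) := by positivity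
          linarith
      nlinarith
    have h4 : (q : ℝ) ^ (3 / 4 : ℝ) = q * (q : ℝ) ^ (-(1 / 4) : ℝ) := by
      conv_rhs => rw [← Real.rpow_one_add' hq0.le (by norm_num)]
      norm_num
    calc _ ≤ (q : ℝ) * (N : ℝ)⁻¹ := by rw [div_eq_mul_inv]; gcongr
      _ ≤ q * (2 * (η + (q : ℝ) ^ (-(1 / 4) : ℝ))) := by gcongr
      _ = _ := by rw [h4]; ring
  nlinarith

lemma card_subset_le {q D : ℕ} [NeZero q] [NeZero D] (hq : q.Prime) (hqD : ¬q ∣ D)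
    (ψ : DirichletCharacter ℂ D) {δ : ℝ} (hδ : 0 < δ) {S : Finset (DirichletCharacter ℂ q)}
    (hS : ∀ χ ∈ S, χ ≠ 1 ∧ ‖1 + epsChar χ * epsChar (prodChar χ ψ)‖ < 2 * δ) :
    (#S : ℝ) ≤ 320 * (δ * q.totient + (q : ℝ) ^ ((3 : ℝ) / 4)) := by
  have : Fact q.Prime := ⟨hq⟩
  have hq0 : (0 : ℝ) < q := by exact_mod_cast hq.pos
  have hφ : (q : ℝ) ≤ 2 * q.totient := by
    rw [Nat.totient_prime hq]
    exact_mod_cast (by have := hq.two_le; lia : q ≤ 2 * (q - 1))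
  have hcard : (#S : ℝ) ≤ q.totient := by
    rw [← card_eq_totient_of_hasEnoughRootsOfUnity ℂ q, Nat.card_eq_fintype_card]
    exact_mod_cast card_le_univ S
  have h34 : 0 ≤ (q : ℝ) ^ ((3 : ℝ) / 4) := by positivity
  have hδφ : 0 ≤ δ * q.totient := by positivity
  rcases le_total (1 / 8) δ with hδ1 | hδ1
  · nlinarith
  rcases Nat.lt_or_ge q 11 with hq11 | hq11
  · have h1 : (1 : ℝ) ≤ (q : ℝ) ^ ((3 : ℝ) / 4) :=
      Real.one_le_rpow (by exact_mod_cast hq.one_le) (by norm_num)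
    have h2 : (q.totient : ℝ) ≤ 11 := by exact_mod_cast (Nat.totient_le q).trans hq11.le
    linarith
  rcases S.eq_empty_or_nonempty with rfl | ⟨χ₀, hχ₀⟩
  · simpa using by linarith
  have hcop : q.Coprime D := (Nat.Prime.coprime_iff_not_dvd hq).2 hqD
  set b : (ZMod q)ˣ := ZMod.unitOfCoprime D hcop.symm
  have hb : ((b : (ZMod q)ˣ) : ZMod q) = D := ZMod.coe_unitOfCoprime D hcop.symm
  have hf1 (χ : DirichletCharacter ℂ q) : χ ≠ 1 → ‖χ b * epsChar χ ^ 2‖ = 1 := fun hχ => by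
    rw [norm_mul, norm_pow, norm_epsChar hχ, one_pow, mul_one]
    exact χ.unit_norm_eq_one b
  set θ := ψ q * epsChar ψ
  have hθ : ∀ χ ∈ S, ‖1 + θ * (χ b * epsChar χ ^ 2)‖ < 2 * δ := fun χ hχ => by
    rw [hb, ← epsChar_mul_epsChar_prodChar hcop]
    exact (hS χ hχ).2
  have hθ1 : 1 / 2 ≤ ‖θ‖ := by
    have h1 := hθ χ₀ hχ₀
    have h2 := norm_sub_norm_le (1 : ℂ) (-(θ * (χ₀ b * epsChar χ₀ ^ 2)))
    rw [sub_neg_eq_add, norm_neg, norm_one, norm_mul, hf1 χ₀ (hS χ₀ hχ₀).1, mul_one] at h2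
    linarith
  have h := card_filter_le b hq11 (S := S) (fun χ hχ => (hS χ hχ).1) (η := 8 * δ) (by linarith)
    (by linarith) (hf1 χ₀ (hS χ₀ hχ₀).1) fun χ hχ => by
      have h1 := norm_sub_le (1 + θ * (χ b * epsChar χ ^ 2)) (1 + θ * (χ₀ b * epsChar χ₀ ^ 2))
      rw [add_sub_add_left_eq_sub, ← mul_sub, norm_mul] at h1
      have h2 := hθ χ hχ
      have h3 := hθ χ₀ hχ₀
      nlinarith
  nlinarith

end Final

end HyperKloosterman


/-- the number of primitive even characters `χ` mod `q` with
`|1 + ε(χ)ε(χψ)| < 2δ` is `O(δ·φ(q) + q^{3/4})`, with an absolute implied constant. -/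
theorem card_small_one_add_eps_le :
    ∃ c : ℝ, 0 < c ∧
      ∀ (D : ℕ) [NeZero D], 1 < D → Squarefree D → D % 4 = 1 →
      ∀ ψ : DirichletCharacter ℂ D, ψ.IsPrimitive → ψ ^ 2 = 1 → ψ ≠ 1 →
      ∀ (q : ℕ) [NeZero q], q.Prime → ¬ q ∣ D →
      ∀ δ : ℝ, 0 < δ →
      (Nat.card {χ : DirichletCharacter ℂ q //
          χ.IsPrimitive ∧ χ (-1) = 1 ∧ ‖1 + epsChar χ * epsChar (prodChar χ ψ)‖ < 2 * δ} : ℝ) ≤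
        c * (δ * (Nat.totient q) + (q : ℝ) ^ ((3 : ℝ) / 4)) := by
  classical
  refine ⟨320, by norm_num, fun D _ _ _ _ ψ _ _ _ q _ hq hqD δ hδ => ?_⟩
  rw [Nat.card_eq_fintype_card, Fintype.card_subtype]
  refine HyperKloosterman.card_subset_le hq hqD ψ hδ fun χ hχ => ?_
  obtain ⟨h1, -, h2⟩ := (mem_filter.1 hχ).2
  refine ⟨?_, h2⟩
  rintro rfl
  rw [isPrimitive_def, conductor_one] at h1
  exact hq.one_lt.ne h1
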